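/- Morton: for every prime p ≥ 5, B(p, ⌊p/4⌋) = (1/4)·(h(√−2p) − 2(ε + ν)), and B(p, ⌊p/3⌋) = (1/4)·(a_p·h(√−3p) − 4δ), where a_p = (1/2)·(2 + (1 + (−1|p))·(2 + (−2|p))). -/

import Mathlib

open Polynomial

noncomputable section

/-- The class number h(√-d) of the imaginary quadratic field ℚ(√-d),
realized as the subfield of ℂ generated by i·√d. -/
def classNumberSqrtNeg (d : ℕ) : ℕ :=
  haveI : FiniteDimensional ℚ (IntermediateField.adjoin ℚ {(Complex.I * Real.sqrt d : ℂ)}) :=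
    IntermediateField.adjoin.finiteDimensional
      ⟨X ^ 2 + C (d : ℚ), monic_X_pow_add_C _ (by norm_num), by
        have h : (Complex.I * (Real.sqrt d : ℂ)) ^ 2 = -(d : ℂ) := by
          rw [mul_pow, Complex.I_sq, ← Complex.ofReal_pow, Real.sq_sqrt (Nat.cast_nonneg d)]
          simp
        simp [h]⟩
  haveI : NumberField (IntermediateField.adjoin ℚ {(Complex.I * Real.sqrt d : ℂ)}) := ⟨⟩
  NumberField.classNumber (IntermediateField.adjoin ℚ {(Complex.I * Real.sqrt d : ℂ)})

variable (p : ℕ) [Fact p.Prime]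

/-- ε = (1 - (-1|p))/2 -/
def eps : ℕ := ((1 - legendreSym p (-1)) / 2).toNat
/-- δ = (1 - (-3|p))/2 -/
def del : ℕ := ((1 - legendreSym p (-3)) / 2).toNat
/-- ν = (1 - (-2|p))/2 -/
def nu : ℕ := ((1 - legendreSym p (-2)) / 2).toNat

/-- The Pochhammer symbol (x)_n = x(x+1)⋯(x+n-1) in 𝔽_p. -/
def poch (x : ZMod p) (n : ℕ) : ZMod p := (ascPochhammer (ZMod p) n).eval x

/-- The Legendre polynomial P_m(x) = 2^{-m} Σ_{k=0}^{m} C(m,k)² (x-1)^{m-k} (x+1)^k,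
reduced modulo the odd prime p. -/
def legendreP (m : ℕ) : (ZMod p)[X] :=
  C (((2 : ZMod p)⁻¹) ^ m) *
    ∑ k ∈ Finset.range (m + 1),
      C ((m.choose k : ZMod p) ^ 2) * (X - 1) ^ (m - k) * (X + 1) ^ k

/-- B(p,m): the number of C ∈ 𝔽_p with −C a quadratic non-residue (so that X² + C is
irreducible over 𝔽_p) such that X² + C divides P_m(X) mod p. -/
def BB (m : ℕ) : ℕ :=
  Nat.card {c : ZMod p // ¬ IsSquare (-c) ∧ (X ^ 2 + C c) ∣ legendreP p m}

section QExp

open UpperHalfPlane Function.Periodic Filter Topology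

/-- The local parameter `exp (2 π i τ / h)` at the cusp `∞`. -/
abbrev qq (h : ℕ) (τ : ℍ) : ℂ := qParam h τ

theorem HasSum.of_eq {f g : ℕ → ℂ} {a b : ℂ} (h : HasSum f a) (hf : ∀ n, g n = f n)
    (ha : b = a) : HasSum g b := by
  rw [funext hf, ha]; exact h

/-- The power series `A` converges to `Φ` on the open unit disc. -/
def DiscSum (A : PowerSeries ℂ) (Φ : ℂ → ℂ) : Prop :=
  ∀ z : ℂ, ‖z‖ < 1 → HasSum (fun n => PowerSeries.coeff n A * z ^ n) (Φ z)

theorem DiscSum.summable_norm {A : PowerSeries ℂ} {Φ : ℂ → ℂ} (h : DiscSum A Φ) {z : ℂ}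
    (hz : ‖z‖ < 1) : Summable fun n => ‖PowerSeries.coeff n A * z ^ n‖ :=
  (h z hz).summable.norm

theorem DiscSum.hasFPowerSeriesOnBall {A : PowerSeries ℂ} {Φ : ℂ → ℂ} (h : DiscSum A Φ) :
    HasFPowerSeriesOnBall Φ
      (FormalMultilinearSeries.ofScalars ℂ fun n => PowerSeries.coeff n A) 0 1 where
  r_le := by
    refine ENNReal.le_of_forall_nnreal_lt fun r hr => ?_
    refine FormalMultilinearSeries.le_radius_of_summable _ ?_
    have hr' : ‖((r : ℝ) : ℂ)‖ < 1 := by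
      have : (r : ℝ) < 1 := by exact_mod_cast hr
      simpa using this
    refine (h.summable_norm hr').congr fun n => ?_
    simp
  r_pos := one_pos
  hasSum := by
    intro y hy
    have hy' : ‖y‖ < 1 := by
      simpa [← NNReal.coe_lt_coe, enorm_eq_nnnorm, Metric.mem_eball, edist_zero_right] using hy
    simpa [FormalMultilinearSeries.ofScalars_apply_eq, mul_comm] using h y hy'

theorem DiscSum.differentiableOn {A : PowerSeries ℂ} {Φ : ℂ → ℂ} (h : DiscSum A Φ) :
    DifferentiableOn ℂ Φ (Metric.ball 0 1) := by
  have := h.hasFPowerSeriesOnBall.differentiableOn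
  rwa [← ENNReal.coe_one, Metric.eball_coe, NNReal.coe_one] at this

theorem DiscSum.unique {A B : PowerSeries ℂ} {Φ Ψ : ℂ → ℂ} (hA : DiscSum A Φ) (hB : DiscSum B Ψ)
    (h : ∀ᶠ z in 𝓝[≠] (0 : ℂ), Φ z = Ψ z) : A = B := by
  have h1 := hA.hasFPowerSeriesOnBall.hasFPowerSeriesAt
  have h2 := hB.hasFPowerSeriesOnBall.hasFPowerSeriesAt
  have h3 : ∀ᶠ z in 𝓝 (0 : ℂ), Φ z = Ψ z :=
    (h1.analyticAt.frequently_eq_iff_eventually_eq h2.analyticAt).1 h.frequently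
  have h4 := (h1.congr h3).eq_formalMultilinearSeries h2
  ext n
  have := congrFun ((FormalMultilinearSeries.ofScalars_series_eq_iff (E := ℂ) _ _).1 h4) n
  exact this

theorem exists_discSum {Φ : ℂ → ℂ} (h : DifferentiableOn ℂ Φ (Metric.ball 0 1)) :
    ∃ A, DiscSum A Φ := by
  refine ⟨PowerSeries.mk fun n => (n.factorial : ℂ)⁻¹ * iteratedDeriv n Φ 0, fun z hz => ?_⟩
  have := Complex.hasSum_taylorSeries_on_ball (r := 1) (c := 0) (z := z) (by simpa using h)
    (by simpa using hz)
  refine this.of_eq (fun n => ?_) rfl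
  simp only [PowerSeries.coeff_mk, sub_zero, smul_eq_mul]
  ring

theorem DiscSum.mul {A B : PowerSeries ℂ} {Φ Ψ : ℂ → ℂ} (hA : DiscSum A Φ) (hB : DiscSum B Ψ) :
    DiscSum (A * B) (fun z => Φ z * Ψ z) := by
  intro z hz
  have h := (summable_norm_sum_mul_antidiagonal_of_summable_norm (hA.summable_norm hz)
    (hB.summable_norm hz)).of_norm.hasSum
  rw [← tsum_mul_tsum_eq_tsum_sum_antidiagonal_of_summable_norm (hA.summable_norm hz)
    (hB.summable_norm hz), (hA z hz).tsum_eq, (hB z hz).tsum_eq] at h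
  refine h.of_eq (fun n => ?_) rfl
  rw [PowerSeries.coeff_mul, Finset.sum_mul]
  refine Finset.sum_congr rfl fun x hx => ?_
  rw [← Finset.HasAntidiagonal.mem_antidiagonal.1 hx, pow_add]
  ring

theorem DiscSum.add {A B : PowerSeries ℂ} {Φ Ψ : ℂ → ℂ} (hA : DiscSum A Φ) (hB : DiscSum B Ψ) :
    DiscSum (A + B) (fun z => Φ z + Ψ z) := fun z hz => by
  simpa [add_mul] using (hA z hz).add (hB z hz)

theorem DiscSum.neg {A : PowerSeries ℂ} {Φ : ℂ → ℂ} (hA : DiscSum A Φ) :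
    DiscSum (-A) (fun z => -Φ z) := fun z hz => by
  simpa using (hA z hz).neg

theorem discSum_C (c : ℂ) : DiscSum (PowerSeries.C c) (fun _ => c) := fun z _ => by
  convert hasSum_single (f := fun n => PowerSeries.coeff n (PowerSeries.C c) * z ^ n) 0 ?_
  · simp
  · intro n hn
    simp [PowerSeries.coeff_C, hn]

theorem discSum_X : DiscSum PowerSeries.X (fun z => z) := fun z _ => by
  convert hasSum_single (f := fun n => PowerSeries.coeff n PowerSeries.X * z ^ n) 1 ?_
  · simp
  · intro n hn
    simp [PowerSeries.coeff_X, hn]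

theorem DiscSum.apply_zero {A : PowerSeries ℂ} {Φ : ℂ → ℂ} (hA : DiscSum A Φ) :
    Φ 0 = PowerSeries.constantCoeff A := by
  have h := hA 0 (by simp)
  refine h.unique ?_
  convert hasSum_single (f := fun n => PowerSeries.coeff n A * (0 : ℂ) ^ n) 0 ?_
  · simp
  · intro n hn
    simp [hn]

theorem DiscSum.inv {A : PowerSeries ℂ} {Φ : ℂ → ℂ} (hA : DiscSum A Φ)
    (h0 : ∀ z, ‖z‖ < 1 → Φ z ≠ 0) : DiscSum A⁻¹ (fun z => (Φ z)⁻¹) := by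
  obtain ⟨B, hB⟩ := exists_discSum (hA.differentiableOn.inv fun z hz => h0 z (by simpa using hz))
  have h1 : A * B = PowerSeries.C 1 := by
    refine (hA.mul hB).unique (discSum_C 1) (eventually_nhdsWithin_of_eventually_nhds ?_)
    filter_upwards [Metric.ball_mem_nhds (0 : ℂ) one_pos] with z hz
    exact mul_inv_cancel₀ (h0 z (by simpa using hz))
  have h2 : PowerSeries.constantCoeff A ≠ 0 := by
    rw [← hA.apply_zero]; exact h0 0 (by simp)
  rw [map_one] at h1
  rw [(PowerSeries.inv_eq_iff_mul_eq_one h2).2 ((mul_comm _ _).trans h1)]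
  exact hB

theorem DiscSum.deriv {A : PowerSeries ℂ} {Φ : ℂ → ℂ} (hA : DiscSum A Φ) :
    DiscSum (PowerSeries.derivative ℂ A) (deriv Φ) := by
  intro z hz
  obtain ⟨r, hr1, hr2⟩ := exists_between hz
  have hr0 : 0 < r := (norm_nonneg z).trans_lt hr1
  have hs : Summable fun n => ‖PowerSeries.coeff n A * (r : ℂ) ^ n‖ :=
    hA.summable_norm (by rwa [Complex.norm_real, Real.norm_of_nonneg hr0.le])
  have h := Complex.hasSum_deriv_of_summable_norm (u := fun n => ‖PowerSeries.coeff n A * (r : ℂ) ^ n‖)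
    (F := fun n w => PowerSeries.coeff n A * w ^ n) (U := Metric.ball 0 r) hs
    (fun n => by fun_prop) Metric.isOpen_ball (fun n w hw => by
      rw [norm_mul, norm_mul, norm_pow, norm_pow, Complex.norm_real, Real.norm_of_nonneg hr0.le]
      have : ‖w‖ ≤ r := by simpa using (mem_ball_zero_iff.1 hw).le
      gcongr) (z := z) (by simpa using hr1)
  have h2 : _root_.deriv (fun w => ∑' n, PowerSeries.coeff n A * w ^ n) z = _root_.deriv Φ z := by
    refine Filter.EventuallyEq.deriv_eq ?_
    filter_upwards [Metric.isOpen_ball.mem_nhds (show z ∈ Metric.ball (0 : ℂ) 1 by simpa using hz)]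
      with w hw
    exact (hA w (by simpa using hw)).tsum_eq
  rw [h2] at h
  rw [← hasSum_nat_add_iff' 1] at h
  simp only [Finset.sum_range_one] at h
  refine h.of_eq (fun n => ?_) (by simp)
  rw [PowerSeries.coeff_derivative]
  simp
  ring

/-- `f` has the expansion `A` in the local parameter `exp (2 π i τ / h)`. -/
def HasExp (h : ℕ) (A : PowerSeries ℂ) (f : ℍ → ℂ) : Prop :=
  ∀ τ : ℍ, HasSum (fun n => PowerSeries.coeff n A * qq h τ ^ n) (f τ)

theorem exists_qParam_eq {h : ℕ} (hh : h ≠ 0) {z : ℂ} (hz : ‖z‖ < 1) (hz0 : z ≠ 0) :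
    ∃ τ : ℍ, qq h τ = z := by
  have hh' : (0 : ℝ) < h := by positivity
  exact ⟨⟨invQParam h z, im_invQParam_pos_of_norm_lt_one hh' hz hz0⟩, qParam_right_inv hh'.ne' hz0⟩

theorem DiscSum.hasExp {A : PowerSeries ℂ} {Φ : ℂ → ℂ} (hA : DiscSum A Φ) {h : ℕ} (hh : h ≠ 0) :
    HasExp h A (fun τ => Φ (qq h τ)) := fun τ => by
  have : NeZero h := ⟨hh⟩
  exact hA _ (norm_qParam_lt_one h τ)

theorem HasExp.exists_discSum {h : ℕ} (hh : h ≠ 0) {A : PowerSeries ℂ} {f : ℍ → ℂ}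
    (hA : HasExp h A f) : ∃ Φ, DiscSum A Φ ∧ ∀ τ, f τ = Φ (qq h τ) := by
  refine ⟨fun z => ∑' n, PowerSeries.coeff n A * z ^ n, fun z hz => ?_, fun τ => (hA τ).tsum_eq.symm⟩
  refine Summable.hasSum ?_
  rcases eq_or_ne z 0 with rfl | hz0
  · exact summable_of_ne_finset_zero (s := {0}) (by
      intro n hn
      have : n ≠ 0 := by simpa using hn
      simp [this])
  · obtain ⟨τ, rfl⟩ := exists_qParam_eq hh hz hz0
    exact (hA τ).summable

theorem HasExp.unique {h : ℕ} (hh : h ≠ 0) {A B : PowerSeries ℂ} {f : ℍ → ℂ}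
    (hA : HasExp h A f) (hB : HasExp h B f) : A = B := by
  obtain ⟨Φ, hΦ, h1⟩ := hA.exists_discSum hh
  obtain ⟨Ψ, hΨ, h2⟩ := hB.exists_discSum hh
  refine hΦ.unique hΨ ?_
  filter_upwards [nhdsWithin_le_nhds (Metric.ball_mem_nhds (0 : ℂ) one_pos), self_mem_nhdsWithin]
    with z hz hz0
  obtain ⟨τ, rfl⟩ := exists_qParam_eq hh (by simpa using hz) hz0
  rw [← h1, h2]

theorem HasExp.mul {h : ℕ} (hh : h ≠ 0) {A B : PowerSeries ℂ} {f g : ℍ → ℂ}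
    (hA : HasExp h A f) (hB : HasExp h B g) : HasExp h (A * B) (f * g) := by
  obtain ⟨Φ, hΦ, h1⟩ := hA.exists_discSum hh
  obtain ⟨Ψ, hΨ, h2⟩ := hB.exists_discSum hh
  convert (hΦ.mul hΨ).hasExp hh using 1
  ext τ
  simp [h1, h2]

/-- The ring of pairs consisting of a power series and the function on `ℍ` it represents. -/
def expRing (h : ℕ) [NeZero h] : Subring (PowerSeries ℂ × (ℍ → ℂ)) where
  carrier := {x | HasExp h x.1 x.2}
  mul_mem' := fun ha hb => HasExp.mul (NeZero.ne h) ha hb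
  one_mem' := by
    have := (discSum_C 1).hasExp (NeZero.ne h)
    rw [map_one] at this
    exact this
  add_mem' := fun {a b} ha hb τ => by
    simpa [add_mul] using (ha τ).add (hb τ)
  zero_mem' := fun τ => by simp [hasSum_zero]
  neg_mem' := fun {a} ha τ => by
    simpa using (ha τ).neg

section Closure

variable {h : ℕ} [NeZero h] {A B : PowerSeries ℂ} {f g : ℍ → ℂ}

theorem hasExp_C (c : ℂ) : HasExp h (PowerSeries.C c) (fun _ => c) :=
  (discSum_C c).hasExp (NeZero.ne h)

theorem hasExp_X : HasExp h PowerSeries.X (fun τ => qq h τ) :=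
  discSum_X.hasExp (NeZero.ne h)

theorem HasExp.add (hA : HasExp h A f) (hB : HasExp h B g) : HasExp h (A + B) (f + g) :=
  fun τ => by simpa [add_mul] using (hA τ).add (hB τ)

theorem HasExp.neg (hA : HasExp h A f) : HasExp h (-A) (-f) :=
  fun τ => by simpa using (hA τ).neg

theorem HasExp.sub (hA : HasExp h A f) (hB : HasExp h B g) : HasExp h (A - B) (f - g) := by
  rw [sub_eq_add_neg, sub_eq_add_neg]; exact hA.add hB.neg

theorem HasExp.pow (hA : HasExp h A f) (n : ℕ) : HasExp h (A ^ n) (f ^ n) := by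
  have : (A ^ n, f ^ n) ∈ expRing h := (expRing h).pow_mem (x := (A, f)) hA n
  exact this

theorem HasExp.prod {ι : Type*} {s : Finset ι} {A : ι → PowerSeries ℂ} {f : ι → ℍ → ℂ}
    (hA : ∀ i ∈ s, HasExp h (A i) (f i)) : HasExp h (∏ i ∈ s, A i) (∏ i ∈ s, f i) := by
  have := (expRing h).prod_mem (t := s) (f := fun i => (A i, f i)) hA
  rw [← prod_mk_prod] at this
  exact this

theorem HasExp.sum {ι : Type*} {s : Finset ι} {A : ι → PowerSeries ℂ} {f : ι → ℍ → ℂ}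
    (hA : ∀ i ∈ s, HasExp h (A i) (f i)) : HasExp h (∑ i ∈ s, A i) (∑ i ∈ s, f i) := by
  have := (expRing h).sum_mem (t := s) (f := fun i => (A i, f i)) hA
  rw [← prod_mk_sum] at this
  exact this

theorem HasExp.inv (hA : HasExp h A f) (hf : ∀ τ, f τ ≠ 0)
    (h0 : PowerSeries.constantCoeff A ≠ 0) : HasExp h A⁻¹ f⁻¹ := by
  obtain ⟨Φ, hΦ, h1⟩ := hA.exists_discSum (NeZero.ne h)
  convert (hΦ.inv ?_).hasExp (NeZero.ne h) using 1
  · ext τ; simp [h1]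
  · intro z hz
    rcases eq_or_ne z 0 with rfl | hz0
    · rwa [hΦ.apply_zero]
    · obtain ⟨τ, rfl⟩ := exists_qParam_eq (NeZero.ne h) hz hz0
      rw [← h1]; exact hf τ

theorem HasExp.mono (hA : HasExp h A f) (hAB : A = B) (hfg : ∀ τ, g τ = f τ) : HasExp h B g := by
  rw [← hAB, funext hfg]; exact hA

end Closure

instance neZero_of_prime (p : ℕ) [hp : Fact p.Prime] : NeZero p := ⟨hp.out.ne_zero⟩

/-- The map `τ ↦ nτ`. -/
def up (n : ℕ) [NeZero n] (τ : ℍ) : ℍ :=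
  ⟨n * τ, by
    have : (0 : ℝ) < n := by exact_mod_cast NeZero.pos n
    simpa using mul_pos this τ.im_pos⟩

/-- The map `τ ↦ (τ + b)/n`. -/
def low (n : ℕ) [NeZero n] (b : ℤ) (τ : ℍ) : ℍ :=
  ⟨(τ + b) / n, by
    have : (0 : ℝ) < n := by exact_mod_cast NeZero.pos n
    simpa using div_pos τ.im_pos this⟩

/-- The Fricke involution `τ ↦ -1/(nτ)`. -/
def fricke (n : ℕ) [NeZero n] (τ : ℍ) : ℍ :=
  ⟨-1 / (n * τ), by
    have h1 := (up n τ).im_inv_neg_coe_pos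
    have h2 : (-1 : ℂ) / (n * τ) = (-(up n τ : ℂ))⁻¹ := by
      rw [← neg_inv]; simp [up, neg_div]
    rw [h2]; exact h1⟩

/-- The translation `τ ↦ τ + 1`. -/
def tr (τ : ℍ) : ℍ := (1 : ℝ) +ᵥ τ

section Coe

variable (n : ℕ) [NeZero n] (b : ℤ) (τ : ℍ)

theorem coe_up : (up n τ : ℂ) = n * τ := rfl

theorem coe_low : (low n b τ : ℂ) = (τ + b) / n := rfl

theorem coe_fricke : (fricke n τ : ℂ) = -1 / (n * τ) := rfl

theorem coe_tr : (tr τ : ℂ) = τ + 1 := by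
  simp [tr, add_comm]

theorem fricke_fricke : fricke n (fricke n τ) = τ := by
  have h1 : (n : ℂ) ≠ 0 := by exact_mod_cast NeZero.ne n
  have h2 : (τ : ℂ) ≠ 0 := UpperHalfPlane.ne_zero τ
  ext1
  simp only [coe_fricke]
  field_simp

theorem qq_pow : qq n τ ^ n = qq 1 τ := by
  have h1 : (n : ℂ) ≠ 0 := by exact_mod_cast NeZero.ne n
  simp only [qq, qParam, ← Complex.exp_nat_mul]
  congr 1
  push_cast
  field_simp

theorem qq_up : qq 1 (up n τ) = qq 1 τ ^ n := by
  simp only [qq, qParam, ← Complex.exp_nat_mul, coe_up]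
  congr 1
  push_cast
  ring

theorem qq_low : qq 1 (low n b τ) = Complex.exp (2 * Real.pi * Complex.I * b / n) * qq n τ := by
  simp only [qq, qParam, ← Complex.exp_add, coe_low]
  congr 1
  push_cast
  ring

theorem qq_tr : qq n (tr τ) = Complex.exp (2 * Real.pi * Complex.I / n) * qq n τ := by
  simp only [qq, qParam, ← Complex.exp_add, coe_tr]
  congr 1
  push_cast
  ring

theorem qq_one_tr : qq 1 (tr τ) = qq 1 τ := by
  rw [qq_tr]; simp

theorem qq_ne_zero : qq n τ ≠ 0 := Complex.exp_ne_zero _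

theorem norm_qq_lt_one : ‖qq n τ‖ < 1 := norm_qParam_lt_one n τ

end Coe

theorem HasSum.expand {A : PowerSeries ℂ} {n : ℕ} (hn : n ≠ 0) {z a : ℂ}
    (h : HasSum (fun k => PowerSeries.coeff k A * (z ^ n) ^ k) a) :
    HasSum (fun k => PowerSeries.coeff k (PowerSeries.expand n hn A) * z ^ k) a := by
  have hi : Function.Injective (fun k : ℕ => n * k) := fun a b hab => by simpa [hn] using hab
  rw [← hi.hasSum_iff]
  · refine h.of_eq (fun k => ?_) rfl
    simp [PowerSeries.coeff_expand_mul, pow_mul]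
  · intro k hk
    rw [PowerSeries.coeff_expand_of_not_dvd, zero_mul]
    rintro ⟨c, rfl⟩
    exact hk ⟨c, rfl⟩

section Change

variable {A : PowerSeries ℂ} {f : ℍ → ℂ}

theorem HasExp.expand (n : ℕ) [NeZero n] (hA : HasExp 1 A f) :
    HasExp n (PowerSeries.expand n (NeZero.ne n) A) f := fun τ =>
  HasSum.expand _ (by simpa only [qq_pow] using hA τ)

theorem HasExp.comp_up (n : ℕ) [NeZero n] (hA : HasExp 1 A f) :
    HasExp 1 (PowerSeries.expand n (NeZero.ne n) A) (fun τ => f (up n τ)) := fun τ =>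
  HasSum.expand _ (by simpa only [qq_up] using hA (up n τ))

theorem HasExp.comp_low (n : ℕ) [NeZero n] (b : ℤ) (hA : HasExp 1 A f) :
    HasExp n (PowerSeries.rescale (Complex.exp (2 * Real.pi * Complex.I * b / n)) A)
      (fun τ => f (low n b τ)) := fun τ => by
  refine (hA (low n b τ)).of_eq (fun k => ?_) rfl
  rw [qq_low, PowerSeries.coeff_rescale, mul_pow]
  ring

theorem HasExp.comp_tr (n : ℕ) [NeZero n] (hA : HasExp n A f) :
    HasExp n (PowerSeries.rescale (Complex.exp (2 * Real.pi * Complex.I / n)) A)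
      (fun τ => f (tr τ)) := fun τ => by
  refine (hA (tr τ)).of_eq (fun k => ?_) rfl
  rw [qq_tr, PowerSeries.coeff_rescale, mul_pow]
  ring

theorem HasExp.apply_tr (hA : HasExp 1 A f) (τ : ℍ) : f (tr τ) = f τ :=
  (hA (tr τ)).unique (by simpa only [qq_one_tr] using hA τ)

theorem HasExp.descend (n : ℕ) [NeZero n] (hA : HasExp n A f) (hf : ∀ τ, f (tr τ) = f τ) :
    ∃ B, A = PowerSeries.expand n (NeZero.ne n) B ∧ HasExp 1 B f := by
  have h1 := HasExp.unique (NeZero.ne n) ((hA.comp_tr n).mono rfl (fun τ => (hf τ).symm)) hA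
  have h2 : ∀ k, ¬ n ∣ k → PowerSeries.coeff k A = 0 := by
    intro k hk
    by_contra h0
    have h3 := congrArg (PowerSeries.coeff k) h1
    rw [PowerSeries.coeff_rescale, mul_eq_right₀ h0] at h3
    exact hk (((Complex.isPrimitiveRoot_exp n (NeZero.ne n)).pow_eq_one_iff_dvd k).1 h3)
  have h4 : A = PowerSeries.expand n (NeZero.ne n)
      (PowerSeries.mk fun k => PowerSeries.coeff (n * k) A) := by
    ext k
    by_cases hk : n ∣ k
    · obtain ⟨c, rfl⟩ := hk
      rw [PowerSeries.coeff_expand_mul, PowerSeries.coeff_mk]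
    · rw [PowerSeries.coeff_expand_of_not_dvd _ _ _ hk, h2 k hk]
  refine ⟨_, h4, fun τ => ?_⟩
  have h5 := hA τ
  rw [h4] at h5
  have hi : Function.Injective (fun k : ℕ => n * k) :=
    fun a b hab => by simpa [NeZero.ne n] using hab
  rw [← hi.hasSum_iff] at h5
  · refine h5.of_eq (fun k => ?_) rfl
    simp only [Function.comp_apply, PowerSeries.coeff_expand_mul, pow_mul, qq_pow]
  · intro k hk
    rw [PowerSeries.coeff_expand_of_not_dvd, zero_mul]
    rintro ⟨c, rfl⟩
    exact hk ⟨c, rfl⟩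

theorem HasExp.differentiableAt {n : ℕ} [NeZero n] (hA : HasExp n A f) (τ : ℍ) :
    DifferentiableAt ℂ (f ∘ ofComplex) τ := by
  obtain ⟨Φ, hΦ, h1⟩ := hA.exists_discSum (NeZero.ne n)
  have h2 : DifferentiableAt ℂ Φ (qq n τ) :=
    hΦ.differentiableOn.differentiableAt
      (Metric.isOpen_ball.mem_nhds (by simpa using norm_qq_lt_one n τ))
  have h3 : DifferentiableAt ℂ (fun z => Φ (qParam n z)) τ :=
    h2.comp (τ : ℂ) (differentiable_qParam _)
  refine h3.congr_of_eventuallyEq ?_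
  filter_upwards [isOpen_upperHalfPlaneSet.mem_nhds τ.im_pos] with z hz
  simp [h1, ofComplex_apply_of_im_pos hz]

end Change

/-- The operator `(2 π i)⁻¹ d/dτ`. -/
def dOp (f : ℍ → ℂ) (τ : ℍ) : ℂ := (2 * Real.pi * Complex.I)⁻¹ * deriv (f ∘ ofComplex) τ

theorem HasExp.dOp {A : PowerSeries ℂ} {f : ℍ → ℂ} (hA : HasExp 1 A f) :
    HasExp 1 (PowerSeries.X * PowerSeries.derivative ℂ A) (dOp f) := by
  obtain ⟨Φ, hΦ, h1⟩ := hA.exists_discSum one_ne_zero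
  refine ((discSum_X.mul hΦ.deriv).hasExp one_ne_zero).mono rfl fun τ => ?_
  have h2 : DifferentiableAt ℂ Φ (qq 1 τ) :=
    hΦ.differentiableOn.differentiableAt
      (Metric.isOpen_ball.mem_nhds (by simpa using norm_qq_lt_one 1 τ))
  have h3 : HasDerivAt (fun z => qParam (1 : ℕ) z) (2 * Real.pi * Complex.I * qq 1 τ) τ := by
    have : HasDerivAt (fun z : ℂ => 2 * Real.pi * Complex.I * z / (1 : ℕ))
        (2 * Real.pi * Complex.I) τ := by
      simpa using (hasDerivAt_id (τ : ℂ)).const_mul (2 * Real.pi * Complex.I)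
    simpa [qq, qParam, mul_comm] using this.cexp
  have h4 : deriv (f ∘ ofComplex) τ = deriv (fun z => Φ (qParam (1 : ℕ) z)) τ := by
    refine Filter.EventuallyEq.deriv_eq ?_
    filter_upwards [isOpen_upperHalfPlaneSet.mem_nhds τ.im_pos] with z hz
    simp [h1, ofComplex_apply_of_im_pos hz, qq]
  have h5 := (h2.hasDerivAt.comp (τ : ℂ) h3).deriv
  rw [show (Φ ∘ fun z => qParam (1 : ℕ) z) = fun z => Φ (qParam (1 : ℕ) z) from rfl] at h5
  rw [_root_.dOp, h4, h5]
  field_simp [Complex.two_pi_I_ne_zero]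

end QExp

section Euler

open UpperHalfPlane Function.Periodic Filter Topology

theorem constantCoeff_iterate_derivative {R : Type*} [CommRing R] (n : ℕ) (A : PowerSeries R) :
    PowerSeries.constantCoeff ((PowerSeries.derivative R)^[n] A) =
      (n.factorial : R) * PowerSeries.coeff n A := by
  induction n generalizing A with
  | zero => simp
  | succ n ih =>
    rw [Function.iterate_succ_apply, ih, PowerSeries.coeff_derivative, Nat.factorial_succ]
    push_cast
    ring

theorem DiscSum.iterate_deriv {A : PowerSeries ℂ} {Φ : ℂ → ℂ} (hA : DiscSum A Φ) (n : ℕ) :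
    DiscSum ((PowerSeries.derivative ℂ)^[n] A) (_root_.deriv^[n] Φ) := by
  induction n generalizing A Φ with
  | zero => exact hA
  | succ n ih => exact ih hA.deriv

theorem DiscSum.differentiableOn_iterate_deriv {Φ : ℂ → ℂ} {n : ℕ} {A : PowerSeries ℂ}
    (hA : DiscSum A Φ) : DifferentiableOn ℂ (_root_.deriv^[n] Φ) (Metric.ball 0 1) :=
  (hA.iterate_deriv n).differentiableOn

/-- Euler's product as an integral power series. -/
def eZ : PowerSeries ℤ := PowerSeries.pentagonalSeries ℤ

/-- The inclusion of integral power series in complex ones. -/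
abbrev zc : PowerSeries ℤ →+* PowerSeries ℂ := PowerSeries.map (Int.castRingHom ℂ)

theorem discSum_prod_one_sub_pow (s : Finset ℕ) :
    DiscSum (∏ n ∈ s, (1 - PowerSeries.X ^ (n + 1))) (fun z => ∏ n ∈ s, (1 - z ^ (n + 1))) := by
  have hX : ∀ n : ℕ, DiscSum (PowerSeries.X ^ n) (fun z => z ^ n) := by
    intro n
    induction n with
    | zero => simpa using discSum_C 1
    | succ n ih => simpa only [pow_succ] using ih.mul discSum_X
  have h1 : DiscSum 1 (fun _ => 1) := by simpa using discSum_C 1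
  classical
  induction s using Finset.induction_on with
  | empty => simpa using h1
  | insert a s ha ih =>
    simp only [Finset.prod_insert ha]
    refine DiscSum.mul ?_ ih
    simpa only [sub_eq_add_neg] using h1.add (hX (a + 1)).neg

theorem discSum_eZ : DiscSum (zc eZ) (fun z => ∏' n : ℕ, (1 - z ^ (n + 1))) := by
  obtain ⟨A, hA⟩ := exists_discSum ModularForm.differentiableOn_tprod_one_sub_pow
  suffices h : zc eZ = A by rwa [h]
  have hu := ModularForm.multipliableLocallyUniformlyOn_one_sub_pow.hasProdLocallyUniformlyOn
  have hu' : ∀ n : ℕ, TendstoLocallyUniformlyOn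
      (fun s : Finset ℕ => deriv^[n] fun z : ℂ => ∏ n ∈ s, (1 - z ^ (n + 1)))
      (deriv^[n] fun z : ℂ => ∏' n : ℕ, (1 - z ^ (n + 1))) atTop (Metric.ball 0 1) := by
    intro n
    induction n with
    | zero => exact hu
    | succ n ih =>
      simp only [Function.iterate_succ_apply']
      exact ih.deriv (Eventually.of_forall fun s =>
        (discSum_prod_one_sub_pow s).differentiableOn_iterate_deriv) Metric.isOpen_ball
  ext n
  have h1 := (hu' n).tendsto_at (a := 0) (by simp)
  rw [(hA.iterate_deriv n).apply_zero, constantCoeff_iterate_derivative] at h1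
  simp only [((discSum_prod_one_sub_pow _).iterate_deriv n).apply_zero,
    constantCoeff_iterate_derivative] at h1
  have h2 : ∀ᶠ s : Finset ℕ in atTop, (n.factorial : ℂ) * PowerSeries.coeff n
      (∏ n ∈ s, (1 - PowerSeries.X ^ (n + 1)) : PowerSeries ℂ) =
        n.factorial * PowerSeries.coeff n (zc eZ) := by
    filter_upwards [PowerSeries.coeff_prod_one_sub_X_pow_eventually_eq ℤ n] with s hs
    rw [eZ, PowerSeries.coeff_map, ← hs, ← PowerSeries.coeff_map]
    simp
  have h3 := tendsto_nhds_unique h1 ((tendsto_congr' h2).2 tendsto_const_nhds)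
  exact (mul_left_cancel₀ (by exact_mod_cast n.factorial_ne_zero) h3).symm

theorem coeff_eZ : PowerSeries.coeff 0 eZ = 1 ∧ PowerSeries.coeff 1 eZ = -1 ∧
    PowerSeries.coeff 2 eZ = -1 ∧ PowerSeries.coeff 3 eZ = 0 := by
  have h0 := PowerSeries.coeff_pentagonalSeries_pentagonal ℤ 0
  have h1 := PowerSeries.coeff_pentagonalSeries_pentagonal ℤ 1
  have h2 := PowerSeries.coeff_pentagonalSeries_pentagonal ℤ (-1)
  simp only [pentagonal_def] at h0 h1 h2
  refine ⟨by simpa [eZ] using h0, by simpa [eZ] using h1, by simpa [eZ] using h2, ?_⟩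
  refine PowerSeries.coeff_pentagonalSeries_eq_zero ℤ ?_
  rintro ⟨k, hk⟩
  have := two_mul_natCast_pentagonal k
  rw [hk] at this
  push_cast at this
  have h3 : k ≤ 2 := by nlinarith
  have h4 : -2 ≤ k := by nlinarith
  interval_cases k <;> omega

/-- Euler's product `∏ (1 - qⁿ)` as a function on the upper half plane. -/
def eF (τ : ℍ) : ℂ := ∏' n : ℕ, (1 - qq 1 τ ^ (n + 1))

theorem hasExp_eF : HasExp 1 (zc eZ) eF := discSum_eZ.hasExp one_ne_zero

theorem eta_eq_eF (τ : ℍ) : ModularForm.eta τ = qq 24 τ * eF τ := by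
  rw [ModularForm.eta, eF]
  congr 2
  ext n
  rw [ModularForm.eta_q_eq_pow]
  simp [qq, qParam]

theorem eF_ne_zero (τ : ℍ) : eF τ ≠ 0 := by
  have h := ModularForm.eta_ne_zero τ.2
  rw [eta_eq_eF] at h
  exact right_ne_zero_of_mul h

end Euler

section Level

open UpperHalfPlane Function.Periodic Filter Topology

variable (N : ℕ) [hN : Fact (N = 2 ∨ N = 3)]

instance neZero_level : NeZero N := ⟨by rcases hN.out with h | h <;> simp [h]⟩

/-- The exponent of `η(Nτ)/η(τ)` in the Hauptmodul. -/
def rr : ℕ := 24 / (N - 1)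

/-- The exponent of `η(τ)^N/η(Nτ)` in the modular form of weight `2 * N`. -/
def ee : ℕ := 12 - 2 * N

/-- The constant `κ`, whose square relates the values of the Hauptmodul at `τ` and `-1/(Nτ)`. -/
def kap : ℕ := N ^ (6 / (N - 1))

/-- `∏ (1 - q^(Nn))` as an integral power series. -/
def eNZ : PowerSeries ℤ := PowerSeries.expand N (NeZero.ne N) eZ

/-- The inverse of Euler's product. -/
def eiZ : PowerSeries ℤ := PowerSeries.invOfUnit eZ 1

/-- The inverse of `∏ (1 - q^(Nn))`. -/
def eNiZ : PowerSeries ℤ := PowerSeries.invOfUnit (eNZ N) 1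

theorem eZ_mul_eiZ : eZ * eiZ = 1 :=
  PowerSeries.mul_invOfUnit _ _ (by simpa using coeff_eZ.1)

theorem eNZ_mul_eNiZ : eNZ N * eNiZ N = 1 :=
  PowerSeries.mul_invOfUnit _ _ (by
    simpa [eNZ, PowerSeries.constantCoeff_expand] using coeff_eZ.1)

/-- The `q`-expansion of the Hauptmodul. -/
def xZ : PowerSeries ℤ := PowerSeries.X * (eNZ N * eiZ) ^ rr N

/-- The `q`-expansion of `(η(τ)^N/η(Nτ))^(12 - 2 * N)`. -/
def gZ : PowerSeries ℤ := eZ ^ (N * ee N) * eNiZ N ^ ee N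

/-- The `q`-expansion of the logarithmic derivative of the Hauptmodul. -/
def EZ : PowerSeries ℤ := 1 + (rr N : PowerSeries ℤ) *
  (PowerSeries.X * PowerSeries.derivative ℤ (eNZ N) * eNiZ N -
    PowerSeries.X * PowerSeries.derivative ℤ eZ * eiZ)

theorem derivative_inverse {R : Type*} [CommRing R] {a b : PowerSeries R} (h : a * b = 1) :
    PowerSeries.derivative R b = - b ^ 2 * PowerSeries.derivative R a := by
  have h1 := congrArg (PowerSeries.derivative R) h
  simp only [Derivation.leibniz, Derivation.map_one_eq_zero, smul_eq_mul] at h1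
  linear_combination b * h1 - PowerSeries.derivative R b * h

theorem X_mul_derivative_xZ :
    PowerSeries.X * PowerSeries.derivative ℤ (xZ N) = xZ N * EZ N := by
  obtain ⟨r, hr⟩ : ∃ r, rr N = r + 1 := by
    rcases hN.out with h | h <;> subst h
    exacts [⟨23, rfl⟩, ⟨11, rfl⟩]
  have h1 := eZ_mul_eiZ
  have h2 := eNZ_mul_eNiZ N
  simp only [xZ, EZ, hr, Derivation.leibniz, Derivation.leibniz_pow, derivative_inverse h1,
    smul_eq_mul, PowerSeries.derivative_X, nsmul_eq_mul, Nat.add_sub_cancel]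
  push_cast
  linear_combination (-(PowerSeries.X ^ 2 * (r + 1 : PowerSeries ℤ) * (eNZ N * eiZ) ^ r *
    PowerSeries.derivative ℤ (eNZ N) * eiZ)) * h2

/-- The Hauptmodul `(η(Nτ)/η(τ))^(24/(N-1))`. -/
def xF (τ : ℍ) : ℂ := qq 1 τ * (eF (up N τ) * (eF τ)⁻¹) ^ rr N

/-- The modular form `(η(τ)^N/η(Nτ))^(12 - 2 * N)`. -/
def gF (τ : ℍ) : ℂ := eF τ ^ (N * ee N) * (eF (up N τ))⁻¹ ^ ee N

/-- The logarithmic derivative of the Hauptmodul. -/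
def EF (τ : ℍ) : ℂ := dOp (xF N) τ / xF N τ

theorem zc_inverse {a b : PowerSeries ℤ} (h : a * b = 1) : zc b = (zc a)⁻¹ := by
  have h1 : zc a * zc b = 1 := by rw [← map_mul, h, map_one]
  have h2 : PowerSeries.constantCoeff (zc a) * PowerSeries.constantCoeff (zc b) = 1 := by
    rw [← map_mul, h1, map_one]
  rw [eq_comm, PowerSeries.inv_eq_iff_mul_eq_one (left_ne_zero_of_mul_eq_one h2), mul_comm, h1]

theorem HasExp.zc_inverse {h : ℕ} [NeZero h] {a b : PowerSeries ℤ} (hab : a * b = 1) {f : ℍ → ℂ}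
    (hf : HasExp h (zc a) f) (h0 : ∀ τ, f τ ≠ 0) : HasExp h (zc b) f⁻¹ := by
  have h1 : zc a * zc b = 1 := by rw [← map_mul, hab, map_one]
  have h2 : PowerSeries.constantCoeff (zc a) * PowerSeries.constantCoeff (zc b) = 1 := by
    rw [← map_mul, h1, map_one]
  rw [_root_.zc_inverse hab]
  exact hf.inv h0 (left_ne_zero_of_mul_eq_one h2)

theorem zc_derivative (a : PowerSeries ℤ) :
    zc (PowerSeries.derivative ℤ a) = PowerSeries.derivative ℂ (zc a) := by
  ext n
  simp [PowerSeries.coeff_derivative]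

theorem hasExp_eNF : HasExp 1 (zc (eNZ N)) (fun τ => eF (up N τ)) := by
  refine (hasExp_eF.comp_up N).mono ?_ fun τ => rfl
  rw [eNZ]
  ext n
  by_cases h : N ∣ n
  · obtain ⟨k, rfl⟩ := h
    simp [PowerSeries.coeff_expand_mul]
  · simp [PowerSeries.coeff_expand_of_not_dvd _ _ _ h]

theorem hasExp_eiF : HasExp 1 (zc eiZ) eF⁻¹ := hasExp_eF.zc_inverse eZ_mul_eiZ eF_ne_zero

theorem hasExp_eNiF : HasExp 1 (zc (eNiZ N)) (fun τ => eF (up N τ))⁻¹ :=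
  (hasExp_eNF N).zc_inverse (eNZ_mul_eNiZ N) fun _ => eF_ne_zero _

theorem hasExp_xF : HasExp 1 (zc (xZ N)) (xF N) :=
  (hasExp_X.mul one_ne_zero (((hasExp_eNF N).mul one_ne_zero hasExp_eiF).pow (rr N))).mono
    (by simp [xZ]) fun τ => rfl

theorem hasExp_gF : HasExp 1 (zc (gZ N)) (gF N) :=
  ((hasExp_eF.pow (N * ee N)).mul one_ne_zero ((hasExp_eNiF N).pow (ee N))).mono
    (by simp [gZ]) fun τ => rfl

theorem xF_ne_zero (τ : ℍ) : xF N τ ≠ 0 :=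
  mul_ne_zero (qq_ne_zero _ _) (pow_ne_zero _ (mul_ne_zero (eF_ne_zero _)
    (inv_ne_zero (eF_ne_zero _))))

theorem gF_ne_zero (τ : ℍ) : gF N τ ≠ 0 :=
  mul_ne_zero (pow_ne_zero _ (eF_ne_zero _)) (pow_ne_zero _ (inv_ne_zero (eF_ne_zero _)))

theorem hasExp_EF : HasExp 1 (zc (EZ N)) (EF N) := by
  have h1 := (hasExp_C (h := 1) 1).add ((hasExp_C (h := 1) (rr N : ℂ)).mul one_ne_zero
    (((hasExp_eNF N).dOp.mul one_ne_zero (hasExp_eNiF N)).sub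
      (hasExp_eF.dOp.mul one_ne_zero hasExp_eiF)))
  have h2 : HasExp 1 (zc (EZ N)) _ := h1.mono (by simp [EZ, zc_derivative]) fun τ => rfl
  have h3 := (hasExp_xF N).mul one_ne_zero h2
  have h4 := (hasExp_xF N).dOp
  rw [← zc_derivative, ← PowerSeries.map_X (Int.castRingHom ℂ), ← map_mul, X_mul_derivative_xZ,
    map_mul] at h4
  refine h2.mono rfl fun τ => ?_
  rw [EF, div_eq_iff (xF_ne_zero N τ), mul_comm]
  exact (h4 τ).unique (h3 τ)

theorem dOp_xF (τ : ℍ) : dOp (xF N) τ = xF N τ * EF N τ := by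
  rw [EF, mul_div_cancel₀ _ (xF_ne_zero N τ)]

theorem eta_sq_of_eq {τ σ : ℍ} (h : (σ : ℂ) = -1 / τ) :
    ModularForm.eta σ ^ 2 = -Complex.I * τ * ModularForm.eta τ ^ 2 := by
  have h1 := ModularForm.eta_comp_eq_csqrt_I_inv τ.2
  simp only [Function.comp_apply, Pi.smul_apply, Pi.mul_apply, smul_eq_mul] at h1
  have h2 : ∀ z : ℂ, z ≠ 0 → Complex.sqrt z ^ 2 = z := by
    intro z hz
    rw [Complex.sqrt, ← Complex.cpow_nat_mul]
    norm_num
  rw [h, h1, mul_pow, mul_pow, inv_pow, h2 _ Complex.I_ne_zero, h2 _ τ.ne_zero, Complex.inv_I]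
  ring

theorem eta_up_ne_zero (τ : ℍ) : ModularForm.eta τ ^ 2 ≠ 0 :=
  pow_ne_zero _ (ModularForm.eta_ne_zero τ.2)

theorem xF_eq_eta (τ : ℍ) : xF N τ =
    (ModularForm.eta (up N τ) ^ 2 / ModularForm.eta τ ^ 2) ^ (12 / (N - 1)) := by
  have h0 : qq 24 (up N τ) = qq 24 τ ^ N := by
    simp only [qq, qParam, coe_up, ← Complex.exp_nat_mul]
    ring_nf
  have h1 := qq_pow 24 τ
  have h2 := eF_ne_zero τ
  have h3 := qq_ne_zero 24 τ
  rw [xF, eta_eq_eF, eta_eq_eF, h0, ← h1]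
  rcases hN.out with h | h <;> subst h
  · norm_num [rr]
    field_simp
  · norm_num [rr]
    field_simp

theorem gF_eq_eta (τ : ℍ) : gF N τ = (ModularForm.eta τ ^ 2) ^ (N * (6 - N)) /
    (ModularForm.eta (up N τ) ^ 2) ^ (6 - N) := by
  have h0 : qq 24 (up N τ) = qq 24 τ ^ N := by
    simp only [qq, qParam, coe_up, ← Complex.exp_nat_mul]
    ring_nf
  have h2 := eF_ne_zero (up N τ)
  have h3 := qq_ne_zero 24 τ
  rw [gF, eta_eq_eF, eta_eq_eF, h0]
  rcases hN.out with h | h <;> subst h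
  · norm_num [ee]
    field_simp
  · norm_num [ee]
    field_simp

theorem up_fricke_coe (τ : ℍ) : (up N (fricke N τ) : ℂ) = -1 / τ := by
  have := τ.ne_zero
  have : (N : ℂ) ≠ 0 := by exact_mod_cast NeZero.ne N
  rw [coe_up, coe_fricke]
  field_simp

theorem xF_fricke (τ : ℍ) : xF N (fricke N τ) * ((kap N : ℂ) ^ 2 * xF N τ) = 1 := by
  rw [xF_eq_eta, xF_eq_eta, eta_sq_of_eq (up_fricke_coe N τ),
    eta_sq_of_eq (τ := up N τ) (σ := fricke N τ) (by rw [coe_fricke, coe_up])]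
  have h1 := τ.ne_zero
  have h2 := eta_up_ne_zero τ
  have h3 := eta_up_ne_zero (up N τ)
  generalize ModularForm.eta (up N τ) ^ 2 = b at *
  generalize ModularForm.eta τ ^ 2 = a at *
  rw [coe_up]
  have h4 := Complex.I_ne_zero
  rcases hN.out with h | h <;> subst h
  · norm_num [kap]
    field_simp
    norm_num
  · norm_num [kap]
    field_simp
    norm_num

/-- The constant in the transformation of `gF` under `τ ↦ -1/(Nτ)`. -/
def gA : ℤ := (-1) ^ N * N ^ (N * (6 - N))

theorem gF_fricke (τ : ℍ) :
    gF N (fricke N τ) = gA N * τ ^ (2 * N) * xF N τ ^ (N - 1) * gF N τ := by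
  rw [gF_eq_eta, gF_eq_eta, xF_eq_eta, eta_sq_of_eq (up_fricke_coe N τ),
    eta_sq_of_eq (τ := up N τ) (σ := fricke N τ) (by rw [coe_fricke, coe_up]), coe_up]
  have h1 := τ.ne_zero
  have h2 := eta_up_ne_zero τ
  have h3 := eta_up_ne_zero (up N τ)
  have h4 := Complex.I_ne_zero
  rcases hN.out with h | h <;> subst h
  · norm_num [gA]
    field_simp
    rw [show Complex.I ^ 4 = 1 from Complex.I_pow_four]
    ring
  · norm_num [gA]
    field_simp
    rw [show Complex.I ^ 6 = -1 by rw [show 6 = 4 + 2 from rfl, pow_add, Complex.I_pow_four,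
      Complex.I_sq, one_mul]]
    ring

theorem dOp_comp_fricke [NeZero N] {f : ℍ → ℂ} (τ : ℍ)
    (hf : DifferentiableAt ℂ (f ∘ ofComplex) (fricke N τ)) :
    dOp (fun τ => f (fricke N τ)) τ = dOp f (fricke N τ) / (N * τ ^ 2) := by
  have hN0 : (N : ℂ) ≠ 0 := by exact_mod_cast NeZero.ne N
  have h1 : HasDerivAt (fun z : ℂ => -1 / (N * z)) (1 / (N * (τ : ℂ) ^ 2)) τ := by
    have h2 := ((hasDerivAt_id (τ : ℂ)).const_mul (N : ℂ)).inv
      (mul_ne_zero hN0 τ.ne_zero) |>.neg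
    have := τ.ne_zero
    refine (h2.congr_deriv ?_).congr_of_eventuallyEq (Eventually.of_forall fun z => ?_)
    · simp only [id]
      field_simp
    · simp [div_eq_mul_inv]
  have h3 := (coe_fricke N τ ▸ hf).hasDerivAt.comp (τ : ℂ) h1
  have h4 : deriv ((fun τ => f (fricke N τ)) ∘ ofComplex) τ =
      deriv ((f ∘ ofComplex) ∘ fun z : ℂ => -1 / (N * z)) τ := by
    refine Filter.EventuallyEq.deriv_eq ?_
    filter_upwards [isOpen_upperHalfPlaneSet.mem_nhds τ.im_pos] with z hz
    simp only [Function.comp_apply]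
    rw [show (-1 / (N * z) : ℂ) = fricke N ⟨z, hz⟩ from rfl, ofComplex_apply,
      ofComplex_apply_of_im_pos hz]
  rw [dOp, dOp, h4, h3.deriv, coe_fricke]
  ring

theorem EF_fricke (τ : ℍ) : EF N (fricke N τ) = -(N * τ ^ 2) * EF N τ := by
  have h0 := dOp_comp_fricke N τ ((hasExp_xF N).differentiableAt _)
  have hN0 : (N : ℂ) ≠ 0 := by exact_mod_cast NeZero.ne N
  have hk : (kap N : ℂ) ≠ 0 := by
    exact_mod_cast pow_ne_zero _ (NeZero.ne N)
  have h1 : (fun τ => xF N (fricke N τ)) = fun τ => ((kap N : ℂ) ^ 2)⁻¹ * (xF N τ)⁻¹ := by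
    funext τ
    rw [← mul_inv, eq_inv_of_mul_eq_one_left (xF_fricke N τ)]
  have h2 : dOp (fun τ => ((kap N : ℂ) ^ 2)⁻¹ * (xF N τ)⁻¹) τ =
      ((kap N : ℂ) ^ 2)⁻¹ * (- dOp (xF N) τ / xF N τ ^ 2) := by
    have h3 := ((hasExp_xF N).differentiableAt τ).hasDerivAt.fun_inv
      (by simpa using xF_ne_zero N τ) |>.const_mul ((kap N : ℂ) ^ 2)⁻¹
    rw [dOp, dOp]
    rw [show ((fun τ => ((kap N : ℂ) ^ 2)⁻¹ * (xF N τ)⁻¹) ∘ ofComplex) =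
      fun z => ((kap N : ℂ) ^ 2)⁻¹ * ((xF N ∘ ofComplex) z)⁻¹ from rfl, h3.deriv]
    simp only [Function.comp_apply, ofComplex_apply]
    ring
  rw [h1, h2, dOp_xF, dOp_xF, eq_inv_of_mul_eq_one_left (xF_fricke N τ)] at h0
  have h5 := τ.ne_zero
  have h6 := xF_ne_zero N τ
  field_simp at h0
  linear_combination -h0

end Level

section Group

open UpperHalfPlane Function.Periodic Filter Topology

/-- `σ` is the image of `τ` under the matrix with rows `(a, b)` and `(c, d)`. -/
def Mob (a b c d : ℤ) (τ σ : ℍ) : Prop := (σ : ℂ) * (c * τ + d) = a * τ + b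

theorem im_mul_normSq_of_mul_eq {a b c d : ℤ} {τ : ℍ} {w : ℂ} (h : w * (c * τ + d) = a * τ + b) :
    w.im * Complex.normSq (c * τ + d) = (a * d - b * c) * τ.im := by
  have h1 : w * Complex.normSq (c * τ + d) =
      (a * τ + b) * (starRingEnd ℂ) (c * τ + d) := by
    rw [← Complex.mul_conj, ← mul_assoc, h]
  have h2 := congrArg Complex.im h1
  rw [Complex.im_mul_ofReal] at h2
  simp only [map_add, map_mul, map_intCast, Complex.mul_im, Complex.add_re,
    Complex.add_im, Complex.mul_re, Complex.intCast_re, Complex.intCast_im, Complex.conj_re,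
    Complex.conj_im, coe_im, coe_re] at h2
  rw [h2]
  ring

theorem Mob.im {a b c d : ℤ} {τ σ : ℍ} (h : Mob a b c d τ σ) :
    σ.im * Complex.normSq (c * τ + d) = (a * d - b * c) * τ.im := im_mul_normSq_of_mul_eq h

theorem ne_zero_of_int {c d : ℤ} (h : c ≠ 0 ∨ d ≠ 0) (τ : ℍ) : (c * τ + d : ℂ) ≠ 0 := by
  intro h0
  have h1 := congrArg Complex.im h0
  have h2 := congrArg Complex.re h0
  simp [τ.im_ne_zero] at h1 h2
  simp [h1] at h2
  omega

theorem Mob.ne_zero {a b c d : ℤ} (h : a * d - b * c ≠ 0) (τ : ℍ) : (c * τ + d : ℂ) ≠ 0 :=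
  ne_zero_of_int (by
    by_contra! hc
    simp [hc.1, hc.2] at h) τ

theorem exists_mob {a b c d : ℤ} (h : 0 < a * d - b * c) (τ : ℍ) : ∃ σ, Mob a b c d τ σ := by
  have h0 := Mob.ne_zero h.ne' τ
  have h1 : 0 < ((a * τ + b) / (c * τ + d) : ℂ).im := by
    have h2 := im_mul_normSq_of_mul_eq (div_mul_cancel₀ (a * τ + b : ℂ) h0)
    have h3 : (0 : ℝ) < a * d - b * c := by exact_mod_cast h
    have h4 : 0 < (a * d - b * c) * τ.im := mul_pos h3 τ.im_pos
    rw [← h2] at h4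
    exact pos_of_mul_pos_left h4 (Complex.normSq_nonneg _)
  exact ⟨⟨_, h1⟩, div_mul_cancel₀ _ h0⟩

theorem Mob.comp {a b c d a' b' c' d' : ℤ} {τ σ ρ : ℍ} (h : Mob a b c d τ σ)
    (h' : Mob a' b' c' d' σ ρ) : Mob (a' * a + b' * c) (a' * b + b' * d) (c' * a + d' * c)
      (c' * b + d' * d) τ ρ := by
  unfold Mob at *
  push_cast
  linear_combination (c * τ + d : ℂ) * h' + (a' - c' * ρ : ℂ) * h

theorem Mob.symm {a b c d : ℤ} {τ σ : ℍ} (h : Mob a b c d τ σ) : Mob d (-b) (-c) a σ τ := by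
  unfold Mob at *
  push_cast
  linear_combination -h

theorem Mob.unique {a b c d : ℤ} (hd : a * d - b * c ≠ 0) {τ σ ρ : ℍ} (h : Mob a b c d τ σ)
    (h' : Mob a b c d τ ρ) : σ = ρ := by
  refine UpperHalfPlane.ext (mul_right_cancel₀ (Mob.ne_zero hd τ) ?_)
  exact Eq.trans h (Eq.symm h')

variable (N : ℕ)

/-- Equivalence under `Γ₀(N)`. -/
def Equi (τ σ : ℍ) : Prop := ∃ a b c d : ℤ, a * d - b * (N * c) = 1 ∧ Mob a b (N * c) d τ σ

variable {N}

theorem Equi.symm {τ σ : ℍ} (h : Equi N τ σ) : Equi N σ τ := by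
  obtain ⟨a, b, c, d, h1, h2⟩ := h
  refine ⟨d, -b, -c, a, by linear_combination h1, ?_⟩
  simpa using h2.symm

theorem Equi.trans {τ σ ρ : ℍ} (h : Equi N τ σ) (h' : Equi N σ ρ) : Equi N τ ρ := by
  obtain ⟨a, b, c, d, h1, h2⟩ := h
  obtain ⟨a', b', c', d', h1', h2'⟩ := h'
  refine ⟨a' * a + b' * (N * c), a' * b + b' * d, c' * a + d' * c, N * c' * b + d' * d, ?_, ?_⟩
  · linear_combination (a * d - b * (N * c)) * h1' + h1
  · have := h2.comp h2'
    rwa [show (N : ℤ) * (c' * a + d' * c) = N * c' * a + d' * (N * c) by ring]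

variable [NeZero N]

theorem Equi.fricke {τ σ : ℍ} (h : Equi N τ σ) : Equi N (fricke N τ) (fricke N σ) := by
  obtain ⟨a, b, c, d, h1, h2⟩ := h
  refine ⟨d, -c, -b, a, by linear_combination h1, ?_⟩
  have h4 := τ.ne_zero
  have h5 := σ.ne_zero
  have h3 : (N : ℂ) ≠ 0 := by exact_mod_cast NeZero.ne N
  unfold Mob at *
  simp only [coe_fricke]
  push_cast at h2 ⊢
  field_simp
  linear_combination h2

theorem tr_vadd {F : ℍ → ℂ} (hF : ∀ τ, F (tr τ) = F τ) (n : ℤ) (τ : ℍ) :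
    F (((n : ℝ)) +ᵥ τ) = F τ := by
  induction n using Int.induction_on generalizing τ with
  | zero => simp
  | succ n ih =>
    rw [show ((((n : ℤ) + 1 : ℤ) : ℝ)) +ᵥ τ = (((n : ℤ) : ℝ)) +ᵥ tr τ by
      rw [tr, ← add_vadd]; push_cast; rfl, ih, hF]
  | pred n ih =>
    rw [← ih τ, show (((-(n : ℤ) : ℤ) : ℝ)) +ᵥ τ = tr ((((-(n : ℤ) - 1 : ℤ) : ℝ)) +ᵥ τ) by
      rw [tr, ← add_vadd]; push_cast; ring_nf, hF]

theorem exists_balanced (a : ℤ) {m : ℤ} (hm : m ≠ 0) : ∃ k : ℤ, 2 * |a + k * m| ≤ |m| := by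
  have h1 := Int.emod_nonneg a hm
  have h2 := Int.emod_lt_abs a hm
  have h3 := Int.mul_ediv_add_emod a m
  by_cases h : 2 * (a % m) ≤ |m|
  · refine ⟨-(a / m), ?_⟩
    rw [show a + -(a / m) * m = a % m by linear_combination -h3, abs_of_nonneg h1]
    exact h
  · refine ⟨-(a / m) - m.sign, ?_⟩
    rw [show a + (-(a / m) - m.sign) * m = a % m - |m| by
      rw [← Int.sign_mul_self_eq_abs]; linear_combination -h3, abs_of_nonpos (by omega)]
    omega

theorem invariant_of_generators (hN : 2 ≤ N) (hN' : N ≤ 3) {F : ℍ → ℂ}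
    (hF : ∀ τ, F (tr τ) = F τ)
    (hW : ∀ τ, F (fricke N (tr τ)) = F (fricke N τ)) {τ σ : ℍ} (h : Equi N τ σ) :
    F σ = F τ := by
  obtain ⟨a, b, c, d, h1, h2⟩ := h
  induction hn : c.natAbs using Nat.strong_induction_on generalizing a b c d σ with
  | _ n ih =>
    subst hn
    by_cases hc : c = 0
    · subst hc
      have had : a = d ∧ (d = 1 ∨ d = -1) := by
        have h3 : a * d = 1 := by linarith
        rcases Int.isUnit_iff.1 (IsUnit.of_mul_eq_one_right a h3) with rfl | rfl <;> omega
      have h3 : σ = (((b * d : ℤ) : ℝ)) +ᵥ τ := by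
        refine UpperHalfPlane.ext ?_
        unfold Mob at h2
        rw [coe_vadd]
        push_cast at h2 ⊢
        obtain ⟨rfl, rfl | rfl⟩ := had
        · push_cast at h2 ⊢; linear_combination h2
        · push_cast at h2 ⊢; linear_combination -h2
      rw [h3, tr_vadd hF]
    · obtain ⟨k, hk⟩ : ∃ k : ℤ, 2 * |a + k * (N * c)| ≤ |(N : ℤ) * c| :=
        exists_balanced a (mul_ne_zero (by omega) hc)
      have ha : a + k * (N * c) ≠ 0 := by
        intro h0
        have : (N : ℤ) * (c * (-(k * d) - b)) = 1 := by linear_combination h1 - d * h0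
        have := Int.isUnit_iff.1 (IsUnit.of_mul_eq_one _ this)
        omega
      obtain ⟨j, hj⟩ : ∃ j : ℤ, 2 * |c + j * (a + k * (N * c))| ≤ |a + k * (N * c)| :=
        exists_balanced c ha
      set σ' : ℍ := ((k : ℝ)) +ᵥ σ with hσ'
      set ω : ℍ := fricke N ((((-j : ℤ) : ℝ)) +ᵥ fricke N σ') with hω
      have h3 : F σ = F σ' := (tr_vadd hF k σ).symm
      have h4 : F ω = F σ' := by
        rw [hω, tr_vadd (F := fun τ => F (fricke N τ)) hW, fricke_fricke]
      rw [h3, ← h4]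
      refine ih (c + j * (a + k * (N * c))).natAbs ?_ (a + k * (N * c)) (b + k * d)
        (c + j * (a + k * (N * c))) (d + j * N * (b + k * d)) ?_ ?_ rfl
      · have h5 : |(N : ℤ) * c| ≤ 3 * |c| := by
          rw [abs_mul, Nat.abs_cast]
          have : (N : ℤ) ≤ 3 := by exact_mod_cast hN'
          gcongr
        have : 0 < |c| := abs_pos.2 hc
        zify
        omega
      · linear_combination h1
      · have h6 : (σ' : ℂ) = k + σ := by rw [hσ', coe_vadd]; norm_cast
        have h7 : (ω : ℂ) * (1 + j * N * σ') = σ' := by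
          have hn := (fricke N ((((-j : ℤ) : ℝ)) +ᵥ fricke N σ')).ne_zero
          have hσ0 := σ'.ne_zero
          have h8 : (N : ℂ) ≠ 0 := by exact_mod_cast NeZero.ne N
          have h9 := ((((-j : ℤ) : ℝ)) +ᵥ fricke N σ').ne_zero
          rw [coe_vadd, coe_fricke] at h9
          rw [hω, coe_fricke, coe_vadd, coe_fricke]
          push_cast at h9 ⊢
          rw [div_mul_eq_mul_div, div_eq_iff (mul_ne_zero h8 h9)]
          field_simp
          ring
        unfold Mob at *
        push_cast at h2 ⊢
        rw [h6] at h7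
        linear_combination (N * c * τ + d : ℂ) * h7 + (1 - j * N * ω : ℂ) * h2

theorem exists_equi_le_im (hN : N.Prime) (τ : ℍ) : ∃ σ, Equi N τ σ ∧
    (1 / (2 * N) ≤ σ.im ∨ 1 / (2 * N) ≤ (fricke N σ).im) := by
  obtain ⟨g, hg⟩ := ModularGroup.exists_one_half_le_im_smul τ
  have hdet := g.det_coe
  rw [Matrix.det_fin_two] at hdet
  set a := g.1 0 0
  set b := g.1 0 1
  set c := g.1 1 0
  set d := g.1 1 1
  have hN1 : (1 : ℝ) ≤ N := by exact_mod_cast hN.one_lt.le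
  have hmob : Mob a b c d τ (g • τ) := by
    have h := UpperHalfPlane.coe_specialLinearGroup_apply g τ
    rw [Mob, h]
    exact div_mul_cancel₀ _ (Mob.ne_zero (a := a) (b := b) (by rw [hdet]; exact one_ne_zero) τ)
  by_cases hc : (N : ℤ) ∣ c
  · obtain ⟨c', hc'⟩ := hc
    refine ⟨g • τ, ⟨a, b, c', d, by rw [← hc']; exact hdet, by rw [← hc']; exact hmob⟩, Or.inl ?_⟩
    refine le_trans ?_ hg
    gcongr
    linarith
  · have hcop : IsCoprime c (N * d) := by
      refine IsCoprime.mul_right ?_ ⟨-b, a, by linear_combination hdet⟩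
      exact ((Nat.prime_iff_prime_int.1 hN).coprime_iff_not_dvd.2 hc).symm
    obtain ⟨y, x, hxy⟩ := hcop
    obtain ⟨σ, hσ⟩ := exists_mob (a := c) (b := d) (c := N * -x) (d := y)
      (by rw [show c * y - d * (N * -x) = 1 by linear_combination hxy]; norm_num) τ
    refine ⟨σ, ⟨c, d, -x, y, by linear_combination hxy, hσ⟩, Or.inr ?_⟩
    have h1 := hmob.im
    have hw : Mob (a := 0) (b := -1) (c := N) (d := 0) σ (fricke N σ) := by
      have h4 := σ.ne_zero
      have h8 : (N : ℂ) ≠ 0 := by exact_mod_cast NeZero.ne N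
      rw [Mob, coe_fricke]
      push_cast
      field_simp
      ring
    have h2 := (hσ.comp hw).im
    have h3 : (c * y - d * (N * -x) : ℝ) = 1 := by
      have : c * y - d * (N * -x) = 1 := by linear_combination hxy
      exact_mod_cast this
    have h4 : (a * d - b * c : ℝ) = 1 := by exact_mod_cast hdet
    push_cast at h2
    rw [show ((N : ℂ) * c + 0 * (N * -x)) * τ + (N * d + 0 * y) = (N : ℝ) * (c * τ + d : ℂ) by
      push_cast; ring, map_mul, Complex.normSq_ofReal] at h2
    rw [h4, one_mul] at h1
    have h5 : 0 < Complex.normSq (c * τ + d) :=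
      Complex.normSq_pos.2 (Mob.ne_zero (a := a) (b := b) (by rw [hdet]; exact one_ne_zero) τ)
    have h6 : (fricke N σ).im * N = (g • τ).im := by
      refine mul_right_cancel₀ h5.ne' (mul_left_cancel₀ (show (N : ℝ) ≠ 0 by positivity) ?_)
      linear_combination h2 - N * h1 + N * τ.im * h3
    rw [div_le_iff₀ (by positivity)]
    linarith

theorem exists_forall_norm_le {Φ : ℂ → ℂ} (h : DifferentiableOn ℂ Φ (Metric.ball 0 1)) {ρ : ℝ}
    (h0 : 0 ≤ ρ) (h1 : ρ < 1) : ∃ z ∈ Metric.ball (0 : ℂ) 1, ∀ w, ‖w‖ ≤ ρ → ‖Φ w‖ ≤ ‖Φ z‖ := by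
  have hsub : Metric.closedBall (0 : ℂ) ρ ⊆ Metric.ball 0 1 :=
    Metric.closedBall_subset_ball h1
  obtain ⟨z, hz, hm⟩ := (isCompact_closedBall (0 : ℂ) ρ).exists_isMaxOn
    ⟨0, by simpa using h0⟩ (h.continuousOn.mono hsub).norm
  exact ⟨z, hsub hz, fun w hw => hm (by simpa using hw)⟩

theorem norm_qq_le {τ : ℍ} {c : ℝ} (h : c ≤ τ.im) : ‖qq 1 τ‖ ≤ Real.exp (-(2 * Real.pi * c)) := by
  rw [qq, norm_qParam]
  have := Real.pi_pos
  simp only [Nat.cast_one, div_one, coe_im]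
  rw [Real.exp_le_exp]
  nlinarith

end Group

section Hauptmodul

open UpperHalfPlane Function.Periodic Filter Topology

variable {N : ℕ} [hN : Fact (N = 2 ∨ N = 3)]

theorem level_prime : N.Prime := by
  rcases hN.out with h | h <;> subst h <;> norm_num

theorem invariant_of_hasExp {A B : PowerSeries ℂ} {F : ℍ → ℂ} (hA : HasExp 1 A F)
    (hB : HasExp 1 B (fun τ => F (fricke N τ))) {τ σ : ℍ} (h : Equi N τ σ) : F σ = F τ := by
  refine invariant_of_generators (N := N) ?_ ?_ hA.apply_tr hB.apply_tr h <;>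
  rcases hN.out with h | h <;> subst h <;> norm_num

theorem eq_const_of_hasExp {A B : PowerSeries ℂ} {F : ℍ → ℂ} (hA : HasExp 1 A F)
    (hB : HasExp 1 B (fun τ => F (fricke N τ))) (τ : ℍ) :
    F τ = PowerSeries.constantCoeff A := by
  obtain ⟨Φ, hΦ, hF⟩ := hA.exists_discSum one_ne_zero
  obtain ⟨Ψ, hΨ, hG⟩ := hB.exists_discSum one_ne_zero
  set ρ := Real.exp (-(2 * Real.pi * (1 / (2 * N)))) with hρ
  have hN0 : (0 : ℝ) < N := by exact_mod_cast level_prime.pos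
  have hρ1 : ρ < 1 := by
    rw [hρ, Real.exp_lt_one_iff]
    have := Real.pi_pos
    simp only [neg_lt_zero]
    positivity
  obtain ⟨z, hz, hz'⟩ := exists_forall_norm_le hΦ.differentiableOn (Real.exp_pos _).le hρ1
  obtain ⟨w, hw, hw'⟩ := exists_forall_norm_le hΨ.differentiableOn (Real.exp_pos _).le hρ1
  have key : ∀ τ, ‖F τ‖ ≤ max ‖Φ z‖ ‖Ψ w‖ := by
    intro τ
    obtain ⟨σ, hσ, h | h⟩ := exists_equi_le_im (N := N) level_prime τ
    · rw [← invariant_of_hasExp hA hB hσ, hF]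
      exact le_max_of_le_left (hz' _ (norm_qq_le h))
    · rw [← invariant_of_hasExp hA hB hσ, ← fricke_fricke N σ]
      refine le_max_of_le_right ?_
      have := hG (fricke N σ)
      rw [this]
      exact hw' _ (norm_qq_le h)
  have hconst : ∀ {Θ : ℂ → ℂ} {H : ℍ → ℂ} {C : PowerSeries ℂ} {y : ℂ}, DiscSum C Θ →
      (∀ τ, H τ = Θ (qq 1 τ)) → y ∈ Metric.ball (0 : ℂ) 1 → (∀ w, ‖w‖ ≤ ρ → ‖Θ w‖ ≤ ‖Θ y‖) →
      (∀ τ, ‖H τ‖ ≤ ‖Θ y‖) → ∀ τ, H τ = Θ 0 := by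
    intro Θ H C y hC hH hy hy' hle τ
    have hm : IsMaxOn (norm ∘ Θ) (Metric.ball 0 1) y := by
      intro v hv
      by_cases hv0 : v = 0
      · exact hy' v (by rw [hv0, norm_zero]; exact (Real.exp_pos _).le)
      · obtain ⟨σ, rfl⟩ := exists_qParam_eq one_ne_zero (by simpa using hv) hv0
        have := hle σ
        rw [hH] at this
        exact this
    have h1 := Complex.eqOn_of_isPreconnected_of_isMaxOn_norm
      (convex_ball (0 : ℂ) 1).isPreconnected Metric.isOpen_ball hC.differentiableOn hy hm
    rw [hH, h1 (show qq 1 τ ∈ Metric.ball (0 : ℂ) 1 by simpa using norm_qq_lt_one 1 τ),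
      h1 (show (0 : ℂ) ∈ Metric.ball (0 : ℂ) 1 by simp), Function.const_apply,
      Function.const_apply]
  rw [← hΦ.apply_zero]
  rcases le_total ‖Ψ w‖ ‖Φ z‖ with h | h
  · exact hconst hΦ hF hz hz' (fun τ => (key τ).trans (by rw [max_eq_left h])) τ
  · have h1 := hconst hΨ hG hw hw' (fun τ => (key _).trans (by rw [max_eq_right h]))
    have h2 : ∀ τ, F τ = Ψ 0 := fun τ => by
      have := h1 (fricke N τ)
      simpa only [fricke_fricke] using this
    rw [h2, hΦ.apply_zero]
    have h3 : HasExp 1 (PowerSeries.C (Ψ 0)) F := (hasExp_C (Ψ 0)).mono rfl fun τ => h2 τ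
    rw [hA.unique one_ne_zero h3]
    simp

theorem HasExp.div_qq {A : PowerSeries ℂ} {F : ℍ → ℂ} (hA : HasExp 1 (PowerSeries.X * A) F) :
    HasExp 1 A (fun τ => F τ / qq 1 τ) := by
  intro τ
  have h := hA τ
  rw [← hasSum_nat_add_iff' 1] at h
  refine (h.div_const (qq 1 τ)).of_eq (fun n => ?_) ?_
  · have := qq_ne_zero 1 τ
    rw [mul_comm PowerSeries.X, PowerSeries.coeff_succ_mul_X, pow_succ]
    field_simp
  · simp

/-- The inverse of the unit `xZ / X`. -/
def vZ (N : ℕ) [Fact (N = 2 ∨ N = 3)] : PowerSeries ℤ := (eZ * eNiZ N) ^ rr N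

theorem xZ_mul_vZ : xZ N * vZ N = PowerSeries.X := by
  rw [xZ, vZ, mul_assoc, ← mul_pow, show eNZ N * eiZ * (eZ * eNiZ N) =
    (eZ * eiZ) * (eNZ N * eNiZ N) by ring, eZ_mul_eiZ, eNZ_mul_eNiZ]
  simp

theorem HasExp.div_xF {A : PowerSeries ℂ} {F : ℍ → ℂ} (hA : HasExp 1 (PowerSeries.X * A) F) :
    HasExp 1 (A * zc (vZ N)) (fun τ => F τ / xF N τ) := by
  have h1 : HasExp 1 (zc (vZ N)) _ :=
    ((hasExp_eF.mul one_ne_zero (hasExp_eNiF N)).pow (rr N)).mono (by simp [vZ]) fun τ => rfl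
  refine (hA.div_qq.mul one_ne_zero h1).mono rfl fun τ => ?_
  have h2 := qq_ne_zero 1 τ
  have h3 := eF_ne_zero τ
  have h4 := eF_ne_zero (up N τ)
  simp only [Pi.mul_apply, Pi.pow_apply, Pi.inv_apply, xF]
  rw [mul_pow, mul_pow, inv_pow, inv_pow]
  field_simp

theorem kap_ne_zero : (kap N : ℂ) ≠ 0 := by
  exact_mod_cast pow_ne_zero _ (NeZero.ne N)

theorem xF_fricke_eq (τ : ℍ) : xF N (fricke N τ) = ((kap N : ℂ) ^ 2 * xF N τ)⁻¹ :=
  eq_inv_of_mul_eq_one_left (xF_fricke N τ)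

/-- A `Γ₀(N)`-invariant function without poles away from the cusp `0`, where it has a pole of
order at most `k`, is a polynomial in the Hauptmodul. -/
theorem exists_eval_xF_eq (R : Subring ℂ) (k : ℕ) {A B : PowerSeries ℂ} {F : ℍ → ℂ}
    (hA : HasExp 1 A F) (hB : HasExp 1 B (fun τ => F (fricke N τ) * xF N τ ^ k))
    (hR : ∀ n, PowerSeries.coeff n A ∈ R) :
    ∃ Q : ℂ[X], Q.natDegree ≤ k ∧ (∀ n, Q.coeff n ∈ R) ∧ ∀ τ, F τ = Q.eval (xF N τ) := by
  induction k generalizing A B F with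
  | zero =>
    refine ⟨C (PowerSeries.constantCoeff A), by simp, fun n => ?_, fun τ => ?_⟩
    · rw [coeff_C]
      split_ifs
      · simpa using hR 0
      · exact R.zero_mem
    · rw [eval_C]
      exact eq_const_of_hasExp (N := N) hA (hB.mono rfl fun τ => by simp) τ
  | succ k ih =>
    set a := PowerSeries.constantCoeff A with ha
    set A' : PowerSeries ℂ := PowerSeries.mk fun n => PowerSeries.coeff (n + 1) A with hA'
    have h1 : A - PowerSeries.C a = PowerSeries.X * A' := by
      rw [mul_comm, hA', sub_eq_iff_eq_add]
      exact A.eq_shift_mul_X_add_const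
    have h2 : HasExp 1 (A' * zc (vZ N)) (fun τ => (F τ - a) / xF N τ) :=
      HasExp.div_xF ((hA.sub (hasExp_C a)).mono h1 fun τ => rfl)
    have h3 : HasExp 1 _ (fun τ => (F (fricke N τ) - a) / xF N (fricke N τ) * xF N τ ^ k) :=
      ((hasExp_C ((kap N : ℂ) ^ 2)).mul one_ne_zero
        (hB.sub ((hasExp_C a).mul one_ne_zero ((hasExp_xF N).pow (k + 1))))).mono rfl fun τ => by
          simp only [Pi.mul_apply, Pi.sub_apply, Pi.pow_apply, xF_fricke_eq, div_inv_eq_mul]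
          ring
    obtain ⟨Q, hQ1, hQ2, hQ3⟩ := ih h2 h3 (fun n => by
      rw [PowerSeries.coeff_mul]
      refine R.sum_mem fun x _ => R.mul_mem ?_ ?_
      · rw [hA', PowerSeries.coeff_mk]
        exact hR _
      · rw [PowerSeries.coeff_map]
        exact intCast_mem R _)
    refine ⟨C a + X * Q, ?_, fun n => ?_, fun τ => ?_⟩
    · refine (natDegree_add_le _ _).trans (max_le (by simp) ?_)
      refine (natDegree_mul_le).trans ?_
      have := natDegree_X_le (R := ℂ)
      omega
    · rw [coeff_add]
      refine R.add_mem ?_ ?_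
      · rw [coeff_C]
        split_ifs
        · simpa using hR 0
        · exact R.zero_mem
      · cases n with
        | zero => simp [R.zero_mem]
        | succ n => rw [coeff_X_mul]; exact hQ2 n
    · simp only [eval_add, eval_C, eval_mul, eval_X, ← hQ3]
      rw [mul_div_cancel₀ _ (xF_ne_zero N τ)]
      ring

theorem eq_zero_of_hasExp (k : ℕ) {A B : PowerSeries ℂ} {F : ℍ → ℂ} (hA : HasExp 1 A F)
    (hB : HasExp 1 B (fun τ => F (fricke N τ) * xF N τ ^ k))
    (h0 : PowerSeries.X ^ (k + 1) ∣ A) (τ : ℍ) : F τ = 0 := by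
  induction k generalizing A B F with
  | zero =>
    rw [eq_const_of_hasExp (N := N) hA (hB.mono rfl fun τ => by simp) τ]
    simpa [PowerSeries.X_dvd_iff] using h0
  | succ k ih =>
    obtain ⟨A', rfl⟩ := h0
    rw [pow_succ', mul_assoc] at hA
    have h3 : HasExp 1 _ (fun τ => F (fricke N τ) / xF N (fricke N τ) * xF N τ ^ k) :=
      ((hasExp_C ((kap N : ℂ) ^ 2)).mul one_ne_zero hB).mono rfl fun τ => by
        simp only [Pi.mul_apply, xF_fricke_eq, div_inv_eq_mul]
        ring
    have := ih (HasExp.div_xF (N := N) hA) h3 ((dvd_mul_right _ _).mul_right _)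
    simpa [xF_ne_zero N τ] using this

end Hauptmodul

section Truncation

theorem X_pow_four_dvd_sub {A : PowerSeries ℤ} {a b c d : ℤ} (h0 : PowerSeries.coeff 0 A = a)
    (h1 : PowerSeries.coeff 1 A = b) (h2 : PowerSeries.coeff 2 A = c)
    (h3 : PowerSeries.coeff 3 A = d) : PowerSeries.X ^ 4 ∣
      A - ((a : PowerSeries ℤ) + (b : PowerSeries ℤ) * PowerSeries.X +
      (c : PowerSeries ℤ) * PowerSeries.X ^ 2 + (d : PowerSeries ℤ) * PowerSeries.X ^ 3) := by
  rw [PowerSeries.X_pow_dvd_iff]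
  intro m hm
  have hC : ∀ z : ℤ, (z : PowerSeries ℤ) = PowerSeries.C z := fun z => by simp
  simp only [hC, map_sub, map_add, PowerSeries.coeff_C_mul, PowerSeries.coeff_X_pow,
    PowerSeries.coeff_X, PowerSeries.coeff_C]
  interval_cases m <;> simp [h1, h2, h3, ← h0]

/-- Truncation of a power series at order four. -/
abbrev tq : PowerSeries ℤ →+* PowerSeries ℤ ⧸ Ideal.span {(PowerSeries.X : PowerSeries ℤ) ^ 4} :=
  Ideal.Quotient.mk _

theorem tq_eq_iff {A B : PowerSeries ℤ} : tq A = tq B ↔ PowerSeries.X ^ 4 ∣ A - B := by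
  rw [Ideal.Quotient.eq, Ideal.mem_span_singleton]

theorem tq_X_pow : tq PowerSeries.X ^ 4 = 0 := by
  rw [← map_pow, ← map_zero tq, tq_eq_iff, sub_zero]

theorem tq_X_mul_derivative {A B : PowerSeries ℤ} (h : tq A = tq B) :
    tq (PowerSeries.X * PowerSeries.derivative ℤ A) =
      tq (PowerSeries.X * PowerSeries.derivative ℤ B) := by
  rw [tq_eq_iff] at h ⊢
  obtain ⟨R, hR⟩ := h
  rw [← mul_sub, ← map_sub, hR]
  refine ⟨4 * R + PowerSeries.X * PowerSeries.derivative ℤ R, ?_⟩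
  simp only [Derivation.leibniz, Derivation.leibniz_pow, PowerSeries.derivative_X, smul_eq_mul,
    nsmul_eq_mul]
  push_cast
  ring

theorem X_mul_derivative_cubic (a b c d : ℤ) : PowerSeries.X * PowerSeries.derivative ℤ
    ((a : PowerSeries ℤ) + (b : PowerSeries ℤ) * PowerSeries.X +
      (c : PowerSeries ℤ) * PowerSeries.X ^ 2 + (d : PowerSeries ℤ) * PowerSeries.X ^ 3) =
    (b : PowerSeries ℤ) * PowerSeries.X + 2 * (c : PowerSeries ℤ) * PowerSeries.X ^ 2 +
      3 * (d : PowerSeries ℤ) * PowerSeries.X ^ 3 := by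
  have hC : ∀ z : ℤ, (z : PowerSeries ℤ) = PowerSeries.C z := fun z => by simp
  simp only [hC, map_add, Derivation.leibniz, Derivation.leibniz_pow, PowerSeries.derivative_X,
    smul_eq_mul, nsmul_eq_mul, PowerSeries.derivative_C]
  push_cast
  ring

theorem tq_X_mul_derivative_of_eq {A : PowerSeries ℤ} {a b c d : ℤ}
    (h : tq A = a + b * tq PowerSeries.X + c * tq PowerSeries.X ^ 2 + d * tq PowerSeries.X ^ 3) :
    tq (PowerSeries.X * PowerSeries.derivative ℤ A) =
      b * tq PowerSeries.X + 2 * c * tq PowerSeries.X ^ 2 + 3 * d * tq PowerSeries.X ^ 3 := by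
  rw [tq_X_mul_derivative (B := (a : PowerSeries ℤ) + (b : PowerSeries ℤ) * PowerSeries.X +
    (c : PowerSeries ℤ) * PowerSeries.X ^ 2 + (d : PowerSeries ℤ) * PowerSeries.X ^ 3) (by rw [h]; simp),
    X_mul_derivative_cubic]
  simp only [map_add, map_mul, map_pow, map_intCast, map_ofNat]

theorem tq_eZ : tq eZ = 1 - tq PowerSeries.X - tq PowerSeries.X ^ 2 := by
  obtain ⟨h0, h1, h2, h3⟩ := coeff_eZ
  have := tq_eq_iff.2 (X_pow_four_dvd_sub h0 h1 h2 h3)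
  rw [this]
  simp only [map_add, map_mul, map_pow, map_intCast]
  push_cast
  ring

theorem tq_eiZ : tq eiZ = 1 + tq PowerSeries.X + 2 * tq PowerSeries.X ^ 2 +
    3 * tq PowerSeries.X ^ 3 := by
  have h1 : tq eZ * tq eiZ = 1 := by rw [← map_mul, eZ_mul_eiZ, map_one]
  have h2 := tq_eZ
  have h3 := tq_X_pow
  rw [h2] at h1
  generalize tq PowerSeries.X = t at *
  generalize tq eiZ = y at *
  linear_combination (1 + t + 2 * t ^ 2 + 3 * t ^ 3) * h1 + (5 + 3 * t) * y * h3

theorem tq_X_mul_derivative_eZ : tq (PowerSeries.X * PowerSeries.derivative ℤ eZ) =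
    - tq PowerSeries.X - 2 * tq PowerSeries.X ^ 2 := by
  rw [tq_X_mul_derivative_of_eq (a := 1) (b := -1) (c := -1) (d := 0)
    (by rw [tq_eZ]; push_cast; ring)]
  push_cast
  ring

instance : Fact (2 = 2 ∨ 2 = 3) := ⟨Or.inl rfl⟩

instance : Fact (3 = 2 ∨ 3 = 3) := ⟨Or.inr rfl⟩

theorem tq_eNZ (N : ℕ) [hN : Fact (N = 2 ∨ N = 3)] : tq (eNZ N) = 1 - tq PowerSeries.X ^ N := by
  obtain ⟨h0, h1, h2, h3⟩ := coeff_eZ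
  obtain ⟨R, hR⟩ := X_pow_four_dvd_sub h0 h1 h2 h3
  rw [sub_eq_iff_eq_add] at hR
  have hC : ∀ z : ℤ, (z : PowerSeries ℤ) = PowerSeries.C z := fun z => by simp
  have h4 : eNZ N = PowerSeries.X ^ (4 * N) * PowerSeries.expand N (NeZero.ne N) R + 1 -
      PowerSeries.X ^ N - PowerSeries.X ^ (2 * N) := by
    rw [eNZ, hR]
    simp only [hC, map_add, map_mul, map_pow, PowerSeries.expand_X, PowerSeries.expand_C]
    simp only [← hC]
    push_cast
    ring
  rw [h4]
  simp only [map_add, map_sub, map_mul, map_pow, map_one]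
  have h5 : tq PowerSeries.X ^ (2 * N) = 0 := by
    have : 4 ≤ 2 * N := by rcases hN.out with h | h <;> omega
    exact pow_eq_zero_of_le this tq_X_pow
  have h6 : tq PowerSeries.X ^ (4 * N) = 0 := by
    have : 4 ≤ 4 * N := by rcases hN.out with h | h <;> omega
    exact pow_eq_zero_of_le this tq_X_pow
  rw [h5, h6]
  ring

theorem tq_eNiZ (N : ℕ) [hN : Fact (N = 2 ∨ N = 3)] :
    tq (eNiZ N) = 1 + tq PowerSeries.X ^ N := by
  have h1 : tq (eNZ N) * tq (eNiZ N) = 1 := by rw [← map_mul, eNZ_mul_eNiZ, map_one]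
  rw [tq_eNZ] at h1
  have h5 : tq PowerSeries.X ^ (2 * N) = 0 := by
    have : 4 ≤ 2 * N := by rcases hN.out with h | h <;> omega
    exact pow_eq_zero_of_le this tq_X_pow
  linear_combination (1 + tq PowerSeries.X ^ N) * h1 + tq (eNiZ N) * h5

theorem tq_xZ_two : tq (xZ 2) = tq PowerSeries.X + 24 * tq PowerSeries.X ^ 2 +
    300 * tq PowerSeries.X ^ 3 := by
  have h0 : rr 2 = 2 * (2 * (2 * 3)) := rfl
  rw [xZ, h0]
  simp only [map_mul, map_pow, tq_eNZ, tq_eiZ, pow_mul]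
  have h := tq_X_pow
  generalize tq PowerSeries.X = t at *
  have h1 : ((1 - t ^ 2) * (1 + t + 2 * t ^ 2 + 3 * t ^ 3)) ^ 2 =
    1 + 2 * t + 3 * t ^ 2 + 6 * t ^ 3 := by grind
  have h2 : (1 + 2 * t + 3 * t ^ 2 + 6 * t ^ 3) ^ 2 = 1 + 4 * t + 10 * t ^ 2 + 24 * t ^ 3 := by
    grind
  have h3 : (1 + 4 * t + 10 * t ^ 2 + 24 * t ^ 3) ^ 2 =
    1 + 8 * t + 36 * t ^ 2 + 128 * t ^ 3 := by grind
  rw [h1, h2, h3]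
  grind

theorem tq_xZ_three : tq (xZ 3) = tq PowerSeries.X + 12 * tq PowerSeries.X ^ 2 +
    90 * tq PowerSeries.X ^ 3 := by
  have h0 : rr 3 = 2 * (2 * 3) := rfl
  rw [xZ, h0]
  simp only [map_mul, map_pow, tq_eNZ, tq_eiZ, pow_mul]
  have h := tq_X_pow
  generalize tq PowerSeries.X = t at *
  have h1 : ((1 - t ^ 3) * (1 + t + 2 * t ^ 2 + 3 * t ^ 3)) ^ 2 =
    1 + 2 * t + 5 * t ^ 2 + 8 * t ^ 3 := by grind
  have h2 : (1 + 2 * t + 5 * t ^ 2 + 8 * t ^ 3) ^ 2 = 1 + 4 * t + 14 * t ^ 2 + 36 * t ^ 3 := by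
    grind
  rw [h1, h2]
  grind

theorem tq_gZ_two : tq (gZ 2) = 1 - 16 * tq PowerSeries.X + 112 * tq PowerSeries.X ^ 2 -
    448 * tq PowerSeries.X ^ 3 := by
  have h0 : ee 2 = 2 * (2 * 2) := rfl
  rw [gZ, h0]
  simp only [map_mul, map_pow, tq_eNiZ, tq_eZ, pow_mul]
  have h := tq_X_pow
  generalize tq PowerSeries.X = t at *
  have h1 : (1 - t - t ^ 2) ^ 2 = 1 - 2 * t - t ^ 2 + 2 * t ^ 3 := by grind
  have h2 : (1 - 2 * t - t ^ 2 + 2 * t ^ 3) ^ 2 = 1 - 4 * t + 2 * t ^ 2 + 8 * t ^ 3 := by grind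
  have h3 : (1 - 4 * t + 2 * t ^ 2 + 8 * t ^ 3) ^ 2 = 1 - 8 * t + 20 * t ^ 2 := by grind
  have h4 : (1 - 8 * t + 20 * t ^ 2) ^ 2 = 1 - 16 * t + 104 * t ^ 2 - 320 * t ^ 3 := by grind
  rw [h1, h2, h3, h4]
  grind

theorem tq_gZ_three : tq (gZ 3) = 1 - 18 * tq PowerSeries.X + 135 * tq PowerSeries.X ^ 2 -
    504 * tq PowerSeries.X ^ 3 := by
  have h0 : ee 3 = 2 * 3 := rfl
  rw [gZ, h0]
  simp only [map_mul, map_pow, tq_eNiZ, tq_eZ, pow_mul]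
  have h := tq_X_pow
  generalize tq PowerSeries.X = t at *
  have h1 : (1 - t - t ^ 2) ^ 3 = 1 - 3 * t + 5 * t ^ 3 := by grind
  have h2 : (1 - 3 * t + 5 * t ^ 3) ^ 2 = 1 - 6 * t + 9 * t ^ 2 + 10 * t ^ 3 := by grind
  have h3 : (1 - 6 * t + 9 * t ^ 2 + 10 * t ^ 3) ^ 3 =
    1 - 18 * t + 135 * t ^ 2 - 510 * t ^ 3 := by grind
  rw [h1, h2, h3]
  grind

theorem tq_EZ_two : tq (EZ 2) = 1 + 24 * tq PowerSeries.X + 24 * tq PowerSeries.X ^ 2 +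
    96 * tq PowerSeries.X ^ 3 := by
  have h0 : rr 2 = 24 := rfl
  have h1 := tq_X_mul_derivative_of_eq (A := eNZ 2) (a := 1) (b := 0) (c := -1) (d := 0)
    (by rw [tq_eNZ]; push_cast; ring)
  have h2 := tq_X_mul_derivative_eZ
  rw [map_mul] at h1 h2
  simp only [EZ, h0, map_add, map_sub, map_mul, map_one, h1, h2, tq_eNiZ, tq_eiZ, map_natCast]
  have h := tq_X_pow
  generalize tq PowerSeries.X = t at *
  push_cast
  grind

theorem tq_EZ_three : tq (EZ 3) = 1 + 12 * tq PowerSeries.X + 36 * tq PowerSeries.X ^ 2 +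
    12 * tq PowerSeries.X ^ 3 := by
  have h0 : rr 3 = 12 := rfl
  have h1 := tq_X_mul_derivative_of_eq (A := eNZ 3) (a := 1) (b := 0) (c := 0) (d := -1)
    (by rw [tq_eNZ]; push_cast; ring)
  have h2 := tq_X_mul_derivative_eZ
  rw [map_mul] at h1 h2
  simp only [EZ, h0, map_add, map_sub, map_mul, map_one, h1, h2, tq_eNiZ, tq_eiZ, map_natCast]
  have h := tq_X_pow
  generalize tq PowerSeries.X = t at *
  push_cast
  grind

end Truncation

section Identities

open UpperHalfPlane Function.Periodic Filter Topology

variable (N : ℕ) [hN : Fact (N = 2 ∨ N = 3)]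

theorem zc_injective : Function.Injective zc :=
  PowerSeries.map_injective _ Int.cast_injective

/-- The inverse of `gZ`. -/
def giZ : PowerSeries ℤ := eiZ ^ (N * ee N) * eNZ N ^ ee N

theorem gZ_mul_giZ : gZ N * giZ N = 1 := by
  rw [gZ, giZ, show eZ ^ (N * ee N) * eNiZ N ^ ee N * (eiZ ^ (N * ee N) * eNZ N ^ ee N) =
    (eZ * eiZ) ^ (N * ee N) * (eNZ N * eNiZ N) ^ ee N by rw [mul_pow, mul_pow]; ring,
    eZ_mul_eiZ, eNZ_mul_eNiZ, one_pow, one_pow, one_mul]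

theorem hasExp_giF : HasExp 1 (zc (giZ N)) (gF N)⁻¹ :=
  (hasExp_gF N).zc_inverse (gZ_mul_giZ N) (gF_ne_zero N)

theorem X_pow_dvd_EZ_pow_sub : (PowerSeries.X : PowerSeries ℤ) ^ N ∣
    EZ N ^ N - (1 + (kap N : PowerSeries ℤ) * xZ N) ^ (N - 1) * gZ N := by
  refine (pow_dvd_pow _ (show N ≤ 4 by rcases hN.out with h | h <;> omega)).trans ?_
  rw [← tq_eq_iff]
  have h := tq_X_pow
  rcases hN.out with rfl | rfl
  · have h1 : kap 2 = 64 := rfl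
    simp only [map_pow, map_mul, map_add, map_one, map_natCast, tq_EZ_two, tq_xZ_two, tq_gZ_two, h1]
    generalize tq PowerSeries.X = t at *
    push_cast
    grind
  · have h1 : kap 3 = 27 := rfl
    simp only [map_pow, map_mul, map_add, map_one, map_natCast, tq_EZ_three, tq_xZ_three,
      tq_gZ_three, h1]
    generalize tq PowerSeries.X = t at *
    push_cast
    grind

theorem gA_ne_zero : (gA N : ℂ) ≠ 0 := by
  have := NeZero.ne N
  simp [gA, this]

theorem EF_pow (τ : ℍ) :
    EF N τ ^ N = (1 + kap N * xF N τ) ^ (N - 1) * gF N τ := by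
  have h1 := (hasExp_C (h := 1) 1).add ((hasExp_C (h := 1) (kap N : ℂ)).mul one_ne_zero
    (hasExp_xF N))
  have h2 := ((hasExp_EF N).pow N).mul one_ne_zero (hasExp_giF N)
  have h3 : HasExp 1 (zc ((EZ N ^ N - (1 + (kap N : PowerSeries ℤ) * xZ N) ^ (N - 1) * gZ N) *
      giZ N)) (fun τ => EF N τ ^ N / gF N τ - (1 + kap N * xF N τ) ^ (N - 1)) := by
    refine (h2.sub (h1.pow (N - 1))).mono ?_ fun τ => by
      simp only [Pi.mul_apply, Pi.pow_apply, Pi.add_apply, Pi.sub_apply, Pi.inv_apply]; rfl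
    rw [sub_mul, mul_assoc _ (gZ N), gZ_mul_giZ]
    simp
  obtain ⟨B, h4⟩ : ∃ B, HasExp 1 B (fun τ => (EF N (fricke N τ) ^ N / gF N (fricke N τ) -
      (1 + kap N * xF N (fricke N τ)) ^ (N - 1)) * xF N τ ^ (N - 1)) := by
    refine ⟨_, (((hasExp_C (h := 1) ((-(N : ℂ)) ^ N / gA N)).mul one_ne_zero h2).sub
      (((hasExp_C (h := 1) ((kap N : ℂ)⁻¹)).add (hasExp_xF N)).pow (N - 1))).mono rfl
        fun τ => ?_⟩
    have e1 := xF_ne_zero N τ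
    have e2 := gF_ne_zero N τ
    have e3 := gA_ne_zero N
    have e4 := kap_ne_zero (N := N)
    have e5 := τ.ne_zero
    simp only [Pi.mul_apply, Pi.pow_apply, Pi.add_apply, Pi.sub_apply, Pi.inv_apply, EF_fricke,
      gF_fricke, xF_fricke_eq]
    rw [sub_mul, ← mul_pow]
    congr 1
    · rw [mul_pow, show (-((N : ℂ) * τ ^ 2)) ^ N = (-(N : ℂ)) ^ N * τ ^ (2 * N) by
        rw [neg_mul_eq_neg_mul, mul_pow, ← pow_mul]]
      field_simp
    · congr 1
      field_simp
      ring
  have h5 := eq_zero_of_hasExp (N := N) (N - 1) h3 h4 (by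
    have h6 := (map_dvd zc (X_pow_dvd_EZ_pow_sub N))
    rw [Nat.sub_add_cancel NeZero.one_le, map_mul]
    simpa using h6.mul_right _) τ
  rw [sub_eq_zero, div_eq_iff (gF_ne_zero N τ)] at h5
  exact h5

theorem EZ_pow : EZ N ^ N = (1 + (kap N : PowerSeries ℤ) * xZ N) ^ (N - 1) * gZ N := by
  refine zc_injective (HasExp.unique (h := 1) one_ne_zero (f := fun τ => EF N τ ^ N)
    (((hasExp_EF N).pow N).mono (by simp) fun τ => rfl) ?_)
  refine ((((hasExp_C (h := 1) 1).add ((hasExp_C (h := 1) (kap N : ℂ)).mul one_ne_zero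
    (hasExp_xF N))).pow (N - 1)).mul one_ne_zero (hasExp_gF N)).mono ?_ fun τ => ?_
  · simp
  · rw [EF_pow]; rfl

end Identities

section Schwarzian

open UpperHalfPlane Function.Periodic Filter Topology

variable (N : ℕ) [hN : Fact (N = 2 ∨ N = 3)]

/-- The derivation `q d/dq`. -/
def xD : Derivation ℤ (PowerSeries ℤ) (PowerSeries ℤ) :=
  (PowerSeries.X : PowerSeries ℤ) • PowerSeries.derivative ℤ

theorem xD_apply (A : PowerSeries ℤ) : xD A = PowerSeries.X * PowerSeries.derivative ℤ A := rfl

theorem HasExp.xD {A : PowerSeries ℤ} {f : ℍ → ℂ} (hA : HasExp 1 (zc A) f) :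
    HasExp 1 (zc (xD A)) (_root_.dOp f) :=
  hA.dOp.mono (by rw [xD_apply, map_mul, zc_derivative]; simp) fun τ => rfl

theorem dOp_const_mul_pow_mul {f : ℍ → ℂ} {τ : ℍ} (hf : DifferentiableAt ℂ (f ∘ ofComplex) τ)
    (c : ℂ) (k : ℕ) : dOp (fun τ => c * ((τ : ℂ) ^ k * f τ)) τ =
      c * (τ ^ k * dOp f τ + k * (2 * Real.pi * Complex.I)⁻¹ * τ ^ (k - 1) * f τ) := by
  have h1 := (((hasDerivAt_id (τ : ℂ)).pow k).mul hf.hasDerivAt).const_mul c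
  have h2 : deriv ((fun τ : ℍ => c * ((τ : ℂ) ^ k * f τ)) ∘ ofComplex) τ =
      deriv (fun y : ℂ => c * ((id : ℂ → ℂ) ^ k * f ∘ ofComplex) y) τ := by
    refine Filter.EventuallyEq.deriv_eq ?_
    filter_upwards [isOpen_upperHalfPlaneSet.mem_nhds τ.im_pos] with z hz
    simp [ofComplex_apply_of_im_pos hz]
  rw [dOp, dOp, h2, h1.deriv]
  simp only [Function.comp_apply, ofComplex_apply, id, Pi.pow_apply]
  ring

theorem differentiableAt_const_mul_pow_mul {f : ℍ → ℂ} {τ : ℍ}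
    (hf : DifferentiableAt ℂ (f ∘ ofComplex) τ)
    (c : ℂ) (k : ℕ) : DifferentiableAt ℂ ((fun τ : ℍ => c * ((τ : ℂ) ^ k * f τ)) ∘ ofComplex) τ := by
  have h1 := (((differentiableAt_id (x := (τ : ℂ))).pow k).mul hf).const_mul c
  refine h1.congr_of_eventuallyEq ?_
  filter_upwards [isOpen_upperHalfPlaneSet.mem_nhds τ.im_pos] with z hz
  simp [ofComplex_apply_of_im_pos hz]

theorem dOp_add {f g : ℍ → ℂ} {τ : ℍ} (hf : DifferentiableAt ℂ (f ∘ ofComplex) τ)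
    (hg : DifferentiableAt ℂ (g ∘ ofComplex) τ) :
    dOp (fun τ => f τ + g τ) τ = dOp f τ + dOp g τ := by
  rw [dOp, dOp, dOp, ← mul_add, ← deriv_add hf hg]
  rfl

theorem dOp_EF_fricke (τ : ℍ) : dOp (EF N) (fricke N τ) = -(N : ℂ) ^ 2 *
    (τ ^ 4 * dOp (EF N) τ + 2 * (2 * Real.pi * Complex.I)⁻¹ * τ ^ 3 * EF N τ) := by
  have h0 := dOp_comp_fricke N τ ((hasExp_EF N).differentiableAt _)
  have hN0 : (N : ℂ) ≠ 0 := by exact_mod_cast NeZero.ne N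
  rw [show (fun τ => EF N (fricke N τ)) = fun τ : ℍ => -(N : ℂ) * ((τ : ℂ) ^ 2 * EF N τ) by
    funext τ; rw [EF_fricke]; ring,
    dOp_const_mul_pow_mul ((hasExp_EF N).differentiableAt τ), eq_div_iff (by
      exact mul_ne_zero hN0 (pow_ne_zero _ τ.ne_zero))] at h0
  rw [← h0]
  push_cast
  ring

theorem dOp_dOp_EF_fricke (τ : ℍ) : dOp (dOp (EF N)) (fricke N τ) = -(N : ℂ) ^ 3 *
    (τ ^ 6 * dOp (dOp (EF N)) τ + 6 * (2 * Real.pi * Complex.I)⁻¹ * τ ^ 5 * dOp (EF N) τ +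
      6 * (2 * Real.pi * Complex.I)⁻¹ ^ 2 * τ ^ 4 * EF N τ) := by
  have h0 := dOp_comp_fricke N τ ((hasExp_EF N).xD.differentiableAt _)
  have hN0 : (N : ℂ) ≠ 0 := by exact_mod_cast NeZero.ne N
  have e1 := (hasExp_EF N).differentiableAt τ
  have e2 := (hasExp_EF N).xD.differentiableAt τ
  rw [show (fun τ => dOp (EF N) (fricke N τ)) = fun τ : ℍ =>
    -(N : ℂ) ^ 2 * ((τ : ℂ) ^ 4 * dOp (EF N) τ) +
      (-(N : ℂ) ^ 2 * 2 * (2 * Real.pi * Complex.I)⁻¹) * ((τ : ℂ) ^ 3 * EF N τ) by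
    funext τ; rw [dOp_EF_fricke]; ring,
    dOp_add (differentiableAt_const_mul_pow_mul e2 _ _)
      (differentiableAt_const_mul_pow_mul e1 _ _),
    dOp_const_mul_pow_mul e1, dOp_const_mul_pow_mul e2, eq_div_iff (by
      exact mul_ne_zero hN0 (pow_ne_zero _ τ.ne_zero))] at h0
  rw [← h0]
  push_cast
  ring

/-- The constant `κab` of the hypergeometric equation. -/
def gam : ℕ := 24 - 6 * N

/-- The modular form `2 * E * D²E - 3 * (DE)²` of weight eight. -/
def RF (τ : ℍ) : ℂ := 2 * EF N τ * dOp (dOp (EF N)) τ - 3 * dOp (EF N) τ ^ 2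

/-- The `q`-expansion of `RF`. -/
def RZ : PowerSeries ℤ := 2 * EZ N * xD (xD (EZ N)) - 3 * xD (EZ N) ^ 2

theorem RF_fricke (τ : ℍ) : RF N (fricke N τ) = N ^ 4 * τ ^ 8 * RF N τ := by
  rw [RF, RF, dOp_dOp_EF_fricke, dOp_EF_fricke, EF_fricke]
  ring

theorem hasExp_RF : HasExp 1 (zc (RZ N)) (RF N) := by
  have h1 := hasExp_EF N
  refine ((((hasExp_C (h := 1) 2).mul one_ne_zero h1).mul one_ne_zero h1.xD.xD).sub
    ((hasExp_C (h := 1) 3).mul one_ne_zero (h1.xD.pow 2))).mono ?_ fun τ => rfl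
  simp only [RZ, map_sub, map_mul, map_pow, map_ofNat]

theorem X_dvd_xD (A : PowerSeries ℤ) : PowerSeries.X ∣ xD A := ⟨_, xD_apply A⟩

theorem X_dvd_RZ : PowerSeries.X ∣ RZ N :=
  dvd_sub ((X_dvd_xD _).mul_left _) (((X_dvd_xD _).trans (dvd_pow_self _ two_ne_zero)).mul_left _)

theorem X_pow_dvd_RZ_sub : (PowerSeries.X : PowerSeries ℤ) ^ (2 * N - 2) ∣
    RZ N * EZ N ^ (2 * N - 4) - (4 * gam N : ℕ) * xZ N *
      (1 + (kap N : PowerSeries ℤ) * xZ N) ^ (2 * N - 4) * gZ N ^ 2 := by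
  refine (pow_dvd_pow _ (show 2 * N - 2 ≤ 4 by rcases hN.out with h | h <;> omega)).trans ?_
  rw [← tq_eq_iff]
  have h := tq_X_pow
  have h10 : ∀ a b c d : ℤ, ∀ A, tq A = a + b * tq PowerSeries.X + c * tq PowerSeries.X ^ 2 +
      d * tq PowerSeries.X ^ 3 → tq (xD A) =
      b * tq PowerSeries.X + 2 * c * tq PowerSeries.X ^ 2 + 3 * d * tq PowerSeries.X ^ 3 :=
    fun a b c d A hA => tq_X_mul_derivative_of_eq hA
  rcases hN.out with rfl | rfl
  · have h1 : kap 2 = 64 := rfl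
    have h2 : gam 2 = 12 := rfl
    have h3 := h10 1 24 24 96 (EZ 2) (by rw [tq_EZ_two]; push_cast; ring)
    have h4 := h10 0 24 48 288 (xD (EZ 2)) (by rw [h3]; push_cast; ring)
    simp only [RZ, map_sub, map_pow, map_mul, map_add, map_one, map_natCast, tq_EZ_two,
      tq_xZ_two, tq_gZ_two, h1, h2, h3, h4, map_ofNat]
    generalize tq PowerSeries.X = t at *
    push_cast
    grind
  · have h1 : kap 3 = 27 := rfl
    have h2 : gam 3 = 6 := rfl
    have h3 := h10 1 12 36 12 (EZ 3) (by rw [tq_EZ_three]; push_cast; ring)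
    have h4 := h10 0 12 72 36 (xD (EZ 3)) (by rw [h3]; push_cast; ring)
    simp only [RZ, map_sub, map_pow, map_mul, map_add, map_one, map_natCast, tq_EZ_three,
      tq_xZ_three, tq_gZ_three, h1, h2, h3, h4, map_ofNat]
    generalize tq PowerSeries.X = t at *
    push_cast
    grind

theorem RF_mul_EF_pow (τ : ℍ) : RF N τ * EF N τ ^ (2 * N - 4) =
    (4 * gam N : ℕ) * xF N τ * (1 + kap N * xF N τ) ^ (2 * N - 4) * gF N τ ^ 2 := by
  have h1 := (hasExp_C (h := 1) 1).add ((hasExp_C (h := 1) (kap N : ℂ)).mul one_ne_zero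
    (hasExp_xF N))
  have h2 := (((hasExp_RF N).mul one_ne_zero ((hasExp_EF N).pow (2 * N - 4))).mul one_ne_zero
    ((hasExp_giF N).pow 2))
  have h3 : HasExp 1 (zc ((RZ N * EZ N ^ (2 * N - 4) - (4 * gam N : ℕ) * xZ N *
      (1 + (kap N : PowerSeries ℤ) * xZ N) ^ (2 * N - 4) * gZ N ^ 2) * giZ N ^ 2))
      (fun τ => RF N τ * EF N τ ^ (2 * N - 4) / gF N τ ^ 2 -
        (4 * gam N : ℕ) * xF N τ * (1 + kap N * xF N τ) ^ (2 * N - 4)) := by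
    refine (h2.sub (((hasExp_C (h := 1) ((4 * gam N : ℕ) : ℂ)).mul one_ne_zero
      (hasExp_xF N)).mul one_ne_zero (h1.pow (2 * N - 4)))).mono ?_ fun τ => by
      simp only [Pi.mul_apply, Pi.pow_apply, Pi.add_apply, Pi.sub_apply, Pi.inv_apply, inv_pow]; rfl
    rw [sub_mul, mul_assoc _ (gZ N ^ 2), ← mul_pow (gZ N), gZ_mul_giZ]
    simp only [map_sub, map_mul, map_pow, map_add, map_one, map_natCast, one_pow, mul_one]
  obtain ⟨A, hA⟩ := X_dvd_RZ N
  have h2' : HasExp 1 _ (fun τ => (RF N τ * EF N τ ^ (2 * N - 4) / gF N τ ^ 2) / xF N τ) :=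
    HasExp.div_xF (N := N) (A := zc (A * EZ N ^ (2 * N - 4) * giZ N ^ 2))
      (h2.mono (by rw [hA]; simp; ring) fun τ => by
        simp only [Pi.mul_apply, Pi.pow_apply, Pi.inv_apply, inv_pow]; rfl)
  obtain ⟨B, h4⟩ : ∃ B, HasExp 1 B (fun τ =>
      (RF N (fricke N τ) * EF N (fricke N τ) ^ (2 * N - 4) / gF N (fricke N τ) ^ 2 -
        (4 * gam N : ℕ) * xF N (fricke N τ) * (1 + kap N * xF N (fricke N τ)) ^ (2 * N - 4)) *
        xF N τ ^ (2 * N - 3)) := by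
    refine ⟨_, (((hasExp_C (h := 1) ((N : ℂ) ^ (2 * N) / gA N ^ 2)).mul one_ne_zero h2').sub
      ((hasExp_C (h := 1) ((4 * gam N : ℕ) * ((kap N : ℂ) ^ 2)⁻¹)).mul one_ne_zero
      (((hasExp_C (h := 1) ((kap N : ℂ)⁻¹)).add (hasExp_xF N)).pow (2 * N - 4)))).mono rfl
        fun τ => ?_⟩
    have e1 := xF_ne_zero N τ
    have e2 := gF_ne_zero N τ
    have e3 := gA_ne_zero N
    have e4 := kap_ne_zero (N := N)
    have e5 := τ.ne_zero
    have e6 : 2 ≤ N := by rcases hN.out with h | h <;> omega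
    simp only [Pi.mul_apply, Pi.pow_apply, Pi.add_apply, Pi.sub_apply, EF_fricke,
      gF_fricke, xF_fricke_eq, RF_fricke]
    rw [sub_mul]
    congr 1
    · obtain ⟨n, rfl⟩ := Nat.exists_eq_add_of_le e6
      rw [show 2 * (2 + n) - 4 = 2 * n by omega, show 2 * (2 + n) - 3 = 2 * n + 1 by omega,
        show 2 + n - 1 = n + 1 by omega]
      rw [neg_mul, Even.neg_pow (even_two_mul n)]
      field_simp
      ring
    · rw [show 2 * N - 3 = 2 * N - 4 + 1 by omega, pow_succ (xF N τ)]
      rw [show (kap N : ℂ)⁻¹ + xF N τ = (1 + kap N * (kap N ^ 2 * xF N τ)⁻¹) * xF N τ by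
        field_simp; ring, mul_pow]
      field_simp
  have h5 := eq_zero_of_hasExp (N := N) (2 * N - 3) h3 h4 (by
    have h6 := (map_dvd zc (X_pow_dvd_RZ_sub N))
    rw [show 2 * N - 3 + 1 = 2 * N - 2 by rcases hN.out with h | h <;> omega, map_mul]
    simpa using h6.mul_right _) τ
  rw [sub_eq_zero, div_eq_iff (pow_ne_zero 2 (gF_ne_zero N τ))] at h5
  exact h5

theorem constantCoeff_xZ : PowerSeries.constantCoeff (xZ N) = 0 := by simp [xZ]

theorem constantCoeff_EZ : PowerSeries.constantCoeff (EZ N) = 1 := by simp [EZ]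

/-- The nonlinear differential equation satisfied by the logarithmic derivative of the
Hauptmodul. -/
theorem RZ_mul_eq : RZ N * (1 + (kap N : PowerSeries ℤ) * xZ N) ^ 2 =
    (4 * gam N : ℕ) * xZ N * EZ N ^ 4 := by
  have h1 : RZ N * EZ N ^ (2 * N - 4) = (4 * gam N : ℕ) * xZ N *
      (1 + (kap N : PowerSeries ℤ) * xZ N) ^ (2 * N - 4) * gZ N ^ 2 := by
    refine zc_injective (HasExp.unique (h := 1) one_ne_zero
      (f := fun τ => RF N τ * EF N τ ^ (2 * N - 4))
      (((hasExp_RF N).mul one_ne_zero ((hasExp_EF N).pow _)).mono (by simp) fun τ => rfl) ?_)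
    refine ((((hasExp_C (h := 1) ((4 * gam N : ℕ) : ℂ)).mul one_ne_zero (hasExp_xF N)).mul
      one_ne_zero ((((hasExp_C (h := 1) 1).add ((hasExp_C (h := 1) (kap N : ℂ)).mul one_ne_zero
      (hasExp_xF N))).pow (2 * N - 4)))).mul one_ne_zero ((hasExp_gF N).pow 2)).mono ?_ fun τ => ?_
    · simp only [map_mul, map_pow, map_add, map_one, map_natCast]
    · rw [RF_mul_EF_pow]; rfl
  have h2 := EZ_pow N
  have h0 : EZ N ≠ 0 := fun h => by simpa [h] using constantCoeff_EZ N
  have e6 : 2 ≤ N := by rcases hN.out with h | h <;> omega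
  refine mul_right_cancel₀ (pow_ne_zero (2 * N - 4) h0) ?_
  obtain ⟨n, rfl⟩ := Nat.exists_eq_add_of_le e6
  rw [show 2 * (2 + n) - 4 = 2 * n by omega] at *
  rw [show 2 + n - 1 = n + 1 by omega] at h2
  have h3 : (EZ (2 + n) ^ (2 + n)) ^ 2 = EZ (2 + n) ^ 4 * EZ (2 + n) ^ (2 * n) := by ring
  rw [mul_assoc _ (EZ (2 + n) ^ 4), ← h3, h2, mul_right_comm, h1]
  ring

end Schwarzian

section Hypergeometric

variable (N : ℕ) [hN : Fact (N = 2 ∨ N = 3)]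

/-- The coefficients of the hypergeometric series. -/
def hA (n : ℕ) : ℕ := ((6 - N) * n).choose (2 * n) * (2 * n).choose n

theorem hA_zero : hA N 0 = 1 := by simp [hA]

theorem hA_mul_factorial (n : ℕ) :
    hA N n * (((4 - N) * n).factorial * n.factorial ^ 2) = ((6 - N) * n).factorial := by
  have h0 : 6 - N = 4 - N + 2 := by rcases hN.out with h | h <;> omega
  have h1 := Nat.add_choose_mul_factorial_mul_factorial ((4 - N) * n) (2 * n)
  have h2 := Nat.add_choose_mul_factorial_mul_factorial n n
  rw [hA, h0, add_mul, ← h1, two_mul, ← h2, Nat.choose_symm_add]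
  ring

theorem hA_succ (n : ℕ) :
    (n + 1) ^ 2 * hA N (n + 1) = (kap N * (n * (n + 1)) + gam N) * hA N n := by
  have h0 := hA_mul_factorial N n
  have h1 := hA_mul_factorial N (n + 1)
  have h2 : 0 < ((4 - N) * n).factorial * n.factorial ^ 2 := by positivity
  refine Nat.eq_of_mul_eq_mul_right h2 ?_
  rw [mul_assoc (_ + gam N), h0]
  rcases hN.out with rfl | rfl
  · have e1 : kap 2 = 64 := rfl
    have e2 : gam 2 = 12 := rfl
    norm_num [mul_add, Nat.factorial_succ] at h1 ⊢
    rw [e1, e2]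
    refine Nat.eq_of_mul_eq_mul_right (show 0 < (2 * n + 1 + 1) * (2 * n + 1) by positivity) ?_
    linarith
  · have e1 : kap 3 = 27 := rfl
    have e2 : gam 3 = 6 := rfl
    norm_num [mul_add, Nat.factorial_succ] at h1 ⊢
    rw [e1, e2]
    refine Nat.eq_of_mul_eq_mul_right (show 0 < (n + 1) by positivity) ?_
    linarith

/-- The truncated hypergeometric series. -/
def FM (M : ℕ) : ℤ[X] := ∑ n ∈ Finset.range M, C (hA N n : ℤ) * X ^ n

theorem coeff_FM (M n : ℕ) : (FM N M).coeff n = if n < M then (hA N n : ℤ) else 0 := by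
  simp [FM, coeff_X_pow]

/-- The operator `X (1 - κ X) d/dX`. -/
def theta (Q : ℤ[X]) : ℤ[X] := X * (1 - (kap N : ℤ[X]) * X) * derivative Q

theorem X_pow_dvd_theta_theta (M : ℕ) : X ^ M ∣ theta N (theta N (FM N M)) -
    (gam N : ℤ[X]) * (X * (1 - (kap N : ℤ[X]) * X)) * FM N M := by
  have h1 : theta N (theta N (FM N M)) -
      (gam N : ℤ[X]) * (X * (1 - (kap N : ℤ[X]) * X)) * FM N M =
      (1 - (kap N : ℤ[X]) * X) * (derivative (X * derivative (FM N M)) * X -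
        (kap N : ℤ[X]) * (derivative (X * (derivative (FM N M) * X)) * X) -
        (gam N : ℤ[X]) * (FM N M * X)) := by
    simp only [theta, derivative_mul, derivative_sub, derivative_X, derivative_natCast,
      derivative_one]
    ring
  rw [h1]
  refine Dvd.dvd.mul_left ?_ _
  rw [X_pow_dvd_iff]
  intro d hd
  simp only [← C_eq_natCast, coeff_sub, coeff_C_mul]
  rcases d with _ | d
  · simp
  · simp only [coeff_mul_X, coeff_derivative, coeff_X_mul, coeff_FM, if_pos hd,
      if_pos (Nat.lt_of_succ_lt hd)]
    rcases d with _ | d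
    · have := hA_succ N 0
      simp at this ⊢
      zify at this
      linarith [this]
    · have := hA_succ N (d + 1)
      zify at this
      rw [coeff_mul_X, coeff_derivative, coeff_FM, if_pos (by omega)]
      push_cast
      linarith

/-- The power series `x / (1 + κ x)`. -/
def sZ : PowerSeries ℤ := xZ N * PowerSeries.invOfUnit (1 + (kap N : PowerSeries ℤ) * xZ N) 1

theorem one_add_mul_invOfUnit : (1 + (kap N : PowerSeries ℤ) * xZ N) *
    PowerSeries.invOfUnit (1 + (kap N : PowerSeries ℤ) * xZ N) 1 = 1 :=
  PowerSeries.mul_invOfUnit _ _ (by simp [constantCoeff_xZ])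

theorem one_add_ne_zero : 1 + (kap N : PowerSeries ℤ) * xZ N ≠ 0 := fun h => by
  simpa [h] using one_add_mul_invOfUnit N

theorem one_add_mul_sZ : (1 + (kap N : PowerSeries ℤ) * xZ N) * sZ N = xZ N := by
  rw [sZ, mul_left_comm, one_add_mul_invOfUnit, mul_one]

theorem one_add_mul_one_sub : (1 + (kap N : PowerSeries ℤ) * xZ N) *
    (1 - (kap N : PowerSeries ℤ) * sZ N) = 1 := by
  linear_combination -(kap N : PowerSeries ℤ) * one_add_mul_sZ N

theorem xD_sZ : xD (sZ N) = sZ N * (1 - (kap N : PowerSeries ℤ) * sZ N) * EZ N := by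
  have h1 : xD (xZ N) = xZ N * EZ N := X_mul_derivative_xZ N
  have h2 := congrArg xD (one_add_mul_sZ N)
  rw [Derivation.leibniz, map_add, Derivation.leibniz, Derivation.map_one_eq_zero,
    Derivation.map_natCast, h1] at h2
  simp only [smul_eq_mul, mul_zero, add_zero, zero_add] at h2
  refine mul_left_cancel₀ (one_add_ne_zero N) ?_
  linear_combination h2 - EZ N * sZ N * one_add_mul_one_sub N - EZ N * one_add_mul_sZ N *
    (1 - (kap N : PowerSeries ℤ) * sZ N) - (kap N : PowerSeries ℤ) * EZ N * sZ N * one_add_mul_sZ N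

theorem X_dvd_sZ : PowerSeries.X ∣ sZ N :=
  Dvd.dvd.mul_right (PowerSeries.X_dvd_iff.2 (constantCoeff_xZ N)) _

theorem xD_aeval (Q : ℤ[X]) : xD (aeval (sZ N) Q) = aeval (sZ N) (theta N Q) * EZ N := by
  rw [Derivation.map_aeval, xD_sZ, theta]
  simp only [map_mul, map_sub, map_one, map_natCast, aeval_X, smul_eq_mul]
  ring

/-- The nonlinear differential operator annihilating `EZ`. -/
def Phi (H : PowerSeries ℤ) : PowerSeries ℤ :=
  2 * H * (EZ N * xD (xD H) - xD (EZ N) * xD H) - EZ N * xD H ^ 2 -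
    4 * (gam N : PowerSeries ℤ) * (sZ N * (1 - (kap N : PowerSeries ℤ) * sZ N)) * EZ N ^ 3 * H ^ 2

theorem Phi_EZ : Phi N (EZ N) = 0 := by
  have h := RZ_mul_eq N
  refine (mul_eq_zero_iff_left (pow_ne_zero 2 (one_add_ne_zero N))).1 ?_
  have h1 : (1 + (kap N : PowerSeries ℤ) * xZ N) ^ 2 *
      (sZ N * (1 - (kap N : PowerSeries ℤ) * sZ N)) = xZ N := by
    linear_combination (1 + (kap N : PowerSeries ℤ) * xZ N) * sZ N * one_add_mul_one_sub N +
      one_add_mul_sZ N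
  rw [RZ] at h
  push_cast at h
  rw [Phi]
  linear_combination EZ N * h - 4 * (gam N : PowerSeries ℤ) * EZ N ^ 5 * h1

theorem X_pow_dvd_Phi (M : ℕ) : PowerSeries.X ^ M ∣ Phi N (aeval (sZ N) (FM N M) ^ 2) := by
  have h1 : Phi N (aeval (sZ N) (FM N M) ^ 2) = aeval (sZ N) (theta N (theta N (FM N M)) -
    (gam N : ℤ[X]) * (X * (1 - (kap N : ℤ[X]) * X)) * FM N M) *
      (4 * EZ N ^ 3 * aeval (sZ N) (FM N M) ^ 3) := by
    rw [Phi, pow_two (aeval (sZ N) (FM N M))]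
    simp only [Derivation.leibniz, xD_aeval, map_add, smul_eq_mul, map_sub, map_mul, map_one,
      map_natCast, aeval_X]
    ring
  rw [h1]
  refine Dvd.dvd.mul_right ?_ _
  refine dvd_trans ?_ (map_dvd _ (X_pow_dvd_theta_theta N M))
  simpa using pow_dvd_pow_of_dvd (X_dvd_sZ N) M

theorem coeff_xD (A : PowerSeries ℤ) (n : ℕ) :
    PowerSeries.coeff n (xD A) = n * PowerSeries.coeff n A := by
  rw [xD_apply]
  rcases n with _ | n
  · simp
  · rw [PowerSeries.coeff_succ_X_mul, PowerSeries.coeff_derivative]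
    push_cast
    ring

theorem constantCoeff_aeval_FM {M : ℕ} (hM : 0 < M) :
    PowerSeries.constantCoeff (aeval (sZ N) (FM N M)) = 1 := by
  have h1 : PowerSeries.constantCoeff (sZ N) = 0 := PowerSeries.X_dvd_iff.1 (X_dvd_sZ N)
  rw [aeval_def, hom_eval₂, h1, eval₂_at_zero, coeff_FM, if_pos hM, hA_zero]
  simp

theorem X_pow_dvd_EZ_sub (M : ℕ) :
    PowerSeries.X ^ M ∣ EZ N - aeval (sZ N) (FM N M) ^ 2 := by
  rcases Nat.eq_zero_or_pos M with rfl | hM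
  · simp
  have key : ∀ n, 1 ≤ n → n ≤ M → PowerSeries.X ^ n ∣ EZ N - aeval (sZ N) (FM N M) ^ 2 := by
    intro n hn
    induction n, hn using Nat.le_induction with
    | base =>
      intro _
      rw [pow_one, PowerSeries.X_dvd_iff]
      simp [constantCoeff_EZ, constantCoeff_aeval_FM N hM]
    | succ n hn ih =>
      intro hnM
      have ih := ih (by omega)
      have h0 := (pow_dvd_pow _ hnM).trans (X_pow_dvd_Phi N M)
      have hc := constantCoeff_aeval_FM N hM
      generalize aeval (sZ N) (FM N M) = f at *
      set H := f ^ 2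
      set Y := EZ N - H with hY
      have hYD : ∀ A : PowerSeries ℤ, PowerSeries.X ^ n ∣ A → PowerSeries.X ^ n ∣ xD A := by
        intro A hA
        rw [PowerSeries.X_pow_dvd_iff] at hA ⊢
        intro d hd
        rw [coeff_xD, hA d hd, mul_zero]
      have h1 := hYD _ ih
      have h2 : 2 * (H * EZ N) * xD (xD Y) = - Phi N H - (2 * (EZ N * xD (xD (EZ N)) - xD (EZ N) *
          xD (EZ N)) * Y - 2 * H * (xD (EZ N) * xD Y) - EZ N * (xD (EZ N) + xD H) * xD Y -
          4 * (gam N : PowerSeries ℤ) * (sZ N * (1 - (kap N : PowerSeries ℤ) * sZ N)) *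
            EZ N ^ 3 * (EZ N + H) * Y) := by
        have := Phi_EZ N
        rw [Phi] at this ⊢
        rw [hY, map_sub, map_sub]
        linear_combination this
      have h3 : ∀ A B : PowerSeries ℤ, PowerSeries.X ∣ A → PowerSeries.X ^ n ∣ B →
          PowerSeries.X ^ (n + 1) ∣ A * B := fun A B hA hB => by
        rw [pow_succ']; exact mul_dvd_mul hA hB
      have h4 : PowerSeries.X ^ (n + 1) ∣ 2 * (H * EZ N) * xD (xD Y) := by
        rw [h2]
        refine dvd_sub (by rwa [dvd_neg]) (dvd_sub (dvd_sub (dvd_sub ?_ ?_) ?_) ?_)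
        · exact h3 _ _ ((dvd_sub ((X_dvd_xD _).mul_left _) ((X_dvd_xD _).mul_left _)).mul_left _) ih
        · exact (h3 _ _ (X_dvd_xD _) h1).mul_left _
        · exact h3 _ _ ((dvd_add (X_dvd_xD _) (X_dvd_xD _)).mul_left _) h1
        · exact h3 _ _ (((((X_dvd_sZ N).mul_right _).mul_left _).mul_right _).mul_right _) ih
      have hu : IsUnit (H * EZ N) := by
        rw [PowerSeries.isUnit_iff_constantCoeff]
        simp [H, hc, constantCoeff_EZ]
      rw [mul_comm (2 : PowerSeries ℤ), mul_assoc, hu.dvd_mul_left] at h4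
      rw [PowerSeries.X_pow_dvd_iff] at h4 ih ⊢
      intro d hd
      rcases (Nat.lt_succ_iff.1 hd).lt_or_eq with h | rfl
      · exact ih d h
      · have h5 := h4 d hd
        rw [two_mul, map_add, coeff_xD, coeff_xD] at h5
        have h6 : (d : ℤ) ≠ 0 := by exact_mod_cast (by omega : d ≠ 0)
        have h7 : (2 * (d : ℤ) ^ 2) * PowerSeries.coeff d Y = 0 := by linarith
        exact (mul_eq_zero.1 h7).resolve_left (by positivity)
  exact key M hM le_rfl

end Hypergeometric

section Lucas

variable (N : ℕ) [hN : Fact (N = 2 ∨ N = 3)] {p : ℕ} [hp : Fact p.Prime]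

theorem hA_add_mul (k : ℕ) {a : ℕ} (ha : a < p) :
    (hA N (a + p * k) : ZMod p) = hA N a * hA N (p * k) := by
  induction a with
  | zero => simp [hA_zero]
  | succ a ih =>
    have h1 := congrArg (Nat.cast : ℕ → ZMod p) (hA_succ N (a + p * k))
    have h2 := congrArg (Nat.cast : ℕ → ZMod p) (hA_succ N a)
    have h3 : ((a : ZMod p) + 1) ≠ 0 := by
      have h4 : ((a + 1 : ℕ) : ZMod p) ≠ 0 := by
        rw [Ne, ZMod.natCast_eq_zero_iff]
        exact Nat.not_dvd_of_pos_of_lt (by omega) ha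
      exact_mod_cast h4
    push_cast [ih (by omega), CharP.cast_eq_zero, zero_mul, add_zero] at h1 h2
    rw [show a + 1 + p * k = a + p * k + 1 by ring]
    refine mul_left_cancel₀ (pow_ne_zero 2 h3) ?_
    linear_combination h1 - (hA N (p * k) : ZMod p) * h2

theorem choose_mul_mul (a b : ℕ) : ((p * a).choose (p * b) : ZMod p) = a.choose b := by
  have h := (ZMod.natCast_eq_natCast_iff _ _ _).2
    (Choose.choose_modEq_choose_mod_mul_choose_div_nat (n := p * a) (k := p * b) (p := p))
  simpa [Nat.mul_div_cancel_left _ hp.out.pos] using h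

theorem hA_mul (k : ℕ) : (hA N (p * k) : ZMod p) = hA N k := by
  rw [hA, hA, Nat.cast_mul, mul_left_comm, mul_left_comm 2, choose_mul_mul, choose_mul_mul,
    Nat.cast_mul]

theorem mod_four_or (h5 : 5 ≤ p) : p % 2 = 1 ∧ p % 3 ≠ 0 := by
  refine ⟨hp.out.eq_two_or_odd.resolve_left (by omega), fun h => ?_⟩
  have := (Nat.prime_dvd_prime_iff_eq Nat.prime_three hp.out).1 (Nat.dvd_of_mod_eq_zero h)
  omega

theorem dvd_kap_mul_add (h5 : 5 ≤ p) :
    p ∣ kap N * (p / (6 - N) * (p / (6 - N) + 1)) + gam N := by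
  obtain ⟨h2, h3⟩ := mod_four_or h5
  rcases hN.out with rfl | rfl
  · change p ∣ 64 * (p / 4 * (p / 4 + 1)) + 12
    have h4 : 64 * (p / 4 * (p / 4 + 1)) + 12 = 4 * (4 * (p / 4) + 1) * (4 * (p / 4) + 3) := by ring
    rw [h4]
    rcases (by omega : 4 * (p / 4) + 1 = p ∨ 4 * (p / 4) + 3 = p) with h | h
    · exact Dvd.dvd.mul_right (by rw [h]; exact dvd_mul_left _ _) _
    · exact Dvd.dvd.mul_left (by rw [h]) _
  · change p ∣ 27 * (p / 3 * (p / 3 + 1)) + 6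
    have h4 : 27 * (p / 3 * (p / 3 + 1)) + 6 = 3 * (3 * (p / 3) + 1) * (3 * (p / 3) + 2) := by ring
    rw [h4]
    rcases (by omega : 3 * (p / 3) + 1 = p ∨ 3 * (p / 3) + 2 = p) with h | h
    · exact Dvd.dvd.mul_right (by rw [h]; exact dvd_mul_left _ _) _
    · exact Dvd.dvd.mul_left (by rw [h]) _

theorem hA_eq_zero {a : ℕ} (ha : p / (6 - N) < a) (hap : a < p) (h5 : 5 ≤ p) :
    (hA N a : ZMod p) = 0 := by
  have key : ∀ a, a + 1 < p → ((kap N * (a * (a + 1)) + gam N : ℕ) : ZMod p) * hA N a = 0 →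
      (hA N (a + 1) : ZMod p) = 0 := by
    intro a hap h0
    have h1 := congrArg (Nat.cast : ℕ → ZMod p) (hA_succ N a)
    have h4 : ((a + 1 : ℕ) : ZMod p) ≠ 0 := by
      rw [Ne, ZMod.natCast_eq_zero_iff]
      exact Nat.not_dvd_of_pos_of_lt (by omega) hap
    rw [Nat.cast_mul, Nat.cast_mul, h0, Nat.cast_pow] at h1
    exact (mul_eq_zero.1 h1).resolve_left (pow_ne_zero 2 h4)
  induction a, ha using Nat.le_induction with
  | base =>
    refine key _ hap ?_
    rw [(ZMod.natCast_eq_zero_iff _ _).2 (dvd_kap_mul_add N h5), zero_mul]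
  | succ a ha ih => exact key _ hap (by rw [ih (by omega), mul_zero])

instance charP_powerSeries_zmod : CharP (PowerSeries (ZMod p)) p :=
  charP_of_injective_ringHom (f := PowerSeries.C) PowerSeries.C_injective p

theorem map_FM_mul (h5 : 5 ≤ p) (L : ℕ) :
    (FM N (p * L)).map (Int.castRingHom (ZMod p)) =
      (FM N (p / (6 - N) + 1)).map (Int.castRingHom (ZMod p)) *
      (FM N L).map (Int.castRingHom (ZMod p)) ^ p := by
  have h1 : (FM N p).map (Int.castRingHom (ZMod p)) =
      (FM N (p / (6 - N) + 1)).map (Int.castRingHom (ZMod p)) := by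
    ext n
    simp only [coeff_map, coeff_FM]
    have h6 : p / (6 - N) < p := Nat.div_lt_self hp.out.pos (by rcases hN.out with h | h <;> omega)
    split_ifs with h7 h8 h8
    · rfl
    · rw [eq_intCast, Int.cast_natCast, hA_eq_zero N (by omega) h7 h5, map_zero]
    · omega
    · rfl
  induction L with
  | zero => simp [FM, hp.out.ne_zero]
  | succ L ih =>
    have h2 : FM N (p * (L + 1)) = FM N (p * L) +
        ∑ a ∈ Finset.range p, C (hA N (p * L + a) : ℤ) * X ^ (p * L + a) := by
      rw [FM, mul_add, mul_one, Finset.sum_range_add, FM]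
    have h3 : FM N (L + 1) = FM N L + C (hA N L : ℤ) * X ^ L := by
      rw [FM, Finset.sum_range_succ, FM]
    rw [h2, h3, Polynomial.map_add, ih, Polynomial.map_add, add_pow_char, mul_add]
    congr 1
    rw [← h1, FM, Polynomial.map_sum, Polynomial.map_sum, Finset.sum_mul]
    refine Finset.sum_congr rfl fun a ha => ?_
    simp only [Polynomial.map_mul, Polynomial.map_pow, map_C, map_X, mul_pow, ← C_pow]
    rw [eq_intCast, eq_intCast, Int.cast_natCast, eq_intCast, Int.cast_natCast, Int.cast_natCast,
      ZMod.pow_card, add_comm,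
      hA_add_mul N L (Finset.mem_range.1 ha), hA_mul, C_mul]
    ring

/-- Reduction of power series modulo `p`. -/
def zp (p : ℕ) : PowerSeries ℤ →+* PowerSeries (ZMod p) := PowerSeries.map (Int.castRingHom (ZMod p))

theorem zp_aeval (s : PowerSeries ℤ) (Q : ℤ[X]) :
    zp p (aeval s Q) = aeval (zp p s) (Q.map (Int.castRingHom (ZMod p))) := by
  rw [aeval_def, hom_eval₂, aeval_def, eval₂_map]
  congr 1
  exact RingHom.ext_int _ _

theorem zp_EZ (h5 : 5 ≤ p) : zp p (EZ N) =
    zp p (aeval (sZ N) (FM N (p / (6 - N) + 1))) ^ 2 * zp p (EZ N) ^ p := by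
  rw [← sub_eq_zero]
  ext n
  rw [map_zero]
  refine PowerSeries.X_pow_dvd_iff.1 ?_ n (Nat.lt_succ_self n)
  set L := n + 1
  have hX : zp p PowerSeries.X = PowerSeries.X := by simp [zp]
  have h1 := map_dvd (zp p) (X_pow_dvd_EZ_sub N (p * L))
  have h2 := map_dvd (zp p) (X_pow_dvd_EZ_sub N L)
  rw [map_pow, hX, map_sub, map_pow] at h1 h2
  have h3 := pow_dvd_pow_of_dvd h2 p
  rw [sub_pow_char] at h3
  have h4 : zp p (aeval (sZ N) (FM N (p * L))) = zp p (aeval (sZ N) (FM N (p / (6 - N) + 1))) *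
      zp p (aeval (sZ N) (FM N L)) ^ p := by
    rw [zp_aeval, map_FM_mul N h5, map_mul, map_pow, ← zp_aeval, ← zp_aeval]
  rw [h4] at h1
  have h5 : PowerSeries.X ^ L ∣ _ := (pow_dvd_pow (PowerSeries.X : PowerSeries (ZMod p))
    (Nat.le_mul_of_pos_left L hp.out.pos)).trans h1
  have h6 : (PowerSeries.X : PowerSeries (ZMod p)) ^ L ∣ _ :=
    (dvd_pow_self _ hp.out.ne_zero).trans h3
  have h7 := dvd_sub h5 (h6.mul_left (zp p (aeval (sZ N) (FM N (p / (6 - N) + 1))) ^ 2))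
  convert h7 using 1
  ring

/-- The homogenised truncated hypergeometric polynomial. -/
def hatP : (ZMod p)[X] := ∑ n ∈ Finset.range (p / (6 - N) + 1),
  C (hA N n : ZMod p) * X ^ n * (1 + (kap N : (ZMod p)[X]) * X) ^ (p / (6 - N) - n)

/-- The exponent measuring the ramification over `1 + κ x = 0`. -/
def eE (p : ℕ) : ℕ := (N - 1) * (p - 1) - 2 * N * (p / (6 - N))

theorem eE_add (h5 : 5 ≤ p) : eE N p + 2 * N * (p / (6 - N)) = (N - 1) * (p - 1) := by
  refine Nat.sub_add_cancel ?_
  obtain ⟨h2, h3⟩ := mod_four_or h5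
  rcases hN.out with rfl | rfl
  · change 2 * 2 * (p / 4) ≤ 1 * (p - 1)
    omega
  · change 2 * 3 * (p / 3) ≤ 2 * (p - 1)
    omega

/-- The polynomial `f` with `g = f(x) g ^ p` modulo `p`. -/
def fPol : (ZMod p)[X] := hatP N ^ (2 * N) * (1 + (kap N : (ZMod p)[X]) * X) ^ eE N p

theorem aeval_hatP : aeval (zp p (xZ N)) (hatP (p := p) N) =
    (1 + (kap N : PowerSeries (ZMod p)) * zp p (xZ N)) ^ (p / (6 - N)) *
      zp p (aeval (sZ N) (FM N (p / (6 - N) + 1))) := by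
  rw [zp_aeval, hatP, FM, Polynomial.map_sum, map_sum, map_sum, Finset.mul_sum]
  refine Finset.sum_congr rfl fun n hn => ?_
  have h1 := congrArg (zp p) (one_add_mul_sZ N)
  simp only [map_mul, map_add, map_one, map_natCast] at h1
  simp only [Polynomial.map_mul, Polynomial.map_pow, map_X, map_mul, map_pow, aeval_X, map_add, map_one, map_natCast]
  have h2 : p / (6 - N) = n + (p / (6 - N) - n) := by
    have := Finset.mem_range.1 hn; omega
  conv_rhs => rw [h2]
  generalize 1 + (kap N : PowerSeries (ZMod p)) * zp p (xZ N) = u at *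
  rw [pow_add, ← h1, mul_pow]
  simp
  ring

theorem zp_gZ (h5 : 5 ≤ p) : zp p (gZ N) = aeval (zp p (xZ N)) (fPol (p := p) N) *
    zp p (gZ N) ^ p := by
  have h1 := zp_EZ (p := p) N h5
  have h2 := congrArg (zp p) (EZ_pow N)
  simp only [map_mul, map_add, map_one, map_natCast, map_pow] at h2
  have h3 : 1 + (kap N : PowerSeries (ZMod p)) * zp p (xZ N) ≠ 0 := fun h => by
    have := congrArg (zp p) (one_add_mul_invOfUnit N)
    simp [h] at this
  rw [fPol, map_mul, map_pow, map_pow, aeval_hatP]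
  simp only [map_add, map_mul, map_natCast, map_one, aeval_X]
  generalize zp p (aeval (sZ N) (FM N (p / (6 - N) + 1))) = P at *
  refine mul_left_cancel₀ (pow_ne_zero (N - 1) h3) ?_
  rw [← h2, h1]
  have h4 := eE_add (p := p) N h5
  generalize 1 + (kap N : PowerSeries (ZMod p)) * zp p (xZ N) = u at *
  have h6 : N - 1 + eE N p + (p / (6 - N)) * (2 * N) = (N - 1) * p := by
    rw [add_assoc, mul_comm _ (2 * N), h4, Nat.mul_sub, mul_one,
      Nat.add_sub_cancel' (Nat.le_mul_of_pos_right _ hp.out.pos)]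
  calc (P ^ 2 * zp p (EZ N) ^ p) ^ N = P ^ (2 * N) * (zp p (EZ N) ^ N) ^ p := by ring
    _ = P ^ (2 * N) * (u ^ (N - 1) * zp p (gZ N)) ^ p := by rw [h2]
    _ = P ^ (2 * N) * (u ^ ((N - 1) * p) * zp p (gZ N) ^ p) := by rw [mul_pow, pow_mul u]
    _ = _ := by rw [← h6]; ring

end Lucas

section Injectivity

open UpperHalfPlane Function.Periodic Filter Topology

theorem abs_le_of_norm_le {m n : ℤ} {τ : ℍ} {R e u : ℝ} (he : 0 < e) (hτ : e ≤ τ.im)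
    (hτR : ‖(τ : ℂ)‖ ≤ R) (hu : ‖(m * τ + n : ℂ)‖ ≤ u) :
    |(m : ℝ)| ≤ u * (1 + (1 + R) / e) ∧ |(n : ℝ)| ≤ u * (1 + (1 + R) / e) := by
  have hu0 : 0 ≤ u := (norm_nonneg _).trans hu
  have hR0 : 0 ≤ R := (norm_nonneg _).trans hτR
  have h1 : |(m : ℝ)| * e ≤ u := by
    have h2 := (Complex.abs_im_le_norm _).trans hu
    have h3 : (m * τ + n : ℂ).im = m * τ.im := by simp
    rw [h3, abs_mul, abs_of_pos τ.im_pos] at h2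
    exact (mul_le_mul_of_nonneg_left hτ (abs_nonneg _)).trans h2
  have h1' : |(m : ℝ)| ≤ u / e := (le_div_iff₀ he).2 h1
  have h2 : |(n : ℝ)| ≤ u + u / e * R := by
    have h3 : ‖(n : ℂ)‖ ≤ ‖(m * τ + n : ℂ)‖ + ‖(m * τ : ℂ)‖ := by
      simpa using norm_sub_le (m * τ + n : ℂ) (m * τ)
    rw [norm_mul, Complex.norm_intCast, Complex.norm_intCast] at h3
    have := mul_le_mul h1' hτR (norm_nonneg _) (by positivity)
    linarith
  have h3 : u * (1 + (1 + R) / e) = u + u / e + u / e * R := by field_simp; ring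
  have h4 : 0 ≤ u / e := by positivity
  have h5 : 0 ≤ u / e * R := by positivity
  constructor <;> linarith

theorem exists_forall_mem_Icc {R e : ℝ} (he : 0 < e) : ∃ B : ℤ, ∀ (a b c d : ℤ) (τ σ : ℍ),
    Mob a b c d τ σ → a * d - b * c = 1 → e ≤ τ.im → e ≤ σ.im → ‖(τ : ℂ)‖ ≤ R → ‖(σ : ℂ)‖ ≤ R →
      a ∈ Set.Icc (-B) B ∧ b ∈ Set.Icc (-B) B ∧ c ∈ Set.Icc (-B) B ∧ d ∈ Set.Icc (-B) B := by
  set U : ℝ := R / e + 1 with hU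
  refine ⟨⌈(U + R * U) * (1 + (1 + R) / e)⌉, fun a b c d τ σ h hd hτ hσ hτR hσR => ?_⟩
  have hR0 : 0 ≤ R := (norm_nonneg _).trans hτR
  have hU0 : 0 ≤ U := by positivity
  have h1 : ‖(c * τ + d : ℂ)‖ ≤ U := by
    have h2 := h.im
    have h3 : ((a : ℝ) * d - b * c) = 1 := by exact_mod_cast hd
    rw [h3, one_mul, Complex.normSq_eq_norm_sq] at h2
    have h4 : τ.im ≤ R := (le_abs_self _).trans ((Complex.abs_im_le_norm _).trans hτR)
    have h5 : ‖(c * τ + d : ℂ)‖ ^ 2 ≤ R / e := by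
      rw [le_div_iff₀ he]
      nlinarith [sq_nonneg ‖(c * τ + d : ℂ)‖]
    have h6 : 0 ≤ R / e := by positivity
    nlinarith [norm_nonneg (c * τ + d : ℂ)]
  have h2 : ‖(a * τ + b : ℂ)‖ ≤ R * U := by
    rw [← h, norm_mul]
    exact mul_le_mul hσR h1 (norm_nonneg _) hR0
  obtain ⟨h3, h4⟩ := abs_le_of_norm_le he hτ hτR h1
  obtain ⟨h5, h6⟩ := abs_le_of_norm_le he hτ hτR h2
  have key : ∀ m : ℤ, |(m : ℝ)| ≤ (U + R * U) * (1 + (1 + R) / e) →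
      m ∈ Set.Icc (-⌈(U + R * U) * (1 + (1 + R) / e)⌉) ⌈(U + R * U) * (1 + (1 + R) / e)⌉ := by
    intro m hm
    rw [Set.mem_Icc, ← abs_le, ← Int.cast_le (R := ℝ), Int.cast_abs]
    exact hm.trans (Int.le_ceil _)
  have h7 : 0 ≤ U * (1 + (1 + R) / e) := by positivity
  have h8 : 0 ≤ R * U * (1 + (1 + R) / e) := by positivity
  have h9 : (U + R * U) * (1 + (1 + R) / e) = U * (1 + (1 + R) / e) + R * U * (1 + (1 + R) / e) := by
    ring
  exact ⟨key a (by linarith), key b (by linarith), key c (by linarith), key d (by linarith)⟩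

theorem Mob.of_tendsto {a b c d : ℤ} {l : Filter ℕ} {u v : ℕ → ℍ} {τ σ : ℍ}
    (hu : Tendsto u l (𝓝 τ)) (hv : Tendsto v l (𝓝 σ)) (h : ∃ᶠ n in l, Mob a b c d (u n) (v n)) :
    Mob a b c d τ σ := by
  have hu' : Tendsto (fun n => (u n : ℂ)) l (𝓝 τ) := (continuous_coe.tendsto τ).comp hu
  have hv' : Tendsto (fun n => (v n : ℂ)) l (𝓝 σ) := (continuous_coe.tendsto σ).comp hv
  have h1 := ((hv'.mul ((hu'.const_mul (c : ℂ)).add_const (d : ℂ))).sub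
    ((hu'.const_mul (a : ℂ)).add_const (b : ℂ)))
  have h2 : σ * (c * τ + d : ℂ) - (a * τ + b) ∈ ({0} : Set ℂ) :=
    isClosed_singleton.mem_of_frequently_of_tendsto (h.mono fun n hn => sub_eq_zero.2 hn) h1
  exact sub_eq_zero.1 h2

theorem Equi.exists_frequently {N : ℕ} {u v : ℕ → ℍ} {τ σ : ℍ}
    (hu : Tendsto u atTop (𝓝 τ)) (hv : Tendsto v atTop (𝓝 σ))
    (h : ∀ n, Equi N (u n) (v n)) : Equi N τ σ := by
  have hu' : Tendsto (fun n => (u n : ℂ)) atTop (𝓝 τ) := (continuous_coe.tendsto τ).comp hu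
  have hv' : Tendsto (fun n => (v n : ℂ)) atTop (𝓝 σ) := (continuous_coe.tendsto σ).comp hv
  set e := min τ.im σ.im / 2
  have he : 0 < e := half_pos (lt_min τ.im_pos σ.im_pos)
  have he1 : e < τ.im := by
    have := min_le_left τ.im σ.im
    have := lt_min τ.im_pos σ.im_pos
    simp only [e]; linarith
  have he2 : e < σ.im := by
    have := min_le_right τ.im σ.im
    have := lt_min τ.im_pos σ.im_pos
    simp only [e]; linarith
  set R := max ‖(τ : ℂ)‖ ‖(σ : ℂ)‖ + 1
  have hR1 : ‖(τ : ℂ)‖ < R := (le_max_left _ _).trans_lt (lt_add_one _)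
  have hR2 : ‖(σ : ℂ)‖ < R := (le_max_right _ _).trans_lt (lt_add_one _)
  obtain ⟨B, hB⟩ := exists_forall_mem_Icc (R := R) he
  have h1 : ∀ᶠ n in atTop, ∃ x ∈ (Set.Icc (-B) B ×ˢ Set.Icc (-B) B ×ˢ Set.Icc (-B) B ×ˢ
      Set.Icc (-B) B : Set (ℤ × ℤ × ℤ × ℤ)), (x.1 * x.2.2.2 - x.2.1 * x.2.2.1 = 1 ∧
        (N : ℤ) ∣ x.2.2.1) ∧ Mob x.1 x.2.1 x.2.2.1 x.2.2.2 (u n) (v n) := by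
    have e1 := (UpperHalfPlane.continuous_im.tendsto τ).comp hu
    have e2 := (UpperHalfPlane.continuous_im.tendsto σ).comp hv
    filter_upwards [e1.eventually (lt_mem_nhds he1), e2.eventually (lt_mem_nhds he2),
      hu'.norm.eventually (gt_mem_nhds hR1), hv'.norm.eventually (gt_mem_nhds hR2)]
      with n h1 h2 h3 h4
    obtain ⟨a, b, c, d, hd, hM⟩ := h n
    obtain ⟨h5, h6, h7, h8⟩ := hB _ _ _ _ _ _ hM hd h1.le h2.le h3.le h4.le
    exact ⟨(a, b, N * c, d), ⟨h5, h6, h7, h8⟩, ⟨hd, dvd_mul_right _ _⟩, hM⟩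
  have hfin : (Set.Icc (-B) B ×ˢ Set.Icc (-B) B ×ˢ Set.Icc (-B) B ×ˢ
      Set.Icc (-B) B : Set (ℤ × ℤ × ℤ × ℤ)).Finite :=
    (Set.finite_Icc _ _).prod ((Set.finite_Icc _ _).prod ((Set.finite_Icc _ _).prod
      (Set.finite_Icc _ _)))
  have h2 : ∃ x : ℤ × ℤ × ℤ × ℤ, ∃ᶠ n in atTop, (x.1 * x.2.2.2 - x.2.1 * x.2.2.1 = 1 ∧
        (N : ℤ) ∣ x.2.2.1) ∧ Mob x.1 x.2.1 x.2.2.1 x.2.2.2 (u n) (v n) := by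
    by_contra hc
    simp only [not_exists, not_frequently] at hc
    have h3 := (eventually_all_finite hfin).2 fun x _ => hc x
    obtain ⟨n, ⟨x, hx, hx1⟩, h4⟩ := (h1.and h3).exists
    exact h4 x hx hx1
  obtain ⟨⟨a, b, c, d⟩, h3⟩ := h2
  obtain ⟨n, ⟨⟨hd, c', rfl⟩, -⟩⟩ := h3.exists
  exact ⟨a, b, c', d, hd, Mob.of_tendsto hu hv (h3.mono fun n hn => hn.2)⟩

variable {N : ℕ} [hN : Fact (N = 2 ∨ N = 3)]

theorem constantCoeff_zc_xZ : PowerSeries.constantCoeff (zc (xZ N)) = 0 := by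
  rw [zc, ← PowerSeries.coeff_zero_eq_constantCoeff_apply, PowerSeries.coeff_map,
    PowerSeries.coeff_zero_eq_constantCoeff_apply, constantCoeff_xZ, map_zero]

theorem exists_xF_eq {w : ℂ} (hw : w ≠ 0) : ∃ τ, xF N τ = w := by
  by_contra! hc
  have h1 := ((hasExp_xF N).sub (hasExp_C (h := 1) w)).inv
    (fun τ => sub_ne_zero.2 (hc τ)) (by simp [constantCoeff_zc_xZ, hw])
  have hk := kap_ne_zero (N := N)
  have h2 := (((hasExp_C (h := 1) 1).sub ((hasExp_C (h := 1) ((kap N : ℂ) ^ 2 * w)).mul one_ne_zero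
    (hasExp_xF N))).inv (fun τ => by
      have h3 := hc (fricke N τ)
      have h4 := xF_fricke N τ
      intro h5
      simp only [Pi.sub_apply, Pi.mul_apply] at h5
      refine h3 (mul_right_cancel₀ (b := (kap N : ℂ) ^ 2 * xF N τ)
        (mul_ne_zero (pow_ne_zero 2 hk) (xF_ne_zero N τ)) ?_)
      rw [h4]
      linear_combination h5) (by simp [constantCoeff_zc_xZ]))
  have h3 : HasExp 1 _ (fun τ => ((xF N - fun _ => w)⁻¹ : ℍ → ℂ) (fricke N τ)) :=
    (((hasExp_C (h := 1) ((kap N : ℂ) ^ 2)).mul one_ne_zero (hasExp_xF N)).mul one_ne_zero h2).mono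
      rfl fun τ => by
    have h3 := hc (fricke N τ)
    have h4 := xF_fricke N τ
    have h5 := xF_ne_zero N τ
    simp only [Pi.sub_apply, Pi.mul_apply, Pi.inv_apply]
    rw [xF_fricke_eq] at h3 ⊢
    have h6 : 1 - (kap N : ℂ) ^ 2 * w * xF N τ ≠ 0 := fun h => h3 (by
      refine (eq_inv_of_mul_eq_one_left ?_).symm
      linear_combination -h)
    rw [eq_comm, ← div_eq_mul_inv, div_eq_iff h6, inv_mul_eq_div, eq_div_iff (sub_ne_zero.2 h3)]
    field_simp
  have h4 := eq_const_of_hasExp h1 h3 UpperHalfPlane.I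
  rw [PowerSeries.constantCoeff_inv] at h4
  simp [constantCoeff_zc_xZ] at h4
  rw [← inv_neg, inv_inj, sub_eq_neg_self] at h4
  exact xF_ne_zero N _ h4

theorem HasStrictDerivAt.exists_injOn {f : ℂ → ℂ} {f' a : ℂ} (h : HasStrictDerivAt f f' a)
    (h0 : f' ≠ 0) : ∃ s ∈ 𝓝 a, Set.InjOn f s :=
  ⟨_, h.eventually_left_inverse h0, fun x hx y hy hxy => by
    rw [← (show h.localInverse f f' a h0 (f x) = x from hx), hxy]; exact hy⟩

theorem coeff_one_zc_xZ : PowerSeries.coeff 1 (zc (xZ N)) ≠ 0 := by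
  intro h
  have h1 := congrArg zc (xZ_mul_vZ (N := N))
  have h2 : PowerSeries.X ^ 2 ∣ zc (xZ N) := by
    rw [PowerSeries.X_pow_dvd_iff]
    intro m hm
    interval_cases m
    · rw [PowerSeries.coeff_zero_eq_constantCoeff_apply, constantCoeff_zc_xZ]
    · exact h
  have h3 := h2.mul_right (zc (vZ N))
  rw [← map_mul, h1, PowerSeries.X_pow_dvd_iff] at h3
  have h4 := h3 1 one_lt_two
  simp [zc] at h4

theorem qq_injective_of_eq {τ σ : ℍ} (h : qq 1 τ = qq 1 σ) : Equi N τ σ := by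
  obtain ⟨n, hn⟩ := Complex.exp_eq_exp_iff_exists_int.1 h
  refine ⟨1, -n, 0, 1, by ring, ?_⟩
  have h2 : (2 * Real.pi * Complex.I : ℂ) ≠ 0 := Complex.two_pi_I_ne_zero
  simp only [Nat.cast_one, Complex.ofReal_one, div_one] at hn
  have h3 : (τ : ℂ) = σ + n := mul_left_cancel₀ h2 (by linear_combination hn)
  unfold Mob
  push_cast
  linear_combination -h3

theorem xF_of_equi {τ σ : ℍ} (h : Equi N τ σ) : xF N σ = xF N τ := by
  refine invariant_of_generators (N := N) ?_ ?_ (hasExp_xF N).apply_tr (fun τ => ?_) h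
  · exact level_prime.two_le
  · rcases hN.out with h | h <;> omega
  · rw [xF_fricke_eq, xF_fricke_eq, (hasExp_xF N).apply_tr]

theorem HasExp.exists_bound {A : PowerSeries ℂ} {F : ℍ → ℂ} (hA : HasExp 1 A F) :
    ∃ C : ℝ, ∀ τ : ℍ, 1 / (2 * N) ≤ τ.im → ‖F τ‖ ≤ C := by
  obtain ⟨Φ, hΦ, hF⟩ := hA.exists_discSum one_ne_zero
  have hN0 : (0 : ℝ) < N := by exact_mod_cast (level_prime (N := N)).pos
  obtain ⟨z, -, hz⟩ := exists_forall_norm_le hΦ.differentiableOn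
    (ρ := Real.exp (-(2 * Real.pi * (1 / (2 * N))))) (Real.exp_pos _).le (by
      rw [Real.exp_lt_one_iff, neg_lt_zero]
      have := Real.pi_pos
      positivity)
  exact ⟨_, fun τ hτ => (hF τ) ▸ hz _ (norm_qq_le hτ)⟩

theorem exists_le_norm_qq : ∃ C : ℝ, 0 < C ∧ ∀ τ : ℍ, 1 / (2 * N) ≤ τ.im →
    ‖qq 1 τ‖ ≤ C * ‖xF N τ‖ ∧ ‖xF N τ‖ ≤ C * ‖qq 1 τ‖ ∧ ‖xF N τ‖ ≤ C := by
  have h1 : HasExp 1 _ (fun τ => qq 1 τ / xF N τ) :=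
    HasExp.div_xF (N := N) (A := 1) ((hasExp_X (h := 1)).mono (mul_one _).symm fun τ => rfl)
  obtain ⟨A, hA⟩ := PowerSeries.X_dvd_iff.2 (constantCoeff_zc_xZ (N := N))
  have h2 := (hA ▸ hasExp_xF N).div_qq
  obtain ⟨C1, hC1⟩ := h1.exists_bound (N := N)
  obtain ⟨C2, hC2⟩ := h2.exists_bound (N := N)
  obtain ⟨C3, hC3⟩ := (hasExp_xF N).exists_bound (N := N)
  refine ⟨max (max C1 C2) (max C3 1), lt_max_of_lt_right (lt_max_of_lt_right one_pos),
    fun τ hτ => ⟨?_, ?_, ?_⟩⟩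
  · have := hC1 τ hτ
    rw [norm_div, div_le_iff₀ (norm_pos_iff.2 (xF_ne_zero N τ))] at this
    exact this.trans (mul_le_mul_of_nonneg_right ((le_max_left _ _).trans (le_max_left _ _))
      (norm_nonneg _))
  · have := hC2 τ hτ
    rw [norm_div, div_le_iff₀ (norm_pos_iff.2 (qq_ne_zero 1 τ))] at this
    exact this.trans (mul_le_mul_of_nonneg_right ((le_max_right _ _).trans (le_max_left _ _))
      (norm_nonneg _))
  · exact (hC3 τ hτ).trans ((le_max_left _ _).trans (le_max_right _ _))

theorem exists_pos_forall_equi : ∃ μ : ℝ, 0 < μ ∧ ∀ τ σ : ℍ, xF N τ = xF N σ → ‖xF N τ‖ < μ →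
    Equi N τ σ := by
  obtain ⟨C, hC, h1⟩ := exists_le_norm_qq (N := N)
  obtain ⟨Φ, hΦ, hx⟩ := (hasExp_xF N).exists_discSum one_ne_zero
  have h2 : HasStrictDerivAt Φ (deriv Φ 0) 0 :=
    (((hΦ.differentiableOn).analyticAt (Metric.ball_mem_nhds _ one_pos))).hasStrictDerivAt
  have h3 : deriv Φ 0 ≠ 0 := by
    rw [hΦ.deriv.apply_zero, ← PowerSeries.coeff_zero_eq_constantCoeff_apply,
      PowerSeries.coeff_derivative]
    simpa using coeff_one_zc_xZ (N := N)
  obtain ⟨s, hs, hinj⟩ := h2.exists_injOn h3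
  obtain ⟨ρ, hρ, hsub⟩ := Metric.mem_nhds_iff.1 hs
  have hk : (0 : ℝ) < (kap N : ℝ) ^ 2 := by
    have := kap_ne_zero (N := N)
    have : (kap N : ℝ) ≠ 0 := by exact_mod_cast this
    positivity
  have key : ∀ τ : ℍ, ‖xF N τ‖ < min (ρ / C) (((kap N : ℝ) ^ 2 * C)⁻¹) →
      ∃ σ, Equi N τ σ ∧ qq 1 σ ∈ s := by
    intro τ hτ
    obtain ⟨σ, hσ, h4⟩ := exists_equi_le_im (level_prime (N := N)) τ
    refine ⟨σ, hσ, hsub ?_⟩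
    rw [← xF_of_equi hσ, lt_min_iff] at hτ
    rcases h4 with h4 | h4
    · rw [mem_ball_zero_iff]
      refine ((h1 σ h4).1).trans_lt ?_
      rw [mul_comm, ← lt_div_iff₀ hC]
      exact hτ.1
    · have h5 := (h1 _ h4).2.2
      rw [xF_fricke_eq, norm_inv, norm_mul, norm_pow, Complex.norm_natCast] at h5
      have h6 := hτ.2
      have h7 := norm_pos_iff.2 (xF_ne_zero N σ)
      rw [inv_le_comm₀ (by positivity) hC] at h5
      rw [mul_inv, mul_comm, ← div_eq_mul_inv, lt_div_iff₀ hk] at h6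
      linarith
  refine ⟨min (ρ / C) (((kap N : ℝ) ^ 2 * C)⁻¹), by positivity, fun τ σ hτσ hτ => ?_⟩
  obtain ⟨τ', h4, h5⟩ := key τ hτ
  obtain ⟨σ', h6, h7⟩ := key σ (hτσ ▸ hτ)
  refine h4.trans (Equi.trans (qq_injective_of_eq (hinj h5 h7 ?_)) h6.symm)
  rw [← hx, ← hx, xF_of_equi h4, xF_of_equi h6, hτσ]

theorem Equi.exists_abs_re_le (τ : ℍ) : ∃ σ : ℍ, Equi N τ σ ∧ |σ.re| ≤ 1 ∧ σ.im = τ.im := by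
  refine ⟨(-(⌊τ.re⌋ : ℝ)) +ᵥ τ, ⟨1, -⌊τ.re⌋, 0, 1, by ring, ?_⟩, ?_, ?_⟩
  · unfold Mob
    rw [coe_vadd]
    push_cast
    ring
  · rw [vadd_re, neg_add_eq_sub, Int.self_sub_floor, abs_of_nonneg (Int.fract_nonneg τ.re)]
    exact (Int.fract_lt_one τ.re).le
  · rw [vadd_im]

theorem im_fricke (τ : ℍ) : (fricke N τ).im = τ.im / (N * Complex.normSq τ) := by
  have h0 : (N : ℝ) ≠ 0 := by exact_mod_cast (level_prime (N := N)).ne_zero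
  rw [← coe_im, coe_fricke, Complex.div_im]
  simp [Complex.normSq_mul]
  field_simp

theorem exists_equi_mem {μ : ℝ} (hμ : 0 < μ) : ∃ e R : ℝ, 0 < e ∧ ∀ τ : ℍ, μ ≤ ‖xF N τ‖ →
    ‖xF N τ‖ ≤ ((kap N : ℝ) ^ 2 * μ)⁻¹ → ∃ σ : ℍ, Equi N τ σ ∧ e ≤ σ.im ∧ ‖(σ : ℂ)‖ ≤ R := by
  obtain ⟨C, hC, h1⟩ := exists_le_norm_qq (N := N)
  have hN0 : (0 : ℝ) < N := by exact_mod_cast (level_prime (N := N)).pos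
  have hk : (0 : ℝ) < (kap N : ℝ) ^ 2 := by
    have := kap_ne_zero (N := N)
    have : (kap N : ℝ) ≠ 0 := by exact_mod_cast this
    positivity
  set Y : ℝ := -Real.log (μ / C) / (2 * Real.pi)
  have key : ∀ τ : ℍ, 1 / (2 * N) ≤ τ.im → μ ≤ ‖xF N τ‖ → τ.im ≤ Y := by
    intro τ hτ hx
    have h2 := hx.trans (h1 τ hτ).2.1
    rw [mul_comm, ← div_le_iff₀ hC, qq, norm_qParam] at h2
    have h3 := (Real.log_le_iff_le_exp (by positivity)).2 h2
    rw [le_div_iff₀ (by positivity)]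
    simp only [coe_im, Nat.cast_one, div_one] at h3
    linarith
  have hnorm : ∀ τ : ℍ, |τ.re| ≤ 1 → τ.im ≤ Y → ‖(τ : ℂ)‖ ≤ 1 + Y := fun τ h2 h3 =>
    (Complex.norm_le_abs_re_add_abs_im _).trans (add_le_add h2
      ((abs_of_pos τ.im_pos).trans_le h3))
  have hY : ∀ τ : ℍ, 1 / (2 * N) ≤ τ.im → μ ≤ ‖xF N τ‖ → ∃ σ : ℍ, Equi N τ σ ∧
      1 / (2 * N) ≤ σ.im ∧ ‖(σ : ℂ)‖ ≤ 1 + Y := by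
    intro τ h2 h3
    obtain ⟨σ, h4, h5, h6⟩ := Equi.exists_abs_re_le (N := N) τ
    exact ⟨σ, h4, h6 ▸ h2, hnorm σ h5 (h6 ▸ key τ h2 h3)⟩
  refine ⟨min (1 / (2 * N)) ((1 / (2 * N)) / (N * (1 + |Y|) ^ 2)), max (1 + Y) (2 : ℝ), by positivity,
    fun τ h2 h3 => ?_⟩
  obtain ⟨σ, h4, h5 | h5⟩ := exists_equi_le_im (level_prime (N := N)) τ
  · obtain ⟨ρ, h6, h7, h8⟩ := hY σ h5 (by rwa [xF_of_equi h4])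
    exact ⟨ρ, h4.trans h6, (min_le_left _ _).trans h7, h8.trans (le_max_left _ _)⟩
  · have h9 : μ ≤ ‖xF N (fricke N σ)‖ := by
      rw [xF_fricke_eq, xF_of_equi h4, norm_inv, norm_mul, norm_pow, Complex.norm_natCast]
      rw [le_inv_comm₀ hμ (mul_pos hk (norm_pos_iff.2 (xF_ne_zero N τ)))]
      rw [mul_inv, ← div_eq_inv_mul, le_div_iff₀ hk] at h3
      rwa [mul_comm]
    obtain ⟨ρ, h6, h7, h8⟩ := hY _ h5 h9
    refine ⟨fricke N ρ, h4.trans ?_, (min_le_right _ _).trans ?_, le_trans ?_ (le_max_right _ _)⟩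
    · simpa [fricke_fricke] using h6.fricke
    · rw [im_fricke, Complex.normSq_eq_norm_sq]
      have h10 : ‖(ρ : ℂ)‖ ≤ 1 + |Y| := h8.trans (by linarith [le_abs_self Y])
      have h11 : 0 < ‖(ρ : ℂ)‖ := norm_pos_iff.2 ρ.ne_zero
      gcongr
    · have h12 : 1 / (2 * N) ≤ ‖(ρ : ℂ)‖ :=
        h7.trans ((le_abs_self _).trans (Complex.abs_im_le_norm _))
      rw [coe_fricke, norm_div, norm_neg, norm_one, norm_mul, Complex.norm_natCast]
      rw [div_le_iff₀ (by positivity)] at h12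
      rw [div_le_iff₀ (mul_pos hN0 (norm_pos_iff.2 ρ.ne_zero))]
      linarith

theorem isOpenMap_xF : IsOpenMap (xF N) := by
  have h1 : AnalyticOnNhd ℂ (xF N ∘ ofComplex) upperHalfPlaneSet := by
    refine DifferentiableOn.analyticOnNhd (fun z hz => ?_) isOpen_upperHalfPlaneSet
    exact ((hasExp_xF N).differentiableAt ⟨z, hz⟩).differentiableWithinAt
  have h2 : IsPreconnected upperHalfPlaneSet := (convex_halfSpace_im_gt 0).isPreconnected
  rcases h1.is_constant_or_isOpen h2 with ⟨w, hw⟩ | h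
  · have h3 : ∀ τ, xF N τ = w := fun τ => by simpa using hw τ τ.im_pos
    obtain ⟨τ, hτ⟩ := exists_xF_eq (N := N) one_ne_zero
    obtain ⟨σ, hσ⟩ := exists_xF_eq (N := N) two_ne_zero
    rw [h3] at hτ hσ
    exact absurd (hτ.symm.trans hσ) (by norm_num)
  · intro U hU
    have h3 := h (((↑) : ℍ → ℂ) '' U) (by rintro _ ⟨τ, -, rfl⟩; exact τ.im_pos)
      (isOpenEmbedding_coe.isOpenMap U hU)
    rw [Set.image_image] at h3
    simpa using h3

theorem exists_injOn_xF {τ : ℍ} (h : 1 + (kap N : ℂ) * xF N τ ≠ 0) :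
    ∃ s ∈ 𝓝 τ, Set.InjOn (xF N) s := by
  have h1 : HasStrictDerivAt (xF N ∘ ofComplex) (deriv (xF N ∘ ofComplex) τ) τ := by
    refine AnalyticAt.hasStrictDerivAt (DifferentiableOn.analyticAt (s := upperHalfPlaneSet)
      (fun z hz => ?_) (isOpen_upperHalfPlaneSet.mem_nhds τ.im_pos))
    exact ((hasExp_xF N).differentiableAt ⟨z, hz⟩).differentiableWithinAt
  obtain ⟨s, hs, hinj⟩ := h1.exists_injOn (fun h0 => by
    have h2 := dOp_xF N τ
    rw [dOp, h0, mul_zero, eq_comm, mul_eq_zero_iff_left (xF_ne_zero N τ)] at h2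
    have h3 := EF_pow N τ
    rw [h2, zero_pow (level_prime (N := N)).ne_zero] at h3
    exact mul_ne_zero (pow_ne_zero _ h) (gF_ne_zero N τ) h3.symm)
  refine ⟨_, continuous_coe.continuousAt.preimage_mem_nhds hs, fun x hx y hy hxy => ?_⟩
  exact UpperHalfPlane.ext (hinj hx hy (by simpa using hxy))


theorem isClosed_equi : IsClosed {t : ℍ × ℍ | Equi N t.1 t.2} := by
  refine IsSeqClosed.isClosed fun u t hu ht => ?_
  exact Equi.exists_frequently ((continuous_fst.tendsto t).comp ht)
    ((continuous_snd.tendsto t).comp ht) hu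

theorem exists_norm_lt {τ σ : ℍ} (h : xF N τ = xF N σ) (hE : ¬ Equi N τ σ) :
    ∃ τ' σ', xF N τ' = xF N σ' ∧ ¬ Equi N τ' σ' ∧ ‖xF N τ'‖ < ‖xF N τ‖ := by
  have h1 : {t : ℍ × ℍ | Equi N t.1 t.2}ᶜ ∈ 𝓝 (τ, σ) := isClosed_equi.isOpen_compl.mem_nhds hE
  rw [nhds_prod_eq, mem_prod_iff] at h1
  obtain ⟨U, hU, V, hV, hUV⟩ := h1
  have h2 : xF N '' U ∩ xF N '' V ∈ 𝓝 (xF N τ) :=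
    inter_mem (isOpenMap_xF.image_mem_nhds hU) (h ▸ isOpenMap_xF.image_mem_nhds hV)
  have h3 : Tendsto (fun t : ℝ => (t : ℂ) * xF N τ) (𝓝[<] 1) (𝓝 (xF N τ)) := by
    have : Continuous fun t : ℝ => (t : ℂ) * xF N τ := by fun_prop
    simpa using (this.tendsto 1).mono_left nhdsWithin_le_nhds
  have h4 : Set.Ioo (0 : ℝ) 1 ∈ 𝓝[<] (1 : ℝ) := Ioo_mem_nhdsLT one_pos
  obtain ⟨t, ⟨⟨u, hu, hut⟩, ⟨v, hv, hvt⟩⟩, ht⟩ := ((h3.eventually h2).and h4).exists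
  refine ⟨u, v, hut.trans hvt.symm, hUV (Set.mk_mem_prod hu hv), ?_⟩
  rw [hut, norm_mul, Complex.norm_real, Real.norm_of_nonneg ht.1.le]
  exact mul_lt_of_lt_one_left (norm_pos_iff.2 (xF_ne_zero N τ)) ht.2

theorem Mob.tendsto {a b c d : ℤ} (hd : a * d - b * c ≠ 0) {l : Filter ℕ} {u v : ℕ → ℍ} {τ σ : ℍ}
    (hu : Tendsto u l (𝓝 τ)) (huv : ∀ n, Mob a b c d (u n) (v n)) (h : Mob a b c d τ σ) :
    Tendsto v l (𝓝 σ) := by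
  have hu' : Tendsto (fun n => (u n : ℂ)) l (𝓝 τ) := (continuous_coe.tendsto τ).comp hu
  have key : ∀ {u v : ℍ}, Mob a b c d u v → (v : ℂ) = (a * u + b) / (c * u + d) := fun h =>
    (eq_div_iff (Mob.ne_zero hd _)).2 h
  refine isOpenEmbedding_coe.isInducing.tendsto_nhds_iff.2 ?_
  rw [key h]
  exact (((hu'.const_mul (a : ℂ)).add_const (b : ℂ)).div ((hu'.const_mul (c : ℂ)).add_const (d : ℂ))
    (Mob.ne_zero hd τ)).congr fun n => (key (huv n)).symm

theorem isCompact_im_norm {e : ℝ} (he : 0 < e) (R : ℝ) :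
    IsCompact {τ : ℍ | e ≤ τ.im ∧ ‖(τ : ℂ)‖ ≤ R} := by
  rw [isOpenEmbedding_coe.isInducing.isCompact_iff]
  have h1 : ((↑) : ℍ → ℂ) '' {τ : ℍ | e ≤ τ.im ∧ ‖(τ : ℂ)‖ ≤ R} =
      Metric.closedBall 0 R ∩ {z | e ≤ z.im} := by
    ext z
    constructor
    · rintro ⟨τ, hτ, rfl⟩
      exact ⟨mem_closedBall_zero_iff.2 hτ.2, hτ.1⟩
    · rintro ⟨h1, h2⟩
      exact ⟨⟨z, he.trans_le h2⟩, ⟨h2, mem_closedBall_zero_iff.1 h1⟩, rfl⟩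
  rw [h1]
  exact (isCompact_closedBall _ _).inter_right (isClosed_le continuous_const Complex.continuous_im)

theorem continuous_xF : Continuous (xF N) := by
  refine continuous_iff_continuousAt.2 fun τ => ?_
  have h1 := ((hasExp_xF N).differentiableAt τ).continuousAt
  have h2 := h1.comp (f := ((↑) : ℍ → ℂ)) (x := τ) continuous_coe.continuousAt
  simpa [Function.comp_def] using h2

theorem equi_of_tendsto {τ σ : ℍ} {u v : ℕ → ℍ} (hu : Tendsto u atTop (𝓝 τ))
    (hv : Tendsto v atTop (𝓝 σ)) (hx : ∀ n, xF N (u n) = xF N (v n)) (h : Equi N τ σ)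
    (h0 : 1 + (kap N : ℂ) * xF N τ ≠ 0) : ∃ n, Equi N (u n) (v n) := by
  obtain ⟨s, hs, hinj⟩ := exists_injOn_xF h0
  obtain ⟨a, b, c, d, hd, hM⟩ := h
  have hd' : d * a - -b * (N * -c) = 1 := by linear_combination hd
  have h1 : ∀ n, ∃ w : ℍ, Mob d (-b) (N * -c) a (v n) w := fun n => exists_mob (by rw [hd']; exact one_pos) _
  choose w hw using h1
  have h2 : Tendsto w atTop (𝓝 τ) :=
    Mob.tendsto (by rw [hd']; exact one_ne_zero) hv hw (by simpa using hM.symm)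
  obtain ⟨n, h3, h4⟩ := ((hu.eventually hs).and (h2.eventually hs)).exists
  have h5 : Equi N (v n) (w n) := ⟨d, -b, -c, a, hd', by exact_mod_cast hw n⟩
  refine ⟨n, ?_⟩
  rw [hinj h3 h4 ((hx n).trans (xF_of_equi h5).symm)]
  exact h5.symm

theorem equi_of_xF_eq {τ σ : ℍ} (h : xF N τ = xF N σ) : Equi N τ σ := by
  by_contra hE
  obtain ⟨μ, hμ, h1⟩ := exists_pos_forall_equi (N := N)
  have hk : (0 : ℝ) < (kap N : ℝ) := by
    have := kap_ne_zero (N := N)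
    have : (kap N : ℝ) ≠ 0 := by exact_mod_cast this
    positivity
  have hW : ∀ τ σ : ℍ, xF N τ = xF N σ → ¬ Equi N τ σ → 
      xF N (fricke N τ) = xF N (fricke N σ) ∧ ¬ Equi N (fricke N τ) (fricke N σ) := by
    intro τ σ h hE
    refine ⟨by rw [xF_fricke_eq, xF_fricke_eq, h], fun h => hE ?_⟩
    simpa [fricke_fricke] using h.fricke
  have hxW : ∀ τ : ℍ, ‖xF N (fricke N τ)‖ = ((kap N : ℝ) ^ 2 * ‖xF N τ‖)⁻¹ := fun τ => by
    rw [xF_fricke_eq, norm_inv, norm_mul, norm_pow, Complex.norm_natCast]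
  set S : Set ℝ := {r | ∃ τ σ : ℍ, xF N τ = xF N σ ∧ ¬ Equi N τ σ ∧ ‖xF N τ‖ = r}
  have hS : S.Nonempty := ⟨_, τ, σ, h, hE, rfl⟩
  have hSb : BddBelow S := ⟨0, by rintro _ ⟨τ, σ, -, -, rfl⟩; exact norm_nonneg _⟩
  have hSinf : ∀ r ∈ S, sInf S < r := by
    rintro _ ⟨τ, σ, h, hE, rfl⟩
    obtain ⟨τ', σ', h2, h3, h4⟩ := exists_norm_lt h hE
    exact (csInf_le hSb ⟨τ', σ', h2, h3, rfl⟩).trans_lt h4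
  obtain ⟨r, -, hr, hrS⟩ := exists_seq_tendsto_sInf hS hSb
  choose u v huv hE' hr' using hrS
  have hlow : ∀ τ σ : ℍ, xF N τ = xF N σ → ¬ Equi N τ σ → μ ≤ ‖xF N τ‖ := fun τ σ h hE =>
    not_lt.1 fun h2 => hE (h1 _ _ h h2)
  have hup : ∀ τ σ : ℍ, xF N τ = xF N σ → ¬ Equi N τ σ → ‖xF N τ‖ ≤ ((kap N : ℝ) ^ 2 * μ)⁻¹ := by
    intro τ σ h hE
    have h2 := hlow _ _ (hW _ _ h hE).1 (hW _ _ h hE).2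
    rw [hxW] at h2
    rw [mul_inv] at h2 ⊢
    have h3 := norm_pos_iff.2 (xF_ne_zero N τ)
    rw [← div_eq_mul_inv, le_div_iff₀ hμ]
    rw [← div_eq_mul_inv, le_div_iff₀ h3] at h2
    linarith
  obtain ⟨e, R, he, h2⟩ := exists_equi_mem (N := N) hμ
  choose u' hu1 hu2 hu3 using fun n => h2 (u n) (hlow _ _ (huv n) (hE' n)) (hup _ _ (huv n) (hE' n))
  choose v' hv1 hv2 hv3 using fun n => h2 (v n) (huv n ▸ hlow _ _ (huv n) (hE' n))
    (huv n ▸ hup _ _ (huv n) (hE' n))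
  have hK := isCompact_im_norm he R
  obtain ⟨⟨τ₀, σ₀⟩, -, φ, hφ, hlim⟩ := (hK.prod hK).tendsto_subseq (x := fun n => (u' n, v' n))
    fun n => ⟨⟨hu2 n, hu3 n⟩, ⟨hv2 n, hv3 n⟩⟩
  have hu4 : Tendsto (u' ∘ φ) atTop (𝓝 τ₀) := (continuous_fst.tendsto _).comp hlim
  have hv4 : Tendsto (v' ∘ φ) atTop (𝓝 σ₀) := (continuous_snd.tendsto _).comp hlim
  have hx' : ∀ n, xF N (u' n) = xF N (v' n) := fun n => by
    rw [xF_of_equi (hu1 n), xF_of_equi (hv1 n), huv n]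
  have hc : Continuous (xF N) := continuous_xF
  have hx0 : xF N τ₀ = xF N σ₀ := tendsto_nhds_unique ((hc.tendsto _).comp hu4)
    (((hc.tendsto _).comp hv4).congr fun n => (hx' (φ n)).symm)
  have hm : ‖xF N τ₀‖ = sInf S := by
    refine tendsto_nhds_unique (((hc.tendsto _).comp hu4).norm) ((hr.comp hφ.tendsto_atTop).congr
      fun n => ?_)
    simp only [Function.comp_apply]
    rw [xF_of_equi (hu1 _), hr']
  by_cases hE0 : Equi N τ₀ σ₀
  · by_cases h0 : 1 + (kap N : ℂ) * xF N τ₀ = 0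
    · have h3 : ‖xF N τ₀‖ = (kap N : ℝ)⁻¹ := by
        have h4 : (kap N : ℂ) * xF N τ₀ = -1 := by linear_combination h0
        have h5 := congrArg norm h4
        rw [norm_mul, Complex.norm_natCast, norm_neg, norm_one] at h5
        exact eq_inv_of_mul_eq_one_right h5
      have h4 := hSinf _ ⟨τ, σ, h, hE, rfl⟩
      have h5 := hSinf _ ⟨_, _, (hW _ _ h hE).1, (hW _ _ h hE).2, rfl⟩
      rw [hxW] at h5
      rw [← hm, h3] at h4 h5
      have h6 := norm_pos_iff.2 (xF_ne_zero N τ)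
      rw [inv_lt_inv₀ hk (by positivity)] at h5
      rw [inv_lt_iff_one_lt_mul₀ hk] at h4
      nlinarith
    · obtain ⟨n, hn⟩ := equi_of_tendsto hu4 hv4 (fun n => hx' _) hE0 h0
      exact hE' _ ((hu1 (φ n)).trans (hn.trans (hv1 (φ n)).symm))
  · exact absurd hm (hSinf _ ⟨τ₀, σ₀, hx0, hE0, rfl⟩).ne'

end Injectivity

section Weight

open UpperHalfPlane Function.Periodic Filter Topology

theorem dOp_comp_mob {a b c d : ℤ} (hd : a * d - b * c ≠ 0) {m : ℍ → ℍ}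
    (hm : ∀ τ, Mob a b c d τ (m τ)) {f : ℍ → ℂ} (τ : ℍ)
    (hf : DifferentiableAt ℂ (f ∘ ofComplex) (m τ)) :
    dOp (fun τ => f (m τ)) τ = dOp f (m τ) * ((a * d - b * c) / (c * τ + d) ^ 2) := by
  have key : ∀ τ, (m τ : ℂ) = (a * τ + b) / (c * τ + d) := fun τ =>
    (eq_div_iff (Mob.ne_zero hd _)).2 (hm τ)
  have h0 := Mob.ne_zero hd τ
  have h1 : HasDerivAt (fun z : ℂ => (a * z + b) / (c * z + d))
      ((a * d - b * c) / (c * (τ : ℂ) + d) ^ 2) τ := by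
    have h2 := (((hasDerivAt_id (τ : ℂ)).const_mul (a : ℂ)).add_const (b : ℂ)).div
      (((hasDerivAt_id (τ : ℂ)).const_mul (c : ℂ)).add_const (d : ℂ)) h0
    refine h2.congr_deriv ?_
    simp only [id, mul_one]
    ring
  have h3 := (key τ ▸ hf).hasDerivAt.comp (τ : ℂ) h1
  have h4 : deriv ((fun τ => f (m τ)) ∘ ofComplex) τ =
      deriv ((f ∘ ofComplex) ∘ fun z : ℂ => (a * z + b) / (c * z + d)) τ := by
    refine Filter.EventuallyEq.deriv_eq ?_
    filter_upwards [isOpen_upperHalfPlaneSet.mem_nhds τ.im_pos] with z hz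
    simp only [Function.comp_apply]
    rw [show (a * z + b) / (c * z + d) = (m ⟨z, hz⟩ : ℂ) from (key ⟨z, hz⟩).symm, ofComplex_apply,
      ofComplex_apply_of_im_pos hz]
  rw [dOp, dOp, h4, h3.deriv, key]
  ring

theorem coe_tr_iterate (k : ℕ) (τ : ℍ) : ((tr^[k] τ : ℍ) : ℂ) = τ + k := by
  induction k with
  | zero => simp
  | succ k ih =>
    rw [Function.iterate_succ_apply', coe_tr, ih]
    push_cast
    ring

theorem low_tr_iterate (n : ℕ) [NeZero n] (b : ℤ) (k : ℕ) (τ : ℍ) :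
    low n b (tr^[k] τ) = low n (b + k) τ := by
  ext1
  rw [coe_low, coe_low, coe_tr_iterate]
  push_cast
  ring

variable {N : ℕ} [hN : Fact (N = 2 ∨ N = 3)]

theorem EF_mob {a b c d : ℤ} (hd : a * d - b * (N * c) = 1) {τ σ : ℍ} (h : Mob a b (N * c) d τ σ) :
    EF N σ = (N * c * τ + d) ^ 2 * EF N τ := by
  have hd' : 0 < a * d - b * (N * c) := by rw [hd]; exact one_pos
  choose m hm using fun τ => exists_mob hd' τ
  have h1 := dOp_comp_mob hd'.ne' hm τ ((hasExp_xF N).differentiableAt _)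
  have h2 : (fun τ => xF N (m τ)) = xF N := funext fun τ => xF_of_equi ⟨a, b, c, d, hd, hm τ⟩
  rw [h2, dOp_xF, dOp_xF, xF_of_equi ⟨a, b, c, d, hd, hm τ⟩] at h1
  rw [Mob.unique hd'.ne' h (hm τ)]
  have h3 := Mob.ne_zero hd'.ne' τ
  have h4 : ((a : ℂ) * d - b * (N * c)) = 1 := by exact_mod_cast hd
  have h5 := xF_ne_zero N τ
  push_cast at h1 h3
  rw [h4] at h1
  field_simp at h1
  linear_combination -h1

theorem dense_one_add_ne_zero : Dense {τ : ℍ | 1 + (kap N : ℂ) * xF N τ ≠ 0} := by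
  have h1 : {τ : ℍ | 1 + (kap N : ℂ) * xF N τ ≠ 0} = xF N ⁻¹' {-(kap N : ℂ)⁻¹}ᶜ := by
    ext τ
    have := kap_ne_zero (N := N)
    simp only [Set.mem_ofPred_eq, Set.mem_preimage, Set.mem_compl_iff, Set.mem_singleton_iff]
    refine not_congr ⟨fun h => ?_, fun h => ?_⟩
    · field_simp
      linear_combination h
    · rw [h]
      field_simp
      ring
  rw [h1]
  exact (dense_compl_singleton _).preimage isOpenMap_xF

theorem continuous_gF : Continuous (gF N) := by
  refine continuous_iff_continuousAt.2 fun τ => ?_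
  have h1 := ((hasExp_gF N).differentiableAt τ).continuousAt
  have h2 := h1.comp (f := ((↑) : ℍ → ℂ)) (x := τ) continuous_coe.continuousAt
  simpa [Function.comp_def] using h2

theorem gF_mob {a b c d : ℤ} (hd : a * d - b * (N * c) = 1) {τ σ : ℍ} (h : Mob a b (N * c) d τ σ) :
    gF N σ = (N * c * τ + d) ^ (2 * N) * gF N τ := by
  have hd' : 0 < a * d - b * (N * c) := by rw [hd]; exact one_pos
  choose m hm using fun τ => exists_mob hd' τ
  have hmc : Continuous m := by
    refine continuous_iff_seqContinuous.2 fun u τ hu => ?_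
    exact Mob.tendsto hd'.ne' hu (fun n => hm _) (hm τ)
  have h1 : (fun τ => gF N (m τ)) = fun τ : ℍ => (N * c * τ + d : ℂ) ^ (2 * N) * gF N τ := by
    refine Continuous.ext_on (dense_one_add_ne_zero (N := N)) (continuous_gF.comp hmc) ?_ fun τ hτ => ?_
    · have := continuous_gF (N := N)
      have := continuous_coe
      fun_prop
    · have h2 := EF_mob hd (hm τ)
      have h3 := EF_pow N (m τ)
      rw [h2, mul_pow, EF_pow, xF_of_equi ⟨a, b, c, d, hd, hm τ⟩] at h3
      refine mul_left_cancel₀ (pow_ne_zero (N - 1) hτ) ?_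
      rw [← h3, ← pow_mul]
      ring
  rw [Mob.unique hd'.ne' h (hm τ)]
  exact congrFun h1 τ

end Weight

section HeckeFricke

open UpperHalfPlane Function.Periodic Filter Topology

variable {N : ℕ} [hN : Fact (N = 2 ∨ N = 3)] {p : ℕ} [hp : Fact p.Prime]

theorem up_fricke (τ : ℍ) : up p (fricke N τ) = fricke N (low p 0 τ) := by
  have h1 : (p : ℂ) ≠ 0 := by exact_mod_cast hp.out.ne_zero
  ext1
  simp only [coe_up, coe_low, coe_fricke]
  push_cast
  field_simp
  simp

theorem low_fricke (τ : ℍ) : low p 0 (fricke N τ) = fricke N (up p τ) := by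
  have h1 : (p : ℂ) ≠ 0 := by exact_mod_cast hp.out.ne_zero
  ext1
  simp only [coe_up, coe_low, coe_fricke]
  push_cast
  field_simp
  simp

theorem exists_mob_low_fricke {b b' : ℤ} (h : (p : ℤ) ∣ b * b' * N + 1) (τ : ℍ) :
    ∃ a : ℤ, a * p - b * (N * b') = 1 ∧
      Mob a b (N * b') p (fricke N (low p b' τ)) (low p b (fricke N τ)) := by
  obtain ⟨a, ha⟩ := h
  refine ⟨a, by linear_combination -ha, ?_⟩
  have h1 : (p : ℂ) ≠ 0 := by exact_mod_cast hp.out.ne_zero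
  have h2 : (N : ℂ) ≠ 0 := by exact_mod_cast NeZero.ne N
  have h3 : (τ + b' : ℂ) ≠ 0 := by simpa using ne_zero_of_int (c := 1) (d := b') (by simp) τ
  have h4 := τ.ne_zero
  have h5 : (b * b' * N + 1 : ℂ) = p * a := by exact_mod_cast ha
  unfold Mob
  simp only [coe_low, coe_fricke]
  push_cast
  field_simp
  linear_combination -(τ : ℂ) * h5

theorem xF_low_fricke {b b' : ℤ} (h : (p : ℤ) ∣ b * b' * N + 1) (τ : ℍ) :
    xF N (low p b (fricke N τ)) = xF N (fricke N (low p b' τ)) := by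
  obtain ⟨a, h1, h2⟩ := exists_mob_low_fricke h τ
  exact xF_of_equi ⟨_, _, _, _, h1, h2⟩

theorem gF_low_fricke {b b' : ℤ} (h : (p : ℤ) ∣ b * b' * N + 1) (τ : ℍ) :
    gF N (low p b (fricke N τ)) =
      gA N * τ ^ (2 * N) * xF N (low p b' τ) ^ (N - 1) * gF N (low p b' τ) := by
  obtain ⟨a, h1, h2⟩ := exists_mob_low_fricke h τ
  have h3 : (p : ℂ) ≠ 0 := by exact_mod_cast hp.out.ne_zero
  have h4 : (N : ℂ) ≠ 0 := by exact_mod_cast NeZero.ne N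
  have h5 : (τ + b' : ℂ) ≠ 0 := by simpa using ne_zero_of_int (c := 1) (d := b') (by simp) τ
  have h6 : (N * b' * fricke N (low p b' τ) + (p : ℤ) : ℂ) * low p b' τ = τ := by
    simp only [coe_low, coe_fricke]
    push_cast
    field_simp
    ring
  rw [gF_mob h1 h2, gF_fricke, ← h6, mul_pow]
  ring

theorem gF_low_zero_fricke (τ : ℍ) : (p : ℂ) ^ (2 * N) * gF N (up p τ) *
    (gA N * τ ^ (2 * N) * xF N (up p τ) ^ (N - 1)) = gF N (low p 0 (fricke N τ)) := by
  rw [low_fricke, gF_fricke, coe_up, mul_pow]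
  ring

theorem gF_up_fricke (τ : ℍ) : (p : ℂ) ^ (2 * N) * gF N (up p (fricke N τ)) =
    gA N * τ ^ (2 * N) * xF N (low p 0 τ) ^ (N - 1) * gF N (low p 0 τ) := by
  have h3 : (p : ℂ) ≠ 0 := by exact_mod_cast hp.out.ne_zero
  rw [up_fricke, gF_fricke, coe_low, div_pow]
  push_cast
  field_simp
  simp only [add_zero]
  ring

/-- The involution `b ↦ -1 / (N b)` of the non-zero residues permutes the factors. -/
theorem prod_range_eq_of_involution (hpN : ¬ p ∣ N) {F G : ℕ → ℂ}
    (h : ∀ b b' : ℕ, (p : ℤ) ∣ b * b' * N + 1 → F b = G b') :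
    (∏ b ∈ Finset.range p, F b) * G 0 = F 0 * ∏ b ∈ Finset.range p, G b := by
  have hr : ∀ H : ℕ → ℂ, ∏ b ∈ Finset.range p, H b =
      H 0 * ∏ z ∈ (Finset.univ : Finset (ZMod p)).erase 0, H z.val := by
    intro H
    have h1 : ∏ b ∈ Finset.range p, H b = ∏ z : ZMod p, H z.val := by
      refine Finset.prod_nbij' (fun b => (b : ZMod p)) ZMod.val ?_ ?_ ?_ ?_ ?_
      · simp
      · intro z _; simpa using ZMod.val_lt z
      · intro b hb; exact ZMod.val_cast_of_lt (Finset.mem_range.1 hb)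
      · intro z _; simp
      · intro b hb; rw [ZMod.val_cast_of_lt (Finset.mem_range.1 hb)]
    rw [h1, ← Finset.mul_prod_erase _ _ (Finset.mem_univ (0 : ZMod p)), ZMod.val_zero]
  have hN0 : (N : ZMod p) ≠ 0 := by rwa [Ne, ZMod.natCast_eq_zero_iff]
  rw [hr F, hr G]
  have h2 : ∏ z ∈ (Finset.univ : Finset (ZMod p)).erase 0, F z.val =
      ∏ z ∈ (Finset.univ : Finset (ZMod p)).erase 0, G z.val := by
    refine Finset.prod_nbij' (fun z => -(N * z)⁻¹) (fun z => -(N * z)⁻¹) ?_ ?_ ?_ ?_ ?_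
    · intro z hz; simpa [hN0] using hz
    · intro z hz; simpa [hN0] using hz
    · intro z hz
      have : z ≠ 0 := by simpa using hz
      field_simp
    · intro z hz
      have : z ≠ 0 := by simpa using hz
      field_simp
    · intro z hz
      have : z ≠ 0 := by simpa using hz
      refine h _ _ ?_
      rw [← ZMod.intCast_zmod_eq_zero_iff_dvd]
      push_cast
      simp only [ZMod.natCast_val, ZMod.cast_id', id]
      field_simp
      ring
  rw [h2]
  ring

theorem not_dvd_level (h5 : 5 ≤ p) : ¬ p ∣ N := by
  intro h
  have := Nat.le_of_dvd (Nat.pos_of_ne_zero (NeZero.ne N)) h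
  rcases hN.out with h | h <;> omega

end HeckeFricke

section Residue

theorem exists_valuationSubring (p : ℕ) [hp : Fact p.Prime] :
    ∃ O : ValuationSubring ℂ, (p : ℂ) ∈ O.nonunits := by
  have h1 : Ideal.span {((p : ℤ) : (Int.castRingHom ℂ).range)} ≠ ⊤ := by
    rw [Ne, Ideal.span_singleton_eq_top]
    intro h
    obtain ⟨⟨_, ⟨b, rfl⟩⟩, hb⟩ := isUnit_iff_exists_inv.1 h
    have h2 : ((p : ℤ) : ℂ) * (b : ℂ) = 1 := by simpa [Subtype.ext_iff] using hb
    have h3 : (p : ℤ) * b = 1 := by exact_mod_cast h2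
    have h4 := Int.isUnit_iff_natAbs_eq.1 (IsUnit.of_mul_eq_one _ h3)
    exact hp.out.one_lt.ne' (by simpa using h4)
  obtain ⟨O, -, h⟩ := Ideal.image_subset_nonunits_valuationSubring _ h1
  exact ⟨O, h ⟨_, Ideal.subset_span rfl, by simp⟩⟩

variable (O : ValuationSubring ℂ)

/-- The residue field of the valuation ring. -/
abbrev Rf : Type := IsLocalRing.ResidueField O

instance : IsAlgClosed (Rf O) := by
  refine IsAlgClosed.of_exists_root _ fun q hq hi => ?_
  obtain ⟨P, hP, hd, hm⟩ := Polynomial.lifts_and_natDegree_eq_and_monic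
    ((Polynomial.mem_lifts q).2 (Polynomial.map_surjective _ IsLocalRing.residue_surjective q)) hq
  have h1 : (P.map (algebraMap O ℂ)).degree ≠ 0 := by
    rw [hm.degree_map, Polynomial.degree_eq_natDegree hm.ne_zero, hd]
    exact_mod_cast hi.natDegree_pos.ne'
  obtain ⟨z, hz⟩ := IsAlgClosed.exists_root _ h1
  have h2 : IsIntegral O z := ⟨P, hm, by rwa [IsRoot, eval_map] at hz⟩
  obtain ⟨w, rfl⟩ := IsIntegrallyClosed.isIntegral_iff.1 h2
  refine ⟨IsLocalRing.residue O w, ?_⟩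
  rw [IsRoot, eval_map_algebraMap, aeval_algebraMap_apply] at hz
  have h3 : aeval w P = 0 := by
    have := (FaithfulSMul.algebraMap_injective O ℂ) (hz.trans (map_zero _).symm)
    exact this
  rw [← hP, eval_map, eval₂_hom, ← coe_aeval_eq_eval, h3, map_zero]

variable (p : ℕ) [hp : Fact p.Prime] [hO : Fact ((p : ℂ) ∈ O.nonunits)]

theorem residue_natCast_self : IsLocalRing.residue O (p : O) = 0 := by
  rw [IsLocalRing.residue_eq_zero_iff]
  obtain ⟨h1, h2⟩ := (ValuationSubring.mem_nonunits_iff_exists_mem_maximalIdeal).1 hO.out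
  convert h2
  simp

theorem charP_residue : CharP (Rf O) p := by
  refine (CharP.charP_iff_prime_eq_zero hp.out).2 ?_
  rw [← residue_natCast_self O p, map_natCast]

/-- The prime field inside the residue field. -/
def kz : ZMod p →+* Rf O :=
  letI := charP_residue O p
  ZMod.castHom dvd_rfl _

variable {O p}

theorem frob_add (a b : PowerSeries (Rf O)) : (a + b) ^ p = a ^ p + b ^ p := by
  have := charP_residue O p
  have : CharP (PowerSeries (Rf O)) p := by
    refine (CharP.charP_iff_prime_eq_zero hp.out).2 ?_
    rw [← map_natCast PowerSeries.C, CharP.cast_eq_zero, map_zero]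
  exact add_pow_char _ _ _

variable (O)

/-- Power series over the valuation ring, seen over `ℂ`. -/
def oc : PowerSeries O →+* PowerSeries ℂ := PowerSeries.map (algebraMap O ℂ)

/-- Reduction of power series. -/
def ok : PowerSeries O →+* PowerSeries (Rf O) := PowerSeries.map (IsLocalRing.residue O)

/-- Integral power series over the valuation ring. -/
def zo : PowerSeries ℤ →+* PowerSeries O := PowerSeries.map (Int.castRingHom O)

/-- Reduction of integral power series in the residue field. -/
def zk : PowerSeries ℤ →+* PowerSeries (Rf O) := PowerSeries.map (Int.castRingHom (Rf O))

variable {O}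

theorem oc_injective : Function.Injective (oc O) :=
  PowerSeries.map_injective _ (FaithfulSMul.algebraMap_injective O ℂ)

theorem oc_zo (A : PowerSeries ℤ) : oc O (zo O A) = zc A := by
  ext n
  simp [oc, zo, zc]

theorem ok_zo (A : PowerSeries ℤ) : ok O (zo O A) = zk O A := by
  ext n
  simp [ok, zo, zk]

theorem map_kz_zp (A : PowerSeries ℤ) : PowerSeries.map (kz O p) (zp p A) = zk O A := by
  ext n
  simp [zp, zk]

theorem expand_zk (A : PowerSeries ℤ) :
    PowerSeries.expand p (NeZero.ne p) (zk O A) = zk O A ^ p := by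
  have := charP_residue O p
  have h := MvPowerSeries.map_frobenius_expand p (NeZero.ne p) (R := Rf O) (f := zk O A)
  have h2 : PowerSeries.map (frobenius (Rf O) p)
      (PowerSeries.expand p (NeZero.ne p) (zk O A)) = zk O A ^ p := h
  rw [← h2, PowerSeries.map_expand]
  congr 1
  ext n
  simp only [zk, PowerSeries.coeff_map, eq_intCast, map_intCast]

theorem exists_zeta : ∃ ζ : O, (ζ : ℂ) = Complex.exp (2 * Real.pi * Complex.I / p) ∧
    IsLocalRing.residue O ζ = 1 := by
  have h0 := Complex.isPrimitiveRoot_exp p hp.out.ne_zero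
  have h1 : IsIntegral O (Complex.exp (2 * Real.pi * Complex.I / p)) :=
    h0.isIntegral hp.out.pos |>.tower_top
  obtain ⟨ζ, hζ⟩ := IsIntegrallyClosed.isIntegral_iff.1 h1
  refine ⟨ζ, hζ, ?_⟩
  have h2 : ζ ^ p = 1 := by
    refine FaithfulSMul.algebraMap_injective O ℂ ?_
    rw [map_pow, hζ, h0.pow_eq_one, map_one]
  have := charP_residue O p
  have h3 : (IsLocalRing.residue O ζ - 1) ^ p = 0 := by
    rw [sub_pow_char, ← map_pow, h2, map_one, one_pow, sub_self]
  exact sub_eq_zero.1 (pow_eq_zero_iff hp.out.ne_zero |>.1 h3)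

end Residue

section Hecke

open UpperHalfPlane Function.Periodic Filter Topology

theorem low_zero_tr_iterate (n : ℕ) [NeZero n] (k : ℕ) (τ : ℍ) :
    low n 0 (tr^[k] τ) = low n k τ := by
  rw [low_tr_iterate, zero_add]

theorem HasExp.comp_tr_iterate {n : ℕ} [NeZero n] {A : PowerSeries ℂ} {f : ℍ → ℂ}
    (hA : HasExp n A f) (k : ℕ) :
    HasExp n (PowerSeries.rescale (Complex.exp (2 * Real.pi * Complex.I / n) ^ k) A)
      (fun τ => f (tr^[k] τ)) := by
  induction k with
  | zero => exact hA.mono (by simp) fun τ => rfl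
  | succ k ih =>
    refine (ih.comp_tr n).mono ?_ fun τ => ?_
    · rw [PowerSeries.rescale_rescale, pow_succ]
    · rw [Function.iterate_succ_apply]

theorem HasExp.apply_tr_iterate {n : ℕ} [NeZero n] {A : PowerSeries ℂ} {f : ℍ → ℂ}
    (hA : HasExp n A f) (τ : ℍ) : f (tr^[n] τ) = f τ := by
  have h1 := hA.comp_tr_iterate n
  rw [(Complex.isPrimitiveRoot_exp n (NeZero.ne n)).pow_eq_one, PowerSeries.rescale_one] at h1
  exact (h1 τ).unique (hA τ)

/-- The Hecke correspondence on `q`-expansions. -/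
theorem HasExp.hecke {n : ℕ} [NeZero n] {U₀ U₁ : PowerSeries ℂ} {u₀ u₁ : ℍ → ℂ}
    (h0 : HasExp n U₀ u₀) (h1 : HasExp 1 U₁ u₁) :
    ∃ B, PowerSeries.expand n (NeZero.ne n) U₁ * ∏ b ∈ Finset.range n, PowerSeries.rescale
        (Complex.exp (2 * Real.pi * Complex.I / n) ^ b) U₀ = PowerSeries.expand n (NeZero.ne n) B ∧
      HasExp 1 B (fun τ => u₁ τ * ∏ b ∈ Finset.range n, u₀ (tr^[b] τ)) := by
  have h2 := (h1.expand n).mul (NeZero.ne n)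
    (HasExp.prod (s := Finset.range n) fun b _ => h0.comp_tr_iterate b)
  have h3 := h2.mono (g := fun τ => u₁ τ * ∏ b ∈ Finset.range n, u₀ (tr^[b] τ)) rfl
    fun τ => by simp
  refine h3.descend n fun τ => ?_
  rw [h1.apply_tr]
  congr 1
  simp only [← Function.iterate_succ_apply]
  obtain ⟨m, hm⟩ := Nat.exists_eq_succ_of_ne_zero (NeZero.ne n)
  have h5 := h0.apply_tr_iterate τ
  rw [hm] at h5 ⊢
  rw [Finset.prod_range_succ, Finset.prod_range_succ', h5]
  rfl


variable {O : ValuationSubring ℂ} {p : ℕ} [hp : Fact p.Prime] [hO : Fact ((p : ℂ) ∈ O.nonunits)]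

theorem rescale_one_residue (A : PowerSeries O) {ζ : O} (hζ : IsLocalRing.residue O ζ = 1) :
    ok O (PowerSeries.rescale ζ A) = ok O A := by
  ext n
  simp [ok, PowerSeries.coeff_rescale, hζ]

theorem HasExp.hecke_residue {U₀ U₁ : PowerSeries O} {u₀ u₁ : ℍ → ℂ}
    (h0 : HasExp p (oc O U₀) u₀) (h1 : HasExp 1 (oc O U₁) u₁) :
    ∃ B, HasExp 1 (oc O B) (fun τ => u₁ τ * ∏ b ∈ Finset.range p, u₀ (tr^[b] τ)) ∧
      PowerSeries.expand p (NeZero.ne p) (ok O B) =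
        PowerSeries.expand p (NeZero.ne p) (ok O U₁) * ok O U₀ ^ p := by
  obtain ⟨B, hB, hB'⟩ := h0.hecke h1
  obtain ⟨ζ, hζ, hζ'⟩ := exists_zeta (O := O) (p := p)
  have h2 : oc O (PowerSeries.expand p (NeZero.ne p) U₁ *
      ∏ b ∈ Finset.range p, PowerSeries.rescale (ζ ^ b) U₀) =
      PowerSeries.expand p (NeZero.ne p) B := by
    rw [← hB, map_mul, map_prod, oc, PowerSeries.map_expand]
    congr 1
    refine Finset.prod_congr rfl fun b _ => ?_
    ext n
    simp [PowerSeries.coeff_rescale, ← hζ]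
  set E := PowerSeries.expand p (NeZero.ne p) U₁ *
      ∏ b ∈ Finset.range p, PowerSeries.rescale (ζ ^ b) U₀ with hE
  have h3 : oc O (PowerSeries.mk fun n => PowerSeries.coeff (p * n) E) = B := by
    ext n
    rw [← PowerSeries.coeff_expand_mul (p := p) (hp := NeZero.ne p) (φ := B), ← h2]
    simp [oc]
  refine ⟨_, by rwa [h3], ?_⟩
  have h4 : PowerSeries.expand p (NeZero.ne p)
      (PowerSeries.mk fun n => PowerSeries.coeff (p * n) E) = E := by
    refine oc_injective ?_
    rw [h2, ← h3, oc, PowerSeries.map_expand]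
  rw [ok, ← PowerSeries.map_expand, h4, hE, map_mul, map_prod, PowerSeries.map_expand]
  congr 1
  refine (Finset.prod_eq_pow_card (b := ok O U₀) fun b _ =>
    rescale_one_residue _ (by simp [hζ'])).trans ?_
  simp [ok]

variable {N : ℕ} [hN : Fact (N = 2 ∨ N = 3)]

theorem constantCoeff_zk_xZ : PowerSeries.constantCoeff (zk O (xZ N)) = 0 := by
  rw [← PowerSeries.coeff_zero_eq_constantCoeff_apply, zk, PowerSeries.coeff_map,
    PowerSeries.coeff_zero_eq_constantCoeff_apply, constantCoeff_xZ, map_zero]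

theorem zk_xZ_ne_zero : zk O (xZ N) ≠ 0 := fun h => by
  have := congrArg (zk O) (xZ_mul_vZ (N := N))
  rw [map_mul, h, zero_mul] at this
  have h2 := congrArg (PowerSeries.coeff 1) this
  simp [zk] at h2

theorem aeval_zk_injective {Q₁ Q₂ : (Rf O)[X]}
    (h : aeval (zk O (xZ N) ^ p) Q₁ = aeval (zk O (xZ N) ^ p) Q₂) : Q₁ = Q₂ := by
  rw [← sub_eq_zero]
  rw [← sub_eq_zero, ← map_sub] at h
  by_contra h0
  obtain ⟨q, hq, hq'⟩ := exists_eq_pow_rootMultiplicity_mul_and_not_dvd _ h0 0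
  rw [hq, map_mul, map_pow, map_zero, sub_zero, aeval_X] at h
  have h1 := (mul_eq_zero.1 h).resolve_left
    (pow_ne_zero _ (pow_ne_zero _ (zk_xZ_ne_zero (N := N) (O := O))))
  refine hq' (dvd_iff_isRoot.2 ?_)
  have h2 := congrArg PowerSeries.constantCoeff h1
  rw [map_zero, aeval_def, hom_eval₂, map_pow, constantCoeff_zk_xZ, zero_pow (NeZero.ne p)] at h2
  rw [IsRoot, eval, ← h2]
  congr 1

theorem exists_eval_hecke (k : ℕ) {U₀ U₁ : PowerSeries O} {u₀ u₁ : ℍ → ℂ}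
    (h0 : HasExp p (oc O U₀) u₀) (h1 : HasExp 1 (oc O U₁) u₁) {V₀ V₁ : PowerSeries ℂ}
    {v₀ v₁ : ℍ → ℂ} (h0' : HasExp p V₀ v₀) (h1' : HasExp 1 V₁ v₁)
    (hW : ∀ τ, (u₁ (fricke N τ) * ∏ b ∈ Finset.range p, u₀ (tr^[b] (fricke N τ))) * xF N τ ^ k =
      v₁ τ * ∏ b ∈ Finset.range p, v₀ (tr^[b] τ)) :
    ∃ Q : O[X], Q.natDegree ≤ k ∧ (∀ τ, u₁ τ * ∏ b ∈ Finset.range p, u₀ (tr^[b] τ) =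
        (Q.map (algebraMap O ℂ)).eval (xF N τ)) ∧
      aeval (zk O (xZ N) ^ p) (Q.map (IsLocalRing.residue O)) =
        PowerSeries.expand p (NeZero.ne p) (ok O U₁) * ok O U₀ ^ p := by
  obtain ⟨B, hB, hB'⟩ := h0.hecke_residue h1
  obtain ⟨V, -, hV⟩ := h0'.hecke h1'
  obtain ⟨Q, hQ1, hQ2, hQ3⟩ := exists_eval_xF_eq (N := N) O.toSubring k hB (hV.mono rfl hW)
    (fun n => by simp [oc])
  obtain ⟨Q', rfl⟩ : ∃ Q' : O[X], Q'.map (algebraMap O ℂ) = Q := by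
    refine (Polynomial.mem_lifts Q).1 ((Polynomial.lifts_iff_coeff_lifts Q).2 fun n => ?_)
    exact ⟨⟨_, hQ2 n⟩, rfl⟩
  have hinj := FaithfulSMul.algebraMap_injective O ℂ
  refine ⟨Q', by rwa [Polynomial.natDegree_map_eq_of_injective hinj] at hQ1, hQ3, ?_⟩
  have h2 : HasExp 1 (aeval (zc (xZ N)) (Q'.map (algebraMap O ℂ)))
      (fun τ => (Q'.map (algebraMap O ℂ)).eval (xF N τ)) := by
    rw [aeval_eq_sum_range]
    refine (HasExp.sum (s := Finset.range ((Q'.map (algebraMap O ℂ)).natDegree + 1)) fun n _ =>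
      (hasExp_C (h := 1) ((Q'.map (algebraMap O ℂ)).coeff n)).mul one_ne_zero
        ((hasExp_xF N).pow n)).mono ?_ fun τ => ?_
    · simp [PowerSeries.smul_eq_C_mul]
    · simp [eval_eq_sum_range]
  have h3 : oc O B = aeval (zc (xZ N)) (Q'.map (algebraMap O ℂ)) :=
    HasExp.unique one_ne_zero hB (h2.mono rfl hQ3)
  have h4 : B = aeval (zo O (xZ N)) Q' := by
    refine oc_injective ?_
    rw [h3, aeval_eq_sum_range, aeval_eq_sum_range, natDegree_map_eq_of_injective hinj, map_sum]
    refine Finset.sum_congr rfl fun n _ => ?_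
    rw [PowerSeries.smul_eq_C_mul, PowerSeries.smul_eq_C_mul, map_mul, map_pow, oc_zo, oc,
      PowerSeries.map_C, coeff_map]
  rw [← hB', h4]
  have h5 : ok O (aeval (zo O (xZ N)) Q') =
      aeval (zk O (xZ N)) (Q'.map (IsLocalRing.residue O)) := by
    rw [aeval_def, hom_eval₂, aeval_def, eval₂_map, ok_zo]
    congr 1
    ext r n
    simp [ok, PowerSeries.coeff_C]
  rw [h5, ← Polynomial.aeval_algHom_apply, expand_zk]

end Hecke

section HeckeApply

open UpperHalfPlane Function.Periodic Filter Topology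

variable {N : ℕ} [hN : Fact (N = 2 ∨ N = 3)] {p : ℕ} [hp : Fact p.Prime]

theorem prod_fricke_eq (h5 : 5 ≤ p) {F G : ℕ → ℂ} {F₁ G₁ : ℂ} (h₁ : F₁ = G 0) (h₀ : F 0 = G₁)
    (h : ∀ b b' : ℕ, (p : ℤ) ∣ b * b' * N + 1 → F b = G b') :
    F₁ * ∏ b ∈ Finset.range p, F b = G₁ * ∏ b ∈ Finset.range p, G b := by
  rw [h₁, mul_comm, prod_range_eq_of_involution (not_dvd_level (N := N) h5) h, h₀]

theorem prod_xF_fricke (h5 : 5 ≤ p) (f : ℂ → ℂ) (τ : ℍ) :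
    f (xF N (up p (fricke N τ))) * ∏ b ∈ Finset.range p, f (xF N (low p b (fricke N τ))) =
      f (xF N (fricke N (up p τ))) * ∏ b ∈ Finset.range p, f (xF N (fricke N (low p b τ))) := by
  refine prod_fricke_eq (N := N) h5 (F := fun b => f (xF N (low p b (fricke N τ))))
    (G := fun b => f (xF N (fricke N (low p b τ)))) ?_ ?_ fun b b' h => ?_
  · rw [up_fricke, Nat.cast_zero]
  · simp only [Nat.cast_zero, low_fricke]
  · simp only [xF_low_fricke h]

theorem exists_prod_xF_eq (h5 : 5 ≤ p) : ∃ a : ℂ, a ≠ 0 ∧ ∀ τ,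
    xF N (up p τ) * ∏ b ∈ Finset.range p, xF N (low p b τ) = a * xF N τ ^ (p + 1) := by
  have hp0 : p ≠ 0 := hp.out.ne_zero
  -- `y = x / q` is a unit at infinity
  obtain ⟨Y, hY, hYX⟩ : ∃ Y, HasExp 1 Y (fun τ => xF N τ / qq 1 τ) ∧
      PowerSeries.constantCoeff Y = 1 := by
    refine ⟨_, ((hasExp_xF N).mono (B := PowerSeries.X * zc ((eNZ N * eiZ) ^ rr N))
      (by simp [xZ]) fun τ => rfl).div_qq, ?_⟩
    rw [← PowerSeries.coeff_zero_eq_constantCoeff_apply, zc, PowerSeries.coeff_map]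
    have h := coeff_eZ.1
    rw [PowerSeries.coeff_zero_eq_constantCoeff_apply] at h
    simp [eNZ, eiZ, PowerSeries.constantCoeff_expand, h]
  set y : ℍ → ℂ := fun τ => xF N τ / qq 1 τ with hy
  have hy0 : ∀ τ, y τ ≠ 0 := fun τ => div_ne_zero (xF_ne_zero N τ) (qq_ne_zero 1 τ)
  have h1 := (hY.comp_up p).mul one_ne_zero ((hY.inv hy0 (by simp [hYX])).pow (p + 1))
  have h0 := hY.comp_low p 0
  obtain ⟨B, hB, hB'⟩ := h0.hecke h1
  set F : ℍ → ℂ := fun τ => (((fun τ => y (up p τ)) * (y⁻¹) ^ (p + 1) : ℍ → ℂ)) τ *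
    ∏ b ∈ Finset.range p, y (low p 0 (tr^[b] τ)) with hF
  set a : ℂ := ∏ b ∈ Finset.range p, Complex.exp (2 * Real.pi * Complex.I * b / p) with ha
  have ha0 : a ≠ 0 := Finset.prod_ne_zero_iff.2 fun b _ => Complex.exp_ne_zero _
  have hF' : ∀ τ, F τ * a * xF N τ ^ (p + 1) =
      xF N (up p τ) * ∏ b ∈ Finset.range p, xF N (low p b τ) := by
    intro τ
    simp only [hF, hy, Pi.mul_apply, Pi.pow_apply, Pi.inv_apply, low_zero_tr_iterate, qq_up,
      qq_low, Finset.prod_div_distrib, Finset.prod_mul_distrib, Finset.prod_const,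
      Finset.card_range, Int.cast_natCast, qq_pow, ← ha]
    have := qq_ne_zero 1 τ
    have := xF_ne_zero N τ
    rw [inv_div, div_pow]
    field_simp
    ring
  have hF0 : ∀ τ, F τ ≠ 0 := fun τ => by
    refine mul_ne_zero (mul_ne_zero (hy0 _) (by simpa using fun h => absurd h (hy0 τ))) ?_
    exact Finset.prod_ne_zero_iff.2 fun b _ => hy0 _
  have hB0 : PowerSeries.constantCoeff B = 1 := by
    have := congrArg PowerSeries.constantCoeff hB
    rw [PowerSeries.constantCoeff_expand] at this
    rw [← this, map_mul, map_prod, PowerSeries.constantCoeff_expand, map_mul, map_pow,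
      PowerSeries.constantCoeff_expand]
    have h : ∀ z (A : PowerSeries ℂ), PowerSeries.constantCoeff (PowerSeries.rescale z A) =
      PowerSeries.constantCoeff A := fun z A => by
        rw [← PowerSeries.coeff_zero_eq_constantCoeff_apply, PowerSeries.coeff_rescale,
          pow_zero, one_mul, PowerSeries.coeff_zero_eq_constantCoeff_apply]
    simp [h, hYX]
  have hW : HasExp 1 (PowerSeries.C (a ^ 2)⁻¹ * B⁻¹) (fun τ => F (fricke N τ)) := by
    refine ((hasExp_C (h := 1) (a ^ 2)⁻¹).mul one_ne_zero (hB'.inv hF0 (by simp [hB0]))).mono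
      rfl fun τ => ?_
    have h2 := hF' (fricke N τ)
    have h3 := prod_xF_fricke (N := N) h5 (fun z => z) τ
    have h4 := hF' τ
    have h6 : (kap N : ℂ) ≠ 0 := kap_ne_zero
    have h7 : (xF N (up p τ) * ∏ b ∈ Finset.range p, xF N (low p b τ)) ≠ 0 := by
      rw [← h4]
      exact mul_ne_zero (mul_ne_zero (hF0 τ) ha0) (pow_ne_zero _ (xF_ne_zero N τ))
    have h8 : xF N (fricke N (up p τ)) *
        ∏ b ∈ Finset.range p, xF N (fricke N (low p b τ)) =
        (((kap N : ℂ) ^ 2) ^ (p + 1) * (xF N (up p τ) *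
          ∏ b ∈ Finset.range p, xF N (low p b τ)))⁻¹ := by
      simp only [xF_fricke_eq, Finset.prod_inv_distrib, Finset.prod_mul_distrib,
        Finset.prod_const, Finset.card_range, ← mul_inv]
      ring
    have h9 := xF_ne_zero N τ
    rw [h3, h8, xF_fricke_eq, ← h4] at h2
    simp only [Pi.mul_apply, Pi.inv_apply]
    have h10 := hF0 τ
    rw [inv_pow, mul_pow] at h2
    field_simp at h2 ⊢
    linear_combination h2
  refine ⟨a, ha0, fun τ => ?_⟩
  rw [← hF', eq_const_of_hasExp hB' hW τ, hB0, one_mul]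

end HeckeApply

section HeckePolynomials

open UpperHalfPlane Function.Periodic Filter Topology

variable {N : ℕ} [hN : Fact (N = 2 ∨ N = 3)] {p : ℕ} [hp : Fact p.Prime]
  {O : ValuationSubring ℂ} [hO : Fact ((p : ℂ) ∈ O.nonunits)]

theorem HasExp.comp_low_zero {n : ℕ} [NeZero n] {A : PowerSeries ℂ} {f : ℍ → ℂ}
    (hA : HasExp 1 A f) : HasExp n A (fun τ => f (low n 0 τ)) :=
  (hA.comp_low n 0).mono (by simp) fun τ => rfl

theorem frob_sub (a b : PowerSeries (Rf O)) (hp2 : 5 ≤ p) : (a - b) ^ p = a ^ p - b ^ p := by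
  have h1 := frob_add (p := p) a (-b)
  rw [Odd.neg_pow (hp.out.odd_of_ne_two (by omega))] at h1
  rw [sub_eq_add_neg, h1, sub_eq_add_neg]

theorem zk_expand (A : PowerSeries ℤ) :
    zk O (PowerSeries.expand p (NeZero.ne p) A) = zk O A ^ p := by
  rw [← expand_zk, zk, PowerSeries.map_expand]

theorem zc_expand (A : PowerSeries ℤ) :
    zc (PowerSeries.expand p (NeZero.ne p) A) = PowerSeries.expand p (NeZero.ne p) (zc A) := by
  rw [zc, PowerSeries.map_expand]

variable (N p O) in
theorem exists_dual_poly (h5 : 5 ≤ p) : ∃ Q : O[X], Q.natDegree ≤ 2 * (p + 1) ∧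
    (∀ τ, (1 - (kap N : ℂ) ^ 2 * xF N τ * xF N (up p τ)) *
      ∏ b ∈ Finset.range p, (1 - (kap N : ℂ) ^ 2 * xF N τ * xF N (low p b τ)) =
        (Q.map (algebraMap O ℂ)).eval (xF N τ)) ∧
    Q.map (IsLocalRing.residue O) = (1 - C ((kap N : Rf O) ^ 2) * X ^ (p + 1)) ^ 2 := by
  have h1 : HasExp 1 (oc O (zo O (1 - (kap N : PowerSeries ℤ) ^ 2 * xZ N *
      PowerSeries.expand p (NeZero.ne p) (xZ N))))
      (fun τ => 1 - (kap N : ℂ) ^ 2 * xF N τ * xF N (up p τ)) := by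
    rw [oc_zo]
    refine ((hasExp_C (h := 1) 1).sub (((hasExp_C (h := 1) ((kap N : ℂ) ^ 2)).mul one_ne_zero
      (hasExp_xF N)).mul one_ne_zero ((hasExp_xF N).comp_up p))).mono ?_ fun τ => rfl
    simp only [map_sub, map_mul, map_pow, map_one, map_natCast, zc_expand]
  have h0 : HasExp p (oc O (zo O (1 - (kap N : PowerSeries ℤ) ^ 2 *
      PowerSeries.expand p (NeZero.ne p) (xZ N) * xZ N)))
      (fun τ => 1 - (kap N : ℂ) ^ 2 * xF N τ * xF N (low p 0 τ)) := by
    rw [oc_zo]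
    refine ((hasExp_C (h := p) 1).sub (((hasExp_C (h := p) ((kap N : ℂ) ^ 2)).mul (NeZero.ne p)
      ((hasExp_xF N).expand p)).mul (NeZero.ne p) ((hasExp_xF N).comp_low_zero))).mono
      ?_ fun τ => rfl
    simp only [map_sub, map_mul, map_pow, map_one, map_natCast, zc_expand]
  obtain ⟨a, ha0, ha⟩ := exists_prod_xF_eq (N := N) h5
  have hx : ∀ τ k, xF N (tr^[k] τ) = xF N τ := fun τ k => by
    induction k with
    | zero => rfl
    | succ k ih => rw [Function.iterate_succ_apply', (hasExp_xF N).apply_tr, ih]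
  have hD : ∀ τ, (1 - (kap N : ℂ) ^ 2 * xF N τ * xF N (up p τ)) * ∏ b ∈ Finset.range p,
      (1 - (kap N : ℂ) ^ 2 * xF N (tr^[b] τ) * xF N (low p 0 (tr^[b] τ))) =
      (1 - (kap N : ℂ) ^ 2 * xF N τ * xF N (up p τ)) *
        ∏ b ∈ Finset.range p, (1 - (kap N : ℂ) ^ 2 * xF N τ * xF N (low p b τ)) := fun τ => by
    simp only [hx, low_zero_tr_iterate]
  have hk0 : (kap N : ℂ) ≠ 0 := kap_ne_zero
  have h1' := (hasExp_C (h := 1) ((((kap N : ℂ) ^ 2) ^ (p + 1) * a)⁻¹)).mul one_ne_zero h1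
  obtain ⟨Q, hQ1, hQ2, hQ3⟩ := exists_eval_hecke (N := N) (2 * (p + 1)) h0 h1 h0 h1' (fun τ => by
    simp only [Pi.mul_apply]
    rw [hD, mul_assoc (((kap N : ℂ) ^ 2) ^ (p + 1) * a)⁻¹, hD]
    have h2 := prod_xF_fricke (N := N) h5
      (fun z => 1 - (kap N : ℂ) ^ 2 * xF N (fricke N τ) * z) τ
    rw [h2]
    have h3 : ∀ σ : ℍ, 1 - (kap N : ℂ) ^ 2 * xF N (fricke N τ) * xF N (fricke N σ) =
        -((1 - (kap N : ℂ) ^ 2 * xF N τ * xF N σ) *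
          ((kap N : ℂ) ^ 2 * xF N τ * xF N σ)⁻¹) := fun σ => by
      rw [xF_fricke_eq, xF_fricke_eq]
      have := xF_ne_zero N τ
      have := xF_ne_zero N σ
      field_simp
      ring
    have h4 := ha τ
    simp only [h3, Finset.prod_neg, Finset.prod_mul_distrib, Finset.prod_inv_distrib,
      Finset.prod_const, Finset.card_range, Odd.neg_one_pow (hp.out.odd_of_ne_two
        (by omega : p ≠ 2))]
    generalize ∏ b ∈ Finset.range p, (1 - (kap N : ℂ) ^ 2 * xF N τ * xF N (low p b τ)) = A
    generalize 1 - (kap N : ℂ) ^ 2 * xF N τ * xF N (up p τ) = A'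
    have h6 := xF_ne_zero N τ
    have h7 : xF N (up p τ) * ∏ b ∈ Finset.range p, xF N (low p b τ) ≠ 0 := by
      rw [h4]
      exact mul_ne_zero ha0 (pow_ne_zero _ h6)
    generalize ∏ b ∈ Finset.range p, xF N (low p b τ) = M at *
    generalize xF N (up p τ) = M' at *
    have h8 := left_ne_zero_of_mul h7
    have h9 := right_ne_zero_of_mul h7
    field_simp
    linear_combination -(A * A' * xF N τ ^ (p + 1) * (kap N : ℂ) ^ (2 * p + 2)) * h4)
  refine ⟨Q, hQ1, fun τ => by rw [← hQ2, hD], aeval_zk_injective (N := N) (p := p) ?_⟩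
  have := charP_residue O p
  have hkp : (kap N : PowerSeries (Rf O)) ^ p = kap N := by
    rw [← map_natCast PowerSeries.C, ← map_pow, ← frobenius_def, map_natCast]
  rw [hQ3, ok_zo, ok_zo, expand_zk]
  simp only [map_sub, map_mul, map_pow, map_one, map_natCast, zk_expand, aeval_X, frob_sub _ _ h5,
    mul_pow, one_pow]
  rw [pow_right_comm _ 2 p, hkp]
  ring

variable (N p) in
/-- The ratio of `g` along the isogeny of degree `p` at the cusp `∞`. -/
def phiU (τ : ℍ) : ℂ := (p : ℂ) ^ (2 * N) * gF N (up p τ) / gF N τ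

variable (N p) in
/-- The ratios of `g` along the other isogenies of degree `p`. -/
def phiL (b : ℤ) (τ : ℍ) : ℂ := gF N (low p b τ) / gF N τ

theorem gA_ne_zero' : (gA N : ℂ) ≠ 0 := by exact_mod_cast gA_ne_zero N

theorem phiU_fricke (τ : ℍ) : phiU N p (fricke N τ) * xF N τ ^ (N - 1) =
    phiL N p 0 τ * xF N (low p 0 τ) ^ (N - 1) := by
  rw [phiU, phiL, gF_up_fricke, gF_fricke]
  have := gF_ne_zero N τ
  have := xF_ne_zero N τ
  have := τ.ne_zero
  have := gA_ne_zero' (N := N)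
  field_simp

theorem phiL_zero_fricke (τ : ℍ) : phiL N p 0 (fricke N τ) * xF N τ ^ (N - 1) =
    phiU N p τ * xF N (up p τ) ^ (N - 1) := by
  rw [phiU, phiL, ← gF_low_zero_fricke, gF_fricke]
  have := gF_ne_zero N τ
  have := xF_ne_zero N τ
  have := τ.ne_zero
  have := gA_ne_zero' (N := N)
  field_simp

theorem phiL_fricke {b b' : ℤ} (h : (p : ℤ) ∣ b * b' * N + 1) (τ : ℍ) :
    phiL N p b (fricke N τ) * xF N τ ^ (N - 1) =
      phiL N p b' τ * xF N (low p b' τ) ^ (N - 1) := by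
  rw [phiL, phiL, gF_low_fricke h, gF_fricke]
  have := gF_ne_zero N τ
  have := xF_ne_zero N τ
  have := τ.ne_zero
  have := gA_ne_zero' (N := N)
  field_simp

theorem prod_phi_fricke (h5 : 5 ≤ p) (f : ℂ → ℂ → ℂ) (τ : ℍ) :
    f (xF N τ ^ (N - 1)) (phiU N p (fricke N τ) * xF N τ ^ (N - 1)) * ∏ b ∈ Finset.range p,
        f (xF N τ ^ (N - 1)) (phiL N p b (fricke N τ) * xF N τ ^ (N - 1)) =
      f (xF N τ ^ (N - 1)) (phiU N p τ * xF N (up p τ) ^ (N - 1)) * ∏ b ∈ Finset.range p,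
        f (xF N τ ^ (N - 1)) (phiL N p b τ * xF N (low p b τ) ^ (N - 1)) := by
  refine prod_fricke_eq (N := N) h5
    (F := fun b => f (xF N τ ^ (N - 1)) (phiL N p b (fricke N τ) * xF N τ ^ (N - 1)))
    (G := fun b => f (xF N τ ^ (N - 1)) (phiL N p b τ * xF N (low p b τ) ^ (N - 1)))
    ?_ ?_ fun b b' h => ?_
  · simp only [phiU_fricke, Nat.cast_zero]
  · simp only [Nat.cast_zero, phiL_zero_fricke]
  · simp only [phiL_fricke h]

theorem hasExp_phiU : HasExp 1 (zc ((p : PowerSeries ℤ) ^ (2 * N) *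
    PowerSeries.expand p (NeZero.ne p) (gZ N) * giZ N)) (phiU N p) := by
  refine (((hasExp_C (h := 1) ((p : ℂ) ^ (2 * N))).mul one_ne_zero ((hasExp_gF N).comp_up p)).mul
    one_ne_zero (hasExp_giF N)).mono ?_ fun τ => by simp [phiU, div_eq_mul_inv]
  simp only [map_mul, map_pow, map_natCast, zc_expand]

theorem hasExp_phiL : HasExp p (zc (gZ N * PowerSeries.expand p (NeZero.ne p) (giZ N)))
    (phiL N p 0) := by
  refine (((hasExp_gF N).comp_low_zero).mul (NeZero.ne p) ((hasExp_giF N).expand p)).mono ?_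
    fun τ => by simp [phiL, div_eq_mul_inv]
  simp only [map_mul, zc_expand]

theorem gF_tr_iterate (τ : ℍ) (k : ℕ) : gF N (tr^[k] τ) = gF N τ := by
  induction k with
  | zero => rfl
  | succ k ih => rw [Function.iterate_succ_apply', (hasExp_gF N).apply_tr, ih]

theorem phiL_tr_iterate (τ : ℍ) (k : ℕ) : phiL N p 0 (tr^[k] τ) = phiL N p k τ := by
  rw [phiL, phiL, gF_tr_iterate, low_zero_tr_iterate]

theorem xF_tr_iterate (τ : ℍ) (k : ℕ) : xF N (tr^[k] τ) = xF N τ := by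
  induction k with
  | zero => rfl
  | succ k ih => rw [Function.iterate_succ_apply', (hasExp_xF N).apply_tr, ih]

variable (N p O) in
/-- The reduction of `g / g ^ p` as a polynomial in the Hauptmodul, over the residue field. -/
def fK : (Rf O)[X] := (fPol (p := p) N).map (kz O p)

theorem zk_gZ (h5 : 5 ≤ p) :
    zk O (gZ N) = aeval (zk O (xZ N)) (fK N p O) * zk O (gZ N) ^ p := by
  have h := congrArg (PowerSeries.map (kz O p)) (zp_gZ (p := p) N h5)
  rw [map_mul, map_pow, map_kz_zp] at h
  rw [fK, ← map_kz_zp (p := p) (xZ N), aeval_def, eval₂_map]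
  convert h using 2
  rw [aeval_def, hom_eval₂]
  congr 1
  exact RingHom.ext fun r => by simp

theorem phi_mem_poly (h5 : 5 ≤ p) (s : O) : ∃ Q : O[X],
    (∀ τ, (1 - s * phiU N p τ) * ∏ b ∈ Finset.range p, (1 - s * phiL N p b τ) =
        (Q.map (algebraMap O ℂ)).eval (xF N τ)) ∧
    Q.map (IsLocalRing.residue O) = 1 - C (IsLocalRing.residue O s ^ p) * fK N p O := by
  have h1 : HasExp 1 (oc O (1 - PowerSeries.C s * zo O ((p : PowerSeries ℤ) ^ (2 * N) *
      PowerSeries.expand p (NeZero.ne p) (gZ N) * giZ N)))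
      (fun τ => 1 - s * phiU N p τ) := by
    refine ((hasExp_C (h := 1) 1).sub ((hasExp_C (h := 1) (s : ℂ)).mul one_ne_zero
      (hasExp_phiU (N := N)))).mono ?_ fun τ => rfl
    rw [map_sub (oc O), map_mul (oc O), oc_zo, map_one (oc O), map_one PowerSeries.C]
    simp only [oc, PowerSeries.map_C, map_mul]
    rfl
  have h0 : HasExp p (oc O (1 - PowerSeries.C s * zo O (gZ N *
      PowerSeries.expand p (NeZero.ne p) (giZ N))))
      (fun τ => 1 - s * phiL N p 0 τ) := by
    refine ((hasExp_C (h := p) 1).sub ((hasExp_C (h := p) (s : ℂ)).mul (NeZero.ne p)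
      (hasExp_phiL (N := N)))).mono ?_ fun τ => rfl
    rw [map_sub (oc O), map_mul (oc O), oc_zo, map_one (oc O), map_one PowerSeries.C]
    simp only [oc, PowerSeries.map_C, map_mul]
    rfl
  have h1' := ((hasExp_xF N).pow (N - 1)).sub (((hasExp_C (h := 1) (s : ℂ)).mul one_ne_zero
      (hasExp_phiU (N := N) (p := p))).mul one_ne_zero (((hasExp_xF N).comp_up p).pow (N - 1)))
  have h0' := (((hasExp_xF N).expand p).pow (N - 1)).sub (((hasExp_C (h := p) (s : ℂ)).mul
    (NeZero.ne p) (hasExp_phiL (N := N) (p := p))).mul (NeZero.ne p)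
      (((hasExp_xF N).comp_low_zero (n := p)).pow (N - 1)))
  obtain ⟨Q, -, hQ2, hQ3⟩ := exists_eval_hecke (N := N) ((N - 1) * (p + 1)) h0 h1 h0' h1'
    (fun τ => by
      simp only [Pi.mul_apply, Pi.pow_apply, Pi.sub_apply, phiL_tr_iterate, xF_tr_iterate,
        low_zero_tr_iterate]
      have h := prod_phi_fricke (N := N) h5 (fun z w => z - s * w) τ
      simp only [mul_assoc] at h ⊢
      rw [← h]
      have h2 : ∀ w : ℂ, xF N τ ^ (N - 1) - s * (w * xF N τ ^ (N - 1)) =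
        xF N τ ^ (N - 1) * (1 - s * w) := fun w => by ring
      simp only [h2, Finset.prod_mul_distrib, Finset.prod_const, Finset.card_range]
      ring)
  refine ⟨Q, fun τ => by rw [← hQ2]; simp only [phiL_tr_iterate],
    aeval_zk_injective (N := N) (p := p) ?_⟩
  have := charP_residue O p
  have hC : ok O (PowerSeries.C s) = PowerSeries.C (IsLocalRing.residue O s) := by
    rw [ok, PowerSeries.map_C]
  have hp' : (p : PowerSeries (Rf O)) = 0 := by
    rw [← map_natCast PowerSeries.C, CharP.cast_eq_zero, map_zero]
  have hg : zk O (gZ N) * zk O (giZ N) = 1 := by rw [← map_mul, gZ_mul_giZ, map_one]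
  have hf : zk O (gZ N) * zk O (giZ N) ^ p = aeval (zk O (xZ N)) (fK N p O) := by
    nth_rewrite 1 [zk_gZ (p := p) h5]
    rw [mul_assoc, ← mul_pow, hg, one_pow, mul_one]
  have hfp : aeval (zk O (xZ N)) (fK N p O) ^ p = aeval (zk O (xZ N) ^ p) (fK N p O) := by
    rw [← expand_zk, aeval_algHom_apply (PowerSeries.expand p (NeZero.ne p)),
      ← hf, map_mul, map_pow, expand_zk, expand_zk, mul_pow]
  rw [hQ3, map_sub (ok O), map_mul (ok O), map_sub (ok O), map_mul (ok O), ok_zo, ok_zo, hC]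
  simp only [map_sub, map_mul, map_pow, map_one, map_natCast, zk_expand, hp', frob_sub _ _ h5, hf,
    mul_pow, one_pow, hfp, aeval_C]
  rw [map_zero, zero_pow (mul_ne_zero two_ne_zero (NeZero.ne N))]
  simp

theorem prod_phi (h5 : 5 ≤ p) (τ : ℍ) :
    phiU N p τ * ∏ b ∈ Finset.range p, phiL N p b τ = (p : ℂ) ^ (2 * N) := by
  obtain ⟨a, -, ha⟩ := exists_prod_xF_eq (N := N) h5
  obtain ⟨B, hB, hB'⟩ := (hasExp_phiL (N := N) (p := p)).hecke (hasExp_phiU (N := N) (p := p))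
  have hg : PowerSeries.constantCoeff (zc (gZ N)) * PowerSeries.constantCoeff (zc (giZ N)) = 1 := by
    rw [← map_mul, ← map_mul, gZ_mul_giZ, map_one, map_one]
  have hB0 : PowerSeries.constantCoeff B = (p : ℂ) ^ (2 * N) := by
    have := congrArg PowerSeries.constantCoeff hB
    rw [PowerSeries.constantCoeff_expand] at this
    have h : ∀ z (A : PowerSeries ℂ), PowerSeries.constantCoeff (PowerSeries.rescale z A) =
      PowerSeries.constantCoeff A := fun z A => by
        rw [← PowerSeries.coeff_zero_eq_constantCoeff_apply, PowerSeries.coeff_rescale,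
          pow_zero, one_mul, PowerSeries.coeff_zero_eq_constantCoeff_apply]
    rw [← this]
    simp only [map_mul, map_prod, PowerSeries.constantCoeff_expand, map_pow, map_natCast, h,
      zc_expand]
    rw [hg, Finset.prod_const_one, mul_one, mul_assoc, hg, mul_one]
  have h1 := eq_const_of_hasExp (N := N) hB' (((hasExp_C (h := 1) (a ^ (N - 1))).mul one_ne_zero hB').mono
    rfl fun τ => ?_) τ
  · simpa only [phiL_tr_iterate, hB0] using h1
  have h := prod_phi_fricke (N := N) h5 (fun _ w => w) τ
  simp only [Finset.prod_mul_distrib, Finset.prod_const, Finset.card_range, Finset.prod_pow] at h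
  have h2 : xF N τ ^ (N - 1) * (xF N τ ^ (N - 1)) ^ p = (xF N τ ^ (p + 1)) ^ (N - 1) := by
    rw [← pow_succ', ← pow_mul, ← pow_mul, mul_comm]
  have h3 := congrArg (· ^ (N - 1)) (ha τ)
  simp only [mul_pow] at h3
  have h4 : xF N τ ^ (p + 1) ≠ 0 := pow_ne_zero _ (xF_ne_zero N τ)
  simp only [phiL_tr_iterate, Pi.mul_apply]
  refine mul_right_cancel₀ (pow_ne_zero (N - 1) h4) ?_
  linear_combination h + (phiU N p τ * ∏ b ∈ Finset.range p, phiL N p b τ) * h3 -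
    (phiU N p (fricke N τ) * ∏ b ∈ Finset.range p, phiL N p b (fricke N τ)) * h2

end HeckePolynomials

section ResidueProduct

open IsLocalRing

variable {O : ValuationSubring ℂ}

theorem exists_mem_of_prod {ι : Type*} [Fintype ι] [DecidableEq ι] {φ : ι → ℂ} {f : Rf O} {n : ℕ}
    (hn : n ≠ 0) (h : ∀ s : O, ∃ y : O, (y : ℂ) = ∏ i, (1 - s * φ i) ∧
      residue O y = 1 - residue O s ^ n * f) :
    ∃ ψ : ι → O, (∀ i, (ψ i : ℂ) = φ i) ∧ (f = 0 ↔ ∀ i, residue O (ψ i) = 0) ∧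
      (Fintype.card ι = n + 1 → ∀ i j, i ≠ j → residue O (ψ i) = 0 → residue O (ψ j) = 0 →
        f = 0) := by
  have hφ : ∀ i, φ i ∈ O := by
    intro i
    by_contra hi
    have h1 : (φ i)⁻¹ ∈ O := (O.mem_or_inv_mem (φ i)).resolve_left hi
    have h0 : φ i ≠ 0 := fun h => hi (h ▸ O.zero_mem)
    have h2 : residue O ⟨_, h1⟩ = 0 := by
      rw [residue_eq_zero_iff, mem_maximalIdeal, mem_nonunits_iff]
      intro hu
      obtain ⟨v, hv⟩ := hu.exists_right_inv
      have h3 := congrArg (Subtype.val) hv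
      refine hi ?_
      have h4 : (φ i)⁻¹ * v = 1 := h3
      rw [inv_mul_eq_one₀ h0] at h4
      exact h4 ▸ v.2
    obtain ⟨y, hy, hy'⟩ := h ⟨_, h1⟩
    rw [Finset.prod_eq_zero (Finset.mem_univ i) (by simp [h0])] at hy
    have h3 : y = 0 := Subtype.ext hy
    rw [h3, h2, map_zero, zero_pow hn] at hy'
    simp at hy'
  have hprod : ∀ s : O, ∏ i, (1 - residue O s * residue O ⟨φ i, hφ i⟩) =
      1 - residue O s ^ n * f := by
    intro s
    obtain ⟨y, hy, hy'⟩ := h s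
    have h1 : y = ∏ i, (1 - s * ⟨φ i, hφ i⟩) := by
      refine Subtype.ext (hy.trans ?_)
      simp
    rw [← hy', h1, map_prod]
    simp
  refine ⟨fun i => ⟨φ i, hφ i⟩, fun i => rfl, ⟨fun hf i => ?_, fun hi => ?_⟩, ?_⟩
  · by_contra hne
    obtain ⟨s, hs⟩ := residue_surjective (R := O) (residue O ⟨φ i, hφ i⟩)⁻¹
    have h1 := hprod s
    rw [hf, mul_zero, sub_zero, Finset.prod_eq_zero (Finset.mem_univ i) (by
      rw [hs, inv_mul_cancel₀ hne, sub_self])] at h1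
    exact zero_ne_one h1
  · have h1 := hprod 1
    simp only [hi, mul_zero, sub_zero, Finset.prod_const_one, map_one, one_pow, one_mul] at h1
    exact sub_eq_self.1 h1.symm
  · intro hc i j hij hi hj
    have : Infinite (Rf O) := IsAlgClosed.instInfinite
    have h1 : (∏ l ∈ (Finset.univ.erase i).erase j, (1 - X * C (residue O ⟨φ l, hφ l⟩))) =
        1 - X ^ n * C f := by
      refine Polynomial.funext fun r => ?_
      obtain ⟨s, rfl⟩ := residue_surjective (R := O) r
      rw [eval_prod]
      simp only [eval_sub, eval_one, eval_mul, eval_X, eval_C, eval_pow]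
      rw [← hprod s, ← Finset.mul_prod_erase _ _ (Finset.mem_univ i), ← Finset.mul_prod_erase
        (Finset.univ.erase i) _ (Finset.mem_erase.2 ⟨hij.symm, Finset.mem_univ j⟩), hi, hj]
      simp
    have h2 : (∏ l ∈ (Finset.univ.erase i).erase j,
        (1 - X * C (residue O ⟨φ l, hφ l⟩))).natDegree ≤ n - 1 := by
      refine (natDegree_prod_le _ _).trans ((Finset.sum_le_card_nsmul _ _ 1 fun l _ => ?_).trans ?_)
      · refine (natDegree_sub_le _ _).trans ?_
        simp only [natDegree_one, zero_le, sup_of_le_right]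
        exact (natDegree_mul_C_le _ _).trans natDegree_X_le
      · rw [Finset.card_erase_of_mem (Finset.mem_erase.2 ⟨hij.symm, Finset.mem_univ j⟩),
          Finset.card_erase_of_mem (Finset.mem_univ i), Finset.card_univ, hc]
        simp
    have h3 := coeff_eq_zero_of_natDegree_lt (n := n) (lt_of_le_of_lt h2 (by omega))
    rw [h1] at h3
    simpa [coeff_one, hn] using h3

end ResidueProduct

section Multipliers

open UpperHalfPlane Function.Periodic Filter Topology

variable {N : ℕ} [hN : Fact (N = 2 ∨ N = 3)] {p : ℕ} [hp : Fact p.Prime]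

variable (p) in
/-- The `p + 1` isogenies of degree `p`. -/
def isog : Option (Fin p) → ℍ → ℍ
  | none => up p
  | some b => low p (b : ℕ)

variable (N p) in
/-- The ratios of `g` along the isogenies of degree `p`. -/
def phi : Option (Fin p) → ℍ → ℂ
  | none => phiU N p
  | some b => phiL N p (b : ℕ)

theorem prod_option_fin {M : Type*} [CommMonoid M] (n : ℕ) (f : M) (g : ℕ → M) (F : Option (Fin n) → M)
    (h0 : F none = f) (h1 : ∀ b : Fin n, F (some b) = g b) :
    ∏ i, F i = f * ∏ b ∈ Finset.range n, g b := by
  rw [Fintype.prod_option, h0, ← Fin.prod_univ_eq_prod_range]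
  simp only [h1]

variable (N p) in
/-- `τ` is a root of the form `N α X² + 2 N β X + γ` of discriminant `-4 N p`. -/
def IsForm (τ : ℍ) (α β γ : ℤ) : Prop :=
  α * γ - N * β ^ 2 = p ∧ (N * α * τ ^ 2 + 2 * N * β * τ + γ : ℂ) = 0

variable (p) in
/-- The isogeny attached to a form. -/
def FormIndex (α β : ℤ) : Option (Fin p) → Prop
  | none => (p : ℤ) ∣ α
  | some e => ¬ (p : ℤ) ∣ α ∧ (p : ℤ) ∣ α * (e : ℕ) - β

/-- An integral quadratic relation satisfied by `τ` has trivial coefficients. -/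
theorem linear_eq_zero {A B : ℤ} {τ : ℍ} (h : (A * τ + B : ℂ) = 0) : A = 0 ∧ B = 0 := by
  by_contra hc
  exact ne_zero_of_int (by tauto) τ h

theorem isForm_proportional {τ : ℍ} {α β γ α' β' γ' : ℤ} (h : (N * α * τ ^ 2 + N * β * τ + γ : ℂ) = 0)
    (h' : (N * α' * τ ^ 2 + N * β' * τ + γ' : ℂ) = 0) : α * β' = α' * β ∧ α * γ' = α' * γ := by
  have hN0 : N ≠ 0 := NeZero.ne N
  obtain ⟨h1, h2⟩ := linear_eq_zero (A := N * (α * β' - α' * β)) (B := α * γ' - α' * γ) (τ := τ) (by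
    push_cast
    linear_combination (α : ℂ) * h' - α' * h)
  refine ⟨?_, by linarith⟩
  rcases mul_eq_zero.1 h1 with h | h
  · exact absurd h (by exact_mod_cast hN0)
  · linarith

theorem fricke_add {c d : ℤ} (τ : ℍ) :
    (N * c * fricke N τ + d : ℂ) = (d * τ - c) / τ := by
  have := τ.ne_zero
  have hN0 : (N : ℂ) ≠ 0 := by exact_mod_cast NeZero.ne N
  rw [coe_fricke]
  field_simp
  ring

theorem gF_mob_fricke {a b c d : ℤ} (hd : a * d - b * (N * c) = 1) {τ σ : ℍ}
    (h : Mob a b (N * c) d (fricke N τ) σ) :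
    gF N σ / gF N τ = gA N * (d * τ - c) ^ (2 * N) * xF N τ ^ (N - 1) := by
  have := τ.ne_zero
  rw [gF_mob hd h, gF_fricke, fricke_add, div_eq_iff (gF_ne_zero N τ), div_pow]
  field_simp

theorem EF_mob_fricke {a b c d : ℤ} (hd : a * d - b * (N * c) = 1) {τ σ : ℍ}
    (h : Mob a b (N * c) d (fricke N τ) σ) :
    EF N σ = - (N * (d * τ - c) ^ 2 * EF N τ) := by
  have := τ.ne_zero
  rw [EF_mob hd h, EF_fricke, fricke_add, div_pow]
  field_simp

theorem mob_fricke_iff {a b c d : ℤ} {τ σ : ℍ} :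
    Mob a b (N * c) d (fricke N τ) σ ↔ (N * σ * (d * τ - c) : ℂ) = b * N * τ - a := by
  have := τ.ne_zero
  have hN0 : (N : ℂ) ≠ 0 := by exact_mod_cast NeZero.ne N
  rw [Mob, Int.cast_mul, Int.cast_natCast, fricke_add, coe_fricke, mul_div_assoc',
    div_eq_iff this]
  constructor
  · intro h
    have h2 := congrArg ((N : ℂ) * ·) h
    field_simp at h2
    linear_combination h2
  · intro h
    field_simp
    linear_combination h

theorem dOp_xF_up (τ : ℍ) : dOp (fun τ => xF N (up p τ)) τ = p * (xF N (up p τ) * EF N (up p τ)) := by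
  rw [dOp_comp_mob (a := p) (b := 0) (c := 0) (d := 1) (by simpa using hp.out.ne_zero)
    (fun τ => by simp [Mob, coe_up]) τ ((hasExp_xF N).differentiableAt _), dOp_xF]
  push_cast
  ring

theorem dOp_xF_low (b : ℤ) (τ : ℍ) :
    dOp (fun τ => xF N (low p b τ)) τ = (xF N (low p b τ) * EF N (low p b τ)) / p := by
  have hp0 : (p : ℂ) ≠ 0 := by exact_mod_cast hp.out.ne_zero
  rw [dOp_comp_mob (a := 1) (b := b) (c := 0) (d := p) (by simpa using hp.out.ne_zero)
    (fun τ => by simp [Mob, coe_low, hp0]) τ ((hasExp_xF N).differentiableAt _), dOp_xF]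
  push_cast
  simp only [zero_mul, zero_add, mul_zero, sub_zero, one_mul]
  field_simp

theorem sq_lt_of_quadratic {lam : ℂ} {t : ℤ} (h : N * lam ^ 2 + N * t * lam + p = 0)
    (him : lam.im ≠ 0) : N * t ^ 2 < 4 * (p : ℤ) := by
  have hN0 : (0 : ℝ) < N := by exact_mod_cast NeZero.pos N
  have h1 := congrArg Complex.re h
  have h2 := congrArg Complex.im h
  simp [pow_two] at h1 h2
  have h3 : lam.re = -(t / 2) := by
    have : (N * lam.im) * (2 * lam.re + t) = 0 := by linarith
    rcases mul_eq_zero.1 this with h | h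
    · exact absurd h (mul_ne_zero hN0.ne' him)
    · linarith
  have h4 : (0 : ℝ) < N * lam.im ^ 2 := by positivity
  rw [h3] at h1
  have : (N * t ^ 2 : ℝ) < 4 * p := by nlinarith
  exact_mod_cast this

theorem exists_multiplier {i : Option (Fin p)} {τ : ℍ}
    (h : xF N (isog p i τ) = xF N (fricke N τ)) : ∃ (lam : ℂ) (t : ℤ),
      N * lam ^ 2 + N * t * lam + p = 0 ∧ N * t ^ 2 < 4 * (p : ℤ) ∧
      phi N p i τ = gA N * lam ^ (2 * N) * xF N τ ^ (N - 1) ∧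
      dOp (fun τ => xF N (isog p i τ)) τ = - (N * lam ^ 2 / p * (EF N τ * xF N (isog p i τ))) ∧
      (t = 0 → ∃ α β γ, IsForm N p τ α β γ ∧ FormIndex p α β i) := by
  obtain ⟨a, b, c, d, hd, hM⟩ := equi_of_xF_eq h.symm
  have hp0 : (p : ℂ) ≠ 0 := by exact_mod_cast hp.out.ne_zero
  have hpp : ¬ (p : ℤ) ∣ 1 := by
    intro h
    have := Int.eq_one_of_dvd_one (by positivity) h
    have := hp.out.one_lt
    omega
  have hN0 : (N : ℂ) ≠ 0 := by exact_mod_cast NeZero.ne N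
  have hd0 : (d : ℝ) ≠ 0 := by
    intro h
    have h0 : d = 0 := by exact_mod_cast h
    have h2 : (N : ℤ) ∣ 1 := ⟨-(b * c), by rw [← hd, h0]; ring⟩
    have := Int.eq_one_of_dvd_one (by positivity) h2
    rcases hN.out with h | h <;> omega
  have hdC : (a * d - b * (N * c) : ℂ) = 1 := by exact_mod_cast hd
  have hg := gF_mob_fricke hd hM
  have hE := EF_mob_fricke hd hM
  have hM' := mob_fricke_iff.1 hM
  rcases i with _ | e
  · have hq : (N * (p * d) * τ ^ 2 - N * (p * c + b) * τ + a : ℂ) = 0 := by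
      simp only [isog, coe_up] at hM'
      linear_combination hM'
    refine ⟨p * (d * τ - c), p * c - b, ?_, ?_, ?_, ?_, fun ht => ⟨p * d, -(p * c), a, ⟨?_, ?_⟩, ?_⟩⟩
    · push_cast
      linear_combination (p * d : ℂ) * hq - p * hdC
    · refine sq_lt_of_quadratic (lam := p * (d * τ - c)) ?_ ?_
      · push_cast
        linear_combination (p * d : ℂ) * hq - p * hdC
      · simp [hd0, τ.im_ne_zero, hp.out.ne_zero]
    · simp only [phi, phiU, isog] at hg ⊢
      rw [mul_div_assoc, hg, mul_pow]
      ring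
    · simp only [isog] at hE ⊢
      rw [dOp_xF_up, hE]
      field_simp
    · have : b = p * c := by linarith
      subst this
      linear_combination p * hd
    · have : b = p * c := by linarith
      subst this
      push_cast at hq ⊢
      linear_combination hq
    · exact dvd_mul_right _ _
  · have hq : (N * d * τ ^ 2 + N * (d * e - c - p * b) * τ + (p * a - N * c * e) : ℂ) = 0 := by
      simp only [isog, coe_low] at hM'
      field_simp at hM'
      push_cast at hM'
      linear_combination hM'
    refine ⟨d * τ - c, c + d * e - p * b, ?_, ?_, ?_, ?_, fun ht => ⟨d, -c, p * a - N * c * (e : ℕ),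
      ⟨?_, ?_⟩, ?_, ?_⟩⟩
    · push_cast
      linear_combination (d : ℂ) * hq - p * hdC
    · refine sq_lt_of_quadratic (lam := d * τ - c) ?_ ?_
      · push_cast
        linear_combination (d : ℂ) * hq - p * hdC
      · simp [hd0, τ.im_ne_zero]
    · simpa only [phi, phiL, isog] using hg
    · simp only [isog] at hE ⊢
      rw [dOp_xF_low, hE]
      field_simp
    · linear_combination p * hd - N * c * ht
    · have h1 : (c + d * (e : ℕ) - p * b : ℂ) = 0 := by exact_mod_cast ht
      push_cast
      linear_combination hq - N * τ * h1
    · rintro ⟨d', rfl⟩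
      have h2 : (p : ℤ) ∣ c := ⟨b - d' * (e : ℕ), by linarith⟩
      obtain ⟨c', rfl⟩ := h2
      exact hpp ⟨a * d' - b * (N * c'), by linarith⟩
    · exact ⟨b, by linarith⟩

theorem exists_formIndex (h5 : 5 ≤ p) {τ : ℍ} {α β γ : ℤ} (h : IsForm N p τ α β γ) :
    ∃ i, FormIndex p α β i ∧ xF N (isog p i τ) = xF N (fricke N τ) ∧ ∃ lam : ℂ,
      N * lam ^ 2 + p = 0 ∧ phi N p i τ = gA N * lam ^ (2 * N) * xF N τ ^ (N - 1) := by
  obtain ⟨h1, h2⟩ := h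
  have hp0 : (p : ℂ) ≠ 0 := by exact_mod_cast hp.out.ne_zero
  have hpI : Prime (p : ℤ) := Nat.prime_iff_prime_int.1 hp.out
  have h1C : (α * γ - N * β ^ 2 : ℂ) = p := by exact_mod_cast h1
  by_cases hα : (p : ℤ) ∣ α
  · obtain ⟨d, rfl⟩ := hα
    have h3 : (p : ℤ) ∣ N * β ^ 2 := ⟨d * γ - 1, by linarith⟩
    have h4 : ¬ (p : ℤ) ∣ N := fun h => not_dvd_level h5 (by exact_mod_cast h)
    obtain ⟨c, rfl⟩ := hpI.dvd_of_dvd_pow ((hpI.dvd_or_dvd h3).resolve_left h4)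
    push_cast at h1C h2
    have hd : γ * d - (-(p * c)) * (N * (-c)) = 1 := by
      refine mul_left_cancel₀ hpI.ne_zero ?_
      linarith
    have hM : Mob γ (-(p * c)) (N * (-c)) d (fricke N τ) (up p τ) := by
      rw [mob_fricke_iff, coe_up]
      push_cast
      linear_combination h2
    refine ⟨none, dvd_mul_right _ _, xF_of_equi ⟨_, _, _, _, hd, hM⟩, p * (d * τ + c), ?_, ?_⟩
    · linear_combination (p * d : ℂ) * h2 - h1C
    · have hg := gF_mob_fricke hd hM
      simp only [phi, phiU]
      rw [mul_div_assoc, hg, mul_pow]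
      push_cast
      ring
  · obtain ⟨u, v, huv⟩ : ∃ u v : ℤ, u * α + v * p = 1 :=
      ((Prime.coprime_iff_not_dvd hpI).2 hα).symm
    set e : ℤ := (β * u) % p with he
    have he0 : 0 ≤ e := Int.emod_nonneg _ hpI.ne_zero
    have he1 : e < p := Int.emod_lt_of_pos _ (by exact_mod_cast hp.out.pos)
    obtain ⟨w, hw⟩ : (p : ℤ) ∣ α * e - β := by
      refine ⟨-(α * (β * u / p)) - β * v, ?_⟩
      have := Int.emod_add_mul_ediv (β * u) p
      linear_combination α * this + β * huv
    obtain ⟨a, ha⟩ : (p : ℤ) ∣ γ - N * β * e := by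
      refine (hpI.dvd_or_dvd (a := α) ?_).resolve_left hα
      exact ⟨1 - N * β * w, by linear_combination h1 - N * β * hw⟩
    have hd : a * α - w * (N * (-β)) = 1 := by
      refine mul_left_cancel₀ hpI.ne_zero ?_
      linear_combination (-α) * ha - N * β * hw + h1
    have haC : (γ - N * β * e : ℂ) = p * a := by exact_mod_cast ha
    have hwC : (α * e - β : ℂ) = p * w := by exact_mod_cast hw
    have hM : Mob a w (N * (-β)) α (fricke N τ) (low p e τ) := by
      rw [mob_fricke_iff, coe_low]
      field_simp
      push_cast
      linear_combination h2 - haC + N * τ * hwC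
    have hee : ((e.toNat : ℕ) : ℤ) = e := Int.toNat_of_nonneg he0
    have hlt : e.toNat < p := by omega
    refine ⟨some ⟨e.toNat, hlt⟩, ⟨hα, ?_⟩, ?_, α * τ + β, ?_, ?_⟩
    · simp only [hee]
      exact ⟨w, hw⟩
    · simp only [isog, hee]
      exact xF_of_equi ⟨_, _, _, _, hd, hM⟩
    · linear_combination (α : ℂ) * h2 - h1C
    · have hg := gF_mob_fricke hd hM
      simp only [phi, phiL, hee]
      rw [hg]
      push_cast
      ring

theorem formIndex_unique (h5 : 5 ≤ p) {τ : ℍ} {α β γ α' β' γ' : ℤ} {i i' : Option (Fin p)}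
    (h : IsForm N p τ α β γ)
    (hi : FormIndex p α β i) (h' : IsForm N p τ α' β' γ') (hi' : FormIndex p α' β' i') : i = i' := by
  have hpI : Prime (p : ℤ) := Nat.prime_iff_prime_int.1 hp.out
  have hpr : α * (2 * β') = α' * (2 * β) ∧ α * γ' = α' * γ := isForm_proportional (N := N) (τ := τ)
    (by push_cast; linear_combination h.2) (by push_cast; linear_combination h'.2)
  have h3 : α * β' = α' * β := by linarith [hpr.1]
  have key : ∀ {α β γ α' β' γ' : ℤ}, α * γ - N * β ^ 2 = p → α * γ' = α' * γ →
      (p : ℤ) ∣ α → (p : ℤ) ∣ α' := by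
    intro α β γ α' β' γ' h1 h2 hα
    obtain ⟨d, rfl⟩ := hα
    have h3 : (p : ℤ) ∣ N * β ^ 2 := ⟨d * γ - 1, by linarith⟩
    have h4 : ¬ (p : ℤ) ∣ N := fun h => not_dvd_level h5 (by exact_mod_cast h)
    obtain ⟨c, rfl⟩ := hpI.dvd_of_dvd_pow ((hpI.dvd_or_dvd h3).resolve_left h4)
    have h5 : ¬ (p : ℤ) ∣ γ := by
      rintro ⟨g, rfl⟩
      refine hpI.not_dvd_one ⟨d * g - N * c ^ 2, ?_⟩
      refine mul_left_cancel₀ hpI.ne_zero ?_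
      linear_combination -h1
    exact (hpI.dvd_or_dvd (⟨d * γ', by linarith⟩ : (p : ℤ) ∣ α' * γ)).resolve_right h5
  rcases i with _ | e <;> rcases i' with _ | e'
  · rfl
  · exact absurd (key (β' := 0) h.1 hpr.2 hi) hi'.1
  · exact absurd (key (β' := 0) h'.1 hpr.2.symm hi') hi.1
  · congr 1
    obtain ⟨hα, u, hu⟩ := hi
    obtain ⟨hα', u', hu'⟩ := hi'
    have h6 : (p : ℤ) ∣ α * (α' * ((e : ℕ) - (e' : ℕ))) :=
      ⟨α' * u - α * u', by linear_combination α' * hu - α * hu' - h3⟩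
    have h7 := ((hpI.dvd_or_dvd ((hpI.dvd_or_dvd h6).resolve_left hα)).resolve_left hα')
    have h8 := e.2
    have h9 := e'.2
    have h10 : (e : ℤ) - (e' : ℕ) = 0 := Int.eq_zero_of_abs_lt_dvd h7 (by rw [abs_lt]; omega)
    exact Fin.ext (by omega)

end Multipliers

section DualRoots

open UpperHalfPlane Function.Periodic Filter Topology

variable {N : ℕ} [hN : Fact (N = 2 ∨ N = 3)] {p : ℕ} [hp : Fact p.Prime]

theorem not_isSquare_of_eq {n : ℕ} (h5 : 5 ≤ p) (hn : n ∣ 4) {a b : ℤ} (ha : a ≠ 0)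
    (h : b ^ 2 = n * p * a ^ 2) : False := by
  have hpI : Prime (p : ℤ) := Nat.prime_iff_prime_int.1 hp.out
  have h2 : ¬ (p : ℤ) ∣ n := by
    intro h
    have h1 := Nat.le_of_dvd (by norm_num) ((Int.natCast_dvd_natCast.1 h).trans hn)
    omega
  have hn0 : n ≠ 0 := fun h => by simp [h] at hn
  have hb : b ≠ 0 := by
    rintro rfl
    have : (n : ℤ) * p * a ^ 2 ≠ 0 :=
      mul_ne_zero (mul_ne_zero (by exact_mod_cast hn0) hpI.ne_zero) (pow_ne_zero 2 ha)
    exact this (by rw [← h]; ring)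
  have h3 := congrArg (emultiplicity (p : ℤ)) h
  have hf1 : FiniteMultiplicity (p : ℤ) b := Int.finiteMultiplicity_iff.2 ⟨by
    simpa using hp.out.ne_one, hb⟩
  have hf2 : FiniteMultiplicity (p : ℤ) a := Int.finiteMultiplicity_iff.2 ⟨by
    simpa using hp.out.ne_one, ha⟩
  rw [emultiplicity_pow hpI, emultiplicity_mul hpI, emultiplicity_mul hpI, emultiplicity_pow hpI,
    emultiplicity_eq_zero.2 h2, hf1.emultiplicity_eq_multiplicity,
    hf2.emultiplicity_eq_multiplicity] at h3
  rw [(Int.finiteMultiplicity_iff.2 ⟨by simpa using hp.out.ne_one, hpI.ne_zero⟩ :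
    FiniteMultiplicity (p : ℤ) p).emultiplicity_self] at h3
  have h4 : 2 * multiplicity (p : ℤ) b = 0 + 1 + 2 * multiplicity (p : ℤ) a := by exact_mod_cast h3
  omega

theorem EF_ne_zero_of_isForm (h5 : 5 ≤ p) {τ : ℍ} {α β γ : ℤ} (h : IsForm N p τ α β γ) :
    EF N τ ≠ 0 := by
  intro hE
  have hN1 : N ≠ 0 := NeZero.ne N
  have h1 := EF_pow (N := N) τ
  rw [hE, zero_pow hN1] at h1
  have h2 : 1 + (kap N : ℂ) * xF N τ = 0 :=
    pow_eq_zero_iff (by rcases hN.out with h | h <;> omega : N - 1 ≠ 0) |>.1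
       ((mul_eq_zero.1 h1.symm).resolve_right (gF_ne_zero N τ))
  have h3 : xF N (fricke N τ) = xF N τ := by
    rw [xF_fricke_eq]
    refine inv_eq_of_mul_eq_one_left ?_
    linear_combination (kap N * xF N τ - 1 : ℂ) * h2
  obtain ⟨a, b, c, d, hd, hM⟩ := equi_of_xF_eq h3
  rw [mob_fricke_iff] at hM
  have hq : (N * d * τ ^ 2 + N * (-c - b : ℤ) * τ + a : ℂ) = 0 := by
    push_cast
    linear_combination hM
  obtain ⟨h4, h6⟩ := isForm_proportional (N := N) (α := α) (β := 2 * β) (γ := γ)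
    (by push_cast; linear_combination h.2) hq
  have hdisc : α ^ 2 * (4 - N * (b - c) ^ 2) = 4 * p * d ^ 2 := by
    have h7 : α ^ 2 * (4 * d * a - N * (-c - b) ^ 2) = d ^ 2 * (4 * (α * γ) - N * (2 * β) ^ 2) := by
      linear_combination (4 * d * α) * h6 - N * (α * (-c - b) + d * (2 * β)) * h4
    linear_combination h7 - α ^ 2 * 4 * hd + 4 * d ^ 2 * h.1
  have hd0 : d ≠ 0 := by
    rintro rfl
    have h2 : (N : ℤ) ∣ 1 := ⟨-(b * c), by rw [← hd]; ring⟩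
    have := Int.eq_one_of_dvd_one (by positivity) h2
    rcases hN.out with h | h <;> omega
  have hpos : 0 < 4 - N * (b - c) ^ 2 := by
    have h8 : 0 < 4 * (p : ℤ) * d ^ 2 := by
      have : (0 : ℤ) < p := by exact_mod_cast hp.out.pos
      positivity
    rw [← hdisc] at h8
    exact pos_of_mul_pos_right h8 (sq_nonneg α)
  have hN2 : (2 : ℤ) ≤ N := by rcases hN.out with h | h <;> omega
  have hs : (b - c) ^ 2 < 2 := by nlinarith [sq_nonneg (b - c)]
  have hs1 : (b - c) ^ 2 = 0 ∨ (b - c) ^ 2 = 1 := by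
    have := sq_nonneg (b - c)
    omega
  rcases hs1 with hs1 | hs1
  · rw [hs1] at hdisc
    exact not_isSquare_of_eq (n := 1) h5 (by norm_num) hd0 (b := α) (by push_cast; linarith)
  · rw [hs1] at hdisc
    rcases hN.out with h | h
    · rw [h] at hdisc
      exact not_isSquare_of_eq (n := 2) h5 (by norm_num) hd0 (b := α) (by
        push_cast at hdisc ⊢; linarith)
    · rw [h] at hdisc
      exact not_isSquare_of_eq (n := 4) h5 (by norm_num) hd0 (b := α) (by
        push_cast at hdisc ⊢; linarith)

variable (N) in
/-- The factor of the dual product attached to an isogeny. -/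
def dualFactor (i : Option (Fin p)) (τ : ℍ) : ℂ := 1 - (kap N : ℂ) ^ 2 * xF N τ * xF N (isog p i τ)

theorem dualFactor_eq_zero_iff {i : Option (Fin p)} {τ : ℍ} :
    dualFactor N i τ = 0 ↔ xF N (isog p i τ) = xF N (fricke N τ) := by
  have h1 : (kap N : ℂ) ^ 2 * xF N τ ≠ 0 :=
    mul_ne_zero (pow_ne_zero _ kap_ne_zero) (xF_ne_zero N τ)
  rw [dualFactor, xF_fricke_eq, sub_eq_zero, eq_comm, mul_comm, mul_eq_one_iff_eq_inv₀ h1]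

theorem differentiableAt_xF_isog (i : Option (Fin p)) (τ : ℍ) :
    DifferentiableAt ℂ ((fun τ => xF N (isog p i τ)) ∘ ofComplex) τ := by
  rcases i with _ | e
  · exact ((hasExp_xF N).comp_up p).differentiableAt τ
  · exact ((hasExp_xF N).comp_low p _).differentiableAt τ

theorem dOp_mul {f g : ℍ → ℂ} {τ : ℍ} (hf : DifferentiableAt ℂ (f ∘ ofComplex) τ)
    (hg : DifferentiableAt ℂ (g ∘ ofComplex) τ) :
    dOp (fun τ => f τ * g τ) τ = dOp f τ * g τ + f τ * dOp g τ := by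
  have h : deriv ((fun τ => f τ * g τ) ∘ ofComplex) τ = _ := (hf.hasDerivAt.mul hg.hasDerivAt).deriv
  rw [dOp, h, dOp, dOp]
  simp only [Function.comp_apply, ofComplex_apply]
  ring

theorem dOp_one_sub_mul {f : ℍ → ℂ} {τ : ℍ} (c : ℂ) (hf : DifferentiableAt ℂ (f ∘ ofComplex) τ) :
    dOp (fun τ => 1 - c * f τ) τ = - (c * dOp f τ) := by
  have h : deriv ((fun τ => 1 - c * f τ) ∘ ofComplex) τ = _ :=
    ((hf.hasDerivAt.const_mul c).const_sub 1).deriv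
  rw [dOp, h, dOp]
  ring

theorem not_sq_dvd_of_unique {Q : ℂ[X]}
    (hQ : ∀ τ, ∏ i : Option (Fin p), dualFactor N i τ = Q.eval (xF N τ)) {τ : ℍ}
    {i : Option (Fin p)} (hi : dualFactor N i τ = 0) (hu : ∀ j, dualFactor N j τ = 0 → j = i)
    {lam : ℂ} (hl : N * lam ^ 2 + p = 0)
    (hD : dOp (fun τ => xF N (isog p i τ)) τ = - (N * lam ^ 2 / p * (EF N τ * xF N (isog p i τ))))
    (hE : EF N τ ≠ 0) : ¬ (X - C (xF N τ)) ^ 2 ∣ Q := by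
  rintro ⟨G, rfl⟩
  have hp0 : (p : ℂ) ≠ 0 := by exact_mod_cast hp.out.ne_zero
  have hxd := (hasExp_xF N).differentiableAt τ
  have hd : ∀ j : Option (Fin p), DifferentiableAt ℂ (dualFactor N j ∘ ofComplex) τ := fun j =>
    (differentiableAt_const 1).sub (((differentiableAt_const ((kap N : ℂ) ^ 2)).mul hxd).mul
      (differentiableAt_xF_isog j τ))
  have hDi : dOp (dualFactor N i) τ = - (2 * EF N τ) := by
    have h1 : dualFactor N i = fun τ => 1 - (kap N : ℂ) ^ 2 * (xF N τ * xF N (isog p i τ)) := by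
      funext σ
      rw [dualFactor]
      ring
    rw [h1, dOp_one_sub_mul (f := fun τ => xF N τ * xF N (isog p i τ)) _
        (hxd.mul (differentiableAt_xF_isog i τ)),
      dOp_mul hxd (differentiableAt_xF_isog i τ), hD, dOp_xF]
    rw [dualFactor] at hi
    have h2 : (N * lam ^ 2 / p : ℂ) = -1 := by
      rw [div_eq_iff hp0]
      linear_combination hl
    rw [h2]
    linear_combination (2 * EF N τ) * hi
  have hG : ∀ j ∈ (Finset.univ.erase i), dualFactor N j τ ≠ 0 := fun j hj h0 =>
    (Finset.mem_erase.1 hj).1 (hu j h0)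
  have hprod : DifferentiableAt ℂ
      ((fun σ => ∏ j ∈ Finset.univ.erase i, dualFactor N j σ) ∘ ofComplex) τ := by
    have := DifferentiableAt.fun_finsetProd (𝕜 := ℂ) (u := Finset.univ.erase i)
      (f := fun j => dualFactor N j ∘ ofComplex) (x := (τ : ℂ)) fun j _ => hd j
    exact this
  have h1 : dOp (fun σ => dualFactor N i σ * ∏ j ∈ Finset.univ.erase i, dualFactor N j σ) τ =
      - (2 * EF N τ) * ∏ j ∈ Finset.univ.erase i, dualFactor N j τ := by
    rw [dOp_mul (hd i) hprod, hDi, hi, zero_mul, add_zero]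
  have h2 : (fun σ => dualFactor N i σ * ∏ j ∈ Finset.univ.erase i, dualFactor N j σ) =
      fun σ => (xF N σ - xF N τ) * ((xF N σ - xF N τ) * G.eval (xF N σ)) := by
    funext σ
    rw [Finset.mul_prod_erase _ (fun j => dualFactor N j σ) (Finset.mem_univ i), hQ]
    simp only [eval_mul, eval_pow, eval_sub, eval_X, eval_C]
    ring
  have hx1 : DifferentiableAt ℂ ((fun σ => xF N σ - xF N τ) ∘ ofComplex) τ :=
    hxd.sub (differentiableAt_const _)
  have hx2 : DifferentiableAt ℂ ((fun σ => G.eval (xF N σ)) ∘ ofComplex) τ :=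
    G.differentiable.differentiableAt.comp (τ : ℂ) hxd
  rw [h2, dOp_mul (g := fun σ => (xF N σ - xF N τ) * G.eval (xF N σ)) hx1 (hx1.mul hx2), sub_self,
    zero_mul, zero_mul, add_zero, mul_zero] at h1
  exact mul_ne_zero (neg_ne_zero.2 (mul_ne_zero two_ne_zero hE)) (Finset.prod_ne_zero_iff.2 hG)
    h1.symm

end DualRoots

section SingularCount

open UpperHalfPlane Function.Periodic Filter Topology IsLocalRing

variable {N : ℕ} [hN : Fact (N = 2 ∨ N = 3)] {p : ℕ} [hp : Fact p.Prime]

variable {O : ValuationSubring ℂ} [hO : Fact ((p : ℂ) ∈ O.nonunits)]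

theorem residue_intCast_ne_zero {n : ℤ} (h : ¬ (p : ℤ) ∣ n) : residue O (n : O) ≠ 0 := by
  have := charP_residue O p
  rw [map_intCast]
  rwa [Ne, CharP.intCast_eq_zero_iff (Rf O) p]

theorem residue_natCast_ne_zero {n : ℕ} (h : ¬ p ∣ n) : residue O (n : O) ≠ 0 := by
  have := residue_intCast_ne_zero (O := O) (p := p) (n := n) (by exact_mod_cast h)
  simpa using this

theorem not_dvd_gA (h5 : 5 ≤ p) : ¬ (p : ℤ) ∣ gA N := by
  have hpI : Prime (p : ℤ) := Nat.prime_iff_prime_int.1 hp.out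
  have h4 : ¬ (p : ℤ) ∣ N := fun h => not_dvd_level h5 (by exact_mod_cast h)
  rw [gA]
  intro h
  rcases hpI.dvd_or_dvd h with h | h
  · have := hpI.dvd_of_dvd_pow h
    rw [dvd_neg] at this
    exact hpI.not_dvd_one this
  · exact h4 (hpI.dvd_of_dvd_pow h)

theorem not_dvd_kap (h5 : 5 ≤ p) : ¬ p ∣ kap N := fun h =>
  not_dvd_level h5 (hp.out.dvd_of_dvd_pow h)

variable (N p O) in
/-- The singular values modulo `p`. -/
def singularSet : Set (Rf O) := {r | (kap N : Rf O) ^ 2 * r ^ (p + 1) = 1 ∧ (fK N p O).eval r = 0}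

variable (N p) in
/-- The values of the Hauptmodul at the roots of the forms of discriminant `-4 N p`. -/
def formValues : Set ℂ := {z | ∃ τ α β γ, IsForm N p τ α β γ ∧ xF N τ = z}

theorem exists_phi_lift (h5 : 5 ≤ p) {τ : ℍ} {z : O} (hz : (z : ℂ) = xF N τ) :
    ∃ ψ : Option (Fin p) → O, (∀ i, (ψ i : ℂ) = phi N p i τ) ∧
      ((fK N p O).eval (residue O z) = 0 ↔ ∀ i, residue O (ψ i) = 0) ∧
      (∀ i j, i ≠ j → residue O (ψ i) = 0 → residue O (ψ j) = 0 →
        (fK N p O).eval (residue O z) = 0) ∧ ∏ i, ψ i = (p : O) ^ (2 * N) := by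
  obtain ⟨ψ, h1, h2, h3⟩ := exists_mem_of_prod (O := O) (φ := fun i => phi N p i τ)
    (f := (fK N p O).eval (residue O z)) (n := p) hp.out.ne_zero fun s => by
      obtain ⟨Q, hQ1, hQ2⟩ := phi_mem_poly (N := N) (p := p) h5 s
      refine ⟨Q.eval z, ?_, ?_⟩
      · rw [prod_option_fin p (1 - s * phiU N p τ) (fun b => 1 - s * phiL N p b τ) _ rfl
          fun b => rfl, hQ1, ← hz]
        exact (eval_map_apply (algebraMap O ℂ) z).symm
      · rw [← eval_map_apply, hQ2]
        simp
  refine ⟨ψ, h1, h2, h3 (by simp), Subtype.ext ?_⟩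
  have h4 := map_prod O.subtype ψ Finset.univ
  have h6 := prod_phi (N := N) h5 τ
  rw [← prod_option_fin p (phiU N p τ) (fun b => phiL N p b τ) (fun i => phi N p i τ) rfl
    fun b => rfl] at h6
  refine Eq.trans h4 ?_
  simp only [ValuationSubring.subtype_apply, h1, h6]
  push_cast
  rfl

/-- A root of the dual polynomial with singular reduction comes from a form. -/
theorem isForm_of_singular (h5 : 5 ≤ p) {τ : ℍ} {z : O} (hz : (z : ℂ) = xF N τ)
    (hzu : residue O z ≠ 0) (hs : (fK N p O).eval (residue O z) = 0) {i : Option (Fin p)}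
    (hi : xF N (isog p i τ) = xF N (fricke N τ)) : ∃ lam : ℂ, N * lam ^ 2 + p = 0 ∧
      dOp (fun τ => xF N (isog p i τ)) τ = - (N * lam ^ 2 / p * (EF N τ * xF N (isog p i τ))) ∧
      ∃ α β γ, IsForm N p τ α β γ ∧ FormIndex p α β i := by
  obtain ⟨lam, t, h1, h2, h3, h4, h6⟩ := exists_multiplier hi
  obtain ⟨ψ, hψ, hψ1, -, hψ3⟩ := exists_phi_lift h5 hz
  have hψ0 := hψ1.1 hs
  have hNu : residue O (N : O) ≠ 0 := residue_natCast_ne_zero (p := p) (not_dvd_level h5)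
  have hAu : residue O (gA N : O) ≠ 0 := residue_intCast_ne_zero (p := p) (not_dvd_gA h5)
  have hpp : residue O (p : O) = 0 := residue_natCast_self O p
  have hunit : ∀ {u : O}, residue O u ≠ 0 → IsUnit u := fun h => (residue_ne_zero_iff_isUnit _).1 h
  by_cases ht : t = 0
  · subst ht
    exact ⟨lam, by simpa using h1, h4, h6 rfl⟩
  exfalso
  have htp : ¬ (p : ℤ) ∣ t := by
    intro h
    have h7 := Int.natAbs_le_of_dvd_ne_zero h ht
    have h8 : (p : ℤ) ^ 2 ≤ t ^ 2 := by
      rw [← Int.natAbs_sq t]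
      have : (p : ℤ) ≤ t.natAbs := by exact_mod_cast h7
      exact pow_le_pow_left₀ (by positivity) this 2
    have hN2 : (2 : ℤ) ≤ N := by rcases hN.out with h | h <;> omega
    have : (5 : ℤ) ≤ p := by exact_mod_cast h5
    nlinarith [sq_nonneg t]
  have htu : residue O (t : O) ≠ 0 := residue_intCast_ne_zero (p := p) htp
  obtain ⟨l, rfl⟩ : ∃ l : O, (l : ℂ) = lam := by
    refine ⟨⟨lam, ?_⟩, rfl⟩
    by_contra hl
    have h7 : lam⁻¹ ∈ O := (O.mem_or_inv_mem lam).resolve_left hl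
    have h0 : lam ≠ 0 := fun h => hl (h ▸ O.zero_mem)
    obtain ⟨m, hm⟩ : ∃ m : O, (m : ℂ) = lam⁻¹ := ⟨⟨_, h7⟩, rfl⟩
    have h8 : (N : O) = m * (-(N * t) - p * m) := by
      refine Subtype.ext ?_
      push_cast
      rw [hm]
      field_simp
      linear_combination h1
    have h9 : IsUnit m := isUnit_of_mul_isUnit_left (h8 ▸ hunit hNu)
    obtain ⟨w, hw⟩ := h9.exists_right_inv
    refine hl ?_
    have : (m : ℂ) * w = 1 := by exact_mod_cast congrArg Subtype.val hw
    rw [hm, inv_mul_eq_one₀ h0] at this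
    exact this ▸ w.2
  have h1' : l * (-(N * (l + t))) = p := by
    refine Subtype.ext ?_
    push_cast
    linear_combination -h1
  have h3' : ψ i = gA N * l ^ (2 * N) * z ^ (N - 1) := by
    refine Subtype.ext ?_
    push_cast
    rw [hψ, h3, hz]
  have hr : residue O l = 0 := by
    have h7 := hψ0 i
    rw [h3', map_mul, map_mul, map_pow, map_pow] at h7
    have h8 := ((mul_eq_zero.1 h7).resolve_right (pow_ne_zero _ hzu))
    have hN0 : 2 * N ≠ 0 := by rcases hN.out with h | h <;> omega
    exact (pow_eq_zero_iff hN0).1 ((mul_eq_zero.1 h8).resolve_left hAu)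
  have hu : IsUnit (-(N * (l + t)) : O) := by
    refine hunit ?_
    rw [map_neg, map_mul, map_add, hr, zero_add]
    exact neg_ne_zero.2 (mul_ne_zero hNu htu)
  set u : O := -(N * (l + t)) with hu_def
  have h7 : gA N * z ^ (N - 1) * ∏ j ∈ Finset.univ.erase i, ψ j = u ^ (2 * N) := by
    rw [← Finset.mul_prod_erase _ _ (Finset.mem_univ i), h3', ← h1', mul_pow] at hψ3
    have hl0 : l ≠ 0 := by
      rintro rfl
      rw [zero_mul] at h1'
      have := congrArg Subtype.val h1'
      push_cast at this
      exact hp.out.ne_zero (by exact_mod_cast this.symm)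
    refine mul_left_cancel₀ (pow_ne_zero (2 * N) hl0) ?_
    linear_combination hψ3
  obtain ⟨j, hj⟩ : ∃ j, j ≠ i := exists_ne i
  have h8 : IsUnit (∏ j ∈ Finset.univ.erase i, ψ j) :=
    isUnit_of_mul_isUnit_right (h7 ▸ hu.pow _)
  have h9 : IsUnit (ψ j) := by
    rw [← Finset.mul_prod_erase _ _ (Finset.mem_erase.2 ⟨hj, Finset.mem_univ j⟩)] at h8
    exact isUnit_of_mul_isUnit_left h8
  exact (residue_ne_zero_iff_isUnit _).2 h9 (hψ0 j)

/-- The values at roots of forms have singular reduction. -/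
theorem singular_of_isForm (h5 : 5 ≤ p) {τ : ℍ} {z : O} (hz : (z : ℂ) = xF N τ)
    {α β γ : ℤ} (h : IsForm N p τ α β γ)
    (hzu : residue O z ≠ 0) : (fK N p O).eval (residue O z) = 0 := by
  obtain ⟨i, -, -, lam, hl, hφ⟩ := exists_formIndex h5 h
  obtain ⟨ψ, hψ, -, hψ2, hψ3⟩ := exists_phi_lift h5 hz
  have hpp : residue O (p : O) = 0 := residue_natCast_self O p
  have hN0 : (N : ℂ) ≠ 0 := by exact_mod_cast NeZero.ne N
  have hAu : residue O (gA N : O) ≠ 0 := residue_intCast_ne_zero (p := p) (not_dvd_gA h5)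
  have hNu : residue O (N : O) ≠ 0 := residue_natCast_ne_zero (p := p) (not_dvd_level h5)
  have hN1 : N ≠ 0 := NeZero.ne N
  have h1 : (N : O) ^ N * ψ i = gA N * (-p) ^ N * z ^ (N - 1) := by
    refine Subtype.ext ?_
    push_cast
    have h2 : (N * lam ^ 2 : ℂ) = -p := by linear_combination hl
    rw [hψ, hφ, hz, ← h2, mul_pow, ← pow_mul]
    ring
  have h2 : residue O (ψ i) = 0 := by
    have := congrArg (residue O) h1
    rw [map_mul, map_pow, map_mul, map_mul, map_pow, map_neg, hpp, neg_zero, zero_pow hN1,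
      mul_zero, zero_mul] at this
    exact (mul_eq_zero.1 this).resolve_left (pow_ne_zero _ hNu)
  have hp0 : (p : O) ≠ 0 := by
    intro h
    have := congrArg Subtype.val h
    push_cast at this
    exact hp.out.ne_zero (by exact_mod_cast this)
  have h3 : gA N * (-1) ^ N * z ^ (N - 1) * ∏ j ∈ Finset.univ.erase i, ψ j =
      (N : O) ^ N * (p : O) ^ N := by
    rw [← Finset.mul_prod_erase _ _ (Finset.mem_univ i)] at hψ3
    refine mul_left_cancel₀ (pow_ne_zero N hp0) ?_
    have : (-(p : O)) ^ N = (-1) ^ N * (p : O) ^ N := neg_pow _ _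
    rw [this] at h1
    have h4 : (p : O) ^ (2 * N) = (p : O) ^ N * (p : O) ^ N := by ring
    rw [h4] at hψ3
    linear_combination (N : O) ^ N * hψ3 - (∏ j ∈ Finset.univ.erase i, ψ j) * h1
  have h4 := congrArg (residue O) h3
  rw [map_mul, map_mul, map_mul, map_mul, map_pow, map_pow, map_pow, map_pow, hpp, zero_pow hN1,
    mul_zero, map_neg, map_one, map_prod] at h4
  have h6 := (mul_eq_zero.1 h4).resolve_left (mul_ne_zero (mul_ne_zero hAu
    (pow_ne_zero _ (neg_ne_zero.2 one_ne_zero))) (pow_ne_zero _ hzu))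
  obtain ⟨j, hj, hj0⟩ := Finset.prod_eq_zero_iff.1 h6
  exact hψ2 i j (Finset.mem_erase.1 hj).1.symm h2 hj0

end SingularCount

section RootCount

open UpperHalfPlane Function.Periodic Filter Topology IsLocalRing

theorem nodup_roots_one_sub {k : Type*} [Field k] {n : ℕ} (hn : (n : k) ≠ 0) {c : k} (hc : c ≠ 0) :
    (1 - C c * X ^ n : k[X]).roots.Nodup := by
  refine nodup_roots ?_
  have h1 : (1 - C c * X ^ n : k[X]) = C (-c) * (X ^ n - C c⁻¹) := by
    rw [mul_sub, ← C_mul, neg_mul c c⁻¹, mul_inv_cancel₀ hc]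
    simp only [map_neg, map_one]
    ring
  rw [h1]
  exact (separable_X_pow_sub_C _ hn (inv_ne_zero hc)).unit_mul
    (isUnit_C.2 (isUnit_iff_ne_zero.2 (neg_ne_zero.2 hc)))

theorem natDegree_one_sub {k : Type*} [Field k] {n : ℕ} {c : k} (hc : c ≠ 0) :
    (1 - C c * X ^ n : k[X]).natDegree = n := by
  rw [sub_eq_neg_add, ← neg_mul, ← C_neg, ← C_1 (R := k), natDegree_add_C,
    natDegree_C_mul_X_pow _ _ (neg_ne_zero.2 hc)]

/-- Counting the simple roots with reduction in a given set. -/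
theorem ncard_roots_of_residue {O : ValuationSubring ℂ} {n : ℕ} {c : Rf O} (hc : c ≠ 0)
    (hn : (n : Rf O) ≠ 0) {Q : O[X]} (hd : Q.natDegree ≤ 2 * n)
    (hQ : Q.map (residue O) = (1 - C c * X ^ n) ^ 2) (S : Set (Rf O))
    (hS : ∀ z : O, (Q.map (algebraMap O ℂ)).eval (z : ℂ) = 0 → residue O z ∈ S →
      ¬ (X - C (z : ℂ)) ^ 2 ∣ Q.map (algebraMap O ℂ)) :
    {z : ℂ | (Q.map (algebraMap O ℂ)).eval z = 0 ∧ ∃ z' : O, (z' : ℂ) = z ∧ residue O z' ∈ S}.ncard =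
      2 * {r | c * r ^ n = 1 ∧ r ∈ S}.ncard ∧
    {z : ℂ | (Q.map (algebraMap O ℂ)).eval z = 0 ∧ ∃ z' : O, (z' : ℂ) = z ∧
      residue O z' ∈ S}.Finite ∧
    ∀ z : ℂ, (Q.map (algebraMap O ℂ)).eval z = 0 → ∃ z' : O, (z' : ℂ) = z := by
  classical
  have hn0 : n ≠ 0 := fun h => hn (by simp [h])
  have hd1 : (Q.map (residue O)).natDegree = 2 * n := by
    rw [hQ, natDegree_pow, natDegree_one_sub hc]
  have hd2 : Q.natDegree = 2 * n := le_antisymm hd (hd1 ▸ natDegree_map_le)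
  have hlc : residue O Q.leadingCoeff ≠ 0 := by
    rw [leadingCoeff, hd2, ← hd1, ← coeff_map, coeff_natDegree]
    rw [Ne, leadingCoeff_eq_zero, hQ]
    intro h
    have := natDegree_one_sub (k := Rf O) (n := n) hc
    rw [pow_eq_zero_iff two_ne_zero] at h
    rw [h, natDegree_zero] at this
    exact hn0 this.symm
  have hu : IsUnit Q.leadingCoeff := (residue_ne_zero_iff_isUnit _).1 hlc
  have hinj : Function.Injective (algebraMap O ℂ) := Subtype.val_injective
  set Qc := Q.map (algebraMap O ℂ) with hQc
  have hQ0 : Q ≠ 0 := fun h => hlc (by simp [h])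
  have hQc0 : Qc ≠ 0 := (Polynomial.map_ne_zero_iff hinj).2 hQ0
  have hmem : ∀ z ∈ Qc.roots, ∃ z' : O, algebraMap O ℂ z' = z := by
    intro z hz
    have h1 : aeval z Q = 0 := by
      rw [mem_roots hQc0, IsRoot, hQc, eval_map_algebraMap] at hz
      exact hz
    refine (IsIntegrallyClosed.isIntegral_iff (R := O) (K := ℂ)).1 ?_
    obtain ⟨v, hv⟩ := hu.exists_left_inv
    refine ⟨C v * Q, ?_, ?_⟩
    · rw [Monic, leadingCoeff_mul, leadingCoeff_C, hv]
    · rw [← aeval_def, map_mul, h1, mul_zero]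
  obtain ⟨M, hM⟩ : ∃ M : Multiset O, M.map (algebraMap O ℂ) = Qc.roots := by
    have : ∀ s : Multiset ℂ, (∀ z ∈ s, ∃ z' : O, algebraMap O ℂ z' = z) →
        ∃ M : Multiset O, M.map (algebraMap O ℂ) = s := by
      intro s
      induction s using Multiset.induction with
      | empty => exact fun _ => ⟨0, rfl⟩
      | cons a s ih =>
        intro h
        obtain ⟨M, hM⟩ := ih fun z hz => h z (Multiset.mem_cons_of_mem hz)
        obtain ⟨a', ha⟩ := h a (Multiset.mem_cons_self a s)
        exact ⟨a' ::ₘ M, by rw [Multiset.map_cons, hM, ha]⟩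
    exact this _ hmem
  have hfac : Q = C Q.leadingCoeff * (M.map fun a => X - C a).prod := by
    refine Polynomial.map_injective _ hinj ?_
    have h1 := (IsAlgClosed.splits Qc).eq_prod_roots
    rw [← hM] at h1
    rw [← hQc, h1, Polynomial.map_mul, map_C, hQc, leadingCoeff_map_of_injective hinj,
      Polynomial.map_multiset_prod, Multiset.map_map, Multiset.map_map]
    congr 3
    ext a
    simp
  have hres : M.map (residue O) = 2 • (1 - C c * X ^ n : (Rf O)[X]).roots := by
    rw [← roots_pow, ← hQ, hfac, Polynomial.map_mul, map_C, roots_C_mul _ hlc,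
      Polynomial.map_multiset_prod, Multiset.map_map]
    have : (Polynomial.map (residue O) ∘ fun a : O => X - C a) =
        (fun b : Rf O => X - C b) ∘ residue O := by
      ext a
      simp
    rw [this, ← Multiset.map_map, roots_multiset_prod_X_sub_C]
  have hnd : (M.filter (residue O · ∈ S)).Nodup := by
    rw [Multiset.nodup_iff_count_le_one]
    intro a
    by_contra! h
    have ha := Multiset.mem_filter.1 (Multiset.count_pos.1 (Nat.lt_of_lt_of_le zero_lt_one h.le))
    have h1 : 2 ≤ Multiset.count a M := le_trans h (Multiset.count_le_of_le _ (Multiset.filter_le _ _))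
    have h2 : a.1 ∈ Qc.roots := by
      rw [← hM]
      exact Multiset.mem_map_of_mem (algebraMap O ℂ) ha.1
    refine hS a ((mem_roots hQc0).1 h2) ha.2 ?_
    rw [← le_rootMultiplicity_iff hQc0, ← count_roots, ← hM]
    refine h1.trans (le_of_eq ?_)
    exact (Multiset.count_map_eq_count' (algebraMap O ℂ) M hinj a).symm
  have hset : {z : ℂ | Qc.eval z = 0 ∧ ∃ z' : O, (z' : ℂ) = z ∧ residue O z' ∈ S} =
      ((M.filter (residue O · ∈ S)).toFinset.image (algebraMap O ℂ) : Finset ℂ) := by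
    ext z
    simp only [Set.mem_ofPred_eq, Finset.coe_image, Multiset.mem_toFinset, Set.mem_image,
      Finset.mem_coe, Multiset.mem_filter]
    constructor
    · rintro ⟨h1, z', rfl, h2⟩
      refine ⟨z', ⟨?_, h2⟩, rfl⟩
      have h3 : (z' : ℂ) ∈ M.map (algebraMap O ℂ) := hM ▸ (mem_roots hQc0).2 h1
      obtain ⟨w, hw, hwz⟩ := Multiset.mem_map.1 h3
      exact hinj hwz ▸ hw
    · rintro ⟨z', ⟨h1, h2⟩, rfl⟩
      refine ⟨(mem_roots hQc0).1 ?_, z', rfl, h2⟩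
      rw [← hM]
      exact Multiset.mem_map_of_mem _ h1
  rw [hset]
  refine ⟨?_, Finset.finite_toSet _, fun z hz => hmem z ((mem_roots hQc0).2 hz)⟩
  have h1 : (1 - C c * X ^ n : (Rf O)[X]) ≠ 0 := by
    intro h
    have := natDegree_one_sub (k := Rf O) (n := n) hc
    rw [h, natDegree_zero] at this
    exact hn0 this.symm
  have hset2 : {r | c * r ^ n = 1 ∧ r ∈ S} =
      (((1 - C c * X ^ n : (Rf O)[X]).roots.filter (· ∈ S)).toFinset : Set (Rf O)) := by
    ext r
    simp only [Set.mem_ofPred_eq, Multiset.toFinset_filter, Finset.coe_filter, Multiset.mem_toFinset,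
      mem_roots h1, IsRoot, eval_sub, eval_mul, eval_pow, eval_C, eval_X, eval_one]
    rw [sub_eq_zero, eq_comm]
  rw [hset2, Set.ncard_coe_finset, Set.ncard_coe_finset, Finset.card_image_of_injective _ hinj,
    Multiset.toFinset_card_of_nodup hnd,
    Multiset.toFinset_card_of_nodup ((nodup_roots_one_sub hn hc).filter _)]
  have h2 := congrArg (fun s => (s.filter (· ∈ S)).card) hres
  simp only [Multiset.filter_map, Multiset.card_map, Multiset.filter_nsmul, Multiset.card_nsmul] at h2
  exact h2

variable {N : ℕ} [hN : Fact (N = 2 ∨ N = 3)] {p : ℕ} [hp : Fact p.Prime]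

variable (N) in
/-- The values of the Hauptmodul at the roots of forms are twice as many as the singular values. -/
theorem ncard_formValues (h5 : 5 ≤ p) (O : ValuationSubring ℂ) [hO : Fact ((p : ℂ) ∈ O.nonunits)] :
    (formValues N p).ncard = 2 * (singularSet N p O).ncard ∧ (formValues N p).Finite := by
  obtain ⟨Q, hQ1, hQ2, hQ3⟩ := exists_dual_poly N p O h5
  have hprod : ∀ τ, ∏ i, dualFactor N (p := p) i τ = (Q.map (algebraMap O ℂ)).eval (xF N τ) := by
    intro τ
    rw [← hQ2]
    exact prod_option_fin p _ (fun b => 1 - (kap N : ℂ) ^ 2 * xF N τ * xF N (low p b τ)) _ rfl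
      fun b => rfl
  have := charP_residue O p
  have hk : (kap N : Rf O) ≠ 0 := by
    rw [Ne, CharP.cast_eq_zero_iff (Rf O) p]
    exact not_dvd_kap h5
  have hn : ((p + 1 : ℕ) : Rf O) ≠ 0 := by simp
  have hroot : ∀ z : O, (Q.map (algebraMap O ℂ)).eval (z : ℂ) = 0 → residue O z ≠ 0 := by
    intro z hz h0
    have h1 : Q.eval z = 0 := Subtype.val_injective ((eval_map_apply (algebraMap O ℂ) z).symm.trans hz)
    have h2 := congrArg (residue O) h1
    rw [← eval_map_apply, hQ3, h0] at h2
    simp at h2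
  have key := ncard_roots_of_residue (pow_ne_zero 2 hk) hn hQ1 hQ3
    {r | (fK N p O).eval r = 0} (by
      intro z hz hs
      have hzu := hroot z hz
      have hz0 : (z : ℂ) ≠ 0 := fun h => hzu (by
        have : z = 0 := Subtype.val_injective h
        rw [this, map_zero])
      obtain ⟨τ, hτ⟩ := exists_xF_eq (N := N) hz0
      rw [← hτ, ← hprod] at hz
      obtain ⟨i, -, hi⟩ := Finset.prod_eq_zero_iff.1 hz
      obtain ⟨lam, hl, hD, α, β, γ, hf, hfi⟩ := isForm_of_singular h5 hτ.symm hzu hs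
        (dualFactor_eq_zero_iff.1 hi)
      rw [← hτ]
      refine not_sq_dvd_of_unique hprod hi (fun j hj => ?_) hl hD (EF_ne_zero_of_isForm h5 hf)
      obtain ⟨-, -, -, α', β', γ', hf', hfj⟩ := isForm_of_singular h5 hτ.symm hzu hs
        (dualFactor_eq_zero_iff.1 hj)
      exact formIndex_unique h5 hf' hfj hf hfi)
  have hset : formValues N p = {z : ℂ | (Q.map (algebraMap O ℂ)).eval z = 0 ∧
      ∃ z' : O, (z' : ℂ) = z ∧ residue O z' ∈ {r | (fK N p O).eval r = 0}} := by
    ext z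
    constructor
    · rintro ⟨τ, α, β, γ, h, rfl⟩
      obtain ⟨i, hi, hi2, -⟩ := exists_formIndex h5 h
      have h1 : (Q.map (algebraMap O ℂ)).eval (xF N τ) = 0 := by
        rw [← hprod]
        exact Finset.prod_eq_zero (Finset.mem_univ i) (dualFactor_eq_zero_iff.2 hi2)
      obtain ⟨z, hz⟩ := key.2.2 _ h1
      exact ⟨h1, z, hz, singular_of_isForm h5 hz h (hroot z (by rw [hz, h1]))⟩
    · rintro ⟨hz, z, rfl, hs⟩
      have hzu := hroot z hz
      have hz0 : (z : ℂ) ≠ 0 := fun h => hzu (by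
        have : z = 0 := Subtype.val_injective h
        rw [this, map_zero])
      obtain ⟨τ, hτ⟩ := exists_xF_eq (N := N) hz0
      rw [← hτ, ← hprod] at hz
      obtain ⟨i, -, hi⟩ := Finset.prod_eq_zero_iff.1 hz
      obtain ⟨lam, hl, hD, α, β, γ, hf, hfi⟩ := isForm_of_singular h5 hτ.symm hzu hs
        (dualFactor_eq_zero_iff.1 hi)
      exact ⟨τ, α, β, γ, hf, hτ⟩
  rw [hset]
  exact ⟨key.1, key.2.1⟩

end RootCount

section LegendreIdentity

theorem sum_choose_mul_choose_add {j m : ℕ} (h : j ≤ m) :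
    ∑ n ∈ Finset.range (j + 1), (-1 : ℤ) ^ (j - n) * j.choose n * (m + n).choose m = m.choose j := by
  have h1 := fwdDiff_iter_eq_sum_shift 1 (fun x : ℕ ↦ (x.choose (j + (m - j)) : ℤ)) j m
  rw [fwdDiff_iter_choose] at h1
  dsimp only at h1
  rw [Nat.choose_symm h] at h1
  rw [h1]
  refine Finset.sum_congr rfl fun n _ => ?_
  simp [Nat.add_sub_cancel' h]

theorem sum_choose_mul_one_sub_pow {R : Type*} [CommRing R] (m : ℕ) (v : R) :
    ∑ n ∈ Finset.range (m + 1), (m.choose n * (m + n).choose m : R) * v ^ n * (1 - v) ^ (m - n) =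
      ∑ j ∈ Finset.range (m + 1), (m.choose j : R) ^ 2 * v ^ j := by
  have h1 : ∀ n ∈ Finset.range (m + 1),
      (m.choose n * (m + n).choose m : R) * v ^ n * (1 - v) ^ (m - n) =
      ∑ i ∈ Finset.range (m + 1 - n), (m.choose n * (m + n).choose m : R) * v ^ n *
        ((-v) ^ i * (m - n).choose i) := by
    intro n hn
    rw [sub_eq_neg_add 1 v, add_pow, Finset.mul_sum, Nat.sub_add_comm (by simpa [Nat.lt_succ_iff] using hn)]
    simp
  rw [Finset.sum_congr rfl h1, ← Finset.sum_range_diag_flip (m + 1) fun n i =>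
    (m.choose n * (m + n).choose m : R) * v ^ n * ((-v) ^ i * (m - n).choose i)]
  refine Finset.sum_congr rfl fun j hj => ?_
  have hj' : j ≤ m := by simpa [Nat.lt_succ_iff] using hj
  have h2 := congrArg (Int.cast : ℤ → R) (sum_choose_mul_choose_add hj')
  push_cast at h2
  rw [sq, mul_assoc, mul_comm (m.choose j : R) (v ^ j)]
  nth_rewrite 2 [← h2]
  rw [Finset.mul_sum, Finset.mul_sum]
  refine Finset.sum_congr rfl fun n hn => ?_
  have hn' : n ≤ j := by simpa [Nat.lt_succ_iff] using hn
  have h3 := congrArg (Nat.cast : ℕ → R) (Nat.choose_mul (n := m) hn')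
  push_cast at h3
  have h4 : v ^ j = v ^ n * v ^ (j - n) := by rw [← pow_add, Nat.add_sub_cancel' hn']
  rw [neg_pow, h4]
  linear_combination -((m + n).choose m * v ^ n * v ^ (j - n) * (-1) ^ (j - n)) * h3

end LegendreIdentity

section HatPolynomial

variable {N : ℕ} [hN : Fact (N = 2 ∨ N = 3)] {p : ℕ} [hp : Fact p.Prime]

theorem hA_eq_choose (h5 : 5 ≤ p) {n : ℕ} (hn : n ≤ p / (6 - N)) : (hA N n : ZMod p) =
    (p / (6 - N)).choose n * (p / (6 - N) + n).choose (p / (6 - N)) * (-(kap N : ZMod p)) ^ n := by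
  set m := p / (6 - N) with hm
  have hmp : m < p := Nat.div_lt_self hp.out.pos (by rcases hN.out with h | h <;> omega)
  have hd : (kap N * (m * (m + 1)) + gam N : ZMod p) = 0 := by
    have := (ZMod.natCast_eq_zero_iff _ p).2 (dvd_kap_mul_add N h5)
    push_cast at this
    exact this
  induction n with
  | zero => simp [hA_zero]
  | succ n ih =>
    have h1 := congrArg (Nat.cast : ℕ → ZMod p) (hA_succ N n)
    push_cast at h1
    rw [ih (by omega)] at h1
    have h4 : ((n + 1 : ℕ) : ZMod p) ≠ 0 := by
      rw [Ne, ZMod.natCast_eq_zero_iff]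
      exact Nat.not_dvd_of_pos_of_lt (by omega) (by omega)
    have h2 := congrArg (Nat.cast : ℕ → ZMod p) (Nat.choose_succ_right_eq m n)
    rw [Nat.cast_mul, Nat.cast_mul, Nat.cast_sub (by omega)] at h2
    have h3 := congrArg (Nat.cast : ℕ → ZMod p) (Nat.add_one_mul_choose_eq (m + n) n)
    rw [← Nat.choose_symm_add, Nat.choose_symm_of_eq_add (show m + n + 1 = n + 1 + m by omega)] at h3
    push_cast at h2 h3 h4
    refine mul_left_cancel₀ (pow_ne_zero 2 h4) ?_
    rw [h1, pow_succ, ← add_assoc]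
    linear_combination (m.choose n * (m + n).choose m * (-(kap N : ZMod p)) ^ n : ZMod p) * hd +
      (-(kap N : ZMod p)) ^ n * kap N *
        ((n + 1) * (m + n + 1).choose m * h2 - (m - n) * m.choose n * h3)

/-- The polynomial as a sum of squares of binomial coefficients. -/
theorem hatP_eq (h5 : 5 ≤ p) : hatP (p := p) N = ∑ j ∈ Finset.range (p / (6 - N) + 1),
    C (((p / (6 - N)).choose j : ZMod p) ^ 2 * (-(kap N : ZMod p)) ^ j) * X ^ j := by
  have h1 := sum_choose_mul_one_sub_pow (p / (6 - N)) (-((kap N : (ZMod p)[X]) * X))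
  rw [hatP]
  refine Eq.trans (Finset.sum_congr rfl fun n hn => ?_) (h1.trans (Finset.sum_congr rfl fun j _ => ?_))
  · rw [hA_eq_choose h5 (by simpa [Nat.lt_succ_iff] using hn), sub_neg_eq_add]
    simp only [map_mul, map_pow, map_natCast, map_neg]
    ring
  · simp only [map_mul, map_pow, map_natCast, map_neg]
    ring

end HatPolynomial

section LegendreRoots

variable {p : ℕ} [hp : Fact p.Prime] {k : Type*} [Field k] (φ : ZMod p →+* k)

theorem eval_legendreP (m : ℕ) (y : k) : (legendreP p m).eval₂ φ y = φ (2⁻¹) ^ m *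
    ∑ j ∈ Finset.range (m + 1), (m.choose j : k) ^ 2 * (y - 1) ^ (m - j) * (y + 1) ^ j := by
  simp [legendreP, eval₂_finsetSum, eval₂_mul, eval₂_pow]

theorem eval_legendreP_neg (m : ℕ) (y : k) :
    (legendreP p m).eval₂ φ (-y) = (-1) ^ m * (legendreP p m).eval₂ φ y := by
  rw [eval_legendreP, eval_legendreP, ← mul_assoc, mul_comm ((-1) ^ m), mul_assoc,
    Finset.mul_sum _ _ ((-1) ^ m)]
  rw [← Finset.sum_range_reflect (fun j => (m.choose j : k) ^ 2 * (-y - 1) ^ (m - j) * (-y + 1) ^ j)]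
  congr 1
  refine Finset.sum_congr rfl fun j hj => ?_
  have hj' : j ≤ m := by simpa [Nat.lt_succ_iff] using hj
  have h1 : m + 1 - 1 - j = m - j := by omega
  have h2 : m - (m - j) = j := by omega
  have h3 : (-1 : k) ^ m = (-1) ^ j * (-1) ^ (m - j) := by rw [← pow_add, Nat.add_sub_cancel' hj']
  rw [h1, h2, Nat.choose_symm hj', (by ring : -y - 1 = -(y + 1)), (by ring : -y + 1 = -(y - 1)),
    neg_pow, neg_pow (y - 1), h3]
  ring

theorem sum_neg_one_pow_mul_choose_sq (l : ℕ) :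
    ∑ j ∈ Finset.range (2 * l + 1), (-1 : ℤ) ^ (2 * l - j) * ((2 * l).choose j : ℤ) ^ 2 =
      (-1) ^ l * (2 * l).choose l := by
  have h1 : ((1 + X) ^ (2 * l) * (1 - X) ^ (2 * l) : ℤ[X]) = (1 - X ^ 2) ^ (2 * l) := by
    rw [← mul_pow]
    ring
  have h2 : ∀ n : ℕ, ((1 - X) ^ n : ℤ[X]) = ((1 + X) ^ n).comp (C (-1) * X) := fun n => by
    simp [pow_comp, sub_eq_add_neg]
  have h3 := congrArg (fun q : ℤ[X] => q.coeff (2 * l)) h1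
  rw [h2, coeff_mul, Finset.Nat.sum_antidiagonal_eq_sum_range_succ_mk] at h3
  have h4 : (1 - X ^ 2 : ℤ[X]) ^ (2 * l) = expand ℤ 2 ((1 - X) ^ (2 * l)) := by simp
  rw [h4, coeff_expand two_pos, if_pos (dvd_mul_right 2 l), Nat.mul_div_cancel_left _ two_pos, h2,
    comp_C_mul_X_coeff, coeff_one_add_X_pow] at h3
  rw [mul_comm ((-1 : ℤ) ^ l), ← h3]
  refine Finset.sum_congr rfl fun j hj => ?_
  rw [comp_C_mul_X_coeff, coeff_one_add_X_pow, coeff_one_add_X_pow,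
    Nat.choose_symm (by simpa [Nat.lt_succ_iff] using hj)]
  ring

theorem natCast_ne_zero_of_not_dvd (φ : ZMod p →+* k) {n : ℕ} (h : ¬ p ∣ n) : (n : k) ≠ 0 := by
  rw [← map_natCast φ, Ne, map_eq_zero, ZMod.natCast_eq_zero_iff]
  exact h

theorem eval_legendreP_zero (h2 : p ≠ 2) {m : ℕ} (hm : m < p) :
    (legendreP p m).eval₂ φ 0 = 0 ↔ m % 2 = 1 := by
  have h20 : (2 : k) ≠ 0 := by
    have := natCast_ne_zero_of_not_dvd φ (n := 2) fun h =>
      h2 ((Nat.prime_dvd_prime_iff_eq hp.out Nat.prime_two).1 h)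
    exact_mod_cast this
  constructor
  · intro h
    by_contra hm2
    obtain ⟨l, rfl⟩ : ∃ l, m = 2 * l := ⟨m / 2, by omega⟩
    rw [eval_legendreP] at h
    have h3 := congrArg (Int.cast : ℤ → k) (sum_neg_one_pow_mul_choose_sq l)
    push_cast at h3
    have h4 : ∑ j ∈ Finset.range (2 * l + 1), (((2 * l).choose j : k) ^ 2 * (0 - 1) ^ (2 * l - j) *
        (0 + 1) ^ j : k) = (-1) ^ l * (2 * l).choose l := by
      rw [← h3]
      refine Finset.sum_congr rfl fun j _ => ?_
      rw [zero_add, one_pow, zero_sub]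
      ring
    rw [h4] at h
    refine mul_ne_zero (pow_ne_zero _ ?_) (mul_ne_zero (pow_ne_zero _ (neg_ne_zero.2 one_ne_zero))
      (natCast_ne_zero_of_not_dvd φ ?_)) h
    · rw [map_inv₀, map_ofNat]
      exact inv_ne_zero h20
    · intro hd
      have h5 := (Nat.choose_mul_factorial_mul_factorial (show l ≤ 2 * l by omega))
      have h6 : p ∣ (2 * l).factorial := by
        rw [← h5, mul_assoc]
        exact hd.mul_right _
      have := (hp.out.dvd_factorial).1 h6
      omega
  · intro h
    have h1 := eval_legendreP_neg φ m 0
    rw [Odd.neg_one_pow (Nat.odd_iff.2 h), neg_zero] at h1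
    have h3 : 2 * (legendreP p m).eval₂ φ 0 = 0 := by linear_combination h1
    exact (mul_eq_zero.1 h3).resolve_left h20

theorem exists_map_eq_of_pow_eq {y : k} (h : y ^ p = y) : ∃ a, φ a = y := by
  classical
  have h0 : (X ^ p - X : k[X]) ≠ 0 := FiniteField.X_pow_card_sub_X_ne_zero k hp.out.one_lt
  have h1 : Finset.univ.image φ = (X ^ p - X : k[X]).roots.toFinset := by
    refine Finset.eq_of_subset_of_card_le (fun z hz => ?_) ?_
    · obtain ⟨a, -, rfl⟩ := Finset.mem_image.1 hz
      simp [h0, ← map_pow]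
    · rw [Finset.card_image_of_injective _ φ.injective, Finset.card_univ, ZMod.card]
      refine (Multiset.toFinset_card_le _).trans ((card_roots' _).trans ?_)
      exact (FiniteField.X_pow_card_sub_X_natDegree_eq k hp.out.one_lt).le
  have h2 : y ∈ (X ^ p - X : k[X]).roots.toFinset := by simp [h0, h]
  rw [← h1] at h2
  obtain ⟨a, -, h3⟩ := Finset.mem_image.1 h2
  exact ⟨a, h3⟩

theorem pow_char_eq {y : k} (h2 : p ≠ 2) {d : ZMod p} (h : y ^ 2 = φ d) :
    y ^ p = y * φ (d ^ (p / 2)) := by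
  have h1 : p = 2 * (p / 2) + 1 := by
    have := hp.out.eq_two_or_odd.resolve_left h2
    omega
  nth_rewrite 1 [h1]
  rw [pow_succ, pow_mul, h, map_pow, mul_comm]

theorem dvd_legendreP_iff {c : ZMod p} (hc : ¬ IsSquare (-c)) {y : k} (h : y ^ 2 = φ (-c)) (m : ℕ) :
    X ^ 2 + C c ∣ legendreP p m ↔ (legendreP p m).eval₂ φ y = 0 := by
  have h0 : (X ^ 2 + C c : (ZMod p)[X]).eval₂ φ y = 0 := by
    simp [h]
  have hi : Irreducible (X ^ 2 + C c : (ZMod p)[X]) := by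
    have := X_pow_sub_C_irreducible_of_prime Nat.prime_two (a := -c) fun b hb =>
      hc ⟨b, by rw [← hb, sq]⟩
    simpa using this
  constructor
  · rintro ⟨q, hq⟩
    rw [hq, eval₂_mul, h0, zero_mul]
  · intro h1
    by_contra hd
    obtain ⟨a, b, hab⟩ := (hi.coprime_iff_not_dvd).2 hd
    have := congrArg (eval₂ φ y) hab
    rw [eval₂_add, eval₂_mul, eval₂_mul, h0, h1, mul_zero, mul_zero, add_zero, eval₂_one] at this
    exact zero_ne_one this

theorem ncard_roots_legendreP [IsAlgClosed k] (h2 : p ≠ 2) {m : ℕ} (hm : m < p) :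
    {y : k | y ^ p = -y ∧ (legendreP p m).eval₂ φ y = 0}.Finite ∧
    {y : k | y ^ p = -y ∧ (legendreP p m).eval₂ φ y = 0}.ncard = 2 * BB p m + m % 2 := by
  classical
  have h20 : (2 : k) ≠ 0 := by
    have := natCast_ne_zero_of_not_dvd φ (n := 2) fun h =>
      h2 ((Nat.prime_dvd_prime_iff_eq hp.out Nat.prime_two).1 h)
    exact_mod_cast this
  have hodd : p % 2 = 1 := hp.out.eq_two_or_odd.resolve_left h2
  set Y : Set k := {y : k | y ^ p = -y ∧ (legendreP p m).eval₂ φ y = 0} with hY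
  have hne : (X ^ p + X : k[X]) ≠ 0 := by
    intro h
    have := congrArg (eval 1) h
    simp only [eval_add, eval_pow, eval_X, one_pow, eval_zero] at this
    exact h20 (by linear_combination this)
  have hfin : Y.Finite := by
    refine ((X ^ p + X : k[X]).roots.toFinset.finite_toSet).subset fun y hy => ?_
    simp [hne, hy.1]
  set F : Finset k := hfin.toFinset.erase 0 with hF
  set T : Finset (ZMod p) := Finset.univ.filter fun c => ¬ IsSquare (-c) ∧ X ^ 2 + C c ∣ legendreP p m
  have hT : BB p m = T.card := by
    rw [BB, Nat.card_eq_fintype_card, Fintype.card_subtype]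
  have hφ : Function.Injective φ := φ.injective
  have hmemF : ∀ y, y ∈ F ↔ y ≠ 0 ∧ y ^ p = -y ∧ (legendreP p m).eval₂ φ y = 0 := by
    intro y
    rw [hF, Finset.mem_erase, Set.Finite.mem_toFinset]
    rfl
  have hex : ∀ y ∈ F, ∃ c ∈ T, φ c = -y ^ 2 := by
    intro y hy
    obtain ⟨h0, h1, h3⟩ := (hmemF y).1 hy
    obtain ⟨c, hc⟩ := exists_map_eq_of_pow_eq φ (y := -y ^ 2) (by
      rw [Odd.neg_pow (Nat.odd_iff.2 hodd), ← pow_mul, mul_comm, pow_mul, h1]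
      ring)
    have hyc : y ^ 2 = φ (-c) := by rw [map_neg, hc, neg_neg]
    have hns : ¬ IsSquare (-c) := by
      rintro ⟨b, hb⟩
      rw [hb, map_mul, ← sq] at hyc
      have hb2 : y ^ p = y := by
        rcases sq_eq_sq_iff_eq_or_eq_neg.1 hyc with h | h
        · rw [h, ← map_pow, ZMod.pow_card]
        · rw [h, Odd.neg_pow (Nat.odd_iff.2 hodd), ← map_pow, ZMod.pow_card]
      refine mul_ne_zero h20 h0 ?_
      linear_combination h1 - hb2
    exact ⟨c, Finset.mem_filter.2 ⟨Finset.mem_univ c, hns, (dvd_legendreP_iff φ hns hyc m).2 h3⟩, hc⟩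
  let g : k → ZMod p := fun y => Function.invFun φ (-y ^ 2)
  have hg : ∀ y c, φ c = -y ^ 2 → g y = c := fun y c h => by
    change Function.invFun φ (-y ^ 2) = c
    rw [← h]
    exact Function.leftInverse_invFun hφ c
  have hcard : F.card = 2 * T.card := by
    rw [Finset.card_eq_sum_card_fiberwise (f := g) (t := T)]
    · rw [Finset.sum_const_nat (m := 2), mul_comm]
      intro c hc
      obtain ⟨-, hns, hd⟩ := Finset.mem_filter.1 hc
      obtain ⟨y, hy⟩ := IsAlgClosed.exists_pow_nat_eq (φ (-c)) two_pos
      have hc0 : -c ≠ 0 := fun h => hns (h ▸ IsSquare.zero)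
      have hy0 : y ≠ 0 := by
        rintro rfl
        rw [zero_pow two_ne_zero] at hy
        exact hc0 ((map_eq_zero φ).1 hy.symm)
      have hyp : ∀ z, z ^ 2 = φ (-c) → z ∈ F ∧ g z = c := by
        intro z hz
        have hz0 : z ≠ 0 := by
          rintro rfl
          rw [zero_pow two_ne_zero] at hz
          exact hc0 ((map_eq_zero φ).1 hz.symm)
        refine ⟨(hmemF z).2 ⟨hz0, ?_, (dvd_legendreP_iff φ hns hz m).1 hd⟩, hg z c ?_⟩
        · rw [pow_char_eq φ h2 hz, (ZMod.pow_div_two_eq_neg_one_or_one p hc0).resolve_left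
            fun h => hns ((ZMod.euler_criterion p hc0).2 h)]
          simp
        · rw [hz, map_neg, neg_neg]
      have : F.filter (fun z => g z = c) = {y, -y} := by
        ext z
        rw [Finset.mem_filter, Finset.mem_insert, Finset.mem_singleton]
        constructor
        · rintro ⟨hz, hgz⟩
          obtain ⟨c', -, hc'⟩ := hex z hz
          rw [hg z c' hc'] at hgz
          refine sq_eq_sq_iff_eq_or_eq_neg.1 ?_
          rw [hy, ← hgz, map_neg, hc', neg_neg]
        · rintro (rfl | rfl)
          · exact hyp _ hy
          · exact hyp _ (by rw [neg_sq, hy])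
      rw [this, Finset.card_pair]
      intro h
      exact mul_ne_zero h20 hy0 (by linear_combination h)
    · intro y hy
      obtain ⟨c, hc, h⟩ := hex y hy
      rw [hg y c h]
      exact hc
  refine ⟨hfin, ?_⟩
  rw [Set.ncard_eq_toFinset_card Y hfin, hT, ← hcard, hF]
  by_cases h0 : m % 2 = 1
  · have h3 : (0 : k) ∈ hfin.toFinset := by
      rw [Set.Finite.mem_toFinset]
      exact ⟨by rw [zero_pow hp.out.ne_zero, neg_zero], (eval_legendreP_zero φ h2 hm).2 h0⟩
    rw [Finset.card_erase_add_one h3 |>.symm, h0]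
  · have h3 : (0 : k) ∉ hfin.toFinset := by
      rw [Set.Finite.mem_toFinset]
      exact fun h => h0 ((eval_legendreP_zero φ h2 hm).1 h.2)
    rw [Finset.erase_eq_of_notMem h3]
    omega

end LegendreRoots

section SingularSet

open IsLocalRing

variable {N : ℕ} [hN : Fact (N = 2 ∨ N = 3)] {p : ℕ} [hp : Fact p.Prime]

theorem div_lt_self_level (h5 : 5 ≤ p) : 2 * (p / (6 - N)) < p := by
  rcases hN.out with rfl | rfl
  · change 2 * (p / 4) < p
    omega
  · change 2 * (p / 3) < p
    omega

theorem eval_hatP (h5 : 5 ≤ p) {k : Type*} [Field k] (φ : ZMod p →+* k) (r : k) :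
    (hatP (p := p) N).eval₂ φ r = ∑ j ∈ Finset.range (p / (6 - N) + 1),
      ((p / (6 - N)).choose j : k) ^ 2 * (-(kap N * r)) ^ j := by
  rw [hatP_eq h5, eval₂_finsetSum]
  refine Finset.sum_congr rfl fun j _ => ?_
  rw [eval₂_mul, eval₂_C, eval₂_pow, eval₂_X]
  simp only [map_mul, map_pow, map_neg, map_natCast]
  ring

theorem eval_hatP_eq (h5 : 5 ≤ p) {k : Type*} [Field k] (φ : ZMod p →+* k) {r : k}
    (hr : 1 + kap N * r ≠ 0) : (hatP (p := p) N).eval₂ φ r = (1 + kap N * r) ^ (p / (6 - N)) *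
      (legendreP p (p / (6 - N))).eval₂ φ ((1 - kap N * r) / (1 + kap N * r)) := by
  have h20 : (2 : k) ≠ 0 := by
    have := natCast_ne_zero_of_not_dvd φ (n := 2) (Nat.not_dvd_of_pos_of_lt two_pos (by omega))
    exact_mod_cast this
  set m := p / (6 - N)
  rw [eval_hatP h5, eval_legendreP, Finset.mul_sum, Finset.mul_sum]
  rw [← Finset.sum_range_reflect (fun j => (m.choose j : k) ^ 2 * (-(kap N * r)) ^ j)]
  refine Finset.sum_congr rfl fun j hj => ?_
  have hj' : j ≤ m := by simpa [Nat.lt_succ_iff] using hj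
  have h1 : m + 1 - 1 - j = m - j := by omega
  have h3 : (1 - kap N * r) / (1 + kap N * r) - 1 = 2 * (-(kap N * r)) / (1 + kap N * r) := by
    field_simp
    ring
  have h4 : (1 - kap N * r) / (1 + kap N * r) + 1 = 2 / (1 + kap N * r) := by
    field_simp
    ring
  have h6 : ∀ a : k, a ^ m = a ^ (m - j) * a ^ j := fun a => by rw [← pow_add, Nat.sub_add_cancel hj']
  rw [h1, Nat.choose_symm hj', h3, h4, div_pow, div_pow, mul_pow, h6, h6, map_inv₀, map_ofNat, inv_pow, inv_pow]
  field_simp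

theorem eval_hatP_ne_zero (h5 : 5 ≤ p) {k : Type*} [Field k] (φ : ZMod p →+* k) {r : k}
    (hr : 1 + kap N * r = 0) : (hatP (p := p) N).eval₂ φ r ≠ 0 := by
  have h1 : -(kap N * r) = 1 := by linear_combination -hr
  have h2 := congrArg (Nat.cast : ℕ → k) (Nat.sum_range_choose_sq (p / (6 - N)))
  push_cast at h2
  rw [eval_hatP h5, h1]
  simp only [one_pow, mul_one]
  rw [h2]
  refine natCast_ne_zero_of_not_dvd φ fun hd => ?_
  have h6 : p ∣ (2 * (p / (6 - N))).factorial := by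
    rw [← Nat.choose_mul_factorial_mul_factorial (show p / (6 - N) ≤ 2 * (p / (6 - N)) by omega),
      mul_assoc]
    exact hd.mul_right _
  have := (hp.out.dvd_factorial).1 h6
  have := div_lt_self_level (N := N) h5
  omega

variable (N) in
theorem ncard_singularSet (h5 : 5 ≤ p) (O : ValuationSubring ℂ)
    [hO : Fact ((p : ℂ) ∈ O.nonunits)] : (singularSet N p O).ncard =
      2 * BB p (p / (6 - N)) + p / (6 - N) % 2 + (if eE N p = 0 then 0 else 1) := by
  classical
  have := charP_residue O p
  have hodd : p % 2 = 1 := (mod_four_or h5).1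
  set m := p / (6 - N) with hm
  have hmp := div_lt_self_level (N := N) h5
  set K : Rf O := ((kap N : ℕ) : Rf O) with hK
  have hK0 : K ≠ 0 := by
    rw [hK, Ne, CharP.cast_eq_zero_iff (Rf O) p]
    exact not_dvd_kap h5
  have h20 : (2 : Rf O) ≠ 0 := by
    have := natCast_ne_zero_of_not_dvd (kz O p) (n := 2)
      (Nat.not_dvd_of_pos_of_lt two_pos (by omega))
    exact_mod_cast this
  have hKp : K ^ p = K := by
    rw [hK, ← map_natCast (kz O p), ← map_pow, ZMod.pow_card]
  have hf : ∀ r, (fK N p O).eval r = (hatP (p := p) N).eval₂ (kz O p) r ^ (2 * N) *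
      (1 + K * r) ^ eE N p := by
    intro r
    rw [fK, fPol, eval_map]
    simp [eval₂_mul, eval₂_pow, hK]
  have hN0 : 2 * N ≠ 0 := by rcases hN.out with h | h <;> omega
  set Y : Set (Rf O) := {y | y ^ p = -y ∧ (legendreP p m).eval₂ (kz O p) y = 0} with hY
  obtain ⟨hfin, hYn⟩ := ncard_roots_legendreP (kz O p) (by omega) (show m < p by omega)
  have hfrob : ∀ a b : Rf O, (a + b) ^ p = a ^ p + b ^ p := fun a b => add_pow_char a b p
  have hY1 : ∀ y ∈ Y, 1 + y ≠ 0 := by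
    rintro y ⟨h1, -⟩ h
    have : y = -1 := by linear_combination h
    rw [this, Odd.neg_one_pow (Nat.odd_iff.2 hodd)] at h1
    exact h20 (by linear_combination -h1)
  let ψ : Rf O → Rf O := fun y => (1 - y) / (K * (1 + y))
  have hψ1 : ∀ y, 1 + y ≠ 0 → 1 + K * ψ y = 2 / (1 + y) := by
    intro y hy
    change 1 + K * ((1 - y) / (K * (1 + y))) = _
    field_simp
    ring
  have hψ2 : ∀ y, 1 + y ≠ 0 → (1 - K * ψ y) / (1 + K * ψ y) = y := by
    intro y hy
    rw [hψ1 y hy]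
    change (1 - K * ((1 - y) / (K * (1 + y)))) / _ = _
    field_simp
    ring
  have hrel : ∀ r, 1 + K * r ≠ 0 → (K ^ 2 * r ^ (p + 1) = 1 ↔
      ((1 - K * r) / (1 + K * r)) ^ p = -((1 - K * r) / (1 + K * r))) := by
    intro r hr
    have h3 : (1 + K * r) ^ p = 1 + K * r ^ p := by rw [hfrob, one_pow, mul_pow, hKp]
    have h4 : (1 - K * r) ^ p = 1 - K * r ^ p := by
      rw [sub_eq_add_neg, hfrob, one_pow, Odd.neg_pow (Nat.odd_iff.2 hodd), mul_pow, hKp]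
      ring
    have h6 : 1 + K * r ^ p ≠ 0 := h3 ▸ pow_ne_zero p hr
    rw [div_pow, h3, h4, ← neg_div, div_eq_div_iff h6 hr, pow_succ]
    constructor
    · intro h
      linear_combination (-2) * h
    · intro h
      refine mul_left_cancel₀ h20 ?_
      linear_combination -h
  have hunion : singularSet N p O = ψ '' Y ∪ (if eE N p = 0 then ∅ else {-K⁻¹}) := by
    ext r
    rw [Set.mem_union]
    change (K ^ 2 * r ^ (p + 1) = 1 ∧ (fK N p O).eval r = 0) ↔ _
    rw [hf]
    by_cases hr : 1 + K * r = 0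
    · have hr' : r = -K⁻¹ := by
        field_simp
        linear_combination hr
      have h1 : r ∉ ψ '' Y := by
        rintro ⟨y, hy, rfl⟩
        rw [hψ1 y (hY1 y hy)] at hr
        exact div_ne_zero h20 (hY1 y hy) hr
      have h3 : K ^ 2 * r ^ (p + 1) = 1 := by
        rw [hr', Even.neg_pow (Nat.even_iff.2 (by omega)), inv_pow, pow_succ K p, hKp]
        field_simp
      have h4 := eval_hatP_ne_zero h5 (kz O p) hr
      split_ifs with h
      · simp [h, h1, h4, h3]
      · refine iff_of_true ⟨h3, ?_⟩ (Or.inr hr')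
        rw [hr, zero_pow h, mul_zero]
    · have h2 : r ∉ (if eE N p = 0 then ∅ else {-K⁻¹} : Set (Rf O)) := by
        split_ifs
        · exact Set.notMem_empty r
        · rintro rfl
          refine hr ?_
          field_simp
          ring
      have h3 := eval_hatP_eq h5 (kz O p) hr
      rw [hrel r hr, mul_eq_zero, or_iff_left (pow_ne_zero _ hr), pow_eq_zero_iff hN0, h3,
        mul_eq_zero, or_iff_right (pow_ne_zero _ hr), or_iff_left h2]
      constructor
      · intro h
        refine ⟨_, h, ?_⟩
        change (1 - (1 - K * r) / (1 + K * r)) / (K * (1 + (1 - K * r) / (1 + K * r))) = r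
        have : 1 + K * r + (1 - K * r) ≠ 0 := by
          intro h
          exact h20 (by linear_combination h)
        field_simp
        ring
      · rintro ⟨y, hy, rfl⟩
        rw [hψ2 y (hY1 y hy)]
        exact hy
  have hinj : Set.InjOn ψ Y := by
    intro y hy y' hy' h
    rw [← hψ2 y (hY1 y hy), h, hψ2 y' (hY1 y' hy')]
  rw [hunion, ← hYn, ← hY, ← hinj.ncard_image]
  split_ifs with h
  · simp
  · rw [Set.ncard_union_eq _ (hfin.image ψ) (Set.finite_singleton _), Set.ncard_singleton]
    rw [Set.disjoint_singleton_right]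
    rintro ⟨y, hy, h1⟩
    have h2 := hψ1 y (hY1 y hy)
    rw [h1] at h2
    refine div_ne_zero h20 (hY1 y hy) (h2.symm.trans ?_)
    field_simp
    ring

end SingularSet

section Lattices

open UpperHalfPlane

/-- The lattice `ℤτ + ℤ`. -/
def lattice (τ : ℍ) : Set ℂ := {z | ∃ m n : ℤ, z = m * τ + n}

/-- Equality up to a nonzero complex factor. -/
def Homothetic (L M : Set ℂ) : Prop := ∃ c : ℂ, c ≠ 0 ∧ ∀ z, z ∈ L ↔ c * z ∈ M

theorem Homothetic.symm {L M : Set ℂ} (h : Homothetic L M) : Homothetic M L := by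
  obtain ⟨c, hc, h⟩ := h
  refine ⟨c⁻¹, inv_ne_zero hc, fun z => ?_⟩
  rw [h, mul_inv_cancel_left₀ hc]

theorem Homothetic.trans {L M P : Set ℂ} (h : Homothetic L M) (h' : Homothetic M P) :
    Homothetic L P := by
  obtain ⟨c, hc, h⟩ := h
  obtain ⟨c', hc', h'⟩ := h'
  refine ⟨c' * c, mul_ne_zero hc' hc, fun z => ?_⟩
  rw [h, h', mul_assoc]

theorem lattice.add_mem {τ : ℍ} {z z' : ℂ} (h : z ∈ lattice τ) (h' : z' ∈ lattice τ) :
    z + z' ∈ lattice τ := by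
  obtain ⟨m, n, rfl⟩ := h
  obtain ⟨m', n', rfl⟩ := h'
  exact ⟨m + m', n + n', by push_cast; ring⟩

theorem lattice.mul_mem (k : ℤ) {τ : ℍ} {z : ℂ} (h : z ∈ lattice τ) : (k : ℂ) * z ∈ lattice τ := by
  obtain ⟨m, n, rfl⟩ := h
  exact ⟨k * m, k * n, by push_cast; ring⟩

theorem lattice.one_mem (τ : ℍ) : (1 : ℂ) ∈ lattice τ := ⟨0, 1, by simp⟩

theorem lattice.self_mem (τ : ℍ) : (τ : ℂ) ∈ lattice τ := ⟨1, 0, by simp⟩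

theorem lattice.ext_iff {τ : ℍ} {m n m' n' : ℤ} : (m * τ + n : ℂ) = m' * τ + n' ↔ m = m' ∧ n = n' := by
  refine ⟨fun h => ?_, fun h => by rw [h.1, h.2]⟩
  obtain ⟨h1, h2⟩ := linear_eq_zero (A := m - m') (B := n - n') (τ := τ) (by
    push_cast
    linear_combination h)
  exact ⟨by linarith, by linarith⟩

theorem homothetic_of_mob {a b c d : ℤ} (h : a * d - b * c = 1) {τ σ : ℍ} (hm : Mob a b c d τ σ) :
    Homothetic (lattice σ) (lattice τ) := by
  refine ⟨c * τ + d, Mob.ne_zero (by rw [h]; exact one_ne_zero) τ, fun z => ?_⟩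
  unfold Mob at hm
  have hC : (a * d - b * c : ℂ) = 1 := by exact_mod_cast h
  constructor
  · rintro ⟨m, n, rfl⟩
    refine ⟨m * a + n * c, m * b + n * d, ?_⟩
    push_cast
    linear_combination (m : ℂ) * hm
  · rintro ⟨m, n, hz⟩
    refine ⟨m * d - n * c, n * a - m * b, ?_⟩
    refine mul_left_cancel₀ (Mob.ne_zero (by rw [h]; exact one_ne_zero) τ : (c * τ + d : ℂ) ≠ 0) ?_
    rw [hz]
    push_cast
    linear_combination (-(m * τ : ℂ) - n) * hC - (m * d - n * c : ℂ) * hm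

theorem exists_mob_of_homothety {τ σ : ℍ} {z : ℂ} (hz : z ≠ 0)
    (h : ∀ y, y ∈ lattice σ ↔ z * y ∈ lattice τ) :
    ∃ a b c d : ℤ, a * d - b * c = 1 ∧ Mob a b c d τ σ ∧ z = c * τ + d := by
  obtain ⟨a, b, h1⟩ := (h _).1 (lattice.self_mem σ)
  obtain ⟨c, d, h2⟩ := (h _).1 (lattice.one_mem σ)
  obtain ⟨a', b', h1'⟩ := (h (z⁻¹ * τ)).2 (by rw [mul_inv_cancel_left₀ hz]; exact lattice.self_mem τ)
  obtain ⟨c', d', h2'⟩ := (h (z⁻¹ * 1)).2 (by rw [mul_inv_cancel_left₀ hz]; exact lattice.one_mem τ)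
  rw [mul_one] at h2
  have hm : Mob a b c d τ σ := by
    unfold Mob
    rw [← h2, ← h1, mul_comm]
  rw [inv_mul_eq_iff_eq_mul₀ hz] at h1' h2'
  have e1 : ((1 : ℤ) * τ + (0 : ℤ) : ℂ) = (a' * a + b' * c : ℤ) * τ + (a' * b + b' * d : ℤ) := by
    push_cast
    linear_combination h1' + (a' : ℂ) * h1 + (b' : ℂ) * h2
  have e2 : ((0 : ℤ) * τ + (1 : ℤ) : ℂ) = (c' * a + d' * c : ℤ) * τ + (c' * b + d' * d : ℤ) := by
    push_cast
    linear_combination h2' + (c' : ℂ) * h1 + (d' : ℂ) * h2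
  rw [lattice.ext_iff] at e1 e2
  have hdet : (a * d - b * c) * (a' * d' - b' * c') = 1 := by
    have : (a' * a + b' * c) * (c' * b + d' * d) - (a' * b + b' * d) * (c' * a + d' * c) = 1 := by
      rw [← e1.1, ← e1.2, ← e2.1, ← e2.2]; norm_num
    linear_combination this
  have hpos : 0 < a * d - b * c := by
    have h3 := hm.im
    have h4 : 0 < σ.im * Complex.normSq (c * τ + d) :=
      mul_pos σ.im_pos (Complex.normSq_pos.2 (by rw [← h2]; exact hz))
    rw [h3] at h4
    have h5 := pos_of_mul_pos_left h4 τ.im_pos.le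
    exact_mod_cast h5
  refine ⟨a, b, c, d, ?_, hm, h2⟩
  rcases Int.isUnit_iff.1 (IsUnit.of_mul_eq_one _ hdet) with h | h <;> omega

variable {N : ℕ} [hN : Fact (N = 2 ∨ N = 3)] {p : ℕ} [hp : Fact p.Prime]

theorem Equi.homothetic {τ σ : ℍ} (h : Equi N τ σ) : Homothetic (lattice σ) (lattice τ) := by
  obtain ⟨a, b, c, d, h, hm⟩ := h
  exact homothetic_of_mob h hm

theorem IsForm.neg {τ : ℍ} {α β γ : ℤ} (h : IsForm N p τ α β γ) :
    IsForm N p τ (-α) (-β) (-γ) := by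
  refine ⟨by linear_combination h.1, ?_⟩
  push_cast
  linear_combination -h.2

theorem IsForm.mul_pos {τ : ℍ} {α β γ : ℤ} (h : IsForm N p τ α β γ) : 0 < α * γ := by
  have h1 := h.1
  have : (0 : ℤ) < p := by exact_mod_cast hp.out.pos
  have : (0 : ℤ) ≤ N * β ^ 2 := by positivity
  linarith

theorem IsForm.exists_pos {τ : ℍ} {α β γ : ℤ} (h : IsForm N p τ α β γ) :
    ∃ α' β' γ' : ℤ, 0 < α' ∧ IsForm N p τ α' β' γ' := by
  rcases lt_trichotomy α 0 with h0 | h0 | h0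
  · exact ⟨_, _, _, by linarith, h.neg⟩
  · have := h.mul_pos
    simp [h0] at this
  · exact ⟨_, _, _, h0, h⟩

/-- The square root of `-d` in the upper half plane. -/
def sqrtNeg (d : ℕ) : ℂ := Complex.I * (Real.sqrt d : ℂ)

theorem sqrtNeg_sq (d : ℕ) : sqrtNeg d ^ 2 = -d := by
  rw [sqrtNeg, mul_pow, Complex.I_sq, ← Complex.ofReal_pow, Real.sq_sqrt (Nat.cast_nonneg d)]
  simp

theorem IsForm.sqrtNeg {τ : ℍ} {α β γ : ℤ} (h : IsForm N p τ α β γ) (hα : 0 < α) :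
    sqrtNeg (N * p) = N * α * τ + N * β := by
  have h1 : (_root_.sqrtNeg (N * p)) ^ 2 = (N * α * τ + N * β) ^ 2 := by
    have h2 := h.1
    have h3 : (α * γ - N * β ^ 2 : ℂ) = p := by exact_mod_cast h2
    rw [sqrtNeg_sq]
    push_cast
    linear_combination (-(N * α) : ℂ) * h.2 + (N : ℂ) * h3
  rcases sq_eq_sq_iff_eq_or_eq_neg.1 h1 with h2 | h2
  · exact h2
  · exfalso
    have h3 := congrArg Complex.im h2
    have h4 : 0 < (N : ℝ) * α * τ.im := by
      have : (0 : ℝ) < α := by exact_mod_cast hα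
      have : (0 : ℝ) < N := by exact_mod_cast NeZero.pos N
      have := τ.im_pos
      positivity
    simp [_root_.sqrtNeg] at h3
    have h5 : 0 ≤ √(N : ℝ) * √(p : ℝ) := by positivity
    linarith

theorem IsForm.equi_of_homothetic (h5 : 5 ≤ p) {τ σ : ℍ} {α β γ α' β' γ' : ℤ}
    (h : IsForm N p τ α β γ) (h' : IsForm N p σ α' β' γ') (hh : Homothetic (lattice σ) (lattice τ)) :
    Equi N τ σ := by
  obtain ⟨α, β, γ, hα, h⟩ := h.exists_pos
  obtain ⟨α', β', γ', hα', h'⟩ := h'.exists_pos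
  obtain ⟨z, hz0, hz⟩ := hh
  obtain ⟨a, b, c, d, hdet, hm, rfl⟩ := exists_mob_of_homothety hz0 hz
  have hw := h.sqrtNeg hα
  have hw' := h'.sqrtNeg hα'
  have h1 : (α' * σ + β' : ℂ) ∈ lattice σ := ⟨_, _, rfl⟩
  obtain ⟨m, n, h2⟩ := (hz _).1 h1
  have h3 : ((-N * β * c + N * α * d : ℤ) * τ + (- c * γ + N * β * d : ℤ) : ℂ) =
      (N * m : ℤ) * τ + (N * n : ℤ) := by
    push_cast
    have h4 := h.2
    rw [hw'] at hw
    linear_combination (N : ℂ) * h2 - (c * τ + d : ℂ) * hw - c * h4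
  have h4 := (lattice.ext_iff.1 h3).2
  have hNp : Prime (N : ℤ) := Nat.prime_iff_prime_int.1 (level_prime (N := N))
  have hγ : ¬ (N : ℤ) ∣ γ := by
    rintro ⟨k, rfl⟩
    have h6 : (N : ℤ) ∣ p := ⟨α * k - β ^ 2, by linear_combination -h.1⟩
    have h7 : N ∣ p := by exact_mod_cast h6
    rcases (Nat.dvd_prime hp.out).1 h7 with h8 | h8
    · exact level_prime.ne_one h8
    · rcases hN.out with h9 | h9 <;> omega
  obtain ⟨e, rfl⟩ : (N : ℤ) ∣ c :=
    (hNp.dvd_or_dvd (⟨β * d - n, by linear_combination -h4⟩ : (N : ℤ) ∣ c * γ)).resolve_right hγ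
  exact ⟨a, b, e, d, hdet, by simpa using hm⟩

/-- A lattice stable under `√(-Np)` is homothetic to the lattice of a form. -/
theorem exists_isForm_of_stable {τ : ℍ} (h : ∀ z ∈ lattice τ, sqrtNeg (N * p) * z ∈ lattice τ) :
    ∃ σ α β γ, IsForm N p σ α β γ ∧ Homothetic (lattice τ) (lattice σ) := by
  obtain ⟨A, B, h1⟩ := h _ (lattice.one_mem τ)
  obtain ⟨C, D, h2⟩ := h _ (lattice.self_mem τ)
  rw [mul_one] at h1
  have hsq := sqrtNeg_sq (N * p)
  have hNp : Prime (N : ℤ) := Nat.prime_iff_prime_int.1 (level_prime (N := N))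
  have hN0 : (N : ℤ) ≠ 0 := hNp.ne_zero
  have h3 : ((A * (C + B) : ℤ) * τ + (A * D + B ^ 2 : ℤ) : ℂ) = (0 : ℤ) * τ + (- (N * p) : ℤ) := by
    push_cast at hsq ⊢
    linear_combination hsq - (A : ℂ) * h2 - (sqrtNeg (N * p) + B : ℂ) * h1
  obtain ⟨h4, h5⟩ := lattice.ext_iff.1 h3
  have hA : A ≠ 0 := by
    rintro rfl
    have h6 : (0 : ℤ) < N * p := by
      have := hp.out.pos
      have := NeZero.pos N
      positivity
    nlinarith [sq_nonneg B]
  have hC : C = -B := by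
    have := (mul_eq_zero.1 h4).resolve_left hA
    linarith
  have hq : (A * τ ^ 2 + 2 * B * τ - D : ℂ) = 0 := by
    rw [h1, hC] at h2
    push_cast at h2
    linear_combination h2
  by_cases hd : (N : ℤ) ∣ A
  · have hB : (N : ℤ) ∣ B := by
      refine hNp.dvd_of_dvd_pow (n := 2) ?_
      rw [show B ^ 2 = -(N * p) - A * D by linear_combination h5]
      exact dvd_sub ⟨-p, by ring⟩ (hd.mul_right D)
    obtain ⟨α, rfl⟩ := hd
    obtain ⟨β, rfl⟩ := hB
    refine ⟨τ, α, β, -D, ⟨mul_left_cancel₀ hN0 (by linear_combination -h5), ?_⟩, 1, one_ne_zero, by simp⟩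
    push_cast at hq ⊢
    linear_combination hq
  · obtain ⟨u, v, huv⟩ := (hNp.coprime_iff_not_dvd.2 hd)
    set t := B * v with ht
    have hB1 : (N : ℤ) ∣ B - A * t := ⟨u * B, by rw [ht]; linear_combination -B * huv⟩
    obtain ⟨β, hβ⟩ := hB1
    have hD1 : (N : ℤ) ∣ A * t ^ 2 - 2 * B * t - D := by
      refine (hNp.dvd_or_dvd (a := A) ?_).resolve_left hd
      refine ⟨p + β * (B - A * t), ?_⟩
      linear_combination -h5 - (-(B - A * t)) * hβ
    obtain ⟨α, hα⟩ := hD1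
    have hdet : (0 : ℤ) * t - (-1) * 1 = 1 := by norm_num
    obtain ⟨σ, hσ⟩ := exists_mob (a := 0) (b := -1) (c := 1) (d := t) (by rw [hdet]; norm_num) τ
    refine ⟨σ, α, -β, A, ⟨?_, ?_⟩, (homothetic_of_mob hdet hσ).symm⟩
    · refine mul_left_cancel₀ hN0 ?_
      linear_combination -h5 - A * hα + (N * β + (B - A * t)) * hβ
    · have h0 := Mob.ne_zero (a := 0) (b := -1) (c := 1) (d := t) (by rw [hdet]; norm_num) τ
      refine (mul_eq_zero.1 (?_ : _ * ((1 : ℤ) * τ + t : ℂ) ^ 2 = 0)).resolve_right (pow_ne_zero _ h0)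
      unfold Mob at hσ
      have hα' : (A * t ^ 2 - 2 * B * t - D : ℂ) = N * α := by exact_mod_cast hα
      have hβ' : (B - A * t : ℂ) = N * β := by exact_mod_cast hβ
      push_cast at hσ ⊢
      linear_combination hq + (N * α : ℂ) * (σ * (1 * τ + t) - 1) * hσ -
        2 * N * β * (1 * τ + t) * hσ - hα' - 2 * hβ' * (τ + t)

/-- The lattice of a form is stable under `√(-Np)`. -/
theorem IsForm.sqrtNeg_mul_mem {τ : ℍ} {α β γ : ℤ} (h : IsForm N p τ α β γ) {z : ℂ}
    (hz : z ∈ lattice τ) : _root_.sqrtNeg (N * p) * z ∈ lattice τ := by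
  obtain ⟨α, β, γ, hα, h⟩ := h.exists_pos
  obtain ⟨m, n, rfl⟩ := hz
  refine ⟨-N * β * m + N * α * n, -γ * m + N * β * n, ?_⟩
  rw [h.sqrtNeg hα]
  push_cast
  linear_combination (m : ℂ) * h.2

end Lattices

section Field

open UpperHalfPlane NumberField

/-- The field `ℚ(√-d)`. -/
abbrev QuadField (d : ℕ) := IntermediateField.adjoin ℚ {(Complex.I * Real.sqrt d : ℂ)}

instance (d : ℕ) : FiniteDimensional ℚ (QuadField d) :=
  IntermediateField.adjoin.finiteDimensional
    ⟨X ^ 2 + C (d : ℚ), monic_X_pow_add_C _ (by norm_num), by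
      have h := sqrtNeg_sq d
      rw [sqrtNeg] at h
      simp [h]⟩

instance (d : ℕ) : NumberField (QuadField d) := ⟨⟩

theorem classNumberSqrtNeg_eq (d : ℕ) :
    classNumberSqrtNeg d = Nat.card (ClassGroup (𝓞 (QuadField d))) := by
  rw [Nat.card_eq_fintype_card]
  rfl

/-- The embedding of the ring of integers of `ℚ(√-d)` in `ℂ`. -/
def intEmb (d : ℕ) : 𝓞 (QuadField d) →+* ℂ :=
  (algebraMap (QuadField d) ℂ).comp (algebraMap (𝓞 (QuadField d)) (QuadField d))

theorem intEmb_injective (d : ℕ) : Function.Injective (intEmb d) :=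
  (algebraMap (QuadField d) ℂ).injective.comp (RingOfIntegers.coe_injective)

theorem isIntegral_intEmb {d : ℕ} (x : 𝓞 (QuadField d)) : IsIntegral ℤ (intEmb d x) :=
  (RingOfIntegers.isIntegral x).map (intEmb d).toIntAlgHom

theorem exists_intEmb {d : ℕ} {z : ℂ} (hz : z ∈ QuadField d) (h : IsIntegral ℤ z) :
    ∃ x, intEmb d x = z := by
  have : IsIntegral ℤ (⟨z, hz⟩ : QuadField d) := by
    rw [← isIntegral_algHom_iff ((algebraMap (QuadField d) ℂ).toIntAlgHom)
      (algebraMap (QuadField d) ℂ).injective]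
    exact h
  exact ⟨⟨⟨z, hz⟩, this⟩, rfl⟩

theorem sqrtNeg_mem (d : ℕ) : sqrtNeg d ∈ QuadField d := IntermediateField.mem_adjoin_simple_self ℚ _

theorem exists_intEmb_half {d : ℕ} {a b n : ℤ} (h : a ^ 2 + d * b ^ 2 = 4 * n) :
    ∃ x, intEmb d x = (a + b * sqrtNeg d) / 2 := by
  refine exists_intEmb ?_ ⟨X ^ 2 - C a * X + C n, ?_, ?_⟩
  · refine div_mem (add_mem (intCast_mem _ _) (mul_mem (intCast_mem _ _) (sqrtNeg_mem d))) ?_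
    exact ofNat_mem _ _
  · monicity!
  · have h' : (a ^ 2 + d * b ^ 2 : ℂ) = 4 * n := by exact_mod_cast h
    have h2 := sqrtNeg_sq d
    rw [← aeval_def]
    simp only [map_add, map_sub, map_mul, map_pow, aeval_X, aeval_C, algebraMap_int_eq, Int.coe_castRingHom]
    linear_combination (b ^ 2 / 4 : ℂ) * h2 - h' / 4

theorem exists_intEmb_sqrtNeg (d : ℕ) : ∃ x, intEmb d x = sqrtNeg d := by
  obtain ⟨x, hx⟩ := exists_intEmb_half (d := d) (a := 0) (b := 2) (n := d) (by ring)
  exact ⟨x, by rw [hx]; push_cast; ring⟩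

theorem exists_rat_of_mem {d : ℕ} {z : ℂ} (hz : z ∈ QuadField d) :
    ∃ r s : ℚ, z = r + s * sqrtNeg d := by
  have hint : IsIntegral ℚ (Complex.I * Real.sqrt d : ℂ) :=
    ⟨X ^ 2 + C (d : ℚ), monic_X_pow_add_C _ (by norm_num), by
      have h := sqrtNeg_sq d
      rw [sqrtNeg] at h
      simp [h]⟩
  have h2 : z ∈ Algebra.adjoin ℚ {(Complex.I * Real.sqrt d : ℂ)} := by
    rw [← IntermediateField.adjoin_simple_toSubalgebra_of_isAlgebraic hint.isAlgebraic]
    exact hz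
  clear hz
  induction h2 using Algebra.adjoin_induction with
  | mem x hx =>
    rw [Set.mem_singleton_iff] at hx
    exact ⟨0, 1, by rw [hx, sqrtNeg]; simp⟩
  | algebraMap r => exact ⟨r, 0, by simp⟩
  | add x y _ _ hx hy =>
    obtain ⟨r, s, rfl⟩ := hx
    obtain ⟨r', s', rfl⟩ := hy
    exact ⟨r + r', s + s', by push_cast; ring⟩
  | mul x y _ _ hx hy =>
    obtain ⟨r, s, rfl⟩ := hx
    obtain ⟨r', s', rfl⟩ := hy
    refine ⟨r * r' - d * s * s', r * s' + r' * s, ?_⟩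
    push_cast
    linear_combination (s * s' : ℂ) * sqrtNeg_sq d

theorem conj_sqrtNeg (d : ℕ) : (starRingEnd ℂ) (sqrtNeg d) = -sqrtNeg d := by
  simp [sqrtNeg]

theorem Rat.exists_int_of_squarefree {d : ℕ} (hd : Squarefree d) {q : ℚ} {n : ℤ}
    (h : d * q ^ 2 = n) : ∃ b : ℤ, q = b := by
  have h1 : (d : ℚ) * q.num ^ 2 = n * q.den ^ 2 := by
    rw [← h, mul_assoc, ← mul_pow, Rat.mul_den_eq_num]
  have h2 : (d : ℤ) * q.num ^ 2 = n * q.den ^ 2 := by exact_mod_cast h1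
  have h3 : ((q.den : ℤ)) ^ 2 ∣ d := by
    refine (IsCoprime.pow (m := 2) (n := 2) ?_ : IsCoprime ((q.den : ℤ) ^ 2) (q.num ^ 2)).dvd_of_dvd_mul_right
      ⟨n, by rw [h2]; ring⟩
    rw [Int.isCoprime_iff_gcd_eq_one, Int.gcd_comm]
    exact q.reduced
  have h4 : q.den * q.den ∣ d := by
    rw [← sq]
    exact_mod_cast h3
  have h5 : q.den = 1 := Nat.isUnit_iff.1 (hd _ h4)
  exact ⟨q.num, by rw [← Rat.mul_den_eq_num, h5]; simp⟩

theorem exists_int_of_intEmb {d : ℕ} (hd : Squarefree d) (x : 𝓞 (QuadField d)) :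
    ∃ a b n : ℤ, intEmb d x = (a + b * sqrtNeg d) / 2 ∧ a ^ 2 + d * b ^ 2 = 4 * n := by
  obtain ⟨r, s, hrs⟩ := exists_rat_of_mem (SetLike.coe_mem (x : QuadField d))
  change intEmb d x = _ at hrs
  have hint := isIntegral_intEmb x
  have hint' : IsIntegral ℤ ((starRingEnd ℂ) (intEmb d x)) := hint.map (starRingEnd ℂ).toIntAlgHom
  have hrat : ∀ q : ℚ, IsIntegral ℤ (q : ℂ) → ∃ n : ℤ, q = n := by
    intro q hq
    have : IsIntegral ℤ q := by
      rw [← isIntegral_algHom_iff ((algebraMap ℚ ℂ).toIntAlgHom) (algebraMap ℚ ℂ).injective]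
      simpa using hq
    obtain ⟨n, hn⟩ := IsIntegrallyClosed.isIntegral_iff.1 this
    exact ⟨n, by rw [← hn]; simp⟩
  have hc : (starRingEnd ℂ) (intEmb d x) = r - s * sqrtNeg d := by
    rw [hrs]
    simp [conj_sqrtNeg, sub_eq_add_neg]
  obtain ⟨a, ha⟩ := hrat (2 * r) (by
    have h := hint.add hint'
    rw [hc, hrs] at h
    rw [show ((2 * r : ℚ) : ℂ) = (r + s * sqrtNeg d) + (r - s * sqrtNeg d) from ?_]
    · exact h
    push_cast
    ring)
  obtain ⟨n, hn⟩ := hrat (r ^ 2 + d * s ^ 2) (by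
    have h := hint.mul hint'
    rw [hc, hrs] at h
    rw [show ((r ^ 2 + d * s ^ 2 : ℚ) : ℂ) = (r + s * sqrtNeg d) * (r - s * sqrtNeg d) from ?_]
    · exact h
    push_cast
    linear_combination (s ^ 2 : ℂ) * sqrtNeg_sq d)
  obtain ⟨b, hb⟩ := Rat.exists_int_of_squarefree hd (q := 2 * s) (n := 4 * n - a ^ 2) (by
    push_cast
    rw [← ha, ← hn]
    ring)
  have ha' : (a : ℂ) = 2 * r := by exact_mod_cast ha.symm
  have hb' : (b : ℂ) = 2 * s := by exact_mod_cast hb.symm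
  refine ⟨a, b, n, ?_, ?_⟩
  · rw [hrs, ha', hb']
    ring
  · have : (a ^ 2 + d * b ^ 2 : ℚ) = 4 * n := by
      rw [← ha, ← hb, ← hn]
      ring
    exact_mod_cast this

theorem sqrtNeg_im_pos {d : ℕ} (hd : 0 < d) : 0 < (sqrtNeg d).im := by
  simp [sqrtNeg, hd]

theorem linearIndependent_sqrtNeg {d : ℕ} (hd : 0 < d) {r s r' s' : ℝ}
    (h : (r + s * sqrtNeg d : ℂ) = r' + s' * sqrtNeg d) : r = r' ∧ s = s' := by
  have h1 := congrArg Complex.im h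
  have h2 := congrArg Complex.re h
  have h3 : (sqrtNeg d).re = 0 := by simp [sqrtNeg]
  simp [h3] at h1 h2
  exact ⟨h2, h1.resolve_right (sqrtNeg_im_pos hd).ne'⟩

theorem finrank_quadField {d : ℕ} (hd : 0 < d) : Module.finrank ℚ (QuadField d) = 2 := by
  let v : Fin 2 → QuadField d := ![1, ⟨sqrtNeg d, sqrtNeg_mem d⟩]
  have hli : LinearIndependent ℚ v := by
    rw [LinearIndependent.pair_iff]
    intro r s h
    have h1 := congrArg (fun x : QuadField d => (x : ℂ)) h
    have h2 : ((r : ℝ) + (s : ℝ) * sqrtNeg d : ℂ) = (0 : ℝ) + (0 : ℝ) * sqrtNeg d := by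
      simpa [Algebra.smul_def] using h1
    have h3 := linearIndependent_sqrtNeg hd h2
    exact_mod_cast h3
  have hsp : ⊤ ≤ Submodule.span ℚ (Set.range v) := by
    rintro ⟨z, hz⟩ -
    obtain ⟨r, s, rfl⟩ := exists_rat_of_mem hz
    simp only [v, Matrix.range_cons, Matrix.range_empty, Set.union_empty, Set.singleton_union]
    rw [Submodule.mem_span_pair]
    refine ⟨r, s, ?_⟩
    ext
    simp [Algebra.smul_def]
  simpa using Module.finrank_eq_card_basis (Module.Basis.mk hli hsp)

end Field

section ClassGroupCount

open UpperHalfPlane NumberField nonZeroDivisors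

/-- Stability of a lattice under the ring of integers of `ℚ(√-d)`. -/
def IntStable (d : ℕ) (L : Set ℂ) : Prop := ∀ (x : 𝓞 (QuadField d)), ∀ z ∈ L, intEmb d x * z ∈ L

theorem IntStable.of_homothetic {d : ℕ} {L M : Set ℂ} (h : Homothetic L M) (hL : IntStable d L) :
    IntStable d M := by
  obtain ⟨c, hc, h⟩ := h.symm
  intro x z hz
  have h1 := hL x _ ((h z).1 hz)
  rw [h]
  convert h1 using 1
  ring

/-- The image of an ideal in `ℂ`. -/
def idealLattice {d : ℕ} (I : Ideal (𝓞 (QuadField d))) : Set ℂ := intEmb d '' I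

theorem intStable_idealLattice {d : ℕ} (I : Ideal (𝓞 (QuadField d))) :
    IntStable d (idealLattice I) := by
  rintro x _ ⟨y, hy, rfl⟩
  exact ⟨x * y, I.mul_mem_left x hy, map_mul _ _ _⟩

theorem mk0_eq_iff_homothetic {d : ℕ} (I J : (Ideal (𝓞 (QuadField d)))⁰) :
    ClassGroup.mk0 I = ClassGroup.mk0 J ↔
      Homothetic (idealLattice (I : Ideal (𝓞 (QuadField d)))) (idealLattice (J : Ideal (𝓞 (QuadField d)))) := by
  have hinj := intEmb_injective d
  rw [ClassGroup.mk0_eq_mk0_iff]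
  constructor
  · rintro ⟨x, y, hx, hy, h⟩
    have hx' : intEmb d x ≠ 0 := (map_ne_zero_iff _ hinj).2 hx
    have hy' : intEmb d y ≠ 0 := (map_ne_zero_iff _ hinj).2 hy
    refine ⟨intEmb d x / intEmb d y, div_ne_zero hx' hy', fun z => ?_⟩
    constructor
    · rintro ⟨a, ha, rfl⟩
      have h1 : x * a ∈ Ideal.span {y} * (J : Ideal (𝓞 (QuadField d))) := by
        rw [← h]
        exact Ideal.mul_mem_mul (Ideal.mem_span_singleton_self x) ha
      obtain ⟨b, hb, h2⟩ := Ideal.mem_span_singleton_mul.1 h1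
      refine ⟨b, hb, ?_⟩
      rw [div_mul_eq_mul_div, eq_div_iff hy', ← map_mul, ← map_mul, ← h2, mul_comm]
    · rintro ⟨b, hb, hz⟩
      have h1 : y * b ∈ Ideal.span {x} * (I : Ideal (𝓞 (QuadField d))) := by
        rw [h]
        exact Ideal.mul_mem_mul (Ideal.mem_span_singleton_self y) hb
      obtain ⟨a, ha, h2⟩ := Ideal.mem_span_singleton_mul.1 h1
      refine ⟨a, ha, ?_⟩
      refine mul_left_cancel₀ (div_ne_zero hx' hy') ?_
      rw [← hz, div_mul_eq_mul_div, div_eq_iff hy', ← map_mul, ← map_mul, h2, mul_comm]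
  · rintro ⟨c, hc, h⟩
    obtain ⟨i, hi, hi0⟩ := Submodule.exists_mem_ne_zero_of_ne_bot (nonZeroDivisors.coe_ne_zero I)
    obtain ⟨j, hj, hij⟩ := (h _).1 ⟨i, hi, rfl⟩
    have hi' : intEmb d i ≠ 0 := (map_ne_zero_iff _ hinj).2 hi0
    have hj' : intEmb d j ≠ 0 := by
      rw [hij]
      exact mul_ne_zero hc hi'
    have hj0 : j ≠ 0 := (map_ne_zero_iff _ hinj).1 hj'
    refine ⟨j, i, hj0, hi0, le_antisymm ?_ ?_⟩
    · rw [Ideal.span_singleton_mul_le_iff]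
      intro a ha
      obtain ⟨b, hb, hab⟩ := (h _).1 ⟨a, ha, rfl⟩
      refine Ideal.mem_span_singleton_mul.2 ⟨b, hb, hinj ?_⟩
      rw [map_mul, map_mul, hab, hij]
      ring
    · rw [Ideal.span_singleton_mul_le_iff]
      intro b hb
      obtain ⟨a, ha, hab⟩ := (h (c⁻¹ * intEmb d b)).2 ⟨b, hb, by rw [mul_inv_cancel_left₀ hc]⟩
      refine Ideal.mem_span_singleton_mul.2 ⟨a, ha, hinj ?_⟩
      rw [map_mul, map_mul, hab, hij]
      field_simp

theorem lattice_of_basis {u v : ℂ} (hu : u ≠ 0) (h : (v / u).im ≠ 0) :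
    ∃ τ, Homothetic {z | ∃ m n : ℤ, z = m * u + n * v} (lattice τ) := by
  rcases h.lt_or_gt with h | h
  · refine ⟨⟨-(v / u), by simpa using h⟩, u⁻¹, inv_ne_zero hu, fun z => ?_⟩
    constructor
    · rintro ⟨m, n, rfl⟩
      refine ⟨-n, m, ?_⟩
      change _ = _ * (-(v / u)) + _
      push_cast
      field_simp
      ring
    · rintro ⟨m, n, hz⟩
      refine ⟨n, -m, ?_⟩
      change _ = _ * (-(v / u)) + _ at hz
      rw [inv_mul_eq_iff_eq_mul₀ hu] at hz
      rw [hz]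
      push_cast
      field_simp
      ring
  · refine ⟨⟨v / u, h⟩, u⁻¹, inv_ne_zero hu, fun z => ?_⟩
    constructor
    · rintro ⟨m, n, rfl⟩
      refine ⟨n, m, ?_⟩
      change _ = _ * (v / u) + _
      field_simp
      ring
    · rintro ⟨m, n, hz⟩
      refine ⟨n, m, ?_⟩
      change _ = _ * (v / u) + _ at hz
      rw [inv_mul_eq_iff_eq_mul₀ hu] at hz
      rw [hz]
      field_simp
      ring

theorem exists_homothetic_lattice {d : ℕ} (hd : 0 < d) {I : Ideal (𝓞 (QuadField d))} (hI : I ≠ ⊥) :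
    ∃ τ, Homothetic (idealLattice I) (lattice τ) := by
  classical
  have hcard : Fintype.card (Module.Free.ChooseBasisIndex ℤ (𝓞 (QuadField d))) = 2 := by
    rw [← Module.finrank_eq_card_chooseBasisIndex, RingOfIntegers.rank, finrank_quadField hd]
  let b := (I.selfBasis (RingOfIntegers.basis (QuadField d)) hI).reindex (Fintype.equivFinOfCardEq hcard)
  set u := intEmb d (b 0) with hu
  set v := intEmb d (b 1) with hv
  have hL : idealLattice I = {z | ∃ m n : ℤ, z = m * u + n * v} := by
    ext z
    constructor
    · rintro ⟨x, hx, rfl⟩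
      have h := b.sum_repr ⟨x, hx⟩
      rw [Fin.sum_univ_two] at h
      refine ⟨b.repr ⟨x, hx⟩ 0, b.repr ⟨x, hx⟩ 1, ?_⟩
      have h1 := congrArg (fun y : I => intEmb d y) h
      simpa using h1.symm
    · rintro ⟨m, n, rfl⟩
      exact ⟨m * b 0 + n * b 1, I.add_mem (I.mul_mem_left _ (b 0).2) (I.mul_mem_left _ (b 1).2), by simp [hu, hv]⟩
  have hu0 : u ≠ 0 := by
    rw [hu, map_ne_zero_iff _ (intEmb_injective d)]
    intro h
    exact b.ne_zero 0 (Subtype.ext h)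
  rw [hL]
  refine lattice_of_basis hu0 fun him => ?_
  obtain ⟨x, hx⟩ := exists_intEmb_sqrtNeg d
  have h1 := intStable_idealLattice I x u (by rw [hL]; exact ⟨1, 0, by simp⟩)
  rw [hL, hx] at h1
  obtain ⟨m, n, h1⟩ := h1
  have h2 : sqrtNeg d = m + n * (v / u) := by
    field_simp
    exact h1
  have h3 := congrArg Complex.im h2
  simp [him] at h3
  exact (sqrtNeg_im_pos hd).ne' h3

variable {N : ℕ} [hN : Fact (N = 2 ∨ N = 3)] {p : ℕ} [hp : Fact p.Prime]

theorem IsForm.exists_ideal {τ : ℍ} {α β γ : ℤ} (h : IsForm N p τ α β γ)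
    (hs : IntStable (N * p) (lattice τ)) :
    ∃ I : (Ideal (𝓞 (QuadField (N * p))))⁰,
      Homothetic (idealLattice (I : Ideal (𝓞 (QuadField (N * p))))) (lattice τ) := by
  obtain ⟨α, β, γ, hα, h⟩ := h.exists_pos
  have hw := h.sqrtNeg hα
  have hc : (N * α : ℂ) ≠ 0 := by
    have := NeZero.ne N
    exact mul_ne_zero (by exact_mod_cast this) (by exact_mod_cast hα.ne')
  let I : Ideal (𝓞 (QuadField (N * p))) :=
    { carrier := {x | (N * α : ℂ)⁻¹ * intEmb (N * p) x ∈ lattice τ}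
      add_mem' := by
        intro a b ha hb
        rw [Set.mem_ofPred_eq, map_add, mul_add]
        exact lattice.add_mem ha hb
      zero_mem' := ⟨0, 0, by simp⟩
      smul_mem' := by
        intro c x hx
        have := hs c _ hx
        rw [Set.mem_ofPred_eq, smul_eq_mul, map_mul]
        convert this using 1
        ring }
  have hI : ∀ x, x ∈ I ↔ (N * α : ℂ)⁻¹ * intEmb (N * p) x ∈ lattice τ := fun x => Iff.rfl
  have hI0 : I ≠ ⊥ := by
    intro h0
    have h1 : ((N * α : ℤ) : 𝓞 (QuadField (N * p))) ∈ I := by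
      rw [hI]
      refine ⟨0, 1, ?_⟩
      push_cast
      rw [map_mul, map_natCast, map_intCast, inv_mul_cancel₀ hc]
      simp
    rw [h0, Ideal.mem_bot] at h1
    have h2 := congrArg (intEmb (N * p)) h1
    push_cast at h2
    rw [map_mul, map_natCast, map_intCast, map_zero] at h2
    exact hc h2
  refine ⟨⟨I, mem_nonZeroDivisors_of_ne_zero hI0⟩, (N * α : ℂ)⁻¹, inv_ne_zero hc, fun z => ?_⟩
  constructor
  · rintro ⟨x, hx, rfl⟩
    exact hx
  · intro hz
    obtain ⟨x, hx⟩ := exists_intEmb_sqrtNeg (N * p)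
    obtain ⟨m, n, h1⟩ := id hz
    refine ⟨m * (x - (N * β : ℤ)) + (N * α * n : ℤ), ?_, ?_⟩
    · rw [SetLike.mem_coe, hI]
      convert hz using 2
      rw [inv_mul_eq_iff_eq_mul₀ hc] at h1
      rw [h1]
      simp [hx]
      linear_combination (m : ℂ) * hw
    · rw [inv_mul_eq_iff_eq_mul₀ hc] at h1
      rw [h1]
      simp [hx]
      linear_combination (m : ℂ) * hw

variable (N p) in
/-- The values of `x` at the forms whose lattice is stable under the full ring of integers. -/
def stableValues : Set ℂ :=
  {z | ∃ τ α β γ, IsForm N p τ α β γ ∧ IntStable (N * p) (lattice τ) ∧ xF N τ = z}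

theorem ncard_stableValues (N : ℕ) [hN : Fact (N = 2 ∨ N = 3)] (h5 : 5 ≤ p) :
    (stableValues N p).ncard = classNumberSqrtNeg (N * p) := by
  have hd : 0 < N * p := Nat.mul_pos (NeZero.pos N) hp.out.pos
  have key : ∀ C : ClassGroup (𝓞 (QuadField (N * p))), ∃ (I : (Ideal (𝓞 (QuadField (N * p))))⁰) (τ : ℍ)
      (α β γ : ℤ), ClassGroup.mk0 I = C ∧ IsForm N p τ α β γ ∧
        Homothetic (idealLattice (I : Ideal (𝓞 (QuadField (N * p))))) (lattice τ) := by
    intro C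
    obtain ⟨I, rfl⟩ := ClassGroup.mk0_surjective C
    obtain ⟨τ, hτ⟩ := exists_homothetic_lattice hd (nonZeroDivisors.coe_ne_zero I)
    have hs := (intStable_idealLattice (I : Ideal (𝓞 (QuadField (N * p))))).of_homothetic hτ
    obtain ⟨x, hx⟩ := exists_intEmb_sqrtNeg (N * p)
    obtain ⟨σ, α, β, γ, h, h'⟩ := exists_isForm_of_stable (N := N) (p := p) (τ := τ) (by
      intro z hz
      rw [← hx]
      exact hs x z hz)
    exact ⟨I, σ, α, β, γ, rfl, h, hτ.trans h'⟩
  choose I τ α β γ hI hF hH using key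
  rw [classNumberSqrtNeg_eq, ← Nat.card_coe_set_eq]
  symm
  refine Nat.card_eq_of_bijective (fun C => ⟨xF N (τ C), τ C, α C, β C, γ C, hF C,
    (intStable_idealLattice _).of_homothetic (hH C), rfl⟩) ⟨?_, ?_⟩
  · intro C C' h
    have h1 := (equi_of_xF_eq (Subtype.ext_iff.1 h)).homothetic
    rw [← hI C, ← hI C', mk0_eq_iff_homothetic]
    exact ((hH C).trans h1.symm).trans (hH C').symm
  · rintro ⟨_, σ, a, b, c, h, hs, rfl⟩
    obtain ⟨J, hJ⟩ := h.exists_ideal hs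
    refine ⟨ClassGroup.mk0 J, Subtype.ext ?_⟩
    have h1 := hI (ClassGroup.mk0 J)
    rw [mk0_eq_iff_homothetic] at h1
    exact xF_of_equi (h.equi_of_homothetic h5 (hF _) (((hH _).symm.trans h1).trans hJ))

end ClassGroupCount

section Stability

open UpperHalfPlane NumberField

variable {N : ℕ} [hN : Fact (N = 2 ∨ N = 3)] {p : ℕ} [hp : Fact p.Prime]

theorem squarefree_mul (N : ℕ) [hN : Fact (N = 2 ∨ N = 3)] (h5 : 5 ≤ p) : Squarefree (N * p) := by
  rw [Nat.squarefree_mul ((Nat.coprime_primes level_prime hp.out).2 ?_)]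
  · exact ⟨level_prime.squarefree, hp.out.squarefree⟩
  · rcases hN.out with h | h <;> omega

/-- If `-Np` is not a discriminant modulo four, all form lattices are stable. -/
theorem IsForm.intStable (h5 : 5 ≤ p) (hm : N * p % 4 = 1 ∨ N * p % 4 = 2) {τ : ℍ} {α β γ : ℤ}
    (h : IsForm N p τ α β γ) : IntStable (N * p) (lattice τ) := by
  intro x z hz
  obtain ⟨a, b, n, hx, hn⟩ := exists_int_of_intEmb (squarefree_mul N h5) x
  have hwz := h.sqrtNeg_mul_mem hz
  generalize N * p = d at *
  have hab : 2 ∣ a ∧ 2 ∣ b := by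
    have h1 : (a ^ 2 + d * b ^ 2) % 4 = 0 := by omega
    have ha : a % 4 = 0 ∨ a % 4 = 1 ∨ a % 4 = 2 ∨ a % 4 = 3 := by omega
    have hb : b % 4 = 0 ∨ b % 4 = 1 ∨ b % 4 = 2 ∨ b % 4 = 3 := by omega
    have hd : (d : ℤ) % 4 = 1 ∨ (d : ℤ) % 4 = 2 := by omega
    rcases ha with ha | ha | ha | ha <;> rcases hb with hb | hb | hb | hb <;>
      rcases hd with hd | hd <;> simp [pow_two, Int.add_emod, Int.mul_emod, ha, hb, hd] at h1 <;>
        omega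
  obtain ⟨⟨a, rfl⟩, b, rfl⟩ := hab
  have h2 := lattice.add_mem (lattice.mul_mem a hz) (lattice.mul_mem b hwz)
  rw [hx]
  push_cast
  convert h2 using 1
  ring

end Stability

section Orders

open UpperHalfPlane NumberField

variable {p : ℕ} [hp : Fact p.Prime]

variable (p) in
/-- The generator `(1 + √(-3 p)) / 2` of the ring of integers. -/
def omegaGen : ℂ := (1 + sqrtNeg (3 * p)) / 2

theorem intStable_iff (h5 : 5 ≤ p) (hm : p % 4 = 1) (τ : ℍ) :
    IntStable (3 * p) (lattice τ) ↔ ∀ z ∈ lattice τ, omegaGen p * z ∈ lattice τ := by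
  constructor
  · intro h z hz
    obtain ⟨x, hx⟩ := exists_intEmb_half (d := 3 * p) (a := 1) (b := 1) (n := (1 + 3 * p) / 4) (by
      push_cast
      omega)
    have h1 := h x z hz
    rw [hx] at h1
    simpa [omegaGen] using h1
  · intro h x z hz
    obtain ⟨a, b, n, hx, hn⟩ := exists_int_of_intEmb (squarefree_mul 3 h5) x
    obtain ⟨e, he⟩ : (2 : ℤ) ∣ a - b := by
      have h1 : (a ^ 2 + (3 * p : ℕ) * b ^ 2) % 2 = 0 := by omega
      have hd : ((3 * p : ℕ) : ℤ) % 2 = 1 := by omega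
      rcases Int.emod_two_eq_zero_or_one a with ha | ha <;>
        rcases Int.emod_two_eq_zero_or_one b with hb | hb <;>
          simp [pow_two, Int.add_emod, Int.mul_emod, ha, hb] at h1 <;> omega
    obtain rfl : a = 2 * e + b := by omega
    have h2 := lattice.add_mem (lattice.mul_mem e hz) (lattice.mul_mem b (h z hz))
    rw [hx]
    convert h2 using 1
    rw [omegaGen]
    push_cast
    ring

theorem IsForm.intStable_iff (h5 : 5 ≤ p) (hm : p % 4 = 1) {τ : ℍ} {α β γ : ℤ}
    (h : IsForm 3 p τ α β γ) : IntStable (3 * p) (lattice τ) ↔ 2 ∣ α ∧ 2 ∣ γ := by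
  wlog hα : 0 < α generalizing α β γ
  · have h1 := h.mul_pos
    have h2 : 0 < -α := by
      rcases lt_trichotomy α 0 with h0 | h0 | h0
      · linarith
      · simp [h0] at h1
      · exact absurd h0 hα
    rw [this h.neg h2, dvd_neg, dvd_neg]
  have hw := h.sqrtNeg hα
  have hq := h.2
  push_cast at hw hq
  rw [_root_.intStable_iff h5 hm]
  constructor
  · intro hs
    obtain ⟨m, n, h1⟩ := hs _ (lattice.one_mem τ)
    obtain ⟨m', n', h2⟩ := hs _ (lattice.self_mem τ)
    rw [omegaGen, hw] at h1 h2
    have h3 : ((3 * α : ℤ) * τ + (3 * β + 1 : ℤ) : ℂ) = (2 * m : ℤ) * τ + (2 * n : ℤ) := by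
      push_cast
      linear_combination 2 * h1
    have h4 : ((1 - 3 * β : ℤ) * τ + (-γ : ℤ) : ℂ) = (2 * m' : ℤ) * τ + (2 * n' : ℤ) := by
      push_cast
      linear_combination 2 * h2 - hq
    have h5 := lattice.ext_iff.1 h3
    have h6 := lattice.ext_iff.1 h4
    omega
  · rintro ⟨⟨a, rfl⟩, c, rfl⟩ z ⟨m, n, rfl⟩
    have hβ : β % 2 = 1 := by
      have h1 := h.1
      have h2 : (3 * β ^ 2) % 2 = 1 := by
        have : 3 * β ^ 2 = 4 * (a * c) - p := by push_cast at h1; linear_combination -h1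
        omega
      rcases Int.emod_two_eq_zero_or_one β with hb | hb
      · simp [pow_two, Int.mul_emod, hb] at h2
      · exact hb
    obtain ⟨b, rfl⟩ : ∃ b, β = 2 * b + 1 := ⟨β / 2, by omega⟩
    refine ⟨m * (-3 * b - 1) + 3 * a * n, -c * m + (3 * b + 2) * n, ?_⟩
    rw [omegaGen, hw]
    push_cast at hq ⊢
    linear_combination (m / 2 : ℂ) * hq

end Orders

section Sublattices

open UpperHalfPlane NumberField

variable {p : ℕ} [hp : Fact p.Prime]

/-- The sublattice of `ℤτ + ℤ` cut out by a linear form modulo two. -/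
def subLattice (u v : ℤ) (τ : ℍ) : Set ℂ := {z | ∃ m n : ℤ, z = m * τ + n ∧ 2 ∣ u * m + v * n}

theorem subLattice_subset (u v : ℤ) (τ : ℍ) : subLattice u v τ ⊆ lattice τ := by
  rintro z ⟨m, n, h, -⟩
  exact ⟨m, n, h⟩

theorem mem_subLattice {u v : ℤ} {τ : ℍ} {m n : ℤ} :
    (m * τ + n : ℂ) ∈ subLattice u v τ ↔ 2 ∣ u * m + v * n := by
  constructor
  · rintro ⟨m', n', h, h'⟩
    obtain ⟨rfl, rfl⟩ := lattice.ext_iff.1 h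
    exact h'
  · exact fun h => ⟨m, n, rfl, h⟩

theorem subLattice_congr {u v u' v' : ℤ} (hu : u % 2 = u' % 2) (hv : v % 2 = v' % 2) (τ : ℍ) :
    subLattice u v τ = subLattice u' v' τ := by
  have key : ∀ m n : ℤ, 2 ∣ u * m + v * n ↔ 2 ∣ u' * m + v' * n := by
    intro m n
    obtain ⟨a, ha⟩ : (2 : ℤ) ∣ u - u' := by omega
    obtain ⟨b, hb⟩ : (2 : ℤ) ∣ v - v' := by omega
    rw [show u * m + v * n = (u' * m + v' * n) + 2 * (a * m + b * n) by
      linear_combination m * ha + n * hb]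
    omega
  ext z
  simp only [subLattice, key]

/-- A stable lattice is generated by its unstable sublattices of index two. -/
theorem exists_add_omegaGen {u v : ℤ} {τ : ℍ} (hJ : ∀ z ∈ lattice τ, omegaGen p * z ∈ lattice τ)
    (hS : ¬ ∀ z ∈ subLattice u v τ, omegaGen p * z ∈ subLattice u v τ) {z : ℂ} (hz : z ∈ lattice τ) :
    ∃ s ∈ subLattice u v τ, ∃ s' ∈ subLattice u v τ, z = s + omegaGen p * s' := by
  push Not at hS
  obtain ⟨s', hs', hs⟩ := hS
  obtain ⟨m, n, hmn⟩ := hJ _ (subLattice_subset _ _ _ hs')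
  obtain ⟨a, b, rfl⟩ := hz
  rw [hmn, mem_subLattice] at hs
  by_cases h : 2 ∣ u * a + v * b
  · exact ⟨_, mem_subLattice.2 h, 0, ⟨0, 0, by simp⟩, by simp⟩
  · refine ⟨(a - m : ℤ) * τ + (b - n : ℤ), mem_subLattice.2 ?_, s', hs', ?_⟩
    · rw [show u * (a - m) + v * (b - n) = (u * a + v * b) - (u * m + v * n) by ring]
      omega
    · rw [hmn]
      push_cast
      ring

theorem omegaGen_stable_of_homothetic {L M : Set ℂ} (h : Homothetic L M)
    (hL : ∀ z ∈ L, omegaGen p * z ∈ L) : ∀ z ∈ M, omegaGen p * z ∈ M := by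
  obtain ⟨c, hc, h⟩ := h.symm
  intro z hz
  rw [h, mul_left_comm]
  exact hL _ ((h z).1 hz)

theorem mul_mem_of_subLattice {u v u' v' : ℤ} {τ τ' : ℍ} {c : ℂ}
    (hJ : ∀ z ∈ lattice τ, omegaGen p * z ∈ lattice τ)
    (hJ' : ∀ z ∈ lattice τ', omegaGen p * z ∈ lattice τ')
    (hS : ¬ ∀ z ∈ subLattice u v τ, omegaGen p * z ∈ subLattice u v τ)
    (h : ∀ z ∈ subLattice u v τ, c * z ∈ subLattice u' v' τ') {z : ℂ} (hz : z ∈ lattice τ) :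
    c * z ∈ lattice τ' := by
  obtain ⟨s, hs, r, hr, rfl⟩ := exists_add_omegaGen hJ hS hz
  rw [mul_add, mul_left_comm]
  exact lattice.add_mem (subLattice_subset _ _ _ (h _ hs))
    (hJ' _ (subLattice_subset _ _ _ (h _ hr)))

/-- A homothety of unstable sublattices of index two extends to the stable lattices. -/
theorem homothety_of_subLattice {u v u' v' : ℤ} {τ τ' : ℍ} {c : ℂ} (hc : c ≠ 0)
    (hJ : ∀ z ∈ lattice τ, omegaGen p * z ∈ lattice τ)
    (hJ' : ∀ z ∈ lattice τ', omegaGen p * z ∈ lattice τ')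
    (hS : ¬ ∀ z ∈ subLattice u v τ, omegaGen p * z ∈ subLattice u v τ)
    (h : ∀ z, z ∈ subLattice u v τ ↔ c * z ∈ subLattice u' v' τ') (z : ℂ) :
    z ∈ lattice τ ↔ c * z ∈ lattice τ' := by
  refine ⟨mul_mem_of_subLattice hJ hJ' hS fun z hz => (h z).1 hz, fun hz => ?_⟩
  have h1 : ∀ z ∈ subLattice u' v' τ', c⁻¹ * z ∈ subLattice u v τ := by
    intro z hz
    rwa [h, mul_inv_cancel_left₀ hc]
  have hS' : ¬ ∀ z ∈ subLattice u' v' τ', omegaGen p * z ∈ subLattice u' v' τ' := fun h2 =>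
    hS (omegaGen_stable_of_homothetic (Homothetic.symm ⟨c, hc, h⟩) h2)
  simpa [inv_mul_cancel_left₀ hc] using mul_mem_of_subLattice hJ' hJ hS' h1 hz

theorem eq_zero_of_sq_eq {d : ℕ} (hd : Squarefree d) (h1 : d ≠ 1) {x y : ℤ} (h : x ^ 2 = d * y ^ 2) :
    x = 0 := by
  by_contra hx
  have hx' : (x : ℚ) ≠ 0 := by exact_mod_cast hx
  obtain ⟨b, hb⟩ := Rat.exists_int_of_squarefree hd (q := y / x) (n := 1) (by
    field_simp
    rw [Int.cast_one, mul_one]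
    exact_mod_cast h.symm)
  rw [div_eq_iff hx'] at hb
  have hb' : y = b * x := by exact_mod_cast hb
  have h2 : (d * b ^ 2 - 1) * x ^ 2 = 0 := by rw [hb'] at h; linear_combination -h
  have h3 : (d : ℤ) * b ^ 2 = 1 := by
    rcases mul_eq_zero.1 h2 with h | h
    · linarith
    · exact absurd (pow_eq_zero_iff (two_ne_zero) |>.1 h) hx
  have h4 := Int.isUnit_iff.1 (IsUnit.of_mul_eq_one _ h3)
  omega

/-- A lattice of a form has no homotheties to itself but the trivial ones. -/
theorem IsForm.eq_one_or_neg_one (h5 : 5 ≤ p) {τ : ℍ} {α β γ : ℤ} (h : IsForm 3 p τ α β γ) {c : ℂ}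
    (hc : c ≠ 0) (hh : ∀ y, y ∈ lattice τ ↔ c * y ∈ lattice τ) : c = 1 ∨ c = -1 := by
  obtain ⟨α, β, γ, hα, h⟩ := h.exists_pos
  obtain ⟨a, b, r, s, hdet, hm, rfl⟩ := exists_mob_of_homothety hc hh
  have hq := h.2
  unfold Mob at hm
  push_cast at hq
  obtain ⟨h1, h2⟩ := linear_eq_zero (A := 3 * α * (s - a) - 6 * β * r) (B := -3 * α * b - r * γ)
    (τ := τ) (by
    push_cast
    linear_combination 3 * (α : ℂ) * hm - r * hq)
  have h3 := h.1
  push_cast at h3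
  have h4 : 3 * α ^ 2 * (4 - (s + a) ^ 2) = 4 * p * r ^ 2 := by
    refine mul_left_cancel₀ (by norm_num : (3 : ℤ) ≠ 0) ?_
    linear_combination -(3 * α * (s - a) + 6 * β * r) * h1 + 12 * α * r * h2 - 36 * α ^ 2 * hdet + 12 * r ^ 2 * h3
  have hα2 : 0 < α ^ 2 := by positivity
  have hp0 : (0 : ℤ) < p := by exact_mod_cast hp.out.pos
  have h6 : (s + a) ^ 2 ≤ 4 := by
    by_contra! h7
    have : 0 ≤ 4 * p * r ^ 2 := by positivity
    nlinarith
  have h7 : s + a ≤ 2 := by nlinarith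
  have h8 : -2 ≤ s + a := by nlinarith
  have hr : r = 0 := by
    by_contra hr
    have h9 : s + a = -2 ∨ s + a = -1 ∨ s + a = 0 ∨ s + a = 1 ∨ s + a = 2 := by omega
    have hr2 : 0 < r ^ 2 := by positivity
    have hpr : 0 < p * r ^ 2 := by positivity
    have h10 : (3 * α) ^ 2 = p * (2 * r) ^ 2 → False := fun h11 => by
      have := eq_zero_of_sq_eq hp.out.squarefree hp.out.one_lt.ne' h11
      omega
    rcases h9 with h9 | h9 | h9 | h9 | h9 <;> rw [h9] at h4
    · linarith
    · exact h10 (by linear_combination h4)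
    · have := eq_zero_of_sq_eq (squarefree_mul 3 h5) (by omega) (x := 3 * α) (y := r) (by
        push_cast
        linarith)
      omega
    · exact h10 (by linear_combination h4)
    · linarith
  rw [hr] at hdet ⊢
  rcases Int.isUnit_iff.1 (IsUnit.of_mul_eq_one s (by linear_combination hdet : a * s = 1)) with h | h
  all_goals
    rw [h] at hdet
    first
    | left; simp; norm_cast; omega
    | right; simp; norm_cast; omega

end Sublattices

section Twists

open UpperHalfPlane NumberField

variable {p : ℕ} [hp : Fact p.Prime]

theorem IsForm.exists_double {τ : ℍ} {a β c : ℤ} (h : IsForm 3 p τ (2 * a) β (2 * c)) :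
    ∃ σ, IsForm 3 p σ a β (4 * c) ∧ Homothetic (subLattice 1 0 τ) (lattice σ) := by
  obtain ⟨σ, hσ⟩ := exists_mob (a := 2) (b := 0) (c := 0) (d := 1) (by norm_num) τ
  obtain ⟨h1, h2⟩ := h
  unfold Mob at hσ
  simp only [Int.cast_zero, Int.cast_one, zero_mul, zero_add, mul_one, add_zero] at hσ
  push_cast at h1 h2 hσ
  refine ⟨σ, ⟨by push_cast; linear_combination h1, ?_⟩, 1, one_ne_zero, fun z => ?_⟩
  · rw [hσ]
    push_cast
    linear_combination 2 * h2
  · rw [one_mul]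
    constructor
    · rintro ⟨m, n, rfl, hm⟩
      obtain ⟨k, rfl⟩ : (2 : ℤ) ∣ m := by omega
      exact ⟨k, n, by rw [hσ]; push_cast; ring⟩
    · rintro ⟨m, n, rfl⟩
      exact ⟨2 * m, n, by rw [hσ]; push_cast; ring, by omega⟩

theorem IsForm.exists_half {τ : ℍ} {a β c : ℤ} (h : IsForm 3 p τ (2 * a) β (2 * c)) :
    ∃ σ, IsForm 3 p σ (4 * a) β c ∧ Homothetic (subLattice 0 1 τ) (lattice σ) := by
  obtain ⟨σ, hσ⟩ := exists_mob (a := 1) (b := 0) (c := 0) (d := 2) (by norm_num) τ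
  obtain ⟨h1, h2⟩ := h
  unfold Mob at hσ
  simp only [Int.cast_zero, Int.cast_one, zero_mul, zero_add, one_mul, add_zero] at hσ
  push_cast at h1 h2 hσ
  refine ⟨σ, ⟨by push_cast; linear_combination h1, ?_⟩, 1 / 2, by norm_num, fun z => ?_⟩
  · push_cast
    rw [← hσ] at h2
    linear_combination h2 / 2
  · constructor
    · rintro ⟨m, n, rfl, hm⟩
      obtain ⟨k, rfl⟩ : (2 : ℤ) ∣ n := by omega
      exact ⟨m, k, by rw [← hσ]; push_cast; ring⟩
    · rintro ⟨m, n, hz⟩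
      exact ⟨m, 2 * n, by rw [← hσ]; push_cast; linear_combination 2 * hz, by omega⟩

theorem IsForm.exists_half_add {τ : ℍ} {a β c : ℤ} (h : IsForm 3 p τ (2 * a) β (2 * c)) :
    ∃ σ, IsForm 3 p σ (4 * a) (β - 2 * a) (3 * a - 3 * β + c) ∧
      Homothetic (subLattice 1 1 τ) (lattice σ) := by
  obtain ⟨σ, hσ⟩ := exists_mob (a := 1) (b := 1) (c := 0) (d := 2) (by norm_num) τ
  obtain ⟨h1, h2⟩ := h
  unfold Mob at hσ
  simp only [Int.cast_zero, Int.cast_one, zero_mul, zero_add, one_mul] at hσ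
  push_cast at h1 h2 hσ
  obtain hτ : (τ : ℂ) = σ * 2 - 1 := by linear_combination -hσ
  refine ⟨σ, ⟨by push_cast; linear_combination h1, ?_⟩, 1 / 2, by norm_num, fun z => ?_⟩
  · push_cast
    rw [hτ] at h2
    linear_combination h2 / 2
  · constructor
    · rintro ⟨m, n, rfl, hm⟩
      obtain ⟨k, rfl⟩ : ∃ k, n = 2 * k + m := ⟨(n - m) / 2, by omega⟩
      exact ⟨m, k, by rw [hτ]; push_cast; ring⟩
    · rintro ⟨m, n, hz⟩
      exact ⟨m, 2 * n + m, by rw [hτ]; push_cast; linear_combination 2 * hz, by omega⟩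

/-- Every form with unstable lattice arises from a stable one. -/
theorem IsForm.exists_twist (h5 : 5 ≤ p) (hm : p % 4 = 1) {σ : ℍ} {α β γ : ℤ}
    (h : IsForm 3 p σ α β γ) (hs : ¬ IntStable (3 * p) (lattice σ)) :
    ∃ τ a b c u v, IsForm 3 p τ (2 * a) b (2 * c) ∧ ¬ (u % 2 = 0 ∧ v % 2 = 0) ∧
      Homothetic (subLattice u v τ) (lattice σ) := by
  rw [h.intStable_iff h5 hm] at hs
  obtain ⟨h1, h2⟩ := h
  push_cast at h1 h2
  have hcases : 4 ∣ α ∨ 4 ∣ γ ∨ (4 ∣ 3 * α - 6 * β + γ) := by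
    have h3 : (α * γ - 3 * β ^ 2) % 4 = 1 := by omega
    have ha : α % 4 = 0 ∨ α % 4 = 1 ∨ α % 4 = 2 ∨ α % 4 = 3 := by omega
    have hb : β % 4 = 0 ∨ β % 4 = 1 ∨ β % 4 = 2 ∨ β % 4 = 3 := by omega
    have hc : γ % 4 = 0 ∨ γ % 4 = 1 ∨ γ % 4 = 2 ∨ γ % 4 = 3 := by omega
    rcases ha with ha | ha | ha | ha <;> rcases hb with hb | hb | hb | hb <;>
      rcases hc with hc | hc | hc | hc <;>
        simp [pow_two, Int.sub_emod, Int.mul_emod, ha, hb, hc] at h3 <;> omega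
  rcases hcases with ⟨a, rfl⟩ | ⟨c, rfl⟩ | ⟨c, hc⟩
  · obtain ⟨τ, hτ⟩ := exists_mob (a := 2) (b := 0) (c := 0) (d := 1) (by norm_num) σ
    unfold Mob at hτ
    simp only [Int.cast_zero, Int.cast_one, zero_mul, zero_add, mul_one, add_zero] at hτ
    push_cast at h1 h2 hτ
    refine ⟨τ, a, β, γ, 0, 1, ⟨by push_cast; linear_combination h1, ?_⟩, by norm_num,
      1 / 2, by norm_num, fun z => ?_⟩
    · rw [hτ]
      push_cast
      linear_combination 2 * h2
    · constructor
      · rintro ⟨m, n, rfl, hn⟩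
        obtain ⟨k, rfl⟩ : (2 : ℤ) ∣ n := by omega
        exact ⟨m, k, by rw [hτ]; push_cast; ring⟩
      · rintro ⟨m, n, hz⟩
        exact ⟨m, 2 * n, by rw [hτ]; push_cast; linear_combination 2 * hz, by omega⟩
  · obtain ⟨τ, hτ⟩ := exists_mob (a := 1) (b := 0) (c := 0) (d := 2) (by norm_num) σ
    unfold Mob at hτ
    simp only [Int.cast_zero, Int.cast_one, zero_mul, zero_add, one_mul, add_zero] at hτ
    push_cast at h1 h2 hτ
    refine ⟨τ, α, β, c, 1, 0, ⟨by push_cast; linear_combination h1, ?_⟩, by norm_num,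
      1, by norm_num, fun z => ?_⟩
    · rw [← hτ] at h2
      push_cast
      linear_combination h2 / 2
    · rw [one_mul]
      constructor
      · rintro ⟨m, n, rfl, hm⟩
        obtain ⟨k, rfl⟩ : (2 : ℤ) ∣ m := by omega
        exact ⟨k, n, by rw [← hτ]; push_cast; ring⟩
      · rintro ⟨m, n, rfl⟩
        exact ⟨2 * m, n, by rw [← hτ]; push_cast; ring, by omega⟩
  · obtain ⟨τ, hτ⟩ := exists_mob (a := 1) (b := 1) (c := 0) (d := 2) (by norm_num) σ
    unfold Mob at hτ
    simp only [Int.cast_zero, Int.cast_one, zero_mul, zero_add, one_mul] at hτ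
    push_cast at h1 h2 hτ
    obtain hσ : (σ : ℂ) = τ * 2 - 1 := by linear_combination -hτ
    obtain rfl : γ = 4 * c - 3 * α + 6 * β := by linear_combination hc
    refine ⟨τ, α, β - α, c, 1, 0, ⟨by push_cast; linear_combination h1, ?_⟩, by norm_num,
      1, by norm_num, fun z => ?_⟩
    · rw [hσ] at h2
      push_cast at h2 ⊢
      linear_combination h2 / 2
    · rw [one_mul]
      constructor
      · rintro ⟨m, n, rfl, hm⟩
        obtain ⟨k, rfl⟩ : (2 : ℤ) ∣ m := by omega
        exact ⟨k, n + k, by rw [hσ]; push_cast; ring⟩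
      · rintro ⟨m, n, rfl⟩
        exact ⟨2 * m, n - m, by rw [hσ]; push_cast; ring, by omega⟩

/-- The first coefficients of the non-zero linear forms modulo two. -/
def twistU : Fin 3 → ℤ := ![1, 0, 1]

/-- The second coefficients of the non-zero linear forms modulo two. -/
def twistV : Fin 3 → ℤ := ![0, 1, 1]

/-- The three sublattices of index two. -/
def twistLattice (i : Fin 3) (τ : ℍ) : Set ℂ := subLattice (twistU i) (twistV i) τ

theorem exists_twistLattice {u v : ℤ} (h : ¬ (u % 2 = 0 ∧ v % 2 = 0)) (τ : ℍ) :
    ∃ i, twistLattice i τ = subLattice u v τ := by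
  have : (u % 2 = 1 ∧ v % 2 = 0) ∨ (u % 2 = 0 ∧ v % 2 = 1) ∨ (u % 2 = 1 ∧ v % 2 = 1) := by omega
  rcases this with h | h | h
  · exact ⟨0, subLattice_congr (by simp [twistU, h.1]) (by simp [twistV, h.2]) τ⟩
  · exact ⟨1, subLattice_congr (by simp [twistU, h.1]) (by simp [twistV, h.2]) τ⟩
  · exact ⟨2, subLattice_congr (by simp [twistU, h.1]) (by simp [twistV, h.2]) τ⟩

theorem twistLattice_injective {τ : ℍ} {i j : Fin 3} {c : ℂ} (hc : c = 1 ∨ c = -1)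
    (h : ∀ z, z ∈ twistLattice i τ ↔ c * z ∈ twistLattice j τ) : i = j := by
  have key : ∀ m n : ℤ, 2 ∣ twistU i * m + twistV i * n ↔ 2 ∣ twistU j * m + twistV j * n := by
    intro m n
    have h1 := h (m * τ + n)
    rcases hc with rfl | rfl
    · rwa [one_mul, twistLattice, twistLattice, mem_subLattice, mem_subLattice] at h1
    · rw [show (-1 * (m * τ + n) : ℂ) = (-m : ℤ) * τ + (-n : ℤ) by push_cast; ring, twistLattice,
        twistLattice, mem_subLattice, mem_subLattice] at h1
      rw [h1, show twistU j * -m + twistV j * -n = -(twistU j * m + twistV j * n) by ring, dvd_neg]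
  have h1 := key 1 0
  have h2 := key 0 1
  fin_cases i <;> fin_cases j <;> first | rfl | (simp [twistU, twistV] at h1 h2)

/-- The stable forms are even. -/
theorem IsForm.exists_even (h5 : 5 ≤ p) (hm : p % 4 = 1) {τ : ℍ} {α β γ : ℤ}
    (h : IsForm 3 p τ α β γ) (hs : IntStable (3 * p) (lattice τ)) :
    ∃ a b c, IsForm 3 p τ (2 * a) b (2 * c) := by
  rw [h.intStable_iff h5 hm] at hs
  obtain ⟨⟨a, rfl⟩, c, rfl⟩ := hs
  exact ⟨a, β, c, h⟩

variable (p) in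
/-- The index two sublattices not stable under the ring of integers. -/
def Unstable (i : Fin 3) (τ : ℍ) : Prop :=
  ¬ ∀ z ∈ twistLattice i τ, omegaGen p * z ∈ twistLattice i τ

theorem unstable_iff (h5 : 5 ≤ p) (hm : p % 4 = 1) {τ σ : ℍ} {i : Fin 3}
    (h : Homothetic (twistLattice i τ) (lattice σ)) :
    Unstable p i τ ↔ ¬ IntStable (3 * p) (lattice σ) := by
  rw [intStable_iff h5 hm, Unstable, not_iff_not]
  exact ⟨omegaGen_stable_of_homothetic h, omegaGen_stable_of_homothetic h.symm⟩

theorem IsForm.unstable_iff (h5 : 5 ≤ p) (hm : p % 4 = 1) {τ : ℍ} {a b c : ℤ}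
    (h : IsForm 3 p τ (2 * a) b (2 * c)) :
    (Unstable p 0 τ ↔ a % 2 = 1) ∧ (Unstable p 1 τ ↔ c % 2 = 1) ∧
      (Unstable p 2 τ ↔ (a + c) % 2 = 0) := by
  have hb : b % 2 = 1 := by
    have h1 := h.1
    have h2 : (3 * b ^ 2) % 2 = 1 := by
      have : 3 * b ^ 2 = 4 * (a * c) - p := by push_cast at h1; linear_combination -h1
      omega
    rcases Int.emod_two_eq_zero_or_one b with hb | hb
    · simp [pow_two, Int.mul_emod, hb] at h2
    · exact hb
  obtain ⟨σ₀, f₀, h₀⟩ := h.exists_double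
  obtain ⟨σ₁, f₁, h₁⟩ := h.exists_half
  obtain ⟨σ₂, f₂, h₂⟩ := h.exists_half_add
  refine ⟨?_, ?_, ?_⟩
  · rw [_root_.unstable_iff h5 hm (i := 0) h₀, f₀.intStable_iff h5 hm]
    omega
  · rw [_root_.unstable_iff h5 hm (i := 1) h₁, f₁.intStable_iff h5 hm]
    omega
  · rw [_root_.unstable_iff h5 hm (i := 2) h₂, f₂.intStable_iff h5 hm]
    omega

theorem IsForm.exists_isForm_twist {τ : ℍ} {a b c : ℤ}
    (h : IsForm 3 p τ (2 * a) b (2 * c)) (i : Fin 3) :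
    ∃ σ α β γ, IsForm 3 p σ α β γ ∧ Homothetic (twistLattice i τ) (lattice σ) := by
  obtain ⟨σ₀, f₀, h₀⟩ := h.exists_double
  obtain ⟨σ₁, f₁, h₁⟩ := h.exists_half
  obtain ⟨σ₂, f₂, h₂⟩ := h.exists_half_add
  fin_cases i
  · exact ⟨_, _, _, _, f₀, h₀⟩
  · exact ⟨_, _, _, _, f₁, h₁⟩
  · exact ⟨_, _, _, _, f₂, h₂⟩

/-- Equivalent points have the same sublattices of index two. -/
theorem Equi.exists_twist {τ τ' : ℍ} (h : Equi 3 τ' τ) {u v : ℤ} (huv : ¬ (u % 2 = 0 ∧ v % 2 = 0)) :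
    ∃ j, Homothetic (subLattice u v τ) (twistLattice j τ') := by
  obtain ⟨a, b, c, d, hdet, hm⟩ := h
  generalize ((3 : ℕ) : ℤ) * c = c at *
  obtain ⟨j, hj⟩ := exists_twistLattice (u := d * u - b * v) (v := -c * u + a * v) (by
    rintro ⟨h1, h2⟩
    obtain ⟨k, hk⟩ := Int.dvd_of_emod_eq_zero h1
    obtain ⟨l, hl⟩ := Int.dvd_of_emod_eq_zero h2
    have hu : u = 2 * (a * k + b * l) := by linear_combination -u * hdet + a * hk + b * hl
    have hv : v = 2 * (c * k + d * l) := by linear_combination -v * hdet + c * hk + d * hl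
    omega) τ'
  refine ⟨j, c * τ' + d, Mob.ne_zero (by rw [hdet]; exact one_ne_zero) τ', fun z => ?_⟩
  rw [hj]
  unfold Mob at hm
  have hC : (a * d - b * c : ℂ) = 1 := by exact_mod_cast hdet
  constructor
  · rintro ⟨m, n, rfl, hmn⟩
    refine ⟨m * a + n * c, m * b + n * d, ?_, ?_⟩
    · push_cast
      linear_combination (m : ℂ) * hm
    · convert hmn using 1
      linear_combination (u * m + v * n) * hdet
  · rintro ⟨m, n, hz, hmn⟩
    refine ⟨m * d - n * c, n * a - m * b, ?_, ?_⟩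
    · refine mul_left_cancel₀ (Mob.ne_zero (by rw [hdet]; exact one_ne_zero) τ' : (c * τ' + d : ℂ) ≠ 0) ?_
      rw [hz]
      push_cast
      linear_combination (-(m * τ' : ℂ) - n) * hC - (m * d - n * c : ℂ) * hm
    · convert hmn using 1
      ring

end Twists

section TwistCount

open UpperHalfPlane NumberField

variable {p : ℕ} [hp : Fact p.Prime]

/-- The values of `x` at the forms whose lattice is not stable under the full ring of integers. -/
def unstableValues (N p : ℕ) [Fact (N = 2 ∨ N = 3)] : Set ℂ :=
  {z | ∃ τ α β γ, IsForm N p τ α β γ ∧ ¬ IntStable (N * p) (lattice τ) ∧ xF N τ = z}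

theorem formValues_eq_union (N p : ℕ) [Fact (N = 2 ∨ N = 3)] [Fact p.Prime] :
    formValues N p = stableValues N p ∪ unstableValues N p := by
  ext z
  constructor
  · rintro ⟨τ, α, β, γ, h, hz⟩
    by_cases hs : IntStable (N * p) (lattice τ)
    · exact Or.inl ⟨τ, α, β, γ, h, hs, hz⟩
    · exact Or.inr ⟨τ, α, β, γ, h, hs, hz⟩
  · rintro (⟨τ, α, β, γ, h, -, hz⟩ | ⟨τ, α, β, γ, h, -, hz⟩)
    · exact ⟨τ, α, β, γ, h, hz⟩
    · exact ⟨τ, α, β, γ, h, hz⟩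

theorem disjoint_stableValues (N p : ℕ) [Fact (N = 2 ∨ N = 3)] [Fact p.Prime] :
    Disjoint (stableValues N p) (unstableValues N p) := by
  rw [Set.disjoint_left]
  rintro _ ⟨τ, α, β, γ, -, hs, rfl⟩ ⟨σ, α', β', γ', -, hs', h⟩
  exact hs' (hs.of_homothetic (equi_of_xF_eq h).homothetic)

theorem ncard_unstableValues (h5 : 5 ≤ p) (hm : p % 4 = 1) :
    (unstableValues 3 p).ncard =
      (if p % 8 = 1 then 3 else 1) * (stableValues 3 p).ncard := by
  have key : ∀ z : stableValues 3 p, ∃ (τ : ℍ) (a b c : ℤ), IsForm 3 p τ (2 * a) b (2 * c) ∧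
      IntStable (3 * p) (lattice τ) ∧ xF 3 τ = z := by
    rintro ⟨z, τ, α, β, γ, h, hs, hz⟩
    obtain ⟨a, b, c, h'⟩ := h.exists_even h5 hm hs
    exact ⟨τ, a, b, c, h', hs, hz⟩
  choose τ a b c hF hS hz using key
  have hω : ∀ z, ∀ y ∈ lattice (τ z), omegaGen p * y ∈ lattice (τ z) := fun z =>
    (intStable_iff h5 hm _).1 (hS z)
  choose σ α β γ hσ hH using fun (x : stableValues 3 p × Fin 3) => (hF x.1).exists_isForm_twist x.2
  have hT : Nat.card {x : stableValues 3 p × Fin 3 // Unstable p x.2 (τ x.1)} =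
      Nat.card (unstableValues 3 p) := by
    refine Nat.card_eq_of_bijective (fun x => ⟨xF 3 (σ x.1), σ x.1, _, _, _, hσ x.1,
      (unstable_iff h5 hm (hH x.1)).1 x.2, rfl⟩) ⟨?_, ?_⟩
    · rintro ⟨⟨z, i⟩, hu⟩ ⟨⟨z', j⟩, hu'⟩ h
      have h1 := (equi_of_xF_eq (Subtype.ext_iff.1 h)).symm.homothetic
      obtain ⟨e, he, h2⟩ := ((hH (z, i)).trans h1).trans (hH (z', j)).symm
      have h3 := homothety_of_subLattice he (hω z) (hω z') hu h2
      have h4 : z = z' := by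
        refine Subtype.ext ?_
        rw [← hz, ← hz]
        exact xF_of_equi ((hF z').equi_of_homothetic h5 (hF z) ⟨e, he, h3⟩)
      subst h4
      have h5 := twistLattice_injective ((hF z).eq_one_or_neg_one h5 he h3) h2
      subst h5
      rfl
    · rintro ⟨_, ρ, α', β', γ', h, hs, rfl⟩
      obtain ⟨τ', a', b', c', u, v, h1, huv, h2⟩ := h.exists_twist h5 hm hs
      have h3 : IntStable (3 * p) (lattice τ') := (h1.intStable_iff h5 hm).2 ⟨⟨_, rfl⟩, ⟨_, rfl⟩⟩
      let z : stableValues 3 p := ⟨xF 3 τ', τ', _, _, _, h1, h3, rfl⟩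
      obtain ⟨j, hj⟩ := (equi_of_xF_eq (hz z)).exists_twist huv
      have h4 : Homothetic (lattice (σ (z, j))) (lattice ρ) := ((hH (z, j)).symm.trans hj.symm).trans h2
      have h6 : ¬ IntStable (3 * p) (lattice (σ (z, j))) := fun h7 => hs (h7.of_homothetic h4)
      refine ⟨⟨(z, j), (unstable_iff h5 hm (hH (z, j))).2 h6⟩, Subtype.ext ?_⟩
      exact xF_of_equi (h.equi_of_homothetic h5 (hσ (z, j)) h4)
  rw [← Nat.card_coe_set_eq, ← Nat.card_coe_set_eq, ← hT]
  have hac : ∀ z, (Unstable p 0 (τ z) ↔ a z % 2 = 1) ∧ (Unstable p 1 (τ z) ↔ c z % 2 = 1) ∧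
      (Unstable p 2 (τ z) ↔ (a z + c z) % 2 = 0) := fun z => (hF z).unstable_iff h5 hm
  have hpar : ∀ z, (p % 8 = 1 ↔ a z % 2 = 1 ∧ c z % 2 = 1) := by
    intro z
    have h1 := (hF z).1
    push_cast at h1
    have hb : (3 * b z ^ 2) % 8 = 3 := by
      have h2 : (3 * b z ^ 2) % 2 = 1 := by
        have : 3 * b z ^ 2 = 4 * (a z * c z) - p := by linear_combination -h1
        omega
      have hb : b z % 8 = 0 ∨ b z % 8 = 1 ∨ b z % 8 = 2 ∨ b z % 8 = 3 ∨ b z % 8 = 4 ∨ b z % 8 = 5 ∨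
        b z % 8 = 6 ∨ b z % 8 = 7 := by omega
      rcases Int.emod_two_eq_zero_or_one (b z) with hb2 | hb2
      · simp [pow_two, Int.mul_emod, hb2] at h2
      · rcases hb with hb | hb | hb | hb | hb | hb | hb | hb <;>
          first | omega | simp [pow_two, Int.mul_emod, hb]
    have h3 : 4 * (a z * c z) = p + 3 * b z ^ 2 := by linear_combination h1
    have h4 : p % 8 = 1 ↔ (a z * c z) % 2 = 1 := by omega
    rw [h4]
    rcases Int.emod_two_eq_zero_or_one (a z) with h | h <;>
      rcases Int.emod_two_eq_zero_or_one (c z) with h' | h' <;> simp [Int.mul_emod, h, h']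
  split_ifs with h8
  · rw [Nat.card_congr (Equiv.subtypeUnivEquiv ?_), Nat.card_prod, mul_comm]
    · simp
    · rintro ⟨z, i⟩
      have h1 := (hpar z).1 h8
      obtain ⟨h2, h3, h4⟩ := hac z
      fin_cases i
      · exact h2.2 h1.1
      · exact h3.2 h1.2
      · exact h4.2 (by omega)
  · rw [one_mul]
    have huniq : ∀ z, ∃! i, Unstable p i (τ z) := by
      intro z
      have h1 := (hpar z).not.1 h8
      obtain ⟨h2, h3, h4⟩ := hac z
      have hc : (a z % 2 = 1 ∧ c z % 2 = 0) ∨ (a z % 2 = 0 ∧ c z % 2 = 1) ∨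
        (a z % 2 = 0 ∧ c z % 2 = 0) := by omega
      rcases hc with h | h | h
      · refine ⟨0, h2.2 h.1, fun i hi => ?_⟩
        fin_cases i
        · rfl
        · have := h3.1 hi; omega
        · have := h4.1 hi; omega
      · refine ⟨1, h3.2 h.2, fun i hi => ?_⟩
        fin_cases i
        · have := h2.1 hi; omega
        · rfl
        · have := h4.1 hi; omega
      · refine ⟨2, h4.2 (by omega), fun i hi => ?_⟩
        fin_cases i
        · have := h2.1 hi; omega
        · have := h3.1 hi; omega
        · rfl
    refine Nat.card_eq_of_bijective (fun x => x.1.1) ⟨?_, fun z => ?_⟩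
    · rintro ⟨⟨z, i⟩, hi⟩ ⟨⟨z', j⟩, hj⟩ h
      obtain rfl : z = z' := h
      obtain rfl := (huniq z).unique hi hj
      rfl
    · obtain ⟨i, hi, -⟩ := huniq z
      exact ⟨⟨(z, i), hi⟩, rfl⟩

theorem ncard_formValues_of_stable (N : ℕ) [Fact (N = 2 ∨ N = 3)] (h5 : 5 ≤ p)
    (hm : N * p % 4 = 1 ∨ N * p % 4 = 2) : (formValues N p).ncard = classNumberSqrtNeg (N * p) := by
  have h : unstableValues N p = ∅ := by
    rw [Set.eq_empty_iff_forall_notMem]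
    rintro z ⟨τ, α, β, γ, h, hs, -⟩
    exact hs (h.intStable h5 hm)
  rw [formValues_eq_union, h, Set.union_empty, ncard_stableValues N h5]

theorem ncard_formValues_three (h5 : 5 ≤ p) (hm : p % 4 = 1) (hfin : (formValues 3 p).Finite) :
    (formValues 3 p).ncard = (if p % 8 = 1 then 4 else 2) * classNumberSqrtNeg (3 * p) := by
  rw [formValues_eq_union] at hfin ⊢
  rw [Set.ncard_union_eq (disjoint_stableValues 3 p) (hfin.subset Set.subset_union_left)
    (hfin.subset Set.subset_union_right), ncard_unstableValues h5 hm, ncard_stableValues 3 h5]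
  split_ifs <;> ring

end TwistCount

section LegendreSymbolValues

variable {p}

lemma legendreSym_neg_one_eq_ite (h5 : 5 ≤ p) :
    legendreSym p (-1) = if p % 4 = 1 then 1 else -1 := by
  have h := (mod_four_or h5).1
  rw [legendreSym.at_neg_one (by omega), ZMod.χ₄_nat_eq_if_mod_four, if_neg (by omega)]

lemma legendreSym_neg_two_eq_ite (h5 : 5 ≤ p) :
    legendreSym p (-2) = if p % 8 = 1 ∨ p % 8 = 3 then 1 else -1 := by
  have h := (mod_four_or h5).1
  rw [legendreSym.at_neg_two (by omega), ZMod.χ₈'_nat_eq_if_mod_eight, if_neg (by omega)]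

lemma legendreSym_neg_three_eq_ite (h5 : 5 ≤ p) :
    legendreSym p (-3) = if p % 3 = 1 then 1 else -1 := by
  have h := mod_four_or h5
  have h3 : legendreSym p 3 =
      if p % 4 = 1 then jacobiSym p 3 else -jacobiSym p 3 := by
    rw [jacobiSym.legendreSym.to_jacobiSym]
    have h := jacobiSym.quadratic_reciprocity_if (a := 3) (b := p) rfl h.1
    split_ifs at h ⊢ <;> first | omega | exact_mod_cast h.symm
  have hj : jacobiSym p 3 = if p % 3 = 1 then 1 else -1 := by
    rw [jacobiSym.mod_left]
    rcases (by omega : p % 3 = 1 ∨ p % 3 = 2) with h | h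
    · have : ((p : ℤ) % (3 : ℕ)) = 1 := by omega
      rw [this, if_pos h]; norm_num
    · have : ((p : ℤ) % (3 : ℕ)) = 2 := by omega
      rw [this, if_neg (by omega)]; norm_num
  rw [show (-3 : ℤ) = -1 * 3 by norm_num, legendreSym.mul, h3, hj, legendreSym_neg_one_eq_ite h5]
  split_ifs <;> rfl

lemma eps_eq_ite (h5 : 5 ≤ p) : eps p = if p % 4 = 1 then 0 else 1 := by
  rw [eps, legendreSym_neg_one_eq_ite h5]; split_ifs <;> rfl

lemma nu_eq_ite (h5 : 5 ≤ p) : nu p = if p % 8 = 1 ∨ p % 8 = 3 then 0 else 1 := by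
  rw [nu, legendreSym_neg_two_eq_ite h5]; split_ifs <;> rfl

lemma del_eq_ite (h5 : 5 ≤ p) : del p = if p % 3 = 1 then 0 else 1 := by
  rw [del, legendreSym_neg_three_eq_ite h5]; split_ifs <;> rfl

end LegendreSymbolValues

variable {p} in
lemma ncard_formValues_eq_BB (N : ℕ) [hN : Fact (N = 2 ∨ N = 3)] (h5 : 5 ≤ p) :
    (formValues N p).ncard =
      4 * BB p (p / (6 - N)) + 2 * (p / (6 - N) % 2) + (if eE N p = 0 then 0 else 2) ∧
      (formValues N p).Finite := by
  obtain ⟨O, hO⟩ := exists_valuationSubring p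
  have : Fact ((p : ℂ) ∈ O.nonunits) := ⟨hO⟩
  obtain ⟨h, hf⟩ := ncard_formValues (p := p) N h5 O
  refine ⟨?_, hf⟩
  rw [h, ncard_singularSet N h5 O]
  split_ifs <;> ring

/-- Morton: for every prime p ≥ 5, B(p, ⌊p/4⌋) = (1/4)·(h(√−2p) − 2(ε + ν)) and
B(p, ⌊p/3⌋) = (1/4)·(a_p·h(√−3p) − 4δ), where a_p = (1/2)·(2 + (1 + (−1|p))·(2 + (−2|p))). -/
theorem morton_number_of_quadratic_factors (hp : 5 ≤ p) :
    (BB p (p / 4) : ℚ) =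
        1 / 4 * ((classNumberSqrtNeg (2 * p) : ℚ) - 2 * ((eps p : ℚ) + (nu p : ℚ)))
      ∧ (BB p (p / 3) : ℚ) =
          1 / 4 * ((1 / 2 * (2 + (1 + (legendreSym p (-1) : ℚ)) * (2 + (legendreSym p (-2) : ℚ)))) *
              (classNumberSqrtNeg (3 * p) : ℚ) - 4 * (del p : ℚ)) := by
  have hmod := mod_four_or hp
  constructor
  · have h := (ncard_formValues_eq_BB 2 hp).1
    rw [ncard_formValues_of_stable 2 hp (by omega)] at h
    have he : (if eE 2 p = 0 then 0 else 2) = 2 * eps p := by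
      have := eE_add 2 hp
      rw [eps_eq_ite hp]
      split_ifs <;> omega
    have hn : p / (6 - 2) % 2 = nu p := by
      rw [nu_eq_ite hp]
      split_ifs <;> omega
    rw [he, hn] at h
    rw [h]
    push_cast
    ring
  · obtain ⟨h, hfin⟩ := ncard_formValues_eq_BB 3 hp
    have hd : 2 * (p / (6 - 3) % 2) + (if eE 3 p = 0 then 0 else 2) = 4 * del p := by
      have := eE_add 3 hp
      rw [del_eq_ite hp]
      split_ifs <;> omega
    rw [add_assoc, hd] at h
    have hB : (BB p (p / 3) : ℚ) = 1 / 4 * (((formValues 3 p).ncard : ℚ) - 4 * del p) := by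
      rw [h]
      push_cast
      ring
    rw [hB, legendreSym_neg_one_eq_ite hp, legendreSym_neg_two_eq_ite hp]
    rcases (by omega : p % 4 = 3 ∨ p % 4 = 1) with h4 | h4
    · rw [ncard_formValues_of_stable 3 hp (by omega), if_neg (by omega)]
      push_cast
      ring
    · rw [ncard_formValues_three hp h4 hfin, if_pos h4]
      rcases (by omega : p % 8 = 1 ∨ p % 8 = 5) with h8 | h8
      · rw [if_pos h8, if_pos (Or.inl h8)]
        push_cast
        ring
      · rw [if_neg (by omega), if_neg (by omega)]
        push_cast
        ring
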